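/- Let (R, m) be a commutative Noetherian local ring, let M be a non-zero finitely generated R-module, and let x ∈ m be an element that is both a non-zerodivisor on R and a non-zerodivisor on M. Then the Gorenstein injective dimension Gid_R(M) is finite if and only if Gid_{R/xR}(M/xM) is finite. -/

import Mathlib

/-!
Definitions needed to state results of "On flat and Gorenstein flat dimensions of
local cohomology modules" by M.R. Zargar and H. Zakeri.
-/

open CategoryTheory IsLocalRing

universe u

namespace Paper

variable (R : Type u) [CommRing R]

/-! ## Resolution/coresolution dimensions with respect to a class of modules -/

/-- `ResDimLE R P n M` : `M` admits a resolution `0 → Xₙ → ⋯ → X₀ → M → 0`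
with each `Xᵢ` in the class `P`. -/
def ResDimLE (P : ModuleCat.{u} R → Prop) : ℕ → ModuleCat.{u} R → Prop
  | 0, M => P M
  | n + 1, M => ResDimLE P n M ∨
      ∃ (X : ModuleCat.{u} R) (f : X →ₗ[R] M), P X ∧ Function.Surjective f ∧
        ResDimLE P n (ModuleCat.of R (LinearMap.ker f))

/-- `CoresDimLE R P n M` : `M` admits a coresolution `0 → M → X₀ → ⋯ → Xₙ → 0`
with each `Xᵢ` in the class `P`. -/
def CoresDimLE (P : ModuleCat.{u} R → Prop) : ℕ → ModuleCat.{u} R → Prop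
  | 0, M => P M
  | n + 1, M => CoresDimLE P n M ∨
      ∃ (X : ModuleCat.{u} R) (f : M →ₗ[R] X), P X ∧ Function.Injective f ∧
        CoresDimLE P n (ModuleCat.of R (X ⧸ LinearMap.range f))

/-- The resolution dimension of `M` with respect to the class `P`, as an
extended natural number (`⊤` if there is no finite resolution). -/
noncomputable def ResDim (P : ModuleCat.{u} R → Prop) (M : ModuleCat.{u} R) : ℕ∞ :=
  sInf {n : ℕ∞ | ∃ k : ℕ, (k : ℕ∞) = n ∧ ResDimLE R P k M}

/-- The coresolution dimension of `M` with respect to the class `P`. -/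
noncomputable def CoresDim (P : ModuleCat.{u} R → Prop) (M : ModuleCat.{u} R) : ℕ∞ :=
  sInf {n : ℕ∞ | ∃ k : ℕ, (k : ℕ∞) = n ∧ CoresDimLE R P k M}

/-- Flat dimension `fd_R M`. -/
noncomputable def flatDim (M : Type u) [AddCommGroup M] [Module R M] : ℕ∞ :=
  ResDim R (fun N => Module.Flat R N) (ModuleCat.of R M)

/-- Projective dimension `pd_R M`. -/
noncomputable def projDim (M : Type u) [AddCommGroup M] [Module R M] : ℕ∞ :=
  ResDim R (fun N => Module.Projective R N) (ModuleCat.of R M)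

/-- Injective dimension `id_R M`. -/
noncomputable def injDim (M : Type u) [AddCommGroup M] [Module R M] : ℕ∞ :=
  CoresDim R (fun N => Module.Injective R N) (ModuleCat.of R M)

/-! ## Local cohomology -/

/-- The local cohomology module `H^i_𝔞(M)`, as an object of `ModuleCat R`. -/
noncomputable def lcoh (𝔞 : Ideal R) (i : ℕ) (M : Type u) [AddCommGroup M] [Module R M] :
    ModuleCat.{u} R :=
  (localCohomology 𝔞 i).obj (ModuleCat.of R M)

/-- `M` is relative Cohen-Macaulay with respect to `𝔞` with `ht_M 𝔞 = n`, i.e. the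
`n`-th local cohomology of `M` with respect to `𝔞` is the only non-vanishing one. -/
def IsRelCM (𝔞 : Ideal R) (n : ℕ) (M : Type u) [AddCommGroup M] [Module R M] : Prop :=
  (∀ i : ℕ, i ≠ n → Subsingleton (lcoh R 𝔞 i M)) ∧ ¬ Subsingleton (lcoh R 𝔞 n M)

/-! ## Depth, dimension, Cohen-Macaulay -/

/-- The depth of a module over a local ring: the supremum of the lengths of
`M`-regular sequences contained in the maximal ideal. -/
noncomputable def depth [IsLocalRing R] (M : Type u) [AddCommGroup M] [Module R M] : ℕ∞ :=
  sSup {n : ℕ∞ | ∃ rs : List R, (rs.length : ℕ∞) = n ∧ (∀ x ∈ rs, x ∈ maximalIdeal R) ∧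
    RingTheory.Sequence.IsRegular M rs}

/-- The (Krull) dimension of a module: the Krull dimension of `R` modulo
the annihilator of `M` (`⊥` for the zero module). -/
noncomputable def moduleDim (M : Type u) [AddCommGroup M] [Module R M] : WithBot ℕ∞ :=
  ringKrullDim (R ⧸ Module.annihilator R M)

/-- A finitely generated module over a local ring is Cohen-Macaulay
if its depth equals its dimension. -/
def IsCohenMacaulayModule [IsLocalRing R] (M : Type u) [AddCommGroup M] [Module R M] : Prop :=
  (depth R M : WithBot ℕ∞) = moduleDim R M

/-- A local ring is Cohen-Macaulay if it is so as a module over itself. -/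
def IsCohenMacaulayRing [IsLocalRing R] : Prop := IsCohenMacaulayModule R R

/-- A local ring is Gorenstein if it has finite injective dimension over itself. -/
def IsGorensteinRing : Prop := injDim R R ≠ ⊤

/-! ## Ext, Tor, semidualizing modules -/

/-- `Ext^i_R(A, B)`. -/
noncomputable def ext (i : ℕ) (A B : Type u) [AddCommGroup A] [Module R A]
    [AddCommGroup B] [Module R B] : ModuleCat.{u} R :=
  ((Ext R (ModuleCat.{u} R) i).obj (Opposite.op (ModuleCat.of R A))).obj (ModuleCat.of R B)

/-- `Tor^R_p(A, B)` indexed by `p : ℤ`, with the convention that it vanishes in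
negative degrees. -/
noncomputable def tor (p : ℤ) (A B : Type u) [AddCommGroup A] [Module R A]
    [AddCommGroup B] [Module R B] : ModuleCat.{u} R :=
  if 0 ≤ p then ((Tor (ModuleCat.{u} R) p.toNat).obj (ModuleCat.of R A)).obj (ModuleCat.of R B)
  else ModuleCat.of R PUnit

/-- A finitely generated module `C` is semidualizing if the natural map
`R → Hom_R(C, C)` is bijective and `Ext^i_R(C, C) = 0` for all `i ≥ 1`. -/
def IsSemidualizing (C : Type u) [AddCommGroup C] [Module R C] : Prop :=
  Module.Finite R C ∧
  Function.Bijective (fun r : R => (r • LinearMap.id : C →ₗ[R] C)) ∧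
  ∀ i : ℕ, 1 ≤ i → Subsingleton (ext R i C C)

/-! ## Gorenstein homological classes -/

/-- `N` is Gorenstein injective: it is the kernel of the `0`-th differential of some
exact complex `Y` of injective modules which stays exact under `Hom(I, -)` for every
injective module `I`. (The complex is written cohomologically.) -/
def IsGorensteinInjective (N : Type u) [AddCommGroup N] [Module R N] : Prop :=
  ∃ (Y : ℤ → ModuleCat.{u} R) (d : ∀ i : ℤ, Y i →ₗ[R] Y (i + 1)),
    (∀ i, Module.Injective R (Y i)) ∧
    (∀ i, Function.Exact (d i) (d (i + 1))) ∧
    (∀ (I : ModuleCat.{u} R), Module.Injective R I →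
      ∀ (i : ℤ) (g : I →ₗ[R] Y (i + 1)), (d (i + 1)).comp g = 0 →
        ∃ h : I →ₗ[R] Y i, (d i).comp h = g) ∧
    ∃ ι : N →ₗ[R] Y 0, Function.Injective ι ∧ Function.Exact ι (d 0)

/-- `N` is Gorenstein projective: it is the cokernel of a differential of some
exact complex `X` of projective modules which stays exact under `Hom(-, P)` for
every projective module `P`. -/
def IsGorensteinProjective (N : Type u) [AddCommGroup N] [Module R N] : Prop :=
  ∃ (X : ℤ → ModuleCat.{u} R) (d : ∀ i : ℤ, X i →ₗ[R] X (i + 1)),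
    (∀ i, Module.Projective R (X i)) ∧
    (∀ i, Function.Exact (d i) (d (i + 1))) ∧
    (∀ (P : ModuleCat.{u} R), Module.Projective R P →
      ∀ (i : ℤ) (g : X (i + 1) →ₗ[R] P), g.comp (d i) = 0 →
        ∃ h : X (i + 1 + 1) →ₗ[R] P, h.comp (d (i + 1)) = g) ∧
    ∃ π : X 0 →ₗ[R] N, Function.Surjective π ∧ Function.Exact (d (-1)) π

/-- `N` is Gorenstein flat: it is the cokernel of a differential of some exact
complex `Z` of flat modules which stays exact under `- ⊗ I` for every injective
module `I`. -/
def IsGorensteinFlat (N : Type u) [AddCommGroup N] [Module R N] : Prop :=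
  ∃ (Z : ℤ → ModuleCat.{u} R) (d : ∀ i : ℤ, Z i →ₗ[R] Z (i + 1)),
    (∀ i, Module.Flat R (Z i)) ∧
    (∀ i, Function.Exact (d i) (d (i + 1))) ∧
    (∀ (I : ModuleCat.{u} R), Module.Injective R I →
      ∀ i : ℤ, Function.Exact (LinearMap.rTensor (R := R) I (d i))
        (LinearMap.rTensor (R := R) I (d (i + 1)))) ∧
    ∃ π : Z 0 →ₗ[R] N, Function.Surjective π ∧ Function.Exact (d (-1)) π

/-- Gorenstein injective dimension `Gid_R M`. -/
noncomputable def GinjDim (M : Type u) [AddCommGroup M] [Module R M] : ℕ∞ :=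
  CoresDim R (fun N => IsGorensteinInjective R N) (ModuleCat.of R M)

/-- Gorenstein projective dimension `Gpd_R M`. -/
noncomputable def GprojDim (M : Type u) [AddCommGroup M] [Module R M] : ℕ∞ :=
  ResDim R (fun N => IsGorensteinProjective R N) (ModuleCat.of R M)

/-- Gorenstein flat dimension `Gfd_R M`. -/
noncomputable def GflatDim (M : Type u) [AddCommGroup M] [Module R M] : ℕ∞ :=
  ResDim R (fun N => IsGorensteinFlat R N) (ModuleCat.of R M)

/-! ## `C`-injective, `C`-projective, `C`-flat modules and the `G_C`-classes -/

/-- `N` is `C`-injective if `N ≅ Hom_R(C, I)` for some injective module `I`. -/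
def IsCInjective (C : Type u) [AddCommGroup C] [Module R C]
    (N : Type u) [AddCommGroup N] [Module R N] : Prop :=
  ∃ I : ModuleCat.{u} R, Module.Injective R I ∧ Nonempty (N ≃ₗ[R] (C →ₗ[R] I))

/-- `N` is `C`-projective if `N ≅ C ⊗_R P` for some projective module `P`. -/
def IsCProjective (C : Type u) [AddCommGroup C] [Module R C]
    (N : Type u) [AddCommGroup N] [Module R N] : Prop :=
  ∃ P : ModuleCat.{u} R, Module.Projective R P ∧ Nonempty (N ≃ₗ[R] TensorProduct R C P)

/-- `N` is `C`-flat if `N ≅ C ⊗_R F` for some flat module `F`. -/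
def IsCFlat (C : Type u) [AddCommGroup C] [Module R C]
    (N : Type u) [AddCommGroup N] [Module R N] : Prop :=
  ∃ F : ModuleCat.{u} R, Module.Flat R F ∧ Nonempty (N ≃ₗ[R] TensorProduct R C F)

/-- `C`-injective dimension `cid_R M`. -/
noncomputable def cInjDim (C : Type u) [AddCommGroup C] [Module R C]
    (M : Type u) [AddCommGroup M] [Module R M] : ℕ∞ :=
  CoresDim R (fun N => IsCInjective R C N) (ModuleCat.of R M)

/-- `C`-projective dimension `cpd_R M`. -/
noncomputable def cProjDim (C : Type u) [AddCommGroup C] [Module R C]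
    (M : Type u) [AddCommGroup M] [Module R M] : ℕ∞ :=
  ResDim R (fun N => IsCProjective R C N) (ModuleCat.of R M)

/-- `N` is `G_C`-injective: `N` is the kernel of the `0`-th differential of an exact
complex `Y` (a complete `I_C I`-coresolution) with `Y i` injective in degrees belonging
to the coresolution part and `C`-injective elsewhere, such that `Hom(I', Y)` is exact
for every `C`-injective module `I'`. -/
def IsGCInjective (C : Type u) [AddCommGroup C] [Module R C]
    (N : Type u) [AddCommGroup N] [Module R N] : Prop :=
  ∃ (Y : ℤ → ModuleCat.{u} R) (d : ∀ i : ℤ, Y i →ₗ[R] Y (i + 1)),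
    (∀ i : ℤ, 0 ≤ i → Module.Injective R (Y i)) ∧
    (∀ i : ℤ, i < 0 → IsCInjective R C (Y i)) ∧
    (∀ i, Function.Exact (d i) (d (i + 1))) ∧
    (∀ (I : ModuleCat.{u} R), IsCInjective R C I →
      ∀ (i : ℤ) (g : I →ₗ[R] Y (i + 1)), (d (i + 1)).comp g = 0 →
        ∃ h : I →ₗ[R] Y i, (d i).comp h = g) ∧
    ∃ ι : N →ₗ[R] Y 0, Function.Injective ι ∧ Function.Exact ι (d 0)

/-- `N` is `G_C`-projective: the cokernel of the degree `0` differential of a complete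
`P_C P`-resolution. -/
def IsGCProjective (C : Type u) [AddCommGroup C] [Module R C]
    (N : Type u) [AddCommGroup N] [Module R N] : Prop :=
  ∃ (X : ℤ → ModuleCat.{u} R) (d : ∀ i : ℤ, X i →ₗ[R] X (i + 1)),
    (∀ i : ℤ, i ≤ 0 → Module.Projective R (X i)) ∧
    (∀ i : ℤ, 0 < i → IsCProjective R C (X i)) ∧
    (∀ i, Function.Exact (d i) (d (i + 1))) ∧
    (∀ (Q : ModuleCat.{u} R), IsCProjective R C Q →
      ∀ (i : ℤ) (g : X (i + 1) →ₗ[R] Q), g.comp (d i) = 0 →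
        ∃ h : X (i + 1 + 1) →ₗ[R] Q, h.comp (d (i + 1)) = g) ∧
    ∃ π : X 0 →ₗ[R] N, Function.Surjective π ∧ Function.Exact (d (-1)) π

/-- `N` is `G_C`-flat: the cokernel of the degree `0` differential of a complete
`F_C F`-resolution. -/
def IsGCFlat (C : Type u) [AddCommGroup C] [Module R C]
    (N : Type u) [AddCommGroup N] [Module R N] : Prop :=
  ∃ (Z : ℤ → ModuleCat.{u} R) (d : ∀ i : ℤ, Z i →ₗ[R] Z (i + 1)),
    (∀ i : ℤ, i ≤ 0 → Module.Flat R (Z i)) ∧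
    (∀ i : ℤ, 0 < i → IsCFlat R C (Z i)) ∧
    (∀ i, Function.Exact (d i) (d (i + 1))) ∧
    (∀ (J : ModuleCat.{u} R), IsCInjective R C J →
      ∀ i : ℤ, Function.Exact (LinearMap.rTensor (R := R) J (d i))
        (LinearMap.rTensor (R := R) J (d (i + 1)))) ∧
    ∃ π : Z 0 →ₗ[R] N, Function.Surjective π ∧ Function.Exact (d (-1)) π

/-- `G_C`-injective dimension `Gid_C M`. -/
noncomputable def GCinjDim (C : Type u) [AddCommGroup C] [Module R C]
    (M : Type u) [AddCommGroup M] [Module R M] : ℕ∞ :=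
  CoresDim R (fun N => IsGCInjective R C N) (ModuleCat.of R M)

/-- `G_C`-projective dimension `G_C-pd_R M`. -/
noncomputable def GCprojDim (C : Type u) [AddCommGroup C] [Module R C]
    (M : Type u) [AddCommGroup M] [Module R M] : ℕ∞ :=
  ResDim R (fun N => IsGCProjective R C N) (ModuleCat.of R M)

/-- `G_C`-flat dimension `G_C-fd_R M`. -/
noncomputable def GCflatDim (C : Type u) [AddCommGroup C] [Module R C]
    (M : Type u) [AddCommGroup M] [Module R M] : ℕ∞ :=
  ResDim R (fun N => IsGCFlat R C N) (ModuleCat.of R M)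

end Paper

open Paper IsLocalRing
open scoped Pointwise


namespace GidAux

section Basic
variable {R : Type u} [CommRing R]

/-- Short exact sequences, unbundled. -/
def SE {A B C : Type u} [AddCommGroup A] [Module R A] [AddCommGroup B] [Module R B]
    [AddCommGroup C] [Module R C] (i : A →ₗ[R] B) (p : B →ₗ[R] C) : Prop :=
  Function.Injective i ∧ Function.Exact i p ∧ Function.Surjective p

variable {A B C D E N I : Type u} [AddCommGroup A] [Module R A] [AddCommGroup B] [Module R B]
    [AddCommGroup C] [Module R C] [AddCommGroup D] [Module R D] [AddCommGroup E] [Module R E]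
    [AddCommGroup N] [Module R N] [AddCommGroup I] [Module R I]

theorem exists_factor (q : A →ₗ[R] B) (hq : Function.Surjective q) (f : A →ₗ[R] C)
    (h : ∀ a, q a = 0 → f a = 0) : ∃ f' : B →ₗ[R] C, ∀ a, f' (q a) = f a := by
  have hle : LinearMap.ker q ≤ LinearMap.ker f := fun a ha => h a ha
  refine ⟨((LinearMap.ker q).liftQ f hle).comp (q.quotKerEquivOfSurjective hq).symm.toLinearMap, ?_⟩
  intro a
  have : (q.quotKerEquivOfSurjective hq).symm (q a) = Submodule.Quotient.mk a := by
    rw [LinearEquiv.symm_apply_eq]; rfl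
  simp [this]

theorem exists_cofactor (j : B →ₗ[R] A) (hj : Function.Injective j) (f : C →ₗ[R] A)
    (h : ∀ c, ∃ b, j b = f c) : ∃ f' : C →ₗ[R] B, ∀ c, j (f' c) = f c := by
  refine ⟨(LinearEquiv.ofInjective j hj).symm.toLinearMap.comp
    (f.codRestrict (LinearMap.range j) (fun c => h c)), ?_⟩
  intro c
  have := LinearEquiv.apply_symm_apply (LinearEquiv.ofInjective j hj)
    (f.codRestrict (LinearMap.range j) (fun c => h c) c)
  exact congrArg Subtype.val this

theorem inj_extend (hI : Module.Injective R I) (j : A →ₗ[R] B) (hj : Function.Injective j)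
    (f : A →ₗ[R] I) : ∃ f' : B →ₗ[R] I, ∀ a, f' (j a) = f a :=
  hI.out j hj f

theorem exists_embed (A : Type u) [AddCommGroup A] [Module R A] :
    ∃ (Y : ModuleCat.{u} R) (j : A →ₗ[R] Y), Module.Injective R Y ∧ Function.Injective j := by
  let J := CategoryTheory.Injective.under (ModuleCat.of R A)
  refine ⟨J, (CategoryTheory.Injective.ι (ModuleCat.of R A)).hom, ?_, ?_⟩
  · haveI : CategoryTheory.Injective (ModuleCat.of R J) :=
      inferInstanceAs (CategoryTheory.Injective J)
    exact Module.injective_module_of_injective_object R J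
  · exact (ModuleCat.mono_iff_injective _).1 inferInstance

/-- Every map from an injective to the end of a short exact sequence starting at `N` lifts. -/
def LiftP (R : Type u) [CommRing R] (N : Type u) [AddCommGroup N] [Module R N] : Prop :=
  ∀ (I B C : ModuleCat.{u} R), Module.Injective R I → ∀ (i : N →ₗ[R] B) (p : B →ₗ[R] C),
    SE i p → ∀ g : I →ₗ[R] C, ∃ h : I →ₗ[R] B, ∀ y, p (h y) = g y

theorem LiftP.lift (h : LiftP R N) (hI : Module.Injective R I) {i : N →ₗ[R] B} {p : B →ₗ[R] C}
    (hs : SE i p) (g : I →ₗ[R] C) : ∃ h : I →ₗ[R] B, ∀ y, p (h y) = g y :=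
  h (ModuleCat.of R I) (ModuleCat.of R B) (ModuleCat.of R C) hI i p hs g

theorem liftP_of_one (hE : Module.Injective R E) {i : N →ₗ[R] E} {p : E →ₗ[R] D} (hs : SE i p)
    (H : ∀ (I : ModuleCat.{u} R), Module.Injective R I → ∀ g : I →ₗ[R] D,
      ∃ h : I →ₗ[R] E, ∀ y, p (h y) = g y) : LiftP R N := by
  intro I B C hI j q hq g
  obtain ⟨f, hf⟩ := inj_extend hE j hq.1 i
  obtain ⟨f', hf'⟩ := exists_factor q hq.2.2 (p.comp f) (by
    intro b hb
    obtain ⟨n, rfl⟩ := (hq.2.1 b).1 hb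
    simp [hf, hs.2.1.apply_apply_eq_zero])
  obtain ⟨k, hk⟩ := H I hI (f'.comp g)
  -- the pullback
  have key : ∀ y, ∃ b : B, q b = g y ∧ f b = k y := by
    intro y
    obtain ⟨b, hb⟩ := hq.2.2 (g y)
    have : p (k y - f b) = 0 := by
      rw [map_sub, hk]; simp only [LinearMap.comp_apply]; rw [← hb, hf']; simp
    obtain ⟨n, hn⟩ := (hs.2.1 _).1 this
    refine ⟨b + j n, ?_, ?_⟩
    · rw [map_add, hq.2.1.apply_apply_eq_zero, hb, add_zero]
    · rw [map_add, hf, hn]; abel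
  have uniq : Function.Injective (q.prod f) := by
    rw [← LinearMap.ker_eq_bot, LinearMap.ker_eq_bot']
    intro b hb
    have h1 : q b = 0 := congrArg Prod.fst hb
    have h2 : f b = 0 := congrArg Prod.snd hb
    obtain ⟨n, rfl⟩ := (hq.2.1 b).1 h1
    rw [hf] at h2
    rw [(map_eq_zero_iff i hs.1).1 h2, map_zero]
  obtain ⟨h, hh⟩ := exists_cofactor (q.prod f) uniq (g.prod k) (by
    intro y
    obtain ⟨b, h1, h2⟩ := key y
    exact ⟨b, Prod.ext h1 h2⟩)
  exact ⟨h, fun y => congrArg Prod.fst (hh y)⟩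

/-- `A → Y → B` short exact with `Y` injective. -/
def Link (R : Type u) [CommRing R] (A B : Type u) [AddCommGroup A] [Module R A]
    [AddCommGroup B] [Module R B] : Prop :=
  ∃ (Y : ModuleCat.{u} R) (i : A →ₗ[R] Y) (p : Y →ₗ[R] B), Module.Injective R Y ∧ SE i p

/-- A class witnessing Gorenstein injectivity. -/
def GClosed (P : ModuleCat.{u} R → Prop) : Prop :=
  ∀ N, P N → LiftP R N ∧ (∃ K : ModuleCat.{u} R, P K ∧ Link R K N) ∧
    ∃ C : ModuleCat.{u} R, P C ∧ Link R N C

theorem gi_of_closed {P : ModuleCat.{u} R → Prop} (hP : GClosed P) (N : ModuleCat.{u} R)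
    (hN : P N) : IsGorensteinInjective R N := by
  have hn : ∀ T : {N // P N}, ∃ T' : {N // P N}, Link R T.1 T'.1 := fun T => by
    obtain ⟨C, hC, h⟩ := (hP T.1 T.2).2.2; exact ⟨⟨C, hC⟩, h⟩
  have hp : ∀ T : {N // P N}, ∃ T' : {N // P N}, Link R T'.1 T.1 := fun T => by
    obtain ⟨C, hC, h⟩ := (hP T.1 T.2).2.1; exact ⟨⟨C, hC⟩, h⟩
  choose nx hnx using hn
  choose pv hpv using hp
  let T0 : {N // P N} := ⟨N, hN⟩
  let Z : ℤ → {N // P N} := fun i => match i with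
    | Int.ofNat n => nx^[n] T0
    | Int.negSucc n => pv^[n+1] T0
  have hZ : ∀ i, Link R (Z i).1 (Z (i+1)).1 := by
    intro i
    match i with
    | Int.ofNat n =>
      have : Z (Int.ofNat n + 1) = nx (Z (Int.ofNat n)) := Function.iterate_succ_apply' nx n T0
      rw [this]; exact hnx _
    | Int.negSucc 0 => exact hpv T0
    | Int.negSucc (n+1) =>
      have : Z (Int.negSucc (n+1)) = pv (Z (Int.negSucc n)) :=
        Function.iterate_succ_apply' pv (n+1) T0
      have h2 : Int.negSucc (n+1) + 1 = Int.negSucc n := by omega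
      rw [h2, this]; exact hpv _
  choose Y i p hY hs using hZ
  refine ⟨Y, fun k => (i (k+1)).comp (p k), hY, ?_, ?_, ⟨i 0, (hs 0).1, ?_⟩⟩
  · intro k y
    constructor
    · intro h
      have h1 : p (k+1) y = 0 := (map_eq_zero_iff _ (hs (k+1+1)).1).1 h
      obtain ⟨z, rfl⟩ := ((hs (k+1)).2.1 y).1 h1
      obtain ⟨w, rfl⟩ := (hs k).2.2 z
      exact ⟨w, rfl⟩
    · rintro ⟨w, rfl⟩
      simp [(hs (k+1)).2.1.apply_apply_eq_zero]
  · intro I hI k g hg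
    obtain ⟨g', hg'⟩ := exists_cofactor (i (k+1)) (hs (k+1)).1 g (by
      intro y
      have h0 := LinearMap.congr_fun hg y
      have h1 : p (k+1) (g y) = 0 := (map_eq_zero_iff _ (hs (k+1+1)).1).1 h0
      exact ((hs (k+1)).2.1 _).1 h1)
    obtain ⟨h, hh⟩ := (hP _ (Z k).2).1.lift hI (hs k) g'
    refine ⟨h, ?_⟩
    ext y
    simp [hh, hg']
  · intro y
    constructor
    · intro h
      have h1 : p 0 y = 0 := (map_eq_zero_iff _ (hs (0+1)).1).1 h
      exact ((hs 0).2.1 y).1 h1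
    · rintro ⟨w, rfl⟩
      have : p 0 (i 0 w) = 0 := (hs 0).2.1.apply_apply_eq_zero w
      exact (congrArg (i (0+1)) this).trans (map_zero _)

theorem gclosed_gi : GClosed (fun N : ModuleCat.{u} R => IsGorensteinInjective R N) := by
  let P : ModuleCat.{u} R → Prop := fun N =>
    ∃ (Y : ℤ → ModuleCat.{u} R) (d : ∀ i : ℤ, Y i →ₗ[R] Y (i + 1)),
    (∀ i, Module.Injective R (Y i)) ∧
    (∀ i, Function.Exact (d i) (d (i + 1))) ∧
    (∀ (I : ModuleCat.{u} R), Module.Injective R I →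
      ∀ (i : ℤ) (g : I →ₗ[R] Y (i + 1)), (d (i + 1)).comp g = 0 →
        ∃ h : I →ₗ[R] Y i, (d i).comp h = g) ∧
    ∃ (k : ℤ) (ι : N →ₗ[R] Y k), Function.Injective ι ∧ Function.Exact ι (d k)
  have hPc : GClosed P := by
    rintro N ⟨Y, d, hY, hd, hl, k, ι, hι, he⟩
    refine ⟨?_, ?_, ?_⟩
    · refine liftP_of_one (hY k) (i := ι) (p := (d k).rangeRestrict)
        ⟨hι, ?_, LinearMap.surjective_rangeRestrict _⟩ ?_
      · intro y
        rw [← he y, ← Subtype.val_inj]; rfl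
      · intro I hI g
        obtain ⟨h, hh⟩ := hl I hI k ((LinearMap.range (d k)).subtype.comp g) (by
          ext y
          obtain ⟨w, hw⟩ := (g y).2
          simp only [LinearMap.comp_apply, Submodule.subtype_apply, ← hw, LinearMap.zero_apply]
          exact (hd k).apply_apply_eq_zero w)
        refine ⟨h, fun y => Subtype.ext ?_⟩
        exact LinearMap.congr_fun hh y
    · obtain ⟨j, rfl⟩ : ∃ j, k = j + 1 := ⟨k - 1, by ring⟩
      obtain ⟨p, hp⟩ := exists_cofactor ι hι (d j) (by
        intro y
        exact (he _).1 ((hd j).apply_apply_eq_zero y))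
      refine ⟨ModuleCat.of R (LinearMap.ker (d j)), ⟨Y, d, hY, hd, hl, j,
        (LinearMap.ker (d j)).subtype, Subtype.val_injective, ?_⟩, Y j,
        (LinearMap.ker (d j)).subtype, p, hY j, Subtype.val_injective, ?_, ?_⟩
      · intro y; exact ⟨fun h => ⟨⟨y, h⟩, rfl⟩, by rintro ⟨w, rfl⟩; exact w.2⟩
      · intro y
        have : p y = 0 ↔ d j y = 0 := by rw [← hp, map_eq_zero_iff _ hι]
        rw [this]
        exact ⟨fun h => ⟨⟨y, h⟩, rfl⟩, by rintro ⟨w, rfl⟩; exact w.2⟩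
      · intro n
        obtain ⟨y, hy⟩ := (hd j (ι n)).1 (he.apply_apply_eq_zero n)
        exact ⟨y, hι (by rw [hp, hy])⟩
    · refine ⟨ModuleCat.of R (LinearMap.range (d k)), ⟨Y, d, hY, hd, hl, k+1,
        (LinearMap.range (d k)).subtype, Subtype.val_injective, ?_⟩, Y k, ι,
        (d k).rangeRestrict, hY k, hι, ?_, LinearMap.surjective_rangeRestrict _⟩
      · intro y
        rw [hd k y]
        exact ⟨fun h => ⟨⟨y, h⟩, rfl⟩, by rintro ⟨w, rfl⟩; exact w.2⟩
      · intro y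
        rw [← he y, ← Subtype.val_inj]; rfl
  intro N hN
  have hN' : P N := by
    obtain ⟨Y, d, h1, h2, h3, ι, h4, h5⟩ := hN
    exact ⟨Y, d, h1, h2, h3, 0, ι, h4, h5⟩
  obtain ⟨h1, ⟨K, hK, hK'⟩, ⟨C, hC, hC'⟩⟩ := hPc N hN'
  exact ⟨h1, ⟨K, gi_of_closed hPc K hK, hK'⟩, ⟨C, gi_of_closed hPc C hC, hC'⟩⟩

abbrev GI (R : Type u) [CommRing R] (N : Type u) [AddCommGroup N] [Module R N] : Prop :=
  IsGorensteinInjective R N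

theorem GI.liftP (h : GI R N) : LiftP R N := (gclosed_gi (ModuleCat.of R N) h).1

theorem GI.left (h : GI R N) : ∃ K : ModuleCat.{u} R, GI R K ∧ Link R K N :=
  (gclosed_gi (ModuleCat.of R N) h).2.1

theorem GI.right (h : GI R N) : ∃ K : ModuleCat.{u} R, GI R K ∧ Link R N K :=
  (gclosed_gi (ModuleCat.of R N) h).2.2

theorem gi_of (h1 : LiftP R N) (hK : GI R A) (hl : Link R A N) (hC : GI R C) (hr : Link R N C) :
    GI R N := by
  refine gi_of_closed (P := fun X => GI R X ∨ X = ModuleCat.of R N) ?_ (ModuleCat.of R N) (Or.inr rfl)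
  rintro X (hX | rfl)
  · obtain ⟨h1, ⟨K, hK, hK'⟩, ⟨C, hC, hC'⟩⟩ := gclosed_gi X hX
    exact ⟨h1, ⟨K, Or.inl hK, hK'⟩, ⟨C, Or.inl hC, hC'⟩⟩
  · exact ⟨h1, ⟨ModuleCat.of R A, Or.inl hK, hl⟩, ⟨ModuleCat.of R C, Or.inl hC, hr⟩⟩

theorem GI.of_equiv (h : GI R A) (e : A ≃ₗ[R] B) : GI R B := by
  obtain ⟨K, hK, Y, i, p, hY, hs⟩ := h.left
  obtain ⟨C, hC, Y', i', p', hY', hs'⟩ := h.right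
  refine gi_of ?_ hK ⟨Y, i, e.toLinearMap.comp p, hY, hs.1, ?_, ?_⟩ hC
    ⟨Y', i'.comp e.symm.toLinearMap, p', hY', ?_, ?_, hs'.2.2⟩
  · intro I X Z hI j q hq g
    refine h.liftP.lift hI (i := j.comp e.toLinearMap) (p := q) ⟨?_, ?_, hq.2.2⟩ g
    · exact hq.1.comp e.injective
    · intro y; rw [hq.2.1 y]
      exact ⟨fun ⟨w, hw⟩ => ⟨e.symm w, by simp [hw]⟩, fun ⟨w, hw⟩ => ⟨e w, hw⟩⟩
  · intro y; rw [← hs.2.1 y]; simp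
  · exact e.surjective.comp hs.2.2
  · exact hs'.1.comp e.symm.injective
  · intro y; rw [hs'.2.1 y]
    exact ⟨fun ⟨w, hw⟩ => ⟨e w, by simp [hw]⟩, fun ⟨w, hw⟩ => ⟨e.symm w, hw⟩⟩

theorem se_fst (A B : Type u) [AddCommGroup A] [Module R A] [AddCommGroup B] [Module R B] :
    SE (LinearMap.inr R A B) (LinearMap.fst R A B) :=
  ⟨LinearMap.inr_injective, fun y => ⟨fun h => ⟨y.2, Prod.ext h.symm rfl⟩, by rintro ⟨w, rfl⟩; rfl⟩,
    fun a => ⟨(a, 0), rfl⟩⟩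

theorem gi_of_injective (hN : Module.Injective R N) : GI R N := by
  refine gi_of_closed (P := fun X => Module.Injective R X) ?_ (ModuleCat.of R N) hN
  intro X hX
  have hz : Module.Injective R PUnit.{u+1} := ⟨fun X Y _ _ _ _ f hf g => ⟨0, fun _ => rfl⟩⟩
  refine ⟨?_, ⟨ModuleCat.of R PUnit, hz, X, 0, LinearMap.id, hX, ?_⟩,
    ⟨ModuleCat.of R PUnit, hz, X, LinearMap.id, 0, hX, ?_⟩⟩
  · refine liftP_of_one (D := PUnit.{u+1}) hX (i := LinearMap.id) (p := 0) ?_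
      (fun I hI g => ⟨0, fun y => rfl⟩)
    exact ⟨fun a b h => h, fun y => by simp, fun y => ⟨0, rfl⟩⟩
  · exact ⟨fun a b h => rfl, fun y => ⟨fun h => ⟨PUnit.unit, h.symm⟩, by rintro ⟨w, rfl⟩; rfl⟩, fun y => ⟨y, rfl⟩⟩
  · exact ⟨fun a b h => h, fun y => by simp, fun y => ⟨0, rfl⟩⟩

end Basic
end GidAux


namespace GidAux

section Ext
variable {R : Type u} [CommRing R]
variable {A B C D E N I A' B' C' X X' : Type u} [AddCommGroup A] [Module R A]
    [AddCommGroup B] [Module R B]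
    [AddCommGroup C] [Module R C] [AddCommGroup D] [Module R D] [AddCommGroup E] [Module R E]
    [AddCommGroup N] [Module R N] [AddCommGroup I] [Module R I]
    [AddCommGroup A'] [Module R A'] [AddCommGroup B'] [Module R B']
    [AddCommGroup C'] [Module R C'] [AddCommGroup X] [Module R X] [AddCommGroup X'] [Module R X']

theorem SE.zero {i : A →ₗ[R] B} {p : B →ₗ[R] C} (h : SE i p) (a : A) : p (i a) = 0 :=
  h.2.1.apply_apply_eq_zero a

theorem SE.lift {i : A →ₗ[R] B} {p : B →ₗ[R] C} (h : SE i p) {b : B} (hb : p b = 0) :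
    ∃ a, i a = b := (h.2.1 b).1 hb

theorem SE.inj0 {i : A →ₗ[R] B} {p : B →ₗ[R] C} (h : SE i p) {a : A} (hb : i a = 0) :
    a = 0 := (map_eq_zero_iff i h.1).1 hb

theorem SE.mk' {i : A →ₗ[R] B} {p : B →ₗ[R] C} (h1 : ∀ a, i a = 0 → a = 0)
    (h2 : ∀ a, p (i a) = 0) (h3 : ∀ b, p b = 0 → ∃ a, i a = b) (h4 : ∀ c, ∃ b, p b = c) :
    SE i p :=
  ⟨(injective_iff_map_eq_zero i).2 h1, fun b => ⟨h3 b, by rintro ⟨a, rfl⟩; exact h2 a⟩, h4⟩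

theorem se_mkQ (i : A →ₗ[R] B) (hi : Function.Injective i) : SE i (LinearMap.range i).mkQ :=
  SE.mk' (fun a h => (map_eq_zero_iff i hi).1 h) (fun a => by simp)
    (fun b hb => by simpa using hb) (Submodule.mkQ_surjective _)

theorem se_ker (p : B →ₗ[R] C) (hp : Function.Surjective p) : SE (LinearMap.ker p).subtype p :=
  SE.mk' (fun a h => Subtype.ext h) (fun a => a.2) (fun b hb => ⟨⟨b, hb⟩, rfl⟩) hp

/-- Cokernels of a map of short exact sequences whose three components are injective. -/
theorem nine_coker {a : A →ₗ[R] X} {b : X →ₗ[R] B} {a' : A' →ₗ[R] X'} {b' : X' →ₗ[R] B'}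
    (h : SE a b) (h' : SE a' b') {fA : A →ₗ[R] A'} {fX : X →ₗ[R] X'} {fB : B →ₗ[R] B'}
    {qA : A' →ₗ[R] C} {qX : X' →ₗ[R] D} {qB : B' →ₗ[R] E}
    (hA : SE fA qA) (hX : SE fX qX) (hB : SE fB qB)
    (c1 : ∀ y, fX (a y) = a' (fA y)) (c2 : ∀ y, fB (b y) = b' (fX y)) :
    ∃ (u : C →ₗ[R] D) (v : D →ₗ[R] E), SE u v := by
  obtain ⟨u, hu⟩ := exists_factor qA hA.2.2 (qX.comp a') (by
    intro y hy
    obtain ⟨z, rfl⟩ := hA.lift hy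
    simp [← c1, hX.zero])
  obtain ⟨v, hv⟩ := exists_factor qX hX.2.2 (qB.comp b') (by
    intro y hy
    obtain ⟨z, rfl⟩ := hX.lift hy
    simp [← c2, hB.zero])
  simp only [LinearMap.comp_apply] at hu hv
  refine ⟨u, v, SE.mk' ?_ ?_ ?_ ?_⟩
  · intro y hy
    obtain ⟨y, rfl⟩ := hA.2.2 y
    rw [hu] at hy
    obtain ⟨z, hz⟩ := hX.lift hy
    have h1 : b z = 0 := hB.inj0 (by rw [c2, hz, h'.zero])
    obtain ⟨w, rfl⟩ := h.lift h1
    rw [c1] at hz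
    rw [← h'.1 hz, hA.zero]
  · intro y
    obtain ⟨y, rfl⟩ := hA.2.2 y
    rw [hu, hv, h'.zero, map_zero]
  · intro y hy
    obtain ⟨y, rfl⟩ := hX.2.2 y
    rw [hv] at hy
    obtain ⟨z, hz⟩ := hB.lift hy
    obtain ⟨w, rfl⟩ := h.2.2 z
    rw [c2] at hz
    have : b' (y - fX w) = 0 := by rw [map_sub, hz, sub_self]
    obtain ⟨t, ht⟩ := h'.lift this
    exact ⟨qA t, by rw [hu, ht, map_sub, hX.zero, sub_zero]⟩
  · intro y
    obtain ⟨y, rfl⟩ := hB.2.2 y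
    obtain ⟨y, rfl⟩ := h'.2.2 y
    exact ⟨qX y, hv y⟩

/-- Kernels of a map of short exact sequences whose three components are surjective. -/
theorem nine_ker {a : A →ₗ[R] X} {b : X →ₗ[R] B} {a' : A' →ₗ[R] X'} {b' : X' →ₗ[R] B'}
    (h : SE a b) (h' : SE a' b') {fA : A →ₗ[R] A'} {fX : X →ₗ[R] X'} {fB : B →ₗ[R] B'}
    {jA : C →ₗ[R] A} {jX : D →ₗ[R] X} {jB : E →ₗ[R] B}
    (hA : SE jA fA) (hX : SE jX fX) (hB : SE jB fB)
    (c1 : ∀ y, fX (a y) = a' (fA y)) (c2 : ∀ y, fB (b y) = b' (fX y)) :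
    ∃ (u : C →ₗ[R] D) (v : D →ₗ[R] E), SE u v := by
  obtain ⟨u, hu⟩ := exists_cofactor jX hX.1 (a.comp jA) (by
    intro y
    exact hX.lift (by simp [c1, hA.zero]))
  obtain ⟨v, hv⟩ := exists_cofactor jB hB.1 (b.comp jX) (by
    intro y
    exact hB.lift (by simp [c2, hX.zero]))
  simp only [LinearMap.comp_apply] at hu hv
  refine ⟨u, v, SE.mk' ?_ ?_ ?_ ?_⟩
  · intro y hy
    have := hu y
    rw [hy, map_zero] at this
    exact hA.inj0 (h.inj0 this.symm)
  · intro y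
    apply hB.inj0
    rw [hv, hu, h.zero]
  · intro y hy
    have h1 := hv y
    rw [hy, map_zero] at h1
    obtain ⟨z, hz⟩ := h.lift h1.symm
    have : fA z = 0 := h'.inj0 (by rw [← c1, hz, hX.zero])
    obtain ⟨w, rfl⟩ := hA.lift this
    exact ⟨w, hX.1 (by rw [hu, hz])⟩
  · intro y
    obtain ⟨z, hz⟩ := h.2.2 (jB y)
    have h1 : b' (fX z) = 0 := by rw [← c2, hz, hB.zero]
    obtain ⟨t, ht⟩ := h'.lift h1
    obtain ⟨s, rfl⟩ := hA.2.2 t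
    have h2 : fX (z - a s) = 0 := by rw [map_sub, c1, ht, sub_self]
    obtain ⟨w, hw⟩ := hX.lift h2
    exact ⟨w, hB.1 (by rw [hv, hw, map_sub, h.zero, sub_zero, hz])⟩

theorem SE.of_equiv_right {i : A →ₗ[R] B} {p : B →ₗ[R] C} (h : SE i p) (e : C ≃ₗ[R] D) :
    SE i (e.toLinearMap.comp p) :=
  SE.mk' (fun a => h.inj0) (fun a => by simp [h.zero])
    (fun b hb => h.lift (by simpa using hb)) (e.surjective.comp h.2.2)

theorem SE.coker_equiv {i : A →ₗ[R] B} {p : B →ₗ[R] C} (h : SE i p) {p' : B →ₗ[R] D}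
    (h' : SE i p') : Nonempty (C ≃ₗ[R] D) := by
  have hk : LinearMap.ker p = LinearMap.ker p' := by
    ext y; exact (h.2.1 y).trans (h'.2.1 y).symm
  exact ⟨(p.quotKerEquivOfSurjective h.2.2).symm ≪≫ₗ Submodule.quotEquivOfEq _ _ hk ≪≫ₗ
    p'.quotKerEquivOfSurjective h'.2.2⟩

theorem liftP_ext {i : A →ₗ[R] X} {p : X →ₗ[R] B} (h : SE i p) (hA : LiftP R A)
    (hB : LiftP R B) : LiftP R X := by
  intro I Y Z hI j q hq g
  have hs := se_mkQ (j.comp i) (hq.1.comp h.1)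
  set π := (LinearMap.range (j.comp i)).mkQ with hπ
  obtain ⟨u, hu⟩ := exists_factor p h.2.2 (π.comp j) (by
    intro y hy
    obtain ⟨z, rfl⟩ := h.lift hy
    exact hs.zero z)
  obtain ⟨v, hv⟩ := exists_factor π hs.2.2 q (by
    intro y hy
    obtain ⟨z, rfl⟩ := hs.lift hy
    exact hq.zero _)
  have huv : SE u v := by
    refine SE.mk' ?_ ?_ ?_ ?_
    · intro y hy
      obtain ⟨y, rfl⟩ := h.2.2 y
      rw [hu] at hy
      obtain ⟨z, hz⟩ := hs.lift hy
      rw [← hq.1 hz, h.zero]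
    · intro y
      obtain ⟨y, rfl⟩ := h.2.2 y
      rw [hu]; simp only [LinearMap.comp_apply]; rw [hv, hq.zero]
    · intro y hy
      obtain ⟨y, rfl⟩ := hs.2.2 y
      rw [hv] at hy
      obtain ⟨z, rfl⟩ := hq.lift hy
      exact ⟨p z, hu z⟩
    · intro y
      obtain ⟨z, rfl⟩ := hq.2.2 y
      exact ⟨π z, hv z⟩
  obtain ⟨g1, hg1⟩ := hB.lift hI huv g
  obtain ⟨g2, hg2⟩ := hA.lift hI hs g1
  exact ⟨g2, fun y => by rw [← hg1, ← hg2, hv]⟩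

theorem injective_prod (hA : Module.Injective R A) (hB : Module.Injective R B) :
    Module.Injective R (A × B) := by
  refine ⟨fun X Y _ _ _ _ f hf g => ?_⟩
  obtain ⟨u, hu⟩ := hA.out f hf ((LinearMap.fst R A B).comp g)
  obtain ⟨v, hv⟩ := hB.out f hf ((LinearMap.snd R A B).comp g)
  exact ⟨u.prod v, fun x => Prod.ext (hu x) (hv x)⟩

theorem se_inl_snd (A B : Type u) [AddCommGroup A] [Module R A] [AddCommGroup B] [Module R B] :
    SE (LinearMap.inl R A B) (LinearMap.snd R A B) :=
  SE.mk' (fun a h => congrArg Prod.fst h) (fun a => rfl)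
    (fun b hb => ⟨b.1, Prod.ext rfl hb.symm⟩) (fun c => ⟨(0, c), rfl⟩)

theorem horseshoe_right {i : A →ₗ[R] X} {p : X →ₗ[R] B} (h : SE i p)
    (hA : Link R A C) (hB : Link R B D) :
    ∃ (E : ModuleCat.{u} R) (u : C →ₗ[R] E) (v : E →ₗ[R] D), Link R X E ∧ SE u v := by
  obtain ⟨Y1, j1, q1, hY1, h1⟩ := hA
  obtain ⟨Y2, j2, q2, hY2, h2⟩ := hB
  obtain ⟨f, hf⟩ := inj_extend hY1 i h.1 j1
  let F : X →ₗ[R] Y1 × Y2 := f.prod (j2.comp p)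
  have hF : Function.Injective F := by
    refine (injective_iff_map_eq_zero F).2 fun y hy => ?_
    have e1 : f y = 0 := congrArg Prod.fst hy
    have e2 : j2 (p y) = 0 := congrArg Prod.snd hy
    obtain ⟨a, rfl⟩ := h.lift (h2.inj0 e2)
    rw [hf] at e1
    rw [h1.inj0 e1, map_zero]
  have hs := se_mkQ F hF
  obtain ⟨u, v, huv⟩ := nine_coker h (se_inl_snd (R := R) Y1 Y2) h1 hs h2
    (fun y => Prod.ext (hf y) (by simp [F, h.zero])) (fun y => rfl)
  exact ⟨ModuleCat.of R (_ ⧸ LinearMap.range F), u, v,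
    ⟨ModuleCat.of R (Y1 × Y2), F, _, injective_prod hY1 hY2, hs⟩, huv⟩

theorem horseshoe_left {i : A →ₗ[R] X} {p : X →ₗ[R] B} (h : SE i p) (hl : LiftP R A)
    (hA : Link R C A) (hB : Link R D B) :
    ∃ (E : ModuleCat.{u} R) (u : C →ₗ[R] E) (v : E →ₗ[R] D), Link R E X ∧ SE u v := by
  obtain ⟨Y1, j1, q1, hY1, h1⟩ := hA
  obtain ⟨Y2, j2, q2, hY2, h2⟩ := hB
  obtain ⟨f, hf⟩ := hl.lift hY2 h q2
  let F : Y1 × Y2 →ₗ[R] X := (i.comp q1).coprod f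
  have hF : Function.Surjective F := by
    intro y
    obtain ⟨z, hz⟩ := h2.2.2 (p y)
    obtain ⟨a, ha⟩ := h.lift (b := y - f z) (by rw [map_sub, hf, hz, sub_self])
    obtain ⟨w, rfl⟩ := h1.2.2 a
    exact ⟨(w, z), by simp [F, ha]⟩
  have hs := se_ker F hF
  obtain ⟨u, v, huv⟩ := nine_ker (se_inl_snd (R := R) Y1 Y2) h h1 hs h2
    (fun y => by simp [F]) (fun y => by simp [F, h.zero, hf])
  exact ⟨ModuleCat.of R (LinearMap.ker F), u, v,
    ⟨ModuleCat.of R (Y1 × Y2), _, F, injective_prod hY1 hY2, hs⟩, huv⟩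

theorem gi_ext {i : A →ₗ[R] X} {p : X →ₗ[R] B} (h : SE i p) (hA : GI R A) (hB : GI R B) :
    GI R X := by
  refine gi_of_closed (P := fun X => ∃ (A B : ModuleCat.{u} R) (i : A →ₗ[R] X) (p : X →ₗ[R] B),
    SE i p ∧ GI R A ∧ GI R B) ?_ (ModuleCat.of R X)
    ⟨ModuleCat.of R A, ModuleCat.of R B, i, p, h, hA, hB⟩
  rintro X ⟨A, B, i, p, h, hA, hB⟩
  refine ⟨liftP_ext h hA.liftP hB.liftP, ?_, ?_⟩
  · obtain ⟨K, hK, hKA⟩ := hA.left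
    obtain ⟨L, hL, hLB⟩ := hB.left
    obtain ⟨E, u, v, hE, huv⟩ := horseshoe_left h hA.liftP hKA hLB
    exact ⟨E, ⟨K, L, u, v, huv, hK, hL⟩, hE⟩
  · obtain ⟨K, hK, hKA⟩ := hA.right
    obtain ⟨L, hL, hLB⟩ := hB.right
    obtain ⟨E, u, v, hE, huv⟩ := horseshoe_right h hKA hLB
    exact ⟨E, ⟨K, L, u, v, huv, hK, hL⟩, hE⟩

/-- Third isomorphism theorem as a short exact sequence of cokernels. -/
theorem se_third {a : A →ₗ[R] B} {b : B →ₗ[R] C} {q : B →ₗ[R] D} (h : SE a q)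
    {r : C →ₗ[R] E} (h2 : SE b r) :
    ∃ (F : ModuleCat.{u} R) (s : C →ₗ[R] F) (u : D →ₗ[R] F) (v : F →ₗ[R] E),
      SE (b.comp a) s ∧ SE u v := by
  have hs := se_mkQ (b.comp a) (h2.1.comp h.1)
  set s := (LinearMap.range (b.comp a)).mkQ
  obtain ⟨u, hu⟩ := exists_factor q h.2.2 (s.comp b) (by
    intro y hy
    obtain ⟨z, rfl⟩ := h.lift hy
    exact hs.zero z)
  obtain ⟨v, hv⟩ := exists_factor s hs.2.2 r (by
    intro y hy
    obtain ⟨z, rfl⟩ := hs.lift hy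
    exact h2.zero _)
  refine ⟨ModuleCat.of R (C ⧸ LinearMap.range (b.comp a)), s, u, v, hs, SE.mk' ?_ ?_ ?_ ?_⟩
  · intro y hy
    obtain ⟨y, rfl⟩ := h.2.2 y
    rw [hu] at hy
    obtain ⟨z, hz⟩ := hs.lift hy
    rw [← h2.1 hz, h.zero]
  · intro y
    obtain ⟨y, rfl⟩ := h.2.2 y
    rw [hu]
    exact (hv _).trans (h2.zero _)
  · intro y hy
    obtain ⟨y, rfl⟩ := hs.2.2 y
    rw [hv] at hy
    obtain ⟨z, rfl⟩ := h2.lift hy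
    exact ⟨q z, hu z⟩
  · intro y
    obtain ⟨z, rfl⟩ := h2.2.2 y
    exact ⟨s z, hv z⟩

theorem gi_coker {i : A →ₗ[R] B} {p : B →ₗ[R] C} (h : SE i p) (hA : GI R A) (hB : GI R B) :
    GI R C := by
  obtain ⟨A1, hA1, Y, j, q, hY, hs⟩ := hA.right
  obtain ⟨f, hf⟩ := inj_extend hY i h.1 j
  obtain ⟨v, hv⟩ := exists_factor (LinearMap.prodMap p (LinearMap.id : Y →ₗ[R] Y))
    (Prod.map_surjective.2 ⟨h.2.2, Function.surjective_id⟩)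
    ((q.comp (LinearMap.snd R B Y)) - (q.comp f).comp (LinearMap.fst R B Y)) (by
      rintro ⟨b, y⟩ hby
      have e1 : p b = 0 := congrArg Prod.fst hby
      have e2 : y = 0 := congrArg Prod.snd hby
      obtain ⟨a, rfl⟩ := h.lift e1
      simp [e2, hf, hs.zero])
  have hv' : ∀ b y, v (p b, y) = q y - q (f b) := fun b y => hv (b, y)
  have hse : SE (p.prod f) v := by
    refine SE.mk' ?_ ?_ ?_ ?_
    · intro b hb
      have e1 : p b = 0 := congrArg Prod.fst hb
      have e2 : f b = 0 := congrArg Prod.snd hb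
      obtain ⟨a, rfl⟩ := h.lift e1
      rw [hf] at e2
      rw [hs.inj0 e2, map_zero]
    · intro b
      exact (hv' b (f b)).trans (sub_self _)
    · rintro ⟨c, y⟩ hc
      obtain ⟨b, rfl⟩ := h.2.2 c
      rw [hv', ← map_sub] at hc
      obtain ⟨a, ha⟩ := hs.lift hc
      refine ⟨b + i a, Prod.ext ?_ ?_⟩
      · simp [h.zero]
      · simp [hf, ha]
    · intro c
      obtain ⟨y, rfl⟩ := hs.2.2 c
      refine ⟨(0, y), ?_⟩
      simpa using hv' 0 y
  have hW : GI R (C × Y) := gi_ext hse hB hA1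
  have hl : LiftP R C := by
    intro I Z V hI k r hkr g
    have hs2 : SE (k.prodMap (LinearMap.id : Y →ₗ[R] Y)) (r.comp (LinearMap.fst R Z Y)) := by
      refine SE.mk' ?_ ?_ ?_ ?_
      · rintro ⟨c, y⟩ hc
        have e1 : k c = 0 := congrArg Prod.fst hc
        have e2 : y = 0 := congrArg Prod.snd hc
        exact Prod.ext (hkr.inj0 e1) e2
      · rintro ⟨c, y⟩
        exact hkr.zero c
      · rintro ⟨c, y⟩ hc
        obtain ⟨d, hd⟩ := hkr.lift hc
        exact ⟨(d, y), Prod.ext hd rfl⟩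
      · intro c
        obtain ⟨d, hd⟩ := hkr.2.2 c
        exact ⟨(d, 0), hd⟩
    obtain ⟨g', hg'⟩ := hW.liftP.lift hI hs2 g
    exact ⟨(LinearMap.fst R Z Y).comp g', hg'⟩
  obtain ⟨K, hK, Y1, j1, q1, hY1, hs1⟩ := hB.left
  obtain ⟨D, hD, Y2, j2, q2, hY2, hs2⟩ := hW.right
  -- right link
  obtain ⟨F, s, u, v', hF, huv⟩ := se_third (se_inl_snd (R := R) C Y) hs2
  have hGF : GI R F := gi_ext huv (gi_of_injective hY) hD
  -- left link
  have hL := se_ker (p.comp q1) (h.2.2.comp hs1.2.2)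
  obtain ⟨t, ht⟩ := exists_cofactor i h.1 (q1.comp (LinearMap.ker (p.comp q1)).subtype) (by
    intro y
    exact h.lift y.2)
  obtain ⟨w, hw⟩ := exists_cofactor (LinearMap.ker (p.comp q1)).subtype Subtype.val_injective j1 (by
    intro y
    exact ⟨⟨j1 y, by simp [hs1.zero]⟩, rfl⟩)
  have hwt : SE w t := by
    refine SE.mk' ?_ ?_ ?_ ?_
    · intro y hy
      have := hw y
      rw [hy, map_zero] at this
      exact hs1.inj0 this.symm
    · intro y
      apply h.inj0
      rw [ht]
      simp only [LinearMap.comp_apply]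
      rw [hw, hs1.zero]
    · intro y hy
      have := ht y
      rw [hy, map_zero] at this
      obtain ⟨z, hz⟩ := hs1.lift this.symm
      exact ⟨z, Subtype.ext ((hw z).trans hz)⟩
    · intro y
      obtain ⟨z, hz⟩ := hs1.2.2 (i y)
      refine ⟨⟨z, by simp [hz, h.zero]⟩, h.1 ?_⟩
      rw [ht]; exact hz
  have hGL : GI R (LinearMap.ker (p.comp q1)) := gi_ext hwt hK hA
  exact gi_of hl hGL ⟨Y1, _, _, hY1, hL⟩ hGF ⟨Y2, _, _, hY2, hF⟩

end Ext
end GidAux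


namespace GidAux

section Tor
variable {R : Type u} [CommRing R] {x : R}
variable {A B C D E G N I : Type u} [AddCommGroup A] [Module R A] [AddCommGroup B] [Module R B]
    [AddCommGroup C] [Module R C] [AddCommGroup D] [Module R D] [AddCommGroup E] [Module R E]
    [AddCommGroup N] [Module R N] [AddCommGroup I] [Module R I] [AddCommGroup G] [Module R G]

/-- The `R`-linear map `x • -`. -/
def mulx (x : R) (A : Type u) [AddCommGroup A] [Module R A] : A →ₗ[R] A := LinearMap.lsmul R A x

@[simp] theorem mulx_apply (a : A) : mulx x A a = x • a := rfl

/-- `x`-divisibility. -/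
def Dv (x : R) (A : Type u) [AddCommGroup A] [Module R A] : Prop := ∀ a : A, ∃ b : A, x • b = a

theorem dv_of_injective (hx : IsSMulRegular R x) (hA : Module.Injective R A) : Dv x A := by
  intro a
  obtain ⟨f, hf⟩ := inj_extend hA (mulx x R) hx (LinearMap.toSpanSingleton R A a)
  refine ⟨f 1, ?_⟩
  have := hf 1
  simp only [mulx_apply] at this
  rw [map_smul] at this
  simpa using this

theorem Dv.of_surj (h : Dv x A) (p : A →ₗ[R] B) (hp : Function.Surjective p) : Dv x B := by
  intro b
  obtain ⟨a, rfl⟩ := hp b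
  obtain ⟨c, rfl⟩ := h a
  exact ⟨p c, by rw [map_smul]⟩

theorem GI.dv (h : GI R A) (hx : IsSMulRegular R x) : Dv x A := by
  obtain ⟨K, hK, Y, i, p, hY, hs⟩ := h.left
  exact (dv_of_injective hx hY).of_surj p hs.2.2

end Tor

section Chg
variable {R : Type u} [CommRing R] {x : R} {S : Type u} [CommRing S] [Algebra R S]
variable {A B C D E G N I : Type u} [AddCommGroup A] [Module R A] [AddCommGroup B] [Module R B]
    [AddCommGroup C] [Module R C] [AddCommGroup D] [Module R D] [AddCommGroup E] [Module R E]
    [AddCommGroup I] [Module R I] [AddCommGroup G] [Module R G]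

/-- `S` is the quotient `R / xR`. -/
structure IsQ (x : R) (S : Type u) [CommRing S] [Algebra R S] : Prop where
  surj : Function.Surjective (algebraMap R S)
  ker : ∀ r : R, algebraMap R S r = 0 ↔ ∃ s, x * s = r

/-- The `S`-module `N` is identified with the submodule of `x`-torsion elements of `G`. -/
structure IsT (x : R) (S : Type u) [CommRing S] [Algebra R S] (N : Type u) [AddCommGroup N]
    [Module S N] (G : Type u) [AddCommGroup G] [Module R G] (j : N →+ G) : Prop where
  inj : Function.Injective j
  smul : ∀ (r : R) n, j (algebraMap R S r • n) = r • j n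
  range : ∀ g : G, x • g = 0 ↔ ∃ n, j n = g

theorem exists_isT (hS : IsQ x S) (G : Type u) [AddCommGroup G] [Module R G] :
    ∃ (N : ModuleCat.{u} S) (j : N →+ G), IsT x S N G j := by
  let T : Submodule R G := LinearMap.ker (mulx x G)
  let ρ : R →+* AddMonoid.End T := Module.toAddMonoidEnd R T
  have hker : RingHom.ker (algebraMap R S) ≤ RingHom.ker ρ := by
    intro r hr
    obtain ⟨s, rfl⟩ := (hS.ker r).1 hr
    rw [RingHom.mem_ker]
    ext t
    have : x • (t : G) = 0 := t.2
    change (x * s) • (t : G) = 0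
    rw [mul_comm, mul_smul, this, smul_zero]
  let ρ' : S →+* AddMonoid.End T := RingHom.liftOfSurjective (algebraMap R S) hS.surj ⟨ρ, hker⟩
  have hρ : ∀ r, ρ' (algebraMap R S r) = ρ r := fun r =>
    RingHom.liftOfRightInverse_comp_apply _ _ _ ⟨ρ, hker⟩ r
  letI : Module S T := Module.compHom T ρ'
  refine ⟨ModuleCat.of S T, T.subtype.toAddMonoidHom, Subtype.val_injective, ?_, ?_⟩
  · intro r n
    change ((ρ' (algebraMap R S r) n : T) : G) = _
    rw [hρ]; rfl
  · intro g
    exact ⟨fun h => ⟨⟨g, h⟩, rfl⟩, by rintro ⟨n, rfl⟩; exact n.2⟩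

variable {N N' N'' J : Type u} [AddCommGroup N] [Module S N] [AddCommGroup N'] [Module S N']
  [AddCommGroup N''] [Module S N''] [AddCommGroup J] [Module S J]

theorem IsT.kill {j : N →+ G} (h : IsT x S N G j) (n : N) : x • j n = 0 := (h.range _).2 ⟨n, rfl⟩

theorem IsQ.x0 (hS : IsQ x S) : algebraMap R S x = 0 := (hS.ker x).2 ⟨1, mul_one x⟩

theorem exists_toT (hS : IsQ x S) {j : N →+ G} (h : IsT x S N G j) (f : J →+ G)
    (hf : ∀ (r : R) n, f (algebraMap R S r • n) = r • f n) :
    ∃ f' : J →ₗ[S] N, ∀ n, j (f' n) = f n := by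
  have hr : ∀ n, ∃ m, j m = f n := fun n => (h.range _).1 (by
    rw [← hf, hS.x0, zero_smul, map_zero])
  choose F hF using hr
  refine ⟨⟨⟨F, ?_⟩, ?_⟩, hF⟩
  · intro a b
    apply h.inj; rw [hF, map_add, map_add, hF, hF]
  · intro s a
    obtain ⟨r, rfl⟩ := hS.surj s
    apply h.inj
    simp only [RingHom.id_apply]
    rw [hF, h.smul, hF, hf]

theorem exists_tmap (hS : IsQ x S) {j : N →+ G} (h : IsT x S N G j) {j' : N' →+ A}
    (h' : IsT x S N' A j') (f : G →ₗ[R] A) : ∃ f' : N →ₗ[S] N', ∀ n, j' (f' n) = f (j n) :=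
  exists_toT hS h' (f.toAddMonoidHom.comp j) (fun r n => by simp [h.smul])

theorem tor_se (hS : IsQ x S) {i : A →ₗ[R] B} {p : B →ₗ[R] C} (hs : SE i p) (hA : Dv x A)
    {j : N →+ A} (h : IsT x S N A j) {j' : N' →+ B} (h' : IsT x S N' B j')
    {j'' : N'' →+ C} (h'' : IsT x S N'' C j'') :
    ∃ (u : N →ₗ[S] N') (v : N' →ₗ[S] N''), SE u v ∧ (∀ n, j' (u n) = i (j n)) ∧
      ∀ n, j'' (v n) = p (j' n) := by
  obtain ⟨u, hu⟩ := exists_tmap hS h h' i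
  obtain ⟨v, hv⟩ := exists_tmap hS h' h'' p
  refine ⟨u, v, SE.mk' ?_ ?_ ?_ ?_, hu, hv⟩
  · intro n hn
    apply h.inj
    apply hs.1
    rw [← hu, hn]; simp
  · intro n
    apply h''.inj
    rw [hv, hu, hs.zero, map_zero]
  · intro n hn
    have h1 := hv n
    rw [hn, map_zero] at h1
    obtain ⟨a, ha⟩ := hs.lift h1.symm
    obtain ⟨m, rfl⟩ := (h.range a).1 (hs.inj0 (by rw [map_smul, ha, h'.kill]))
    exact ⟨m, h'.inj (by rw [hu, ha])⟩
  · intro n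
    obtain ⟨b, hb⟩ := hs.2.2 (j'' n)
    have h1 : p (x • b) = 0 := by rw [map_smul, hb, h''.kill]
    obtain ⟨a, ha⟩ := hs.lift h1
    obtain ⟨a, rfl⟩ := hA a
    obtain ⟨m, hm⟩ := (h'.range (b - i a)).1 (by rw [smul_sub, ← map_smul, ha, sub_self])
    exact ⟨m, h''.inj (by rw [hv, hm, map_sub, hs.zero, sub_zero, hb])⟩

theorem injective_tor (hS : IsQ x S) (hE : Module.Injective R E) {j : N →+ E}
    (h : IsT x S N E j) : Module.Injective S N := by
  refine ⟨fun X Y _ _ _ _ f hf g => ?_⟩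
  letI : Module R X := Module.compHom X (algebraMap R S)
  letI : Module R Y := Module.compHom Y (algebraMap R S)
  let f' : X →ₗ[R] Y := ⟨f.toAddMonoidHom.toAddHom, fun r y => f.map_smul (algebraMap R S r) y⟩
  let g' : X →ₗ[R] E := ⟨(j.comp g.toAddMonoidHom).toAddHom, fun r y => by
    change j (g (algebraMap R S r • y)) = r • j (g y)
    rw [map_smul, h.smul]⟩
  obtain ⟨k, hk⟩ := inj_extend hE f' hf g'
  obtain ⟨k', hk'⟩ := exists_toT hS h k.toAddMonoidHom (fun r n => k.map_smul r n)
  exact ⟨k', fun y => h.inj ((hk' _).trans (hk y))⟩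

theorem exists_embedT (hS : IsQ x S) (J : Type u) [AddCommGroup J] [Module S J] :
    ∃ (E : ModuleCat.{u} R) (T : ModuleCat.{u} S) (j : T →+ E) (e : J →ₗ[S] T),
      Module.Injective R E ∧ IsT x S T E j ∧ Function.Injective e := by
  letI : Module R J := Module.compHom J (algebraMap R S)
  obtain ⟨E, f, hE, hf⟩ := exists_embed (R := R) J
  obtain ⟨T, j, hT⟩ := exists_isT hS E
  obtain ⟨e, he⟩ := exists_toT hS hT f.toAddMonoidHom (fun r n => f.map_smul r n)
  exact ⟨E, T, j, e, hE, hT, fun a b hab => hf (by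
    have := congrArg j hab
    rwa [he, he] at this)⟩

/-- A map from the `x`-torsion of an injective `E` to a Gorenstein injective extends to `E`. -/
theorem extend_tor (hx : IsSMulRegular R x) (hE : Module.Injective R E) {j : N →+ E}
    (h : IsT x S N E j) (hC : GI R C) (f : N →+ C)
    (hf : ∀ (r : R) n, f (algebraMap R S r • n) = r • f n) :
    ∃ g : E →ₗ[R] C, ∀ n, g (j n) = f n := by
  obtain ⟨D, hD, Y, i, p, hY, hs⟩ := hC.right
  letI : Module R N := Module.compHom N (algebraMap R S)
  let j' : N →ₗ[R] E := ⟨j.toAddHom, h.smul⟩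
  let f' : N →ₗ[R] C := ⟨f.toAddHom, hf⟩
  obtain ⟨g1, hg1⟩ := inj_extend hY j' h.inj (i.comp f')
  have hg1' : ∀ n, g1 (j n) = i (f n) := hg1
  obtain ⟨k, hk⟩ := exists_factor (mulx x E) (dv_of_injective hx hE) (p.comp g1) (by
    intro e he
    obtain ⟨n, rfl⟩ := (h.range e).1 he
    simp [hg1', hs.zero])
  obtain ⟨l, hl⟩ := hC.liftP.lift hE hs k
  obtain ⟨g2, hg2⟩ := exists_cofactor i hs.1 (g1 - l.comp (mulx x E)) (by
    intro e
    apply hs.lift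
    simp only [LinearMap.sub_apply, LinearMap.comp_apply, map_sub, hl, hk, sub_self])
  refine ⟨g2, fun n => hs.1 ?_⟩
  rw [hg2]
  simp [h.kill, hg1']

theorem gi_tor (hx : IsSMulRegular R x) (hS : IsQ x S) (hG : GI R G) {j : N →+ G}
    (h : IsT x S N G j) : GI S N := by
  refine gi_of_closed (P := fun N => ∃ (G : ModuleCat.{u} R) (j : N →+ G), GI R G ∧ IsT x S N G j)
    ?_ (ModuleCat.of S N) ⟨ModuleCat.of R G, j, hG, h⟩
  rintro N ⟨G, j, hG, h⟩
  obtain ⟨K, hK, Y', i', p', hY', hs'⟩ := hG.left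
  obtain ⟨C, hC, Y, i, p, hY, hs⟩ := hG.right
  obtain ⟨NK, jK, hNK⟩ := exists_isT hS K
  obtain ⟨NC, jC, hNC⟩ := exists_isT hS C
  obtain ⟨NY, jY, hNY⟩ := exists_isT hS Y
  obtain ⟨NY', jY', hNY'⟩ := exists_isT hS Y'
  obtain ⟨u, v, huv, hu, hv⟩ := tor_se hS hs (hG.dv hx) h hNY hNC
  obtain ⟨u', v', huv', hu', hv'⟩ := tor_se hS hs' (hK.dv hx) hNK hNY' h
  refine ⟨?_, ⟨NK, ⟨K, jK, hK, hNK⟩, NY', u', v', injective_tor hS hY' hNY', huv'⟩,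
    ⟨NC, ⟨C, jC, hC, hNC⟩, NY, u, v, injective_tor hS hY hNY, huv⟩⟩
  refine liftP_of_one (injective_tor hS hY hNY) huv ?_
  intro J hJ g
  obtain ⟨E, T, jT, e, hE, hT, he⟩ := exists_embedT hS J
  obtain ⟨r, hr⟩ := inj_extend hJ e he LinearMap.id
  obtain ⟨g1, hg1⟩ := extend_tor hx hE hT hC (jC.comp (g.comp r).toAddMonoidHom) (fun s n => by
    simp [hNC.smul])
  obtain ⟨g2, hg2⟩ := hG.liftP.lift hE hs g1
  obtain ⟨g3, hg3⟩ := exists_tmap hS hT hNY g2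
  refine ⟨g3.comp e, fun y => hNC.inj ?_⟩
  simp only [LinearMap.comp_apply]
  rw [hv, hg3, hg2, hg1]
  simp [hr]

end Chg

section Dim
variable {R : Type u} [CommRing R]

abbrev GD (R : Type u) [CommRing R] (n : ℕ) (M : Type u) [AddCommGroup M] [Module R M] : Prop :=
  CoresDimLE R (fun N => IsGorensteinInjective R N) n (ModuleCat.of R M)

variable {A B C M N Q X : Type u} [AddCommGroup A] [Module R A] [AddCommGroup B] [Module R B]
    [AddCommGroup C] [Module R C] [AddCommGroup M] [Module R M] [AddCommGroup N] [Module R N]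
    [AddCommGroup Q] [Module R Q] [AddCommGroup X] [Module R X]

theorem GD.of_equiv {n : ℕ} (h : GD R n A) (e : A ≃ₗ[R] B) : GD R n B := by
  induction n with
  | zero => exact GI.of_equiv (h : GI R A) e
  | succ n ih =>
    rcases h with h | ⟨X, f, hX, hf, hc⟩
    · exact Or.inl (ih h)
    · refine Or.inr ⟨X, f.comp e.symm.toLinearMap, hX, hf.comp e.symm.injective, ?_⟩
      have : LinearMap.range (f.comp e.symm.toLinearMap) = LinearMap.range f := by
        rw [LinearMap.range_comp_of_range_eq_top]; exact LinearEquiv.range _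
      have h2 : (LinearMap.range (f.comp e.symm.toLinearMap)) = (LinearMap.range f) := this
      change GD R n (X ⧸ LinearMap.range (f.comp e.symm.toLinearMap))
      rw [h2]
      exact hc

theorem gd_succ {n : ℕ} {i : M →ₗ[R] X} {p : X →ₗ[R] Q} (h : SE i p) (hX : GI R X)
    (hQ : GD R n Q) : GD R (n+1) M := by
  obtain ⟨e⟩ := h.coker_equiv (se_mkQ i h.1)
  exact Or.inr ⟨ModuleCat.of R X, i, hX, h.1, hQ.of_equiv e⟩

theorem GD.succ_cases {n : ℕ} (h : GD R (n+1) M) : GD R n M ∨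
    ∃ (X Q : ModuleCat.{u} R) (i : M →ₗ[R] X) (p : X →ₗ[R] Q), SE i p ∧ GI R X ∧ GD R n Q := by
  rcases h with h | ⟨X, f, hX, hf, hc⟩
  · exact Or.inl h
  · exact Or.inr ⟨X, ModuleCat.of R (X ⧸ LinearMap.range f), f, _, se_mkQ f hf, hX, hc⟩

theorem gd_coker {n : ℕ} {i : A →ₗ[R] B} {p : B →ₗ[R] C} (h : SE i p) (hA : GI R A)
    (hB : GD R n B) : GD R n C := by
  induction n with
  | zero => exact gi_coker h hA hB
  | succ n ih =>
    rcases hB.succ_cases with hB | ⟨X, Q, j, q, hs, hX, hQ⟩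
    · exact Or.inl (ih hB)
    · obtain ⟨F, s, u, v, h1, h2⟩ := se_third h hs
      exact gd_succ h2 (gi_coker h1 hA hX) hQ

theorem ginjDim_ne_top_iff : GinjDim R M ≠ ⊤ ↔ ∃ n, GD R n M := by
  unfold GinjDim CoresDim
  constructor
  · intro h
    by_contra hn
    push Not at hn
    apply h
    have : {n : ℕ∞ | ∃ k : ℕ, (k : ℕ∞) = n ∧
        CoresDimLE R (fun N => IsGorensteinInjective R N) k (ModuleCat.of R M)} = ∅ := by
      ext n; simp only [Set.mem_setOf_eq, Set.mem_empty_iff_false, iff_false]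
      rintro ⟨k, _, hk⟩; exact hn k hk
    rw [this, sInf_empty]
  · rintro ⟨n, hn⟩ h
    rw [sInf_eq_top] at h
    exact absurd (h n ⟨n, rfl, hn⟩) (ENat.coe_ne_top n)

end Dim

section Fwd
variable {R : Type u} [CommRing R] {x : R} {S : Type u} [CommRing S] [Algebra R S]

theorem gd_tor (hx : IsSMulRegular R x) (hS : IsQ x S) (n : ℕ) :
    ∀ (C N : Type u) [AddCommGroup C] [Module R C] [AddCommGroup N] [Module S N] (j : N →+ C),
      Dv x C → GD R n C → IsT x S N C j → GD S n N := by
  induction n with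
  | zero => intro C N _ _ _ _ j _ hC h; exact gi_tor hx hS hC h
  | succ n ih =>
    intro C N _ _ _ _ j hd hC h
    rcases hC.succ_cases with hC | ⟨X, Q, i, q, hs, hX, hQ⟩
    · exact Or.inl (ih C N j hd hC h)
    · obtain ⟨NX, jX, hNX⟩ := exists_isT hS X
      obtain ⟨NQ, jQ, hNQ⟩ := exists_isT hS Q
      obtain ⟨u, v, huv, -, -⟩ := tor_se hS hs hd h hNX hNQ
      exact gd_succ huv (gi_tor hx hS hX hNX)
        (ih Q NQ jQ ((hX.dv hx).of_surj q hs.2.2) hQ hNQ)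

theorem tor_conn (hS : IsQ x S)
    {M X Q : Type u} [AddCommGroup M] [Module R M] [AddCommGroup X] [Module R X] [AddCommGroup Q]
    [Module R Q] (hM : IsSMulRegular M x) {i : M →ₗ[R] X} {q : X →ₗ[R] Q} (hs : SE i q) (hdX : Dv x X)
    {N NX NQ : Type u} [AddCommGroup N] [Module S N] [AddCommGroup NX] [Module S NX]
    [AddCommGroup NQ] [Module S NQ] (π : M →+ N) (hπ : Function.Surjective π)
    (hl : ∀ (r : R) m, π (r • m) = algebraMap R S r • π m)
    (hk : ∀ m, π m = 0 ↔ ∃ m', x • m' = m) {jX : NX →+ X} (hNX : IsT x S NX X jX)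
    {jQ : NQ →+ Q} (hNQ : IsT x S NQ Q jQ) :
    ∃ (u : NX →ₗ[S] NQ) (δ : NQ →ₗ[S] N), SE u δ := by
  obtain ⟨u, hu⟩ := exists_tmap hS hNX hNQ q
  letI : Module R N := Module.compHom N (algebraMap R S)
  letI : Module R NQ := Module.compHom NQ (algebraMap R S)
  let jQ' : NQ →ₗ[R] Q := ⟨jQ.toAddHom, hNQ.smul⟩
  let π' : M →ₗ[R] N := ⟨π.toAddHom, hl⟩
  let L : Submodule R X := (LinearMap.range i).comap (mulx x X)
  obtain ⟨a, ha⟩ := exists_cofactor i hs.1 ((mulx x X).comp L.subtype) (fun y => y.2)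
  obtain ⟨b, hb⟩ := exists_cofactor jQ' hNQ.inj (q.comp L.subtype) (fun y => by
    obtain ⟨m, hm⟩ := y.2
    refine (hNQ.range _).1 ?_
    have : i m = x • (y : X) := hm
    rw [LinearMap.comp_apply, ← map_smul, Submodule.subtype_apply, ← this, hs.zero])
  have ha' : ∀ y : L, i (a y) = x • (y : X) := ha
  have hb' : ∀ y : L, jQ (b y) = q y := hb
  have hbs : Function.Surjective b := by
    intro t
    obtain ⟨y, hy⟩ := hs.2.2 (jQ t)
    obtain ⟨m, hm⟩ := hs.lift (b := x • y) (by rw [map_smul, hy, hNQ.kill])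
    exact ⟨⟨y, m, hm⟩, hNQ.inj ((hb' _).trans hy)⟩
  obtain ⟨δ, hδ⟩ := exists_factor b hbs (π'.comp a) (by
    intro y hy
    have h1 := hb' y
    rw [hy, map_zero] at h1
    obtain ⟨m, hm⟩ := hs.lift h1.symm
    have h2 : a y = x • m := hs.1 (by rw [ha', ← hm, map_smul])
    exact (hk _).2 ⟨m, h2.symm⟩)
  have hδ' : ∀ y, δ (b y) = π (a y) := hδ
  let δ' : NQ →ₗ[S] N := ⟨δ.toAddMonoidHom.toAddHom, fun s y => by
    obtain ⟨r, rfl⟩ := hS.surj s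
    exact δ.map_smul r y⟩
  have hse : SE u δ' := by
    refine SE.mk' ?_ ?_ ?_ ?_
    · intro t ht
      have h1 := hu t
      rw [ht, map_zero] at h1
      obtain ⟨m, hm⟩ := hs.lift h1.symm
      have h2 : x • m = 0 := hs.inj0 (by rw [map_smul, hm, hNX.kill])
      have h3 : m = 0 := hM (by simpa using h2)
      apply hNX.inj
      rw [← hm, h3]; simp
    · intro t
      let y : L := ⟨jX t, 0, by simp [hNX.kill]⟩
      have h1 : b y = u t := hNQ.inj (by rw [hb', hu])
      have h2 : a y = 0 := hs.inj0 ((ha' y).trans (hNX.kill t))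
      change δ (u t) = 0
      rw [← h1, hδ', h2, map_zero]
    · intro t ht
      obtain ⟨y, rfl⟩ := hbs t
      have h1 : π (a y) = 0 := (hδ' y).symm.trans ht
      obtain ⟨m, hm⟩ := (hk _).1 h1
      obtain ⟨z, hz⟩ := (hNX.range ((y : X) - i m)).1 (by
        rw [smul_sub, ← map_smul, hm, ha', sub_self])
      exact ⟨z, hNQ.inj (by rw [hu, hz, hb', map_sub, hs.zero, sub_zero])⟩
    · intro t
      obtain ⟨m, rfl⟩ := hπ t
      obtain ⟨y, hy⟩ := hdX (i m)
      refine ⟨b ⟨y, m, hy.symm⟩, (hδ' _).trans ?_⟩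
      congr 1
      exact hs.1 ((ha' _).trans hy)
  exact ⟨u, δ', hse⟩

theorem fwd (hx : IsSMulRegular R x) (hS : IsQ x S) (n : ℕ)
    {M : Type u} [AddCommGroup M] [Module R M] (hM : IsSMulRegular M x)
    {N : Type u} [AddCommGroup N] [Module S N] (π : M →+ N) (hπ : Function.Surjective π)
    (hl : ∀ (r : R) m, π (r • m) = algebraMap R S r • π m)
    (hk : ∀ m, π m = 0 ↔ ∃ m', x • m' = m) (h : GD R n M) : GD S n N := by
  induction n with
  | zero =>
    have hd := GI.dv h hx
    have : Subsingleton N := ⟨fun a b => by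
      obtain ⟨a, rfl⟩ := hπ a
      obtain ⟨b, rfl⟩ := hπ b
      rw [(hk a).2 (hd a), (hk b).2 (hd b)]⟩
    exact gi_of_injective ⟨fun X Y _ _ _ _ f hf g => ⟨0, fun _ => Subsingleton.elim _ _⟩⟩
  | succ n ih =>
    rcases h.succ_cases with h | ⟨X, Q, i, q, hs, hX, hQ⟩
    · exact Or.inl (ih h)
    · refine Or.inl ?_
      obtain ⟨NX, jX, hNX⟩ := exists_isT hS X
      obtain ⟨NQ, jQ, hNQ⟩ := exists_isT hS Q
      have hdX := hX.dv hx
      have hGQ := gd_tor hx hS n Q NQ jQ (hdX.of_surj q hs.2.2) hQ hNQ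
      obtain ⟨u, δ, hse⟩ := tor_conn hS hM hs hdX π hπ hl hk hNX hNQ
      exact gd_coker hse (gi_tor hx hS hX hNX) hGQ

end Fwd
end GidAux



namespace GidAux

section GDim
variable {R : Type u} [CommRing R]
variable {A B C D I M N Q X Y : Type u} [AddCommGroup A] [Module R A] [AddCommGroup B] [Module R B]
    [AddCommGroup C] [Module R C] [AddCommGroup D] [Module R D] [AddCommGroup I] [Module R I]
    [AddCommGroup M] [Module R M] [AddCommGroup N] [Module R N]
    [AddCommGroup Q] [Module R Q] [AddCommGroup X] [Module R X] [AddCommGroup Y] [Module R Y]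

theorem GD.mono {n : ℕ} (h : GD R n A) : GD R (n+1) A := Or.inl h

theorem GD.mono_le {n m : ℕ} (h : GD R n A) (hnm : n ≤ m) : GD R m A := by
  induction hnm with
  | refl => exact h
  | step _ ih => exact ih.mono

theorem gi_gd {n : ℕ} (h : GI R A) : GD R n A := by
  have : GD R 0 A := h
  exact this.mono_le (Nat.zero_le n)

theorem gd_inj_prod {n : ℕ} (hI : Module.Injective R I) (h : GD R n Q) : GD R n (I × Q) := by
  induction n generalizing Q with
  | zero => exact gi_ext (se_inl_snd (R := R) I Q) (gi_of_injective hI) h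
  | succ n ih =>
    rcases h.succ_cases with h | ⟨X, Q', i, p, hs, hX, hQ⟩
    · exact Or.inl (ih h)
    · have h2 : SE (LinearMap.prodMap (LinearMap.id : I →ₗ[R] I) i)
          (p.comp (LinearMap.snd R I X)) := by
        refine SE.mk' ?_ ?_ ?_ ?_
        · intro a ha
          have e1 : a.1 = 0 := congrArg Prod.fst ha
          have e2 : i a.2 = 0 := congrArg Prod.snd ha
          exact Prod.ext e1 (hs.inj0 e2)
        · intro a; exact hs.zero a.2
        · rintro ⟨b1, b2⟩ hb
          obtain ⟨a, rfl⟩ := hs.lift (b := b2) hb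
          exact ⟨(b1, a), rfl⟩
        · intro c
          obtain ⟨b, rfl⟩ := hs.2.2 c
          exact ⟨(0, b), rfl⟩
      exact gd_succ h2 (gi_ext (se_inl_snd (R := R) I X) (gi_of_injective hI) hX) hQ

/-- The cosyzygy of a module of Gorenstein injective dimension at most `n+1`. -/
theorem gd_cosyz {n : ℕ} (hI : Module.Injective R I) {j : Y →ₗ[R] I} {c : I →ₗ[R] C}
    (hs : SE j c) (h : GD R (n+1) Y) : GD R n C := by
  induction n with
  | zero =>
    rcases h.succ_cases with h | ⟨X, Q, i, p, h1, hX, hQ⟩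
    · exact gi_coker hs h (gi_of_injective hI)
    · obtain ⟨f, hf⟩ := inj_extend hI i h1.1 j
      obtain ⟨g, hg⟩ := exists_factor p h1.2.2 (c.comp f) (fun b hb => by
        obtain ⟨y, rfl⟩ := h1.lift hb
        simp [hf, hs.zero])
      have h3 : SE (f.prod p) (c.comp (LinearMap.fst R I Q) - g.comp (LinearMap.snd R I Q)) := by
        refine SE.mk' ?_ ?_ ?_ ?_
        · intro a ha
          have e1 : f a = 0 := congrArg Prod.fst ha
          have e2 : p a = 0 := congrArg Prod.snd ha
          obtain ⟨y, rfl⟩ := h1.lift e2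
          rw [hf] at e1
          rw [hs.inj0 e1, map_zero]
        · intro a; simp [hg]
        · rintro ⟨a, q⟩ hb
          obtain ⟨b, rfl⟩ := h1.2.2 q
          have hb' : c (a - f b) = 0 := by simpa [hg] using hb
          obtain ⟨y, hy⟩ := hs.lift hb'
          refine ⟨b + i y, Prod.ext ?_ ?_⟩
          · simp [hf, hy]
          · simp [h1.zero]
        · intro z
          obtain ⟨b, rfl⟩ := hs.2.2 z
          exact ⟨(b, 0), by simp⟩
      exact gd_coker h3 hX (gd_inj_prod hI hQ)
  | succ n ih =>
    rcases h.succ_cases with h | ⟨X, Q, i, p, h1, hX, hQ⟩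
    · exact (ih h).mono
    · obtain ⟨f, hf⟩ := inj_extend hI i h1.1 j
      obtain ⟨g, hg⟩ := exists_factor p h1.2.2 (c.comp f) (fun b hb => by
        obtain ⟨y, rfl⟩ := h1.lift hb
        simp [hf, hs.zero])
      have h3 : SE (f.prod p) (c.comp (LinearMap.fst R I Q) - g.comp (LinearMap.snd R I Q)) := by
        refine SE.mk' ?_ ?_ ?_ ?_
        · intro a ha
          have e1 : f a = 0 := congrArg Prod.fst ha
          have e2 : p a = 0 := congrArg Prod.snd ha
          obtain ⟨y, rfl⟩ := h1.lift e2
          rw [hf] at e1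
          rw [hs.inj0 e1, map_zero]
        · intro a; simp [hg]
        · rintro ⟨a, q⟩ hb
          obtain ⟨b, rfl⟩ := h1.2.2 q
          have hb' : c (a - f b) = 0 := by simpa [hg] using hb
          obtain ⟨y, hy⟩ := hs.lift hb'
          refine ⟨b + i y, Prod.ext ?_ ?_⟩
          · simp [hf, hy]
          · simp [h1.zero]
        · intro z
          obtain ⟨b, rfl⟩ := hs.2.2 z
          exact ⟨(b, 0), by simp⟩
      exact gd_coker h3 hX (gd_inj_prod hI hQ)

theorem gd_link {n : ℕ} (h : Link R Y C) (hY : GD R (n+1) Y) : GD R n C := by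
  obtain ⟨I, j, c, hI, hs⟩ := h
  exact gd_cosyz hI hs hY

theorem gd_of_link {n : ℕ} (h : Link R Y C) (hC : GD R n C) : GD R (n+1) Y := by
  obtain ⟨I, j, c, hI, hs⟩ := h
  exact gd_succ hs (gi_of_injective hI) hC

theorem exists_link (Y : Type u) [AddCommGroup Y] [Module R Y] :
    ∃ C : ModuleCat.{u} R, Link R Y C := by
  obtain ⟨I, j, hI, hj⟩ := exists_embed (R := R) Y
  exact ⟨ModuleCat.of R (I ⧸ LinearMap.range j), I, j, _, hI, se_mkQ j hj⟩

theorem gd_ext {n : ℕ} {i : A →ₗ[R] B} {p : B →ₗ[R] C} (h : SE i p) (hA : GD R n A)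
    (hC : GD R n C) : GD R n B := by
  induction n generalizing A B C with
  | zero => exact gi_ext h hA hC
  | succ n ih =>
    obtain ⟨A', lA⟩ := exists_link (R := R) A
    obtain ⟨C', lC⟩ := exists_link (R := R) C
    obtain ⟨E, u, v, lE, huv⟩ := horseshoe_right h lA lC
    exact gd_of_link lE (ih huv (gd_link lA hA) (gd_link lC hC))

theorem gd_coker' {n : ℕ} {i : A →ₗ[R] B} {p : B →ₗ[R] C} (h : SE i p) (hA : GD R n A)
    (hB : GD R n B) : GD R n C := by
  induction n generalizing A B C with
  | zero => exact gi_coker h hA hB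
  | succ n ih =>
    obtain ⟨A', lA⟩ := exists_link (R := R) A
    obtain ⟨C', lC⟩ := exists_link (R := R) C
    obtain ⟨E, u, v, lE, huv⟩ := horseshoe_right h lA lC
    exact gd_of_link lC (ih huv (gd_link lA hA) (gd_link lE hB))

theorem gd_ker {n : ℕ} {i : A →ₗ[R] B} {p : B →ₗ[R] C} (h : SE i p) (hB : GD R n B)
    (hC : GD R n C) : GD R (n+1) A := by
  induction n generalizing A B C with
  | zero => exact gd_succ h hB hC
  | succ n ih =>
    obtain ⟨A', lA⟩ := exists_link (R := R) A
    obtain ⟨C', lC⟩ := exists_link (R := R) C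
    obtain ⟨E, u, v, lE, huv⟩ := horseshoe_right h lA lC
    exact gd_of_link lA (ih huv (gd_link lE hB) (gd_link lC hC))

theorem se_pi {ι : Type u} {A B C : ι → Type u} [∀ i, AddCommGroup (A i)] [∀ i, Module R (A i)]
    [∀ i, AddCommGroup (B i)] [∀ i, Module R (B i)] [∀ i, AddCommGroup (C i)]
    [∀ i, Module R (C i)] {f : ∀ i, A i →ₗ[R] B i} {g : ∀ i, B i →ₗ[R] C i}
    (h : ∀ i, SE (f i) (g i)) :
    SE (LinearMap.pi (fun i => (f i).comp (LinearMap.proj i)) : (∀ i, A i) →ₗ[R] ∀ i, B i)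
      (LinearMap.pi (fun i => (g i).comp (LinearMap.proj i)) : (∀ i, B i) →ₗ[R] ∀ i, C i) := by
  refine SE.mk' ?_ ?_ ?_ ?_
  · intro a ha
    funext i
    exact (h i).inj0 (congrFun ha i)
  · intro a
    funext i
    exact (h i).zero _
  · intro b hb
    have : ∀ i, ∃ a, f i a = b i := fun i => (h i).lift (congrFun hb i)
    choose a ha using this
    exact ⟨a, funext ha⟩
  · intro c
    have : ∀ i, ∃ b, g i b = c i := fun i => (h i).2.2 (c i)
    choose a ha using this
    exact ⟨a, funext ha⟩

theorem injective_pi {ι : Type u} {A : ι → Type u} [∀ i, AddCommGroup (A i)]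
    [∀ i, Module R (A i)] (h : ∀ i, Module.Injective R (A i)) : Module.Injective R (∀ i, A i) := by
  refine ⟨fun X Y _ _ _ _ f hf g => ?_⟩
  have : ∀ i, ∃ k : Y →ₗ[R] A i, ∀ x, k (f x) = g x i := fun i =>
    (h i).out f hf ((LinearMap.proj i).comp g)
  choose k hk using this
  exact ⟨LinearMap.pi k, fun x => funext fun i => hk i x⟩

theorem gi_pi {ι : Type u} {A : ι → Type u} [∀ i, AddCommGroup (A i)]
    [∀ i, Module R (A i)] (h : ∀ i, GI R (A i)) : GI R (∀ i, A i) := by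
  refine gi_of_closed (P := fun X => ∃ A : ι → ModuleCat.{u} R, (∀ i, GI R (A i)) ∧
    Nonempty (X ≃ₗ[R] ∀ i, A i)) ?_ (ModuleCat.of R (∀ i, A i))
    ⟨fun i => ModuleCat.of R (A i), h, ⟨LinearEquiv.refl R _⟩⟩
  rintro X ⟨A, hA, ⟨e⟩⟩
  choose K hK lK using fun i => (hA i).left
  choose Y a b hY hs using lK
  choose K' hK' lK' using fun i => (hA i).right
  choose Y' a' b' hY' hs' using lK'
  have s1 := se_pi hs
  have s2 := se_pi hs'
  have t1 := s1.of_equiv_right e.symm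
  have t2 : SE ((LinearMap.pi (fun i => (a' i).comp (LinearMap.proj i))).comp e.toLinearMap)
      (LinearMap.pi (fun i => (b' i).comp (LinearMap.proj i)) :
        (∀ i, Y' i) →ₗ[R] ∀ i, K' i) := by
    refine SE.mk' ?_ ?_ ?_ s2.2.2
    · intro x hx
      exact e.map_eq_zero_iff.1 (s2.inj0 hx)
    · intro x; exact s2.zero _
    · intro y hy
      obtain ⟨z, hz⟩ := s2.lift hy
      exact ⟨e.symm z, by simpa using hz⟩
  refine ⟨?_, ⟨ModuleCat.of R (∀ i, K i), ⟨K, hK, ⟨LinearEquiv.refl R _⟩⟩,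
    ModuleCat.of R (∀ i, Y i), _, _, injective_pi hY, t1⟩,
    ⟨ModuleCat.of R (∀ i, K' i), ⟨K', hK', ⟨LinearEquiv.refl R _⟩⟩,
    ModuleCat.of R (∀ i, Y' i), _, _, injective_pi hY', t2⟩⟩
  refine liftP_of_one (injective_pi hY') t2 fun I hI g => ?_
  choose k hk using fun i => (hA i).liftP.lift hI (hs' i) ((LinearMap.proj i).comp g)
  exact ⟨LinearMap.pi k, fun y => funext fun i => hk i y⟩

theorem gd_pi {n : ℕ} {ι : Type u} {A : ι → Type u} [∀ i, AddCommGroup (A i)]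
    [∀ i, Module R (A i)] (h : ∀ i, GD R n (A i)) : GD R n (∀ i, A i) := by
  induction n generalizing A with
  | zero => exact gi_pi h
  | succ n ih =>
    choose K lK using fun i => exists_link (R := R) (A i)
    have := ih (A := fun i => K i) fun i => gd_link (lK i) (h i)
    choose Y a b hY hs using lK
    exact gd_succ (se_pi hs) (gi_of_injective (injective_pi hY)) this

end GDim

end GidAux


namespace GidAux
open TensorProduct

section FlatHom
variable {A : Type u} [CommRing A]

theorem hom_comp_aux {I J : Type u} [AddCommGroup I] [Module A I] [AddCommGroup J] [Module A J]
    (hI : Module.Injective A I) (hJ : Module.Injective A J) {n k : ℕ} (f : Fin n → A)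
    (r : Fin k → Fin n → A)
    (hr2 : ∀ v : Fin n → A, ∑ l, v l * f l = 0 → v ∈ Submodule.span A (Set.range r))
    (φ : Fin n → I →ₗ[A] J) (hφ : ∑ l, f l • φ l = 0) :
    ∃ y : Fin k → I →ₗ[A] J, ∀ l, φ l = ∑ j, r j l • y j := by
  let Ψ : (Fin n → I) →ₗ[A] J := ∑ l, (φ l).comp (LinearMap.proj l)
  let ρ : (Fin n → I) →ₗ[A] (Fin k → I) :=
    LinearMap.pi (fun j => ∑ l, r j l • LinearMap.proj l)
  have hρ : ∀ v j, ρ v j = ∑ l, r j l • v l := fun v j => by simp [ρ]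
  have hΨ : ∀ v, Ψ v = ∑ l, φ l (v l) := fun v => by simp [Ψ]
  have hker : ∀ v, ρ v = 0 → Ψ v = 0 := by
    intro v hv
    let s : (Fin n → A) →ₗ[A] A := ∑ l, f l • LinearMap.proj l
    let t : (Fin n → A) →ₗ[A] I := ∑ l, (LinearMap.toSpanSingleton A I (v l)).comp (LinearMap.proj l)
    have hs : ∀ w, s w = ∑ l, w l * f l := fun w => by simp [s, mul_comm]
    have ht : ∀ w, t w = ∑ l, w l • v l := fun w => by simp [t]
    have hst : ∀ w, s w = 0 → t w = 0 := by
      intro w hw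
      have hw' := hr2 w (by rw [← hs]; exact hw)
      have hle : Submodule.span A (Set.range r) ≤ LinearMap.ker t := by
        rw [Submodule.span_le]
        rintro _ ⟨j, rfl⟩
        have := congrFun hv j
        rw [hρ] at this
        simpa [ht] using this
      exact hle hw'
    obtain ⟨t', ht'⟩ := exists_factor s.rangeRestrict s.surjective_rangeRestrict t
      (fun w hw => hst w (congrArg Subtype.val hw))
    obtain ⟨t'', ht''⟩ := inj_extend hI (LinearMap.range s).subtype
      (Submodule.injective_subtype _) t'
    have hvl : ∀ l, v l = f l • t'' 1 := by
      intro l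
      have h1 : s (Pi.single l 1) = f l := by rw [hs]; simp [Pi.single_apply]
      have h2 : t (Pi.single l 1) = v l := by rw [ht]; simp [Pi.single_apply, ite_smul]
      rw [← h2, ← ht', ← ht'']
      rw [← map_smul, smul_eq_mul, mul_one, ← h1]
      rfl
    rw [hΨ]
    have : ∑ l, φ l (v l) = (∑ l, f l • φ l) (t'' 1) := by
      simp only [LinearMap.sum_apply, LinearMap.smul_apply]
      exact Finset.sum_congr rfl (fun l _ => by rw [hvl l, map_smul])
    rw [this, hφ]; rfl
  obtain ⟨y', hy'⟩ := exists_factor ρ.rangeRestrict ρ.surjective_rangeRestrict Ψ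
      (fun w hw => hker w (congrArg Subtype.val hw))
  obtain ⟨y, hy⟩ := inj_extend hJ (LinearMap.range ρ).subtype (Submodule.injective_subtype _) y'
  refine ⟨fun j => y.comp (LinearMap.single A (fun _ => I) j), fun l => ?_⟩
  ext v
  have h1 : Ψ (Pi.single l v) = φ l v := by
    rw [hΨ, Finset.sum_eq_single l]
    · simp
    · intro b _ hb; simp [Pi.single_eq_of_ne hb]
    · simp
  have h2 : y (ρ (Pi.single l v)) = Ψ (Pi.single l v) := by
    rw [← hy', ← hy]; rfl
  have h3 : ρ (Pi.single l v) = ∑ j, Pi.single j (r j l • v) := by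
    ext j
    rw [hρ, Finset.sum_apply, Finset.sum_eq_single l, Finset.sum_eq_single j]
    · simp
    · intro b _ hb; simp [Pi.single_eq_of_ne hb.symm]
    · simp
    · intro b _ hb; simp [Pi.single_eq_of_ne hb]
    · simp
  rw [← h1, ← h2, h3, map_sum]
  simp only [LinearMap.sum_apply, LinearMap.smul_apply, LinearMap.comp_apply, LinearMap.coe_single]
  exact Finset.sum_congr rfl (fun j _ => by rw [← map_smul, ← Pi.single_smul])

theorem flat_pi_hom [IsNoetherianRing A] {ι : Type u} {I J : ι → Type u}
    [∀ i, AddCommGroup (I i)] [∀ i, Module A (I i)] [∀ i, AddCommGroup (J i)]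
    [∀ i, Module A (J i)] (hI : ∀ i, Module.Injective A (I i))
    (hJ : ∀ i, Module.Injective A (J i)) : Module.Flat A (∀ i, I i →ₗ[A] J i) := by
  refine Module.Flat.of_forall_isTrivialRelation ?_
  intro n f x hx
  let s : (Fin n → A) →ₗ[A] A := ∑ l, f l • LinearMap.proj l
  have hs : ∀ w, s w = ∑ l, w l * f l := fun w => by simp [s, mul_comm]
  obtain ⟨k, r, hr⟩ := Submodule.fg_iff_exists_fin_generating_family.1
    (IsNoetherian.noetherian (LinearMap.ker s))
  have : ∀ i, ∃ y : Fin k → I i →ₗ[A] J i, ∀ l, x l i = ∑ j, r j l • y j := by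
    intro i
    refine hom_comp_aux (hI i) (hJ i) f r ?_ (fun l => x l i) ?_
    · intro v hv
      rw [hr, LinearMap.mem_ker, hs]; exact hv
    · have := congrFun hx i
      simpa using this
  choose y hy using this
  refine ⟨k, fun l j => r j l, fun j i => y i j, fun l => ?_, fun j => ?_⟩
  · ext1 i
    rw [hy i l]; simp
  · have : r j ∈ LinearMap.ker s := by rw [← hr]; exact Submodule.subset_span ⟨j, rfl⟩
    rw [LinearMap.mem_ker, hs] at this
    simpa [mul_comm] using this

theorem flat_hom [IsNoetherianRing A] {I J : Type u} [AddCommGroup I] [Module A I]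
    [AddCommGroup J] [Module A J] (hI : Module.Injective A I) (hJ : Module.Injective A J) :
    Module.Flat A (I →ₗ[A] J) := by
  have := flat_pi_hom (A := A) (ι := PUnit) (I := fun _ => I) (J := fun _ => J)
    (fun _ => hI) (fun _ => hJ)
  exact Module.Flat.of_linearEquiv (LinearEquiv.funUnique PUnit A (I →ₗ[A] J)).symm

end FlatHom

section Restrict
variable {A B : Type u} [CommRing A] [CommRing B] [Algebra A B]

theorem injective_of_equiv {I J : Type u} [AddCommGroup I] [Module A I] [AddCommGroup J]
    [Module A J] (hI : Module.Injective A I) (e : I ≃ₗ[A] J) : Module.Injective A J := by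
  refine ⟨fun X Y _ _ _ _ f hf g => ?_⟩
  obtain ⟨h, hh⟩ := hI.out f hf (e.symm.toLinearMap.comp g)
  exact ⟨e.toLinearMap.comp h, fun x => by simp [hh]⟩

theorem injective_restrict [Module.Flat A B] {J : Type u} [AddCommGroup J] [Module A J]
    [Module B J] [IsScalarTower A B J] (hJ : Module.Injective B J) : Module.Injective A J := by
  refine ⟨fun X Y _ _ _ _ f hf g => ?_⟩
  have hf' : Function.Injective (LinearMap.baseChange B f) :=
    Module.Flat.lTensor_preserves_injective_linearMap f hf
  obtain ⟨h, hh⟩ := hJ.out (LinearMap.baseChange B f) hf'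
    (LinearMap.liftBaseChange B g)
  refine ⟨(h.restrictScalars A).comp ((TensorProduct.mk A B Y) 1), fun x => ?_⟩
  have := hh (1 ⊗ₜ x)
  simpa using this

/-- `Hom_A(F, I)` is `A`-injective for flat `F`. -/
theorem injective_hom_flat {F I : Type u} [AddCommGroup F] [Module A F] [Module.Flat A F]
    [AddCommGroup I] [Module A I] (hI : Module.Injective A I) :
    Module.Injective A (F →ₗ[A] I) := by
  refine ⟨fun X Y _ _ _ _ f hf g => ?_⟩
  obtain ⟨h, hh⟩ := hI.out (f.rTensor F) (Module.Flat.rTensor_preserves_injective_linearMap f hf)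
    (TensorProduct.lift g)
  refine ⟨TensorProduct.curry h, fun x => ?_⟩
  ext y
  simpa using hh (x ⊗ₜ y)

theorem se_hom {X Y Z J : Type u} [AddCommGroup X] [Module A X] [AddCommGroup Y] [Module A Y]
    [AddCommGroup Z] [Module A Z] [AddCommGroup J] [Module A J] [Module B J]
    [IsScalarTower A B J] (hJ : Module.Injective A J) {i : X →ₗ[A] Y} {p : Y →ₗ[A] Z}
    (h : SE i p) : SE (LinearMap.lcomp B J p) (LinearMap.lcomp B J i) := by
  refine SE.mk' (fun f hf => ?_) (fun f => ?_) (fun f hf => ?_) (fun f => ?_)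
  · ext z
    obtain ⟨y, rfl⟩ := h.2.2 z
    exact LinearMap.congr_fun hf y
  · ext x
    simp [h.zero]
  · obtain ⟨f', hf'⟩ := exists_factor p h.2.2 f (fun y hy => by
      obtain ⟨x, rfl⟩ := h.lift hy
      exact LinearMap.congr_fun hf x)
    exact ⟨f', by ext y; exact hf' y⟩
  · obtain ⟨f', hf'⟩ := inj_extend hJ i h.1 f
    exact ⟨f', by ext y; exact hf' y⟩

/-- Closedness for the class of totally reflexive modules. -/
def TClosed (P : ModuleCat.{u} A → Prop) : Prop :=
  ∀ G, P G → (∃ (a : ℕ) (G1 : ModuleCat.{u} A) (i : G1 →ₗ[A] (Fin a → A)) (p : (Fin a → A) →ₗ[A] G),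
      P G1 ∧ SE i p ∧ ∀ f : G1 →ₗ[A] A, ∃ f' : (Fin a → A) →ₗ[A] A, ∀ g, f' (i g) = f g) ∧
    (∃ (a : ℕ) (G1 : ModuleCat.{u} A) (i : G →ₗ[A] (Fin a → A)) (p : (Fin a → A) →ₗ[A] G1),
      P G1 ∧ SE i p)

/-- Totally reflexive modules. -/
def TR (A : Type u) [CommRing A] (G : Type u) [AddCommGroup G] [Module A G] : Prop :=
  ∃ P : ModuleCat.{u} A → Prop, TClosed P ∧ P (ModuleCat.of A G)

theorem TR.finite {G : Type u} [AddCommGroup G] [Module A G] (h : TR A G) : Module.Finite A G := by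
  obtain ⟨P, hP, hG⟩ := h
  obtain ⟨⟨a, G1, i, p, -, hs, -⟩, -⟩ := hP _ hG
  exact Module.Finite.of_surjective p hs.2.2

theorem tr_gi [IsNoetherianRing A] [IsNoetherianRing B] [Module.Flat A B]
    {G J : Type u} [AddCommGroup G] [Module A G] (hG : TR A G) [AddCommGroup J] [Module A J]
    [Module B J] [IsScalarTower A B J] (hJ : Module.Injective B J) : GI B (G →ₗ[A] J) := by
  have hJA : Module.Injective A J := injective_restrict (B := B) hJ
  have hfree : ∀ a : ℕ, Module.Injective B ((Fin a → A) →ₗ[A] J) := by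
    intro a
    have h1 : Module.Injective B (ULift.{u} (Fin a) → J) := injective_pi (fun _ => hJ)
    refine injective_of_equiv h1 ?_
    let e1 : (Fin a → J) ≃ₗ[B] (Fin a → (A →ₗ[A] J)) :=
      LinearEquiv.piCongrRight (fun _ => (LinearMap.ringLmapEquivSelf A B J).symm)
    let e2 : (Fin a → (A →ₗ[A] J)) ≃ₗ[B] ((Fin a → A) →ₗ[A] J) :=
      LinearMap.lsum A (fun _ : Fin a => A) B
    exact (LinearEquiv.funCongrLeft B J Equiv.ulift.symm).trans (e1.trans e2)
  obtain ⟨P, hP, hG⟩ := hG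
  refine gi_of_closed (P := fun X => ∃ G : ModuleCat.{u} A, P G ∧
    Nonempty (X ≃ₗ[B] (G →ₗ[A] J))) ?_ (ModuleCat.of B (G →ₗ[A] J))
    ⟨ModuleCat.of A G, hG, ⟨LinearEquiv.refl B _⟩⟩
  rintro X ⟨G, hG, ⟨e⟩⟩
  obtain ⟨⟨a, G1, i, p, hG1, hs, hext⟩, ⟨b, G', i', p', hG', hs'⟩⟩ := hP _ hG
  have h1 := se_hom (B := B) hJA hs
  have h2 := se_hom (B := B) hJA hs'
  have h1' : SE ((LinearMap.lcomp B J p).comp e.toLinearMap) (LinearMap.lcomp B J i) :=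
    SE.mk' (fun x hx => by simpa using h1.inj0 hx) (fun x => h1.zero _)
      (fun y hy => by
        obtain ⟨z, hz⟩ := h1.lift hy
        exact ⟨e.symm z, by simpa using hz⟩) h1.2.2
  refine ⟨?_, ⟨ModuleCat.of B (G' →ₗ[A] J), ⟨G', hG', ⟨LinearEquiv.refl B _⟩⟩,
    ModuleCat.of B ((Fin b → A) →ₗ[A] J), _, _, hfree b, h2.of_equiv_right e.symm⟩,
    ⟨ModuleCat.of B (G1 →ₗ[A] J), ⟨G1, hG1, ⟨LinearEquiv.refl B _⟩⟩,
    ModuleCat.of B ((Fin a → A) →ₗ[A] J), _, _, hfree a, h1'⟩⟩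
  refine liftP_of_one (hfree a) h1' ?_
  intro I hI g
  haveI : Module.Flat B (I →ₗ[B] J) := flat_hom hI hJ
  haveI : Module.Flat A (I →ₗ[B] J) := Module.Flat.trans A B _
  haveI : Module.Finite A G1 := Module.Finite.of_injective i hs.1
  let gf : G1 →ₗ[A] (I →ₗ[B] J) :=
    { toFun := fun w => { toFun := fun y => g y w, map_add' := by simp, map_smul' := by simp }
      map_add' := fun w w' => by ext y; simp
      map_smul' := fun r w => by ext y; simp }
  haveI : Module.FinitePresentation A G1 := Module.finitePresentation_of_finite A G1
  obtain ⟨k, h₂, h₃, hh⟩ := Module.Flat.exists_factorization_of_finitePresentation gf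
  have : ∀ j : Fin k, ∃ f' : (Fin a → A) →ₗ[A] A, ∀ w, f' (i w) = h₂ w j := fun j =>
    hext ((Finsupp.lapply j).comp h₂)
  choose f' hf' using this
  let F : (Fin a → A) →ₗ[A] (Fin k →₀ A) :=
    (Finsupp.linearEquivFunOnFinite A A (Fin k)).symm.toLinearMap.comp (LinearMap.pi f')
  have hF : ∀ w, F (i w) = h₂ w := fun w => by
    ext j; simp [F, hf']
  refine ⟨{ toFun := fun y => { toFun := fun v => h₃ (F v) y, map_add' := by simp,
                                map_smul' := by simp }
            map_add' := fun y y' => by ext v; simp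
            map_smul' := fun c y => by ext v; simp }, fun y => ?_⟩
  ext w
  have := LinearMap.congr_fun (LinearMap.congr_fun hh w) y
  simp only [LinearMap.lcomp_apply, LinearMap.coe_mk, AddHom.coe_mk, hF]
  exact this.symm

end Restrict
end GidAux


namespace GidAux

section Gam
variable {R : Type u} [CommRing R]

/-- `𝔟`-torsion submodule. -/
def gam (b : Ideal R) (I : Type u) [AddCommGroup I] [Module R I] : Submodule R I where
  carrier := {y | ∃ n : ℕ, ∀ r ∈ b ^ n, r • y = 0}
  zero_mem' := ⟨0, by simp⟩
  add_mem' := by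
    rintro y z ⟨n, hn⟩ ⟨m, hm⟩
    refine ⟨n + m, fun r hr => ?_⟩
    rw [smul_add, hn r (Ideal.pow_le_pow_right (Nat.le_add_right n m) hr),
      hm r (Ideal.pow_le_pow_right (Nat.le_add_left m n) hr), add_zero]
  smul_mem' := by
    rintro c y ⟨n, hn⟩
    exact ⟨n, fun r hr => by rw [smul_comm, hn r hr, smul_zero]⟩

variable {I J : Type u} [AddCommGroup I] [Module R I] [AddCommGroup J] [Module R J]

theorem mem_gam {b : Ideal R} {y : I} : y ∈ gam b I ↔ ∃ n : ℕ, ∀ r ∈ b ^ n, r • y = 0 := Iff.rfl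

theorem mem_gam_span {x : R} {y : I} : y ∈ gam (Ideal.span {x}) I ↔ ∃ n : ℕ, x ^ n • y = 0 := by
  rw [mem_gam]
  constructor
  · rintro ⟨n, hn⟩
    exact ⟨n, hn _ (Ideal.pow_mem_pow (Ideal.mem_span_singleton_self x) n)⟩
  · rintro ⟨n, hn⟩
    refine ⟨n, fun r hr => ?_⟩
    rw [Ideal.span_singleton_pow] at hr
    obtain ⟨c, rfl⟩ := Ideal.mem_span_singleton'.1 hr
    rw [mul_smul, hn, smul_zero]

theorem gam_mono {b c : Ideal R} (h : b ≤ c) : gam c I ≤ gam b I := by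
  rintro y ⟨n, hn⟩
  exact ⟨n, fun r hr => hn r (Ideal.pow_right_mono h n hr)⟩

theorem gam_map {b : Ideal R} (f : I →ₗ[R] J) {y : I} (hy : y ∈ gam b I) : f y ∈ gam b J := by
  obtain ⟨n, hn⟩ := hy
  exact ⟨n, fun r hr => by rw [← map_smul, hn r hr, map_zero]⟩

theorem gam_of_inj {b : Ideal R} (f : I →ₗ[R] J) (hf : Function.Injective f) {y : I}
    (hy : f y ∈ gam b J) : y ∈ gam b I := by
  obtain ⟨n, hn⟩ := hy
  exact ⟨n, fun r hr => hf (by rw [map_smul, hn r hr, map_zero])⟩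

theorem fg_bound [IsNoetherianRing R] (b : Ideal R) {X : Type u} [AddCommGroup X] [Module R X]
    [Module.Finite R X] (f : X →ₗ[R] I) (hf : ∀ a, f a ∈ gam b I) :
    ∃ n : ℕ, ∀ r ∈ b ^ n, ∀ a, r • f a = 0 := by
  obtain ⟨s, hs⟩ := (Module.Finite.fg_top : (⊤ : Submodule R X).FG)
  choose n hn using hf
  refine ⟨s.sup n, fun r hr a => ?_⟩
  have : (⊤ : Submodule R X) ≤ LinearMap.ker (r • f) := by
    rw [← hs, Submodule.span_le]
    intro y hy
    exact hn y r (Ideal.pow_le_pow_right (Finset.le_sup hy) hr)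
  exact this (Submodule.mem_top : a ∈ ⊤)

theorem artin_rees_le [IsNoetherianRing R] (b a : Ideal R) (n : ℕ) :
    ∃ k, a ⊓ b ^ k ≤ b ^ n • (a : Submodule R R) := by
  obtain ⟨k, hk⟩ := Ideal.exists_pow_inf_eq_pow_smul b (a : Submodule R R)
  refine ⟨n + k, ?_⟩
  have h := hk (n + k) (Nat.le_add_left k n)
  rw [Nat.add_sub_cancel] at h
  intro y hy
  have h1 : y ∈ b ^ (n + k) • (⊤ : Submodule R R) ⊓ a := ⟨by simpa using hy.2, hy.1⟩
  rw [h] at h1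
  exact Submodule.smul_mono le_rfl inf_le_right h1

theorem injective_gam [IsNoetherianRing R] (b : Ideal R) (hI : Module.Injective R I) :
    Module.Injective R (gam b I) := by
  refine Module.Baer.injective ?_
  intro a g
  let f : a →ₗ[R] I := (gam b I).subtype.comp g
  obtain ⟨n, hn⟩ := fg_bound b f (fun y => (g y).2)
  obtain ⟨k, hk⟩ := artin_rees_le b a n
  have hkill : ∀ y : a, (y : R) ∈ b ^ k → f y = 0 := by
    intro y hy
    have h1 : (y : R) ∈ b ^ n • (a : Submodule R R) := hk ⟨y.2, hy⟩
    have h2 : b ^ n • (a : Submodule R R) ≤ Submodule.map a.subtype (LinearMap.ker f) := by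
      refine Submodule.smul_le.2 fun r hr w hw => ?_
      exact ⟨r • ⟨w, hw⟩, by rw [SetLike.mem_coe, LinearMap.mem_ker, map_smul, hn r hr], rfl⟩
    obtain ⟨w, hw, hw'⟩ := h2 h1
    have : w = y := Subtype.ext hw'
    rw [← this]; exact hw
  let q : a →ₗ[R] R ⧸ (b ^ k) := (Submodule.mkQ (b ^ k)).comp a.subtype
  obtain ⟨f', hf'⟩ := exists_factor q.rangeRestrict q.surjective_rangeRestrict f (fun y hy => by
    refine hkill y ?_
    have : q y = 0 := congrArg Subtype.val hy
    exact (Submodule.Quotient.mk_eq_zero _).1 this)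
  obtain ⟨F, hF⟩ := inj_extend hI (LinearMap.range q).subtype (Submodule.injective_subtype _) f'
  have hmem : ∀ r, F (Submodule.mkQ (b ^ k) r) ∈ gam b I := fun r =>
    ⟨k, fun t ht => by
      rw [← map_smul, ← map_smul]
      have : Submodule.mkQ (b ^ k) (t • r) = 0 := by
        exact (Submodule.Quotient.mk_eq_zero _).2 (Ideal.mul_mem_right r _ ht)
      rw [this, map_zero]⟩
  refine ⟨(F.comp (Submodule.mkQ (b ^ k))).codRestrict _ hmem, fun y hy => ?_⟩
  refine Subtype.ext ?_
  change F (Submodule.mkQ (b ^ k) y) = f ⟨y, hy⟩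
  rw [← hf', ← hF]; rfl

theorem inj_good [IsNoetherianRing R] (s : R) (hI : Module.Injective R I) (y : I) :
    ∃ (l : ℕ) (z : I), s ^ l • y = s ^ (l+1) • z := by
  obtain ⟨n, hn⟩ := monotone_stabilizes_iff_noetherian.2 (inferInstance : IsNoetherian R R)
    ⟨fun n => LinearMap.ker (LinearMap.lsmul R R (s ^ n)), monotone_nat_of_le_succ (fun n r hr => by
      have : s ^ n * r = 0 := hr
      change s ^ (n+1) * r = 0
      rw [pow_succ', mul_assoc, this, mul_zero])⟩
  refine ⟨n, ?_⟩
  let p : R →ₗ[R] R := LinearMap.lsmul R R (s ^ (n+1))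
  obtain ⟨f, hf⟩ := exists_factor p.rangeRestrict p.surjective_rangeRestrict
    (LinearMap.toSpanSingleton R I (s ^ n • y)) (fun r hr => by
      have h1 : r ∈ LinearMap.ker (LinearMap.lsmul R R (s ^ (n+1))) := congrArg Subtype.val hr
      have h2 := hn (n+1) (Nat.le_succ n)
      have h3 : r ∈ LinearMap.ker (LinearMap.lsmul R R (s ^ n)) := by
        change LinearMap.ker (LinearMap.lsmul R R (s ^ n)) =
          LinearMap.ker (LinearMap.lsmul R R (s ^ (n+1))) at h2
        rw [h2]; exact h1
      have h4 : s ^ n * r = 0 := h3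
      rw [LinearMap.toSpanSingleton_apply, smul_smul, mul_comm, h4, zero_smul])
  obtain ⟨F, hF⟩ := inj_extend hI (LinearMap.range p).subtype (Submodule.injective_subtype _) f
  refine ⟨F 1, ?_⟩
  have h1 := hf 1
  rw [← hF, LinearMap.toSpanSingleton_apply, one_smul] at h1
  rw [← h1, ← map_smul]
  rfl

theorem SE.section {A B C : Type u} [AddCommGroup A] [Module R A] [AddCommGroup B] [Module R B]
    [AddCommGroup C] [Module R C] {i : A →ₗ[R] B} {p : B →ₗ[R] C} (h : SE i p)
    (hA : Module.Injective R A) : ∃ σ : C →ₗ[R] B, ∀ c, p (σ c) = c := by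
  obtain ⟨ρ, hρ⟩ := inj_extend hA i h.1 LinearMap.id
  obtain ⟨σ, hσ⟩ := exists_factor p h.2.2 (LinearMap.id - i.comp ρ) (fun b hb => by
    obtain ⟨a, rfl⟩ := h.lift hb
    simp [hρ])
  refine ⟨σ, fun c => ?_⟩
  obtain ⟨b, rfl⟩ := h.2.2 c
  rw [hσ]
  simp [h.zero]

theorem injective_retract {A B : Type u} [AddCommGroup A] [Module R A] [AddCommGroup B]
    [Module R B] (hB : Module.Injective R B) (i : A →ₗ[R] B) (p : B →ₗ[R] A)
    (h : ∀ a, p (i a) = a) : Module.Injective R A := by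
  refine ⟨fun X Y _ _ _ _ f hf g => ?_⟩
  obtain ⟨k, hk⟩ := hB.out f hf (i.comp g)
  exact ⟨p.comp k, fun x => by simp [hk, h]⟩

theorem SE.injective_right {A B C : Type u} [AddCommGroup A] [Module R A] [AddCommGroup B]
    [Module R B] [AddCommGroup C] [Module R C] {i : A →ₗ[R] B} {p : B →ₗ[R] C} (h : SE i p)
    (hA : Module.Injective R A) (hB : Module.Injective R B) : Module.Injective R C := by
  obtain ⟨σ, hσ⟩ := h.section hA
  exact injective_retract hB σ p hσ

end Gam

section Co
variable {R : Type u} [CommRing R]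

/-- multiplication by `s` is bijective -/
def Inv (s : R) (W : Type u) [AddCommGroup W] [Module R W] : Prop :=
  Function.Bijective (fun w : W => s • w)

/-- compatible sequences of `s`-quotients -/
def co (s : R) (C : Type u) [AddCommGroup C] [Module R C] : Submodule R (ℕ → C) where
  carrier := {y | ∀ k, y k = s • y (k+1)}
  zero_mem' := fun k => by simp
  add_mem' := fun {y z} hy hz k => by
    simp only [Pi.add_apply, smul_add]; rw [← hy k, ← hz k]
  smul_mem' := fun c y hy k => by
    simp only [Pi.smul_apply]; rw [smul_comm, ← hy k]

variable {s : R} {A B C W : Type u} [AddCommGroup A] [Module R A] [AddCommGroup B] [Module R B]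
  [AddCommGroup C] [Module R C] [AddCommGroup W] [Module R W]

theorem co.eq (y : co s C) (k : ℕ) : y.1 k = s • y.1 (k+1) := y.2 k

theorem co.pow (y : co s C) (k m : ℕ) : s ^ k • y.1 (k + m) = y.1 m := by
  induction k with
  | zero => simp
  | succ k ih => rw [pow_succ, mul_smul, show k + 1 + m = (k + m) + 1 by ring, ← co.eq, ih]

/-- evaluation at zero -/
def ev0 (s : R) (C : Type u) [AddCommGroup C] [Module R C] : co s C →ₗ[R] C :=
  (LinearMap.proj 0).comp (co s C).subtype

@[simp] theorem ev0_apply (y : co s C) : ev0 s C y = y.1 0 := rfl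

theorem co_inv : Inv s (co s C) := by
  constructor
  · intro y z h
    ext k
    have := congrFun (congrArg Subtype.val h) (k+1)
    change s • y.1 (k+1) = s • z.1 (k+1) at this
    rw [co.eq, co.eq z, this]
  · intro y
    refine ⟨⟨fun k => y.1 (k+1), fun k => y.2 (k+1)⟩, ?_⟩
    ext k
    exact (y.2 k).symm

/-- functoriality of `co` -/
def coMap (s : R) (f : A →ₗ[R] B) : co s A →ₗ[R] co s B where
  toFun y := ⟨fun k => f (y.1 k), fun k => by
    change f (y.1 k) = s • f (y.1 (k+1))
    rw [← map_smul, ← co.eq]⟩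
  map_add' y z := by ext k; simp
  map_smul' c y := by ext k; simp

@[simp] theorem coMap_apply (f : A →ₗ[R] B) (y : co s A) (k : ℕ) :
    (coMap s f y).1 k = f (y.1 k) := rfl

/-- vanishing of the derived limit -/
def A2 (s : R) (C : Type u) [AddCommGroup C] [Module R C] : Prop :=
  ∀ y : ℕ → C, ∃ z : ℕ → C, ∀ k, y k = z k - s • z (k+1)

theorem Dv.a2 (h : Dv s C) : A2 s C := by
  intro y
  choose d hd using h
  let z : ℕ → C := fun n => Nat.rec 0 (fun k w => d (w - y k)) n
  refine ⟨z, fun k => ?_⟩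
  have : z (k+1) = d (z k - y k) := rfl
  rw [this, hd]; abel

theorem A2.of_surj (h : A2 s A) (p : A →ₗ[R] B) (hp : Function.Surjective p) : A2 s B := by
  intro y
  choose d hd using hp
  obtain ⟨z, hz⟩ := h (fun k => d (y k))
  refine ⟨fun k => p (z k), fun k => ?_⟩
  rw [← map_smul, ← map_sub, ← hz, hd]

theorem co_se {i : A →ₗ[R] B} {p : B →ₗ[R] C} (h : SE i p) (hA : A2 s A) :
    SE (coMap s i) (coMap s p) := by
  refine SE.mk' (fun y hy => ?_) (fun y => ?_) (fun y hy => ?_) (fun y => ?_)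
  · ext k
    exact h.inj0 (congrFun (congrArg Subtype.val hy) k)
  · ext k; simp [h.zero]
  · have : ∀ k, ∃ a, i a = y.1 k := fun k => h.lift (congrFun (congrArg Subtype.val hy) k)
    choose a ha using this
    refine ⟨⟨a, fun k => h.1 ?_⟩, ?_⟩
    · rw [map_smul, ha, ha, ← co.eq]
    · ext k; exact ha k
  · have : ∀ k, ∃ b, p b = y.1 k := fun k => h.2.2 _
    choose b hb using this
    have : ∀ k, ∃ a, i a = b k - s • b (k+1) := fun k => h.lift (by
      rw [map_sub, map_smul, hb, hb, ← co.eq, sub_self])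
    choose a ha using this
    obtain ⟨z, hz⟩ := hA a
    refine ⟨⟨fun k => b k - i (z k), fun k => ?_⟩, ?_⟩
    · have h1 := ha k
      rw [hz, map_sub, map_smul] at h1
      change b k - i (z k) = s • (b (k+1) - i (z (k+1)))
      rw [smul_sub, sub_eq_sub_iff_add_eq_add]
      rw [sub_eq_sub_iff_add_eq_add] at h1
      rw [add_comm (s • b (k+1)), h1, add_comm]
    · ext k
      simp [h.zero, hb]

theorem exists_toCo (hW : Inv s W) (f : W →ₗ[R] C) :
    ∃ f' : W →ₗ[R] co s C, ∀ w, (f' w).1 0 = f w := by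
  let e : W ≃ₗ[R] W := LinearEquiv.ofBijective (LinearMap.lsmul R W s) hW
  have he : ∀ w, s • e.symm w = w := fun w => e.apply_symm_apply w
  let F : ℕ → W →ₗ[R] W := fun k => Nat.rec LinearMap.id (fun _ g => e.symm.toLinearMap.comp g) k
  refine ⟨LinearMap.codRestrict _ (LinearMap.pi (fun k => f.comp (F k))) (fun w k => ?_), fun w => rfl⟩
  change f (F k w) = s • f (e.symm (F k w))
  rw [← map_smul, he]

theorem ev0_surj (h : Dv s C) : Function.Surjective (ev0 s C) := by
  intro c
  choose d hd using h
  exact ⟨⟨fun n => Nat.rec c (fun _ w => d w) n, fun k => (hd _).symm⟩, rfl⟩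

theorem inv_iff_unit : Inv s W ↔ IsUnit (algebraMap R (Module.End R W) s) := by
  rw [Module.End.isUnit_iff]; rfl

theorem injective_co (hC : Module.Injective R C) : Module.Injective R (co s C) := by
  refine ⟨fun X Y _ _ _ _ f hf g => ?_⟩
  let S : Submonoid R := Submonoid.powers s
  have hu : ∀ t : S, IsUnit (algebraMap R (Module.End R (co s C)) t) := by
    rintro ⟨_, n, rfl⟩
    rw [map_pow]
    exact (inv_iff_unit.1 co_inv).pow n
  have huY : Inv s (LocalizedModule S Y) := inv_iff_unit.2
    (IsLocalizedModule.map_units (LocalizedModule.mkLinearMap S Y) ⟨s, Submonoid.mem_powers s⟩)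
  let gs : LocalizedModule S X →ₗ[R] co s C :=
    IsLocalizedModule.lift S (LocalizedModule.mkLinearMap S X) g hu
  let fs : LocalizedModule S X →ₗ[R] LocalizedModule S Y :=
    IsLocalizedModule.map S (LocalizedModule.mkLinearMap S X) (LocalizedModule.mkLinearMap S Y) f
  have hfs : Function.Injective fs := IsLocalizedModule.map_injective S _ _ f hf
  obtain ⟨φ, hφ⟩ := inj_extend hC fs hfs ((ev0 s C).comp gs)
  obtain ⟨φ', hφ'⟩ := exists_toCo huY φ
  refine ⟨φ'.comp (LocalizedModule.mkLinearMap S Y), fun x => ?_⟩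
  have h1 : ∀ z, φ' (fs z) = gs z := by
    have huX : Inv s (LocalizedModule S X) := inv_iff_unit.2
      (IsLocalizedModule.map_units (LocalizedModule.mkLinearMap S X) ⟨s, Submonoid.mem_powers s⟩)
    intro z
    ext k
    have hp : ∀ k, ∃ z', s ^ k • z' = z := by
      intro k
      induction k with
      | zero => exact ⟨z, by simp⟩
      | succ k ih =>
        obtain ⟨w, hw⟩ := ih
        obtain ⟨v, hv⟩ := huX.2 w
        exact ⟨v, by rw [← hw, ← hv, pow_succ, mul_smul]⟩
    obtain ⟨w, rfl⟩ := hp k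
    rw [map_smul, map_smul, map_smul]
    have h2 : ∀ y : co s C, (s ^ k • y).1 k = y.1 0 := fun y => co.pow y k 0
    rw [h2, h2, hφ', hφ]; rfl
  have h2 : LocalizedModule.mkLinearMap S Y (f x) = fs (LocalizedModule.mkLinearMap S X x) :=
    (IsLocalizedModule.map_apply S _ _ f x).symm
  rw [LinearMap.comp_apply, h2, h1]
  exact IsLocalizedModule.lift_apply S _ g hu x

end Co
end GidAux


namespace GidAux

theorem exists_soc {R : Type u} [CommRing R] {T : Type u} [AddCommGroup T] [Module R T] {b : Ideal R} {t : T} (ht : t ∈ gam b T)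
    (h0 : t ≠ 0) : ∃ r : R, r • t ≠ 0 ∧ ∀ s ∈ b, s • r • t = 0 := by
  classical
  have hex : ∃ n : ℕ, ∀ r ∈ b ^ n, r • t = 0 := ht
  have hn := Nat.find_spec hex
  rcases hk : Nat.find hex with _ | k
  · rw [hk] at hn
    exact absurd (by simpa using hn 1 (by simp)) h0
  · have := Nat.find_min hex (m := k) (by omega)
    push Not at this
    obtain ⟨r, hr, hrt⟩ := this
    refine ⟨r, hrt, fun s hs => ?_⟩
    rw [smul_smul, mul_comm]
    exact (hk ▸ hn) _ (by rw [pow_succ]; exact Ideal.mul_mem_mul hr hs)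

section HullSec
variable {R : Type u} [CommRing R] [IsLocalRing R]

/-- `E` is an injective hull of the residue field. -/
structure Hull (R : Type u) [CommRing R] [IsLocalRing R] (E : Type u) [AddCommGroup E]
    [Module R E] (e0 : E) : Prop where
  inj : Module.Injective R E
  tors : ∀ e : E, e ∈ gam (maximalIdeal R) E
  ne : e0 ≠ 0
  kill : ∀ r ∈ maximalIdeal R, r • e0 = 0
  soc : ∀ e : E, (∀ r ∈ maximalIdeal R, r • e = 0) → ∃ r : R, e = r • e0

theorem exists_hull (R : Type u) [CommRing R] [IsLocalRing R] [IsNoetherianRing R] :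
    ∃ (E : ModuleCat.{u} R) (e0 : E), Hull R E e0 := by
  set m := maximalIdeal R with hm
  obtain ⟨J, j, hJ, hj⟩ := exists_embed (R := R) (R ⧸ m)
  let T := gam m J
  have hT : Module.Injective R T := injective_gam m hJ
  have htors : ∀ t : T, t ∈ gam m T := by
    intro t
    obtain ⟨n, hn⟩ := t.2
    exact ⟨n, fun r hr => Subtype.ext (hn r hr)⟩
  have hk0 : ∀ r ∈ m, r • j (Ideal.Quotient.mk m 1) = 0 := by
    intro r hr
    rw [← map_smul, ← map_zero j]; congr 1
    change Ideal.Quotient.mk m (r * 1) = 0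
    rw [mul_one]; exact Ideal.Quotient.eq_zero_iff_mem.2 hr
  let e0 : T := ⟨j (Ideal.Quotient.mk m 1), ⟨1, fun r hr => hk0 r (by simpa using hr)⟩⟩
  have he0 : e0 ≠ 0 := by
    intro h
    have h1 : j (Ideal.Quotient.mk m 1) = 0 := congrArg Subtype.val h
    rw [← map_zero j] at h1
    have h2 := hj h1
    rw [Ideal.Quotient.eq_zero_iff_mem] at h2
    exact (Ideal.ne_top_iff_one m).1 (IsLocalRing.maximalIdeal.isMaximal R).ne_top h2
  have hke0 : ∀ r ∈ m, r • e0 = 0 := fun r hr => Subtype.ext (hk0 r hr)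
  -- first Zorn
  let S : Set (Submodule R T) := {X | e0 ∈ X ∧ ∀ t ∈ X, (∀ r ∈ m, r • t = 0) → ∃ r : R, t = r • e0}
  obtain ⟨E, hE1, hE⟩ : ∃ E, (Submodule.span R {e0}) ≤ E ∧ Maximal (fun X => X ∈ S) E := by
    refine zorn_le_nonempty₀ S ?_ _ ⟨Submodule.mem_span_singleton_self _, fun t ht _ => ?_⟩
    · intro c hc hch y hy
      refine ⟨sSup c, ⟨?_, ?_⟩, fun z hz => le_sSup hz⟩
      · exact le_sSup hy (hc hy).1
      · intro t ht hrt
        rw [Submodule.mem_sSup_of_directed ⟨y, hy⟩ hch.directedOn] at ht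
        obtain ⟨z, hz, htz⟩ := ht
        exact (hc hz).2 t htz hrt
    · obtain ⟨r, hr⟩ := Submodule.mem_span_singleton.1 ht
      exact ⟨r, hr.symm⟩
  -- second Zorn
  obtain ⟨H, -, hH⟩ : ∃ H, (⊥ : Submodule R T) ≤ H ∧
      Maximal (fun X => X ∈ {X : Submodule R T | ∀ t ∈ X, t ∈ E → t = 0}) H := by
    refine zorn_le_nonempty₀ _ ?_ _ (fun t ht _ => by simpa using ht)
    intro c hc hch y hy
    refine ⟨sSup c, fun t ht htE => ?_, fun z hz => le_sSup hz⟩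
    rw [Submodule.mem_sSup_of_directed ⟨y, hy⟩ hch.directedOn] at ht
    obtain ⟨z, hz, htz⟩ := ht
    exact hc hz t htz htE
  have hHE : ∀ t ∈ H, t ∈ E → t = 0 := hH.prop
  let q := H.mkQ
  have hqE : Function.Injective (q.comp E.subtype) := by
    rw [← LinearMap.ker_eq_bot, LinearMap.ker_eq_bot']
    intro e he
    exact Subtype.ext (hHE _ ((Submodule.Quotient.mk_eq_zero H).1 he) e.2)
  obtain ⟨g, hg⟩ := inj_extend hT (q.comp E.subtype) hqE E.subtype
  have hg' : ∀ e ∈ E, g (q e) = e := fun e he => hg ⟨e, he⟩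
  -- socle of T/H
  have hsoc : ∀ t : T, (∀ r ∈ m, r • t ∈ H) → ∃ r : R, q t = q (r • e0) := by
    intro t ht
    by_cases htH : t ∈ H
    · exact ⟨0, by rw [zero_smul, map_zero]; exact (Submodule.Quotient.mk_eq_zero H).2 htH⟩
    have hlt : ¬ (∀ a ∈ H ⊔ Submodule.span R {t}, a ∈ E → a = 0) := by
      intro h
      have := hH.le_of_ge (y := H ⊔ Submodule.span R {t}) h le_sup_left
      exact htH (this (Submodule.mem_sup_right (Submodule.mem_span_singleton_self t)))
    push Not at hlt
    obtain ⟨a, ha, haE, ha0⟩ := hlt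
    obtain ⟨h, hh, z, hz, rfl⟩ := Submodule.mem_sup.1 ha
    obtain ⟨r, rfl⟩ := Submodule.mem_span_singleton.1 hz
    have hr : IsUnit r := by
      by_contra hr
      exact ha0 (hHE _ (H.add_mem hh (ht r ((IsLocalRing.mem_maximalIdeal r).2 hr))) haE)
    obtain ⟨u, rfl⟩ := hr
    set e' : T := (↑u⁻¹ : R) • (h + (u : R) • t) with he'
    have he'E : e' ∈ E := E.smul_mem _ haE
    have hte : t = e' - (↑u⁻¹ : R) • h := by
      rw [he', smul_add, smul_smul]; simp
    have hqt : q t = q e' := by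
      rw [hte, map_sub, sub_eq_self]
      exact (Submodule.Quotient.mk_eq_zero H).2 (H.smul_mem _ hh)
    obtain ⟨r, hr⟩ := hE.prop.2 e' he'E (fun r hr => hHE _ (by
      have : r • e' = r • t + r • (↑u⁻¹ : R) • h := by rw [hte]; simp [smul_sub]
      rw [this]
      exact H.add_mem (ht r hr) (H.smul_mem _ (H.smul_mem _ hh))) (E.smul_mem _ he'E))
    exact ⟨r, by rw [hqt, hr]⟩
  have hginj : ∀ t : T, g (q t) = 0 → t ∈ H := by
    intro t ht
    by_contra htH
    have h0 : q t ≠ 0 := fun h => htH ((Submodule.Quotient.mk_eq_zero H).1 h)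
    obtain ⟨r, hr, hs⟩ := exists_soc (gam_map q (htors t)) h0
    obtain ⟨c, hc⟩ := hsoc (r • t) (fun s hs' => by
      have := hs s hs'
      rw [← map_smul, ← map_smul] at this
      exact (Submodule.Quotient.mk_eq_zero H).1 this)
    have : c • e0 = 0 := by
      rw [← hg' (c • e0) (E.smul_mem _ hE.prop.1), ← hc, map_smul, map_smul, ht, smul_zero]
    rw [this, map_zero, map_smul] at hc
    exact hr hc
  have hgE : ∀ t : T, g (q t) ∈ E := by
    have hle : E ≤ LinearMap.range (g.comp q) := fun e he => ⟨e, hg' e he⟩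
    have := hE.le_of_ge (y := LinearMap.range (g.comp q)) ⟨hle hE.prop.1, ?_⟩ hle
    · exact fun t => this ⟨t, rfl⟩
    · rintro _ ⟨t, rfl⟩ hs
      obtain ⟨c, hc⟩ := hsoc t (fun r hr => hginj _ (by
        have := hs r hr
        rw [map_smul, map_smul]; exact this))
      refine ⟨c, ?_⟩
      change g (q t) = _
      rw [hc, hg' _ (E.smul_mem _ hE.prop.1)]
  refine ⟨ModuleCat.of R E, ⟨e0, hE.prop.1⟩, ?_, ?_, ?_, ?_, ?_⟩
  · exact injective_retract hT E.subtype ((g.comp q).codRestrict E hgE)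
      (fun e => Subtype.ext (hg' e.1 e.2))
  · exact fun e => gam_of_inj E.subtype Subtype.val_injective (htors e.1)
  · exact fun h => he0 (congrArg Subtype.val h)
  · exact fun r hr => Subtype.ext (hke0 r hr)
  · intro e he
    obtain ⟨r, hr⟩ := hE.prop.2 e.1 e.2 (fun r hr => congrArg Subtype.val (he r hr))
    exact ⟨r, Subtype.ext hr⟩

theorem Hull.cogen {E : Type u} [AddCommGroup E] [Module R E] {e0 : E} (h : Hull R E e0)
    {T : Type u} [AddCommGroup T] [Module R T] {t : T} (ht : t ≠ 0) :
    ∃ f : T →ₗ[R] E, f t ≠ 0 := by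
  let q := (LinearMap.toSpanSingleton R T t).rangeRestrict
  obtain ⟨f', hf'⟩ := exists_factor q (LinearMap.surjective_rangeRestrict _)
    (LinearMap.toSpanSingleton R E e0) (by
      intro a ha
      have ha' : a • t = 0 := congrArg Subtype.val ha
      refine h.kill a ((IsLocalRing.mem_maximalIdeal a).2 (fun hu => ht ?_))
      obtain ⟨u, rfl⟩ := hu
      simpa using congrArg ((↑u⁻¹ : R) • ·) ha')
  obtain ⟨f, hf⟩ := inj_extend h.inj (Submodule.subtype _) Subtype.val_injective f'
  refine ⟨f, ?_⟩
  have h1 := hf (q 1)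
  rw [hf'] at h1
  have h2 : (Submodule.subtype _) (q 1) = t := one_smul R t
  rw [h2] at h1
  rw [h1]
  simpa using h.ne

theorem Hull.length_le {E : Type u} [AddCommGroup E] [Module R E] {e0 : E} (h : Hull R E e0)
    {L : Type u} [AddCommGroup L] [Module R L] (hL : IsFiniteLength R L) :
    Module.length R (L →ₗ[R] E) ≤ Module.length R L := by
  induction hL with
  | @of_subsingleton M _ _ _ =>
    have : Subsingleton (M →ₗ[R] E) := ⟨fun f g => LinearMap.ext fun a => by
      rw [Subsingleton.elim a 0, map_zero, map_zero]⟩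
    rw [Module.length_eq_zero]; exact bot_le
  | @of_simple_quotient M _ _ N hs _ ih =>
    have hse := se_hom (B := R) h.inj (SE.mk' (i := N.subtype) (p := N.mkQ)
      (fun a ha => Subtype.ext ha) (fun a => (Submodule.Quotient.mk_eq_zero N).2 a.2)
      (fun b hb => ⟨⟨b, (Submodule.Quotient.mk_eq_zero N).1 hb⟩, rfl⟩)
      (Submodule.mkQ_surjective N))
    rw [Module.length_eq_add_of_exact _ _ hse.1 hse.2.2 hse.2.1,
      Module.length_eq_add_of_exact N.subtype N.mkQ Subtype.val_injective
        (Submodule.mkQ_surjective N) (LinearMap.exact_subtype_mkQ N), add_comm]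
    refine add_le_add ih ?_
    rw [Module.length_eq_one (R := R) (M := M ⧸ N)]
    -- Hom from a simple module
    haveI : Nontrivial (M ⧸ N) := IsSimpleModule.nontrivial R (M ⧸ N)
    obtain ⟨a, ha⟩ := exists_ne (0 : M ⧸ N)
    have hann : ∀ r ∈ maximalIdeal R, r • a = 0 := by
      obtain ⟨I, hI, ⟨e⟩⟩ := isSimpleModule_iff_quot_maximal.1 hs
      have hIm := IsLocalRing.eq_maximalIdeal hI
      intro r hr
      apply e.injective
      rw [map_smul, map_zero]
      obtain ⟨c, hc⟩ := Ideal.Quotient.mk_surjective (e a)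
      rw [← hc]
      change Ideal.Quotient.mk I (r * c) = 0
      exact Ideal.Quotient.eq_zero_iff_mem.2 (I.mul_mem_right _ (hIm ▸ hr))
    have hgen : ∀ b : M ⧸ N, ∃ r : R, r • a = b := by
      intro b
      have := IsSimpleModule.span_singleton_eq_top R ha
      exact Submodule.mem_span_singleton.1 (this ▸ Submodule.mem_top (x := b))
    let K : Submodule R E := Submodule.span R {e0}
    let φ : ((M ⧸ N) →ₗ[R] E) →ₗ[R] E := LinearMap.applyₗ a
    have hφ : Function.Injective φ := by
      rw [← LinearMap.ker_eq_bot, LinearMap.ker_eq_bot']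
      intro f hf
      ext1
      ext b
      obtain ⟨r, hr⟩ := hgen (N.mkQ b)
      have hf' : f a = 0 := hf
      simp only [LinearMap.comp_apply]
      rw [← hr, map_smul, hf', smul_zero]; rfl
    have hK : ∀ f, φ f ∈ K := by
      intro f
      obtain ⟨r, hr⟩ := h.soc (f a) (fun r hr => by rw [← map_smul, hann r hr, map_zero])
      exact Submodule.mem_span_singleton.2 ⟨r, hr.symm⟩
    refine (Module.length_le_of_injective (φ.codRestrict K hK)
      (fun f g hfg => hφ (congrArg Subtype.val hfg))).trans ?_
    obtain ⟨f', hf'⟩ := exists_factor (LinearMap.toSpanSingleton R (M ⧸ N) a) hgen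
      (LinearMap.toSpanSingleton R K ⟨e0, Submodule.mem_span_singleton_self e0⟩) (by
        intro r hr
        have hr' : r • a = 0 := hr
        apply Subtype.ext
        refine h.kill r ((IsLocalRing.mem_maximalIdeal r).2 (fun hu => ha ?_))
        obtain ⟨u, rfl⟩ := hu
        simpa using congrArg ((↑u⁻¹ : R) • ·) hr')
    refine (Module.length_le_of_surjective f' ?_).trans_eq (Module.length_eq_one _ _)
    rintro ⟨y, hy⟩
    obtain ⟨r, rfl⟩ := Submodule.mem_span_singleton.1 hy
    exact ⟨_, hf' r⟩

theorem finiteLength_pow [IsNoetherianRing R] (k : ℕ) :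
    IsFiniteLength R (R ⧸ maximalIdeal R ^ k) := by
  have : IsArtinianRing (R ⧸ maximalIdeal R ^ k) := by
    rw [isArtinianRing_iff_isNoetherianRing_krullDimLE_zero]
    refine ⟨inferInstance, Ring.KrullDimLE.mk₀ fun P hP => ?_⟩
    have hle : maximalIdeal R ≤ P.comap (Ideal.Quotient.mk _) := by
      have hpr : (P.comap (Ideal.Quotient.mk (maximalIdeal R ^ k))).IsPrime := hP.comap _
      refine hpr.le_of_pow_le (n := k) ?_
      intro r hr
      rw [Ideal.mem_comap, Ideal.Quotient.eq_zero_iff_mem.2 hr]; exact P.zero_mem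
    have hmax : (P.comap (Ideal.Quotient.mk (maximalIdeal R ^ k))).IsMaximal := by
      have hpr : (P.comap (Ideal.Quotient.mk (maximalIdeal R ^ k))).IsPrime := hP.comap _
      rw [← (IsLocalRing.maximalIdeal.isMaximal R).eq_of_le hpr.ne_top hle]
      exact IsLocalRing.maximalIdeal.isMaximal R
    have := Ideal.map_comap_of_surjective _
      (Ideal.Quotient.mk_surjective (I := maximalIdeal R ^ k)) P
    rw [← this]
    refine (Ideal.map_eq_top_or_isMaximal_of_surjective _ Ideal.Quotient.mk_surjective
      hmax).resolve_left ?_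
    rw [this]; exact hP.ne_top
  rw [← Module.length_ne_top_iff,
    Module.length_eq_of_surjective (S := R) (R := R ⧸ maximalIdeal R ^ k)
      Ideal.Quotient.mk_surjective, Module.length_ne_top_iff,
    isFiniteLength_iff_isNoetherian_isArtinian]
  exact ⟨inferInstance, inferInstance⟩

end HullSec

end GidAux


namespace GidAux

/-- The elements killed by an ideal. -/
def kil {R : Type u} [CommRing R] (b : Ideal R) (E : Type u) [AddCommGroup E] [Module R E] : Submodule R E where
  carrier := {e | ∀ s ∈ b, s • e = 0}
  zero_mem' := fun s _ => smul_zero s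
  add_mem' := fun {a c} ha hc s hs => by rw [smul_add, ha s hs, hc s hs, add_zero]
  smul_mem' := fun r a ha s hs => by rw [smul_comm, ha s hs, smul_zero]

theorem mem_kil {R : Type u} [CommRing R] {b : Ideal R} {E : Type u} [AddCommGroup E] [Module R E] {e : E} :
    e ∈ kil b E ↔ ∀ s ∈ b, s • e = 0 := Iff.rfl

theorem gam_common {R : Type u} [CommRing R] {E : Type u} [AddCommGroup E] [Module R E] {e e' : E} {b : Ideal R} (he : e ∈ gam b E) (he' : e' ∈ gam b E) :
    ∃ K, e ∈ kil (b ^ K) E ∧ e' ∈ kil (b ^ K) E := by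
  obtain ⟨k, hk⟩ := he
  obtain ⟨l, hl⟩ := he'
  exact ⟨k + l, fun r hr => hk r (Ideal.pow_le_pow_right (by omega) hr),
    fun r hr => hl r (Ideal.pow_le_pow_right (by omega) hr)⟩

section MDSec
variable {R : Type u} [CommRing R] [IsLocalRing R]

theorem Hull.ann {E : Type u} [AddCommGroup E] [Module R E] {e0 : E} (h : Hull R E e0)
    (b : Ideal R) (r : R) (hr : ∀ e ∈ kil b E, r • e = 0) : r ∈ b := by
  by_contra hrb
  have h0 : (Ideal.Quotient.mk b r) ≠ 0 := fun hh => hrb (Ideal.Quotient.eq_zero_iff_mem.1 hh)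
  obtain ⟨f, hf⟩ := h.cogen h0
  apply hf
  have : (Ideal.Quotient.mk b r) = r • (Ideal.Quotient.mk b 1) := by
    change _ = Ideal.Quotient.mk b (r * 1); rw [mul_one]
  rw [this, map_smul]
  refine hr _ (fun s hs => ?_)
  rw [← map_smul]
  have : s • (Ideal.Quotient.mk b 1) = 0 := by
    change Ideal.Quotient.mk b (s * 1) = 0
    rw [mul_one]; exact Ideal.Quotient.eq_zero_iff_mem.2 hs
  rw [this, map_zero]

theorem Hull.endo_local [IsNoetherianRing R] {E : Type u} [AddCommGroup E] [Module R E] {e0 : E}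
    (h : Hull R E e0) (k : ℕ) (f : E →ₗ[R] E) :
    ∃ r : R, ∀ e ∈ kil (maximalIdeal R ^ k) E, f e = r • e := by
  set b := maximalIdeal R ^ k with hb
  let Ek := kil b E
  have hfin := finiteLength_pow (R := R) k
  -- `Ek` embeds in the dual of `R/b`
  let φ : Ek →ₗ[R] ((R ⧸ b) →ₗ[R] E) :=
    { toFun := fun e => Submodule.liftQ b (LinearMap.toSpanSingleton R E e.1) (fun s hs => e.2 s hs)
      map_add' := fun a c => by
        refine LinearMap.ext fun q => ?_
        obtain ⟨r, rfl⟩ := Submodule.Quotient.mk_surjective b q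
        exact smul_add r a.1 c.1
      map_smul' := fun a c => by
        refine LinearMap.ext fun q => ?_
        obtain ⟨r, rfl⟩ := Submodule.Quotient.mk_surjective b q
        exact smul_comm r a c.1 }
  have hφ : Function.Injective φ := by
    intro a c hac
    have := LinearMap.congr_fun hac (Submodule.Quotient.mk 1)
    apply Subtype.ext
    have h' : (1 : R) • a.1 = (1 : R) • c.1 := this
    rwa [one_smul, one_smul] at h'
  have hl1 : Module.length R Ek ≤ Module.length R (R ⧸ b) :=
    (Module.length_le_of_injective φ hφ).trans (h.length_le hfin)
  have hEfin : IsFiniteLength R Ek := by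
    rw [← Module.length_ne_top_iff] at hfin ⊢
    exact ne_top_of_le_ne_top hfin hl1
  have hl2 : Module.length R (Ek →ₗ[R] E) ≤ Module.length R (R ⧸ b) :=
    (h.length_le hEfin).trans hl1
  have hHfin : IsFiniteLength R (Ek →ₗ[R] E) := by
    rw [← Module.length_ne_top_iff] at hfin ⊢
    exact ne_top_of_le_ne_top hfin hl2
  rw [isFiniteLength_iff_isNoetherian_isArtinian] at hHfin
  obtain ⟨hN, hA⟩ := hHfin
  let μ : (R ⧸ b) →ₗ[R] (Ek →ₗ[R] E) :=
    Submodule.liftQ b (LinearMap.toSpanSingleton R _ Ek.subtype) (fun s hs => by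
      ext e; exact e.2 s hs)
  have hμ : Function.Injective μ := by
    rw [← LinearMap.ker_eq_bot, LinearMap.ker_eq_bot']
    intro q hq
    obtain ⟨r, rfl⟩ := Submodule.Quotient.mk_surjective b q
    refine (Submodule.Quotient.mk_eq_zero b).2 (h.ann b r (fun e he => ?_))
    exact LinearMap.congr_fun hq ⟨e, he⟩
  have htop : LinearMap.range μ = ⊤ := by
    by_contra hne
    have hlt := Submodule.length_lt hne
    rw [← (LinearEquiv.ofInjective μ hμ).length_eq] at hlt
    exact absurd hl2 (not_le.2 hlt)
  obtain ⟨q, hq⟩ := LinearMap.range_eq_top.1 htop (f.comp Ek.subtype)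
  obtain ⟨r, rfl⟩ := Submodule.Quotient.mk_surjective b q
  refine ⟨r, fun e he => ?_⟩
  exact (LinearMap.congr_fun hq ⟨e, he⟩).symm

/-- Matlis data: `E` is the hull of the residue field and `A` its endomorphism ring. -/
structure MD (R A E : Type u) [CommRing R] [IsLocalRing R] [CommRing A] [Algebra R A]
    [AddCommGroup E] [Module R E] [Module A E] (e0 : E) : Prop extends Hull R E e0 where
  endo : ∀ f : E →ₗ[R] E, ∃ a : A, ∀ e, f e = a • e
  faith : ∀ a : A, (∀ e : E, a • e = 0) → a = 0
  dens : ∀ (k : ℕ) (a : A), ∃ r : R, ∀ e ∈ kil (maximalIdeal R ^ k) E, a • e = r • e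

variable {E : Type u} [AddCommGroup E] [Module R E] {n : ℕ} (s : Fin n → R)

def mon (d : Fin n →₀ ℕ) : R := ∏ i, s i ^ d i

theorem mon_add {R : Type u} [CommRing R] {n : ℕ} (s : Fin n → R) (d d' : Fin n →₀ ℕ) : mon s (d + d') = mon s d * mon s d' := by
  simp [mon, pow_add, Finset.prod_mul_distrib]

theorem mon_zero {R : Type u} [CommRing R] {n : ℕ} (s : Fin n → R) : mon s 0 = 1 := by simp [mon]

theorem mon_mem (hs : ∀ i, s i ∈ maximalIdeal R) (d : Fin n →₀ ℕ) :
    mon s d ∈ maximalIdeal R ^ d.degree := by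
  rw [mon, Finsupp.degree_eq_sum]
  rw [← Finset.prod_pow_eq_pow_sum]
  exact Ideal.prod_mem_prod (fun i _ => Ideal.pow_mem_pow (hs i) _)

noncomputable def box (K : ℕ) : Finset (Fin n →₀ ℕ) := Finset.Iic (Finsupp.equivFunOnFinite.symm fun _ => K)

theorem mem_box {K : ℕ} {d : Fin n →₀ ℕ} : d ∈ box (n := n) K ↔ ∀ i, d i ≤ K := by
  simp [box, Finsupp.le_def]

theorem not_mem_box {K : ℕ} {d : Fin n →₀ ℕ} (h : d ∉ box (n := n) K) : K ≤ d.degree := by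
  rw [mem_box] at h
  push Not at h
  obtain ⟨i, hi⟩ := h
  have := Finsupp.le_degree i d
  omega

/-- The action of a power series on a torsion module. -/
noncomputable def actf (f : MvPowerSeries (Fin n) R) (e : E) : E :=
  ∑ᶠ d : Fin n →₀ ℕ, MvPowerSeries.coeff d f • mon s d • e

variable {s}

theorem mon_kill (hs : ∀ i, s i ∈ maximalIdeal R) {K : ℕ} {e : E}
    (he : e ∈ kil (maximalIdeal R ^ K) E) {d : Fin n →₀ ℕ} (hd : K ≤ d.degree) :
    mon s d • e = 0 :=
  he _ (Ideal.pow_le_pow_right hd (mon_mem s hs d))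

theorem actf_eq (hs : ∀ i, s i ∈ maximalIdeal R) {K : ℕ} {e : E}
    (he : e ∈ kil (maximalIdeal R ^ K) E) (f : MvPowerSeries (Fin n) R) :
    actf s f e = ∑ d ∈ box K, MvPowerSeries.coeff d f • mon s d • e := by
  refine finsum_eq_sum_of_support_subset _ (fun d hd => ?_)
  by_contra hb
  exact hd (by
    change MvPowerSeries.coeff d f • mon s d • e = 0
    rw [mon_kill hs he (not_mem_box hb), smul_zero])

theorem actf_mul (hs : ∀ i, s i ∈ maximalIdeal R) {K : ℕ} {e : E}
    (he : e ∈ kil (maximalIdeal R ^ K) E) (f g : MvPowerSeries (Fin n) R) :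
    actf s (f * g) e = actf s f (actf s g e) := by
  classical
  have he' : actf s g e ∈ kil (maximalIdeal R ^ K) E := by
    rw [actf_eq hs he]
    exact Submodule.sum_mem _ (fun d _ => Submodule.smul_mem _ _ (Submodule.smul_mem _ _ he))
  rw [actf_eq hs he, actf_eq hs he', actf_eq hs he]
  have h1 : ∀ d ∈ box (n := n) K, MvPowerSeries.coeff d (f * g) • mon s d • e =
      ∑ p ∈ Finset.HasAntidiagonal.antidiagonal d,
        (MvPowerSeries.coeff p.1 f * MvPowerSeries.coeff p.2 g) • mon s (p.1 + p.2) • e := by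
    intro d _
    rw [MvPowerSeries.coeff_mul, Finset.sum_smul]
    refine Finset.sum_congr rfl fun p hp => ?_
    rw [Finset.HasAntidiagonal.mem_antidiagonal.1 hp]
  have h2 : ∀ d ∈ box (n := n) K, MvPowerSeries.coeff d f • mon s d •
      ∑ d' ∈ box (n := n) K, MvPowerSeries.coeff d' g • mon s d' • e =
      ∑ d' ∈ box (n := n) K,
        (MvPowerSeries.coeff d f * MvPowerSeries.coeff d' g) • mon s (d + d') • e := by
    intro d _
    rw [Finset.smul_sum, Finset.smul_sum]
    refine Finset.sum_congr rfl fun p hp => ?_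
    rw [mon_add]
    simp only [smul_smul]; congr 1; ring
  rw [Finset.sum_congr rfl h1, Finset.sum_congr rfl h2, Finset.sum_sigma', ← Finset.sum_product'
    (f := fun d d' => (MvPowerSeries.coeff d f * MvPowerSeries.coeff d' g) • mon s (d + d') • e)]
  refine Finset.sum_bij_ne_zero (fun x _ _ => x.2) ?_ ?_ ?_ ?_
  · intro x hx _
    rw [Finset.mem_sigma, Finset.HasAntidiagonal.mem_antidiagonal, mem_box] at hx
    rw [Finset.mem_product, mem_box, mem_box]
    have hle : ∀ i, x.2.1 i + x.2.2 i = x.1 i := fun i => by rw [← hx.2]; rfl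
    exact ⟨fun i => by have := hx.1 i; have := hle i; omega,
      fun i => by have := hx.1 i; have := hle i; omega⟩
  · rintro ⟨a, a'⟩ ha _ ⟨c, c'⟩ hc _ (hac : a' = c')
    rw [Finset.mem_sigma, Finset.HasAntidiagonal.mem_antidiagonal] at ha hc
    subst hac
    have : a = c := ha.2.symm.trans hc.2
    subst this; rfl
  · intro p hp hne
    refine ⟨⟨p.1 + p.2, p⟩, ?_, hne, rfl⟩
    rw [Finset.mem_sigma, Finset.HasAntidiagonal.mem_antidiagonal]
    refine ⟨?_, rfl⟩
    by_contra hb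
    exact hne (by rw [mon_kill hs he (not_mem_box hb), smul_zero])
  · intro x _ _; rfl

variable (s) in
/-- The ring homomorphism from power series to endomorphisms. -/
noncomputable def actHom (hs : ∀ i, s i ∈ maximalIdeal R)
    (hE : ∀ e : E, e ∈ gam (maximalIdeal R) E) :
    MvPowerSeries (Fin n) R →+* Module.End R E where
  toFun f :=
    { toFun := actf s f
      map_add' := fun a c => by
        obtain ⟨K, ha, hc⟩ := gam_common (hE a) (hE c)
        rw [actf_eq hs ha, actf_eq hs hc, actf_eq hs (Submodule.add_mem _ ha hc),
          ← Finset.sum_add_distrib]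
        exact Finset.sum_congr rfl fun d _ => by rw [smul_add, smul_add]
      map_smul' := fun r a => by
        obtain ⟨K, ha⟩ := hE a
        rw [actf_eq hs ha, actf_eq hs (Submodule.smul_mem _ r ha), RingHom.id_apply, Finset.smul_sum]
        exact Finset.sum_congr rfl fun d _ => by rw [smul_comm _ r, smul_comm _ r] }
  map_one' := by
    ext e
    change ∑ᶠ d : Fin n →₀ ℕ, _ = e
    rw [finsum_eq_single _ 0]
    · simp [mon_zero]
    · intro d hd
      classical
      rw [MvPowerSeries.coeff_one, if_neg hd, zero_smul]
  map_zero' := by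
    ext e
    change ∑ᶠ d : Fin n →₀ ℕ, _ = (0 : E)
    simp
  map_add' f g := by
    ext e
    obtain ⟨K, he⟩ := hE e
    change actf s (f + g) e = actf s f e + actf s g e
    rw [actf_eq hs he, actf_eq hs he, actf_eq hs he, ← Finset.sum_add_distrib]
    exact Finset.sum_congr rfl fun d _ => by rw [map_add, add_smul]
  map_mul' f g := by
    ext e
    obtain ⟨K, he⟩ := hE e
    exact actf_mul hs he f g

theorem actHom_surj [IsNoetherianRing R] {e0 : E} (h : Hull R E e0)
    (hs : ∀ i, s i ∈ maximalIdeal R) (hspan : Ideal.span (Set.range s) = maximalIdeal R) :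
    Function.Surjective (actHom s hs h.tors) := by
  intro φ
  choose r hr using fun k => h.endo_local k φ
  let r' : ℕ → R := fun k => if k = 0 then 0 else r k
  have hr' : ∀ k, ∀ e ∈ kil (maximalIdeal R ^ k) E, φ e = r' k • e := by
    intro k e he
    by_cases hk : k = 0
    · subst hk
      have : e = 0 := by simpa using he 1 (by simp)
      rw [this]; simp
    · simp only [r', if_neg hk]; exact hr k e he
  have hdiff : ∀ k, ∃ p : MvPolynomial (Fin n) R, p.IsHomogeneous k ∧
      MvPolynomial.eval s p = r' (k + 1) - r' k := by
    intro k
    rw [← Ideal.mem_span_pow_iff_exists_isHomogeneous, hspan]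
    refine h.ann _ _ (fun e he => ?_)
    rw [sub_smul, ← hr' k e he, ← hr' (k+1) e (fun c hc =>
      he c (Ideal.pow_le_pow_right (by omega) hc)), sub_self]
  choose p hp hpe using hdiff
  let F : MvPowerSeries (Fin n) R := fun d => MvPolynomial.coeff d (p d.degree)
  refine ⟨F, ?_⟩
  ext e
  obtain ⟨K, he⟩ := h.tors e
  let P : MvPolynomial (Fin n) R := ∑ k ∈ Finset.range K, p k
  have hPe : MvPolynomial.eval s P = r' K := by
    rw [map_sum, Finset.sum_congr rfl (fun k _ => hpe k), Finset.sum_range_sub]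
    simp [r']
  have h1 : actf s F e = actf s (P : MvPowerSeries (Fin n) R) e := by
    refine finsum_congr fun d => ?_
    by_cases hd : K ≤ d.degree
    · rw [mon_kill hs he hd, smul_zero, smul_zero]
    · congr 1
      rw [MvPolynomial.coeff_coe]
      change MvPolynomial.coeff d (p d.degree) = _
      rw [MvPolynomial.coeff_sum, Finset.sum_eq_single d.degree]
      · intro k _ hk
        by_contra hne
        exact hk (by
          have := hp k hne
          rw [← this, Finsupp.degree_eq_weight_one]; rfl)
      · intro hn; exact absurd (Finset.mem_range.2 (by omega)) hn
  change actf s F e = φ e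
  rw [h1, hr' K e he, ← hPe, MvPolynomial.eval_eq', Finset.sum_smul]
  rw [actf, finsum_eq_sum_of_support_subset (s := P.support)]
  · exact Finset.sum_congr rfl fun d _ => by rw [MvPolynomial.coeff_coe, smul_smul]; rfl
  · intro d hd
    rw [Finset.mem_coe, MvPolynomial.mem_support_iff]
    intro h0
    exact hd (by
      change MvPowerSeries.coeff d (P : MvPowerSeries (Fin n) R) • mon s d • e = 0
      rw [MvPolynomial.coeff_coe, h0, zero_smul])

theorem exists_md [IsNoetherianRing R] {e0 : E} (h : Hull R E e0) :
    ∃ (A : Type u) (_ : CommRing A) (_ : Algebra R A) (_ : Module A E) (_ : IsScalarTower R A E),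
      IsNoetherianRing A ∧ MD R A E e0 := by
  obtain ⟨n, s, hspan⟩ := Submodule.fg_iff_exists_fin_generating_family.1
    ((isNoetherianRing_iff_ideal_fg R).1 inferInstance (maximalIdeal R))
  have hs : ∀ i, s i ∈ maximalIdeal R := fun i => by
    rw [← hspan]; exact Submodule.subset_span ⟨i, rfl⟩
  let Φ := actHom s hs h.tors
  have hsurj := actHom_surj h hs hspan
  let A := MvPowerSeries (Fin n) R ⧸ RingHom.ker Φ
  let ψ : A →+* Module.End R E := RingHom.kerLift Φ
  letI : Module A E := Module.compHom E ψ
  have hsm : ∀ (f : MvPowerSeries (Fin n) R) (e : E),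
      ((Ideal.Quotient.mk _ f : A) • e) = actf s f e := fun f e => rfl
  have htow : IsScalarTower R A E := by
    refine IsScalarTower.of_algebraMap_smul (fun r e => ?_)
    change (Ideal.Quotient.mk _ (algebraMap R (MvPowerSeries (Fin n) R) r) : A) • e = _
    rw [hsm]
    rw [actf, finsum_eq_single _ 0]
    · simp [mon_zero, MvPowerSeries.algebraMap_apply]
    · intro d hd
      classical
      rw [MvPowerSeries.algebraMap_apply, Algebra.algebraMap_self_apply, MvPowerSeries.coeff_C,
        if_neg hd, zero_smul]
  refine ⟨A, inferInstance, inferInstance, inferInstance, htow, ?_, ⟨h, ?_, ?_, ?_⟩⟩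
  · haveI := MvPowerSeries.isNoetherianRing (σ := Fin n) (S := R)
    infer_instance
  · intro f
    obtain ⟨F, hF⟩ := hsurj f
    exact ⟨Ideal.Quotient.mk _ F, fun e => by rw [hsm, ← hF]; rfl⟩
  · intro a ha
    obtain ⟨F, rfl⟩ := Ideal.Quotient.mk_surjective a
    refine Ideal.Quotient.eq_zero_iff_mem.2 ?_
    rw [RingHom.mem_ker]
    ext e
    exact ha e
  · intro k a
    obtain ⟨F, rfl⟩ := Ideal.Quotient.mk_surjective a
    refine ⟨∑ d ∈ box k, MvPowerSeries.coeff d F * mon s d, fun e he => ?_⟩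
    rw [hsm, actf_eq hs he, Finset.sum_smul]
    exact Finset.sum_congr rfl fun d _ => by rw [mul_smul]

end MDSec

end GidAux

namespace GidAux
open scoped TensorProduct
section DenseSec
variable {R A : Type u} [CommRing R] [CommRing A] [Algebra R A]

/-- extending a map through a (not nec. injective) map into a domain of an injective module. -/
theorem inj_extend' {R : Type u} [CommRing R] {X Y I : Type u} [AddCommGroup X] [Module R X]
    [AddCommGroup Y] [Module R Y] [AddCommGroup I] [Module R I]
    (hI : Module.Injective R I) (t : X →ₗ[R] Y) (f : X →ₗ[R] I)
    (h : ∀ a, t a = 0 → f a = 0) : ∃ f' : Y →ₗ[R] I, ∀ a, f' (t a) = f a := by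
  obtain ⟨g, hg⟩ := exists_factor t.rangeRestrict (LinearMap.surjective_rangeRestrict _) f
    (fun a ha => h a (congrArg Subtype.val ha))
  obtain ⟨f', hf'⟩ := inj_extend hI (LinearMap.range t).subtype (Submodule.subtype_injective _) g
  exact ⟨f', fun a => by rw [← hg, ← hf']; rfl⟩

theorem gam_algebra {b : Ideal R} {T : Type u} [AddCommGroup T] [Module R T] [Module A T]
    [IsScalarTower R A T] {y : T} : y ∈ gam (b.map (algebraMap R A)) T ↔ y ∈ gam b T := by
  rw [mem_gam, mem_gam]
  constructor
  · rintro ⟨n, hn⟩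
    refine ⟨n, fun r hr => ?_⟩
    have := hn (algebraMap R A r) (by rw [← Ideal.map_pow]; exact Ideal.mem_map_of_mem _ hr)
    rwa [algebraMap_smul] at this
  · rintro ⟨n, hn⟩
    refine ⟨n, fun r hr => ?_⟩
    rw [← Ideal.map_pow] at hr
    refine Submodule.span_induction (p := fun a _ => a • y = 0) ?_ ?_ ?_ ?_ hr
    · rintro _ ⟨s, hs, rfl⟩
      rw [algebraMap_smul]; exact hn s hs
    · simp
    · intro a c _ _ ha hc
      rw [add_smul, ha, hc, add_zero]
    · intro a c _ hc
      rw [smul_assoc, hc, smul_zero]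

theorem map_smul_zero {b : Ideal R} {T : Type u} [AddCommGroup T] [Module R T] [Module A T]
    [IsScalarTower R A T] {y : T} (h : ∀ r ∈ b, r • y = 0) {a : A}
    (ha : a ∈ b.map (algebraMap R A)) : a • y = 0 := by
  refine Submodule.span_induction (p := fun a _ => a • y = 0) ?_ ?_ ?_ ?_ ha
  · rintro _ ⟨s, hs, rfl⟩
    rw [algebraMap_smul]; exact h s hs
  · simp
  · intro a c _ _ ha hc
    rw [add_smul, ha, hc, add_zero]
  · intro a c _ hc
    rw [smul_assoc, hc, smul_zero]

/-- `R` is dense in `A` for the `b`-adic topology. -/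
def Dns (R A : Type u) [CommRing R] [CommRing A] [Algebra R A] (b : Ideal R) : Prop :=
  ∀ (k : ℕ) (a : A), ∃ r : R, a - algebraMap R A r ∈ (b ^ k).map (algebraMap R A)

theorem Dns.linear {b : Ideal R} (hd : Dns R A b) {X Y : Type u} [AddCommGroup X] [Module R X]
    [Module A X] [IsScalarTower R A X] [AddCommGroup Y] [Module R Y] [Module A Y]
    [IsScalarTower R A Y] (hX : ∀ x : X, x ∈ gam b X) (f : X →ₗ[R] Y) (a : A) (x : X) :
    f (a • x) = a • f x := by
  obtain ⟨k, hk⟩ := hX x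
  obtain ⟨r, hr⟩ := hd k a
  have h1 : (a - algebraMap R A r) • x = 0 := map_smul_zero hk hr
  have h2 : (a - algebraMap R A r) • f x = 0 :=
    map_smul_zero (fun s hs => by rw [← map_smul, hk s hs, map_zero]) hr
  rw [sub_smul, algebraMap_smul, sub_eq_zero] at h1 h2
  rw [h1, h2, map_smul]

def Dns.lin {b : Ideal R} (hd : Dns R A b) {X Y : Type u} [AddCommGroup X] [Module R X]
    [Module A X] [IsScalarTower R A X] [AddCommGroup Y] [Module R Y] [Module A Y]
    [IsScalarTower R A Y] (hX : ∀ x : X, x ∈ gam b X) (f : X →ₗ[R] Y) : X →ₗ[A] Y :=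
  { f with map_smul' := fun a x => hd.linear hX f a x }

/-- a map from an ideal to a torsion module vanishes on a small neighbourhood of zero. -/
theorem ideal_kill [IsNoetherianRing A] (b c : Ideal A) {T : Type u} [AddCommGroup T] [Module A T]
    (g : c →ₗ[A] T) (hg : ∀ a, g a ∈ gam b T) : ∃ k, ∀ z : c, (z : A) ∈ b ^ k → g z = 0 := by
  obtain ⟨n, hn⟩ := fg_bound b g hg
  obtain ⟨k, hk⟩ := artin_rees_le b c n
  refine ⟨k, fun y hy => ?_⟩
  have h1 : (y : A) ∈ b ^ n • (c : Submodule A A) := hk ⟨y.2, hy⟩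
  have h2 : b ^ n • (c : Submodule A A) ≤ Submodule.map c.subtype (LinearMap.ker g) := by
    refine Submodule.smul_le.2 fun r hr w hw => ?_
    exact ⟨r • ⟨w, hw⟩, by rw [SetLike.mem_coe, LinearMap.mem_ker, map_smul, hn r hr], rfl⟩
  obtain ⟨w, hw, hw'⟩ := h2 h1
  have : w = y := Subtype.ext hw'
  rw [← this]; exact hw

theorem Dns.injective {b : Ideal R} (hd : Dns R A b) [IsNoetherianRing A] {T : Type u}
    [AddCommGroup T] [Module R T] [Module A T] [IsScalarTower R A T]
    (hT : ∀ t : T, t ∈ gam b T) (hI : Module.Injective R T) : Module.Injective A T := by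
  refine Module.Baer.injective (fun c g => ?_)
  obtain ⟨k, hk⟩ := ideal_kill (b.map (algebraMap R A)) c g (fun a => gam_algebra.2 (hT _))
  set d := (b ^ k).map (algebraMap R A) with hd'
  let q : c →ₗ[A] A ⧸ d := (Submodule.mkQ d).comp c.subtype
  obtain ⟨h, hh⟩ := inj_extend' hI (q.restrictScalars R) (g.restrictScalars R) (fun y hy => by
    refine hk y ?_
    have : q y = 0 := hy
    rw [← Ideal.map_pow]
    exact (Submodule.Quotient.mk_eq_zero _).1 this)
  have htor : ∀ z : A ⧸ d, z ∈ gam b (A ⧸ d) := by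
    intro z
    obtain ⟨a, rfl⟩ := Submodule.mkQ_surjective d z
    refine ⟨k, fun r hr => ?_⟩
    have : r • d.mkQ a = d.mkQ (algebraMap R A r * a) := by
      rw [← smul_eq_mul, map_smul, algebraMap_smul]
    rw [this]
    exact (Submodule.Quotient.mk_eq_zero _).2 (Ideal.mul_mem_right _ _ (Ideal.mem_map_of_mem _ hr))
  refine ⟨(hd.lin htor h).comp (Submodule.mkQ d), fun y hy => ?_⟩
  exact hh ⟨y, hy⟩

/-- torsion modules do not change under base change to a dense flat algebra with enough
separation; the separation is provided by `hc`. -/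
theorem Dns.tensor {b : Ideal R} (hd : Dns R A b) {T : Type u} [AddCommGroup T] [Module R T]
    (hT : ∀ t : T, t ∈ gam b T) :
    Function.Surjective (TensorProduct.mk R A T 1) := by
  intro z
  induction z using TensorProduct.induction_on with
  | zero => exact ⟨0, map_zero _⟩
  | add x y hx hy =>
    obtain ⟨s, rfl⟩ := hx
    obtain ⟨t, rfl⟩ := hy
    exact ⟨s + t, map_add _ _ _⟩
  | tmul a t =>
    obtain ⟨k, hk⟩ := hT t
    obtain ⟨r, hr⟩ := hd k a
    refine ⟨r • t, ?_⟩
    have h0 := map_smul_zero (T := TensorProduct R A T) (y := (1 : A) ⊗ₜ[R] t) (b := b ^ k)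
      (fun s hs => by rw [← TensorProduct.tmul_smul, hk s hs, TensorProduct.tmul_zero]) hr
    rw [TensorProduct.smul_tmul', smul_eq_mul, mul_one, TensorProduct.sub_tmul, sub_eq_zero] at h0
    rw [h0, Algebra.algebraMap_eq_smul_one, TensorProduct.smul_tmul]
    rfl
end DenseSec

section MDFacts
variable {R A E : Type u} [CommRing R] [IsLocalRing R] [IsNoetherianRing R] [CommRing A]
  [IsNoetherianRing A] [Algebra R A] [AddCommGroup E] [Module R E] [Module A E]
  [IsScalarTower R A E] {e0 : E}

theorem MD.equiv (h : MD R A E e0) :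
    ∃ e : A ≃ₗ[A] (E →ₗ[R] E), ∀ a x, e a x = a • x := by
  let f : A →ₗ[A] (E →ₗ[R] E) :=
    { toFun := fun a => Algebra.lsmul R R E a
      map_add' := fun a b => by ext; simp [add_smul]
      map_smul' := fun a b => by ext; simp [mul_smul] }
  refine ⟨LinearEquiv.ofBijective f ⟨?_, ?_⟩, fun a x => rfl⟩
  · refine (injective_iff_map_eq_zero f).2 fun a ha => h.faith a fun e => ?_
    exact LinearMap.congr_fun ha e
  · intro g
    obtain ⟨a, ha⟩ := h.endo g
    exact ⟨a, LinearMap.ext fun e => (ha e).symm⟩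

theorem MD.flat (h : MD R A E e0) : Module.Flat R A := by
  obtain ⟨e, -⟩ := h.equiv
  haveI := flat_hom h.inj h.inj
  exact Module.Flat.of_linearEquiv (e.restrictScalars R)

theorem MD.ann (h : MD R A E e0) (b : Ideal R) (a : A) (ha : ∀ e ∈ kil b E, a • e = 0) :
    a ∈ b.map (algebraMap R A) := by
  obtain ⟨n, t, ht⟩ := Submodule.fg_iff_exists_fin_generating_family.1
    ((isNoetherianRing_iff_ideal_fg R).1 inferInstance b)
  let τ : E →ₗ[R] (Fin n → E) := LinearMap.pi fun i => LinearMap.lsmul R E (t i)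
  obtain ⟨f, hf⟩ := inj_extend' h.inj τ (Algebra.lsmul R R E a) (fun e he => by
    refine ha e fun r hr => ?_
    rw [← ht] at hr
    refine Submodule.span_induction (p := fun r _ => r • e = 0) ?_ ?_ ?_ ?_ hr
    · rintro _ ⟨i, rfl⟩
      exact congrFun he i
    · simp
    · intro a c _ _ ha hc
      rw [add_smul, ha, hc, add_zero]
    · intro a c _ hc
      rw [smul_assoc, hc, smul_zero])
  choose c hc using fun i => h.endo (f.comp (LinearMap.single R (fun _ => E) i))
  have : a = ∑ i, algebraMap R A (t i) * c i := by
    rw [← sub_eq_zero]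
    refine h.faith _ fun e => ?_
    have h1 : a • e = f (τ e) := (hf e).symm
    have h2 : τ e = ∑ i, Pi.single i (t i • e) := by
      rw [Finset.univ_sum_single]; rfl
    rw [sub_smul, h1, h2, map_sum, Finset.sum_smul, sub_eq_zero]
    refine Finset.sum_congr rfl fun i _ => ?_
    have := hc i (t i • e)
    rw [LinearMap.comp_apply, LinearMap.single_apply] at this
    rw [this, mul_smul, algebraMap_smul, smul_comm]
  rw [this]
  refine Ideal.sum_mem _ fun i _ => Ideal.mul_mem_right _ _ (Ideal.mem_map_of_mem _ ?_)
  rw [← ht]; exact Submodule.subset_span ⟨i, rfl⟩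

theorem MD.dns (h : MD R A E e0) : Dns R A (maximalIdeal R) := by
  intro k a
  obtain ⟨r, hr⟩ := h.dens k a
  refine ⟨r, h.ann _ _ fun e he => ?_⟩
  rw [sub_smul, hr e he, algebraMap_smul, sub_self]

theorem MD.injA (h : MD R A E e0) : Module.Injective A E := h.dns.injective h.tors h.inj

theorem MD.tensor (h : MD R A E e0) {T : Type u} [AddCommGroup T] [Module R T]
    (hT : ∀ t : T, t ∈ gam (maximalIdeal R) T) :
    Function.Bijective (TensorProduct.mk R A T 1) := by
  refine ⟨(injective_iff_map_eq_zero _).2 fun t ht => ?_, h.dns.tensor hT⟩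
  by_contra h0
  obtain ⟨f, hf⟩ := h.cogen h0
  refine hf ?_
  have := congrArg (LinearMap.liftBaseChange A f) ht
  simpa using this

theorem MD.flat_dual (h : MD R A E e0) {T : Type u} [AddCommGroup T] [Module R T]
    (hT : ∀ t : T, t ∈ gam (maximalIdeal R) T) (hI : Module.Injective R T) :
    Module.Flat A (T →ₗ[R] E) := by
  let e : T ≃ₗ[R] TensorProduct R A T := LinearEquiv.ofBijective _ (h.tensor hT)
  have h1 : Module.Injective A (TensorProduct R A T) := by
    refine h.dns.injective ?_ (injective_of_equiv hI e)
    intro z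
    obtain ⟨t, rfl⟩ := e.surjective z
    exact gam_map e.toLinearMap (hT t)
  haveI := flat_hom h1 h.injA
  exact Module.Flat.of_linearEquiv (LinearMap.liftBaseChangeEquiv (M := T) (N := E) (R := R) A)

theorem MD.isUnit_of (h : MD R A E e0) {a : A} (ha : Function.Bijective fun e : E => a • e) :
    IsUnit a := by
  let f : E ≃ₗ[R] E := LinearEquiv.ofBijective (Algebra.lsmul R R E a : E →ₗ[R] E) ha
  obtain ⟨c, hc⟩ := h.endo f.symm.toLinearMap
  refine IsUnit.of_mul_eq_one c ?_
  rw [← sub_eq_zero]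
  refine h.faith _ fun e => ?_
  rw [sub_smul, mul_smul, ← hc, one_smul, sub_eq_zero]
  exact f.apply_symm_apply e

theorem MD.unit_add (h : MD R A E e0) {z : A} (hz : z ∈ (maximalIdeal R).map (algebraMap R A)) :
    IsUnit (1 + z) := by
  have hnil : ∀ e : E, ∃ n, z ^ n • e = 0 := fun e => by
    obtain ⟨n, hn⟩ := gam_algebra (A := A) |>.2 (h.tors e)
    exact ⟨n, hn _ (Ideal.pow_mem_pow hz n)⟩
  refine h.isUnit_of ⟨?_, ?_⟩
  · intro e e' hee
    rw [← sub_eq_zero] at hee ⊢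
    rw [← smul_sub] at hee
    set d := e - e'
    obtain ⟨n, hn⟩ := hnil d
    have h1 : d = (-z) • d := by
      rw [neg_smul, eq_neg_iff_add_eq_zero]; simpa [add_smul] using hee
    have h2 : ∀ k, d = (-z) ^ k • d := by
      intro k
      induction k with
      | zero => simp
      | succ k ih => rw [pow_succ, mul_smul, ← h1, ← ih]
    rw [h2 n, neg_pow, mul_smul, hn, smul_zero]
  · intro e
    obtain ⟨n, hn⟩ := hnil e
    refine ⟨(∑ i ∈ Finset.range n, (-z) ^ i) • e, ?_⟩
    have := mul_neg_geom_sum (-z) n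
    rw [sub_neg_eq_add] at this
    change (1 + z) • (∑ i ∈ Finset.range n, (-z) ^ i) • e = e
    rw [← mul_smul, this, sub_smul, one_smul, neg_pow, mul_smul, hn, smul_zero, sub_zero]

theorem MD.local (h : MD R A E e0) : ∃ _ : IsLocalRing A,
    maximalIdeal A = (maximalIdeal R).map (algebraMap R A) := by
  haveI : Nontrivial A := by
    refine ⟨⟨1, 0, fun h0 => h.ne ?_⟩⟩
    rw [← one_smul A e0, h0, zero_smul]
  have key : ∀ a : A, ∃ r : R, a - algebraMap R A r ∈ (maximalIdeal R).map (algebraMap R A) :=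
    fun a => by simpa using h.dns 1 a
  have hu : ∀ (a : A) (r : R), IsUnit r →
      a - algebraMap R A r ∈ (maximalIdeal R).map (algebraMap R A) → IsUnit a := by
    rintro a r ⟨u, rfl⟩ ha
    have h1 := h.unit_add (Ideal.mul_mem_left _ (algebraMap R A (↑u⁻¹ : R)) ha)
    rw [mul_sub, ← map_mul, Units.inv_mul, map_one] at h1
    rw [show (1 : A) + (algebraMap R A ↑u⁻¹ * a - 1) = algebraMap R A ↑u⁻¹ * a by ring] at h1
    exact isUnit_of_mul_isUnit_right h1
  have hl : IsLocalRing A := by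
    refine IsLocalRing.of_isUnit_or_isUnit_one_sub_self fun a => ?_
    obtain ⟨r, hr⟩ := key a
    rcases IsLocalRing.isUnit_or_isUnit_one_sub_self r with h1 | h1
    · exact Or.inl (hu a r h1 hr)
    · refine Or.inr (hu _ _ h1 ?_)
      rw [map_sub, map_one]
      rw [show (1 : A) - a - (1 - algebraMap R A r) = -(a - algebraMap R A r) by ring]
      exact neg_mem hr
  refine ⟨hl, le_antisymm (fun a ha => ?_) ?_⟩
  · obtain ⟨r, hr⟩ := key a
    by_cases h1 : IsUnit r
    · exact absurd (hu a r h1 hr) ((IsLocalRing.mem_maximalIdeal _).1 ha)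
    · have := Ideal.mem_map_of_mem (algebraMap R A) ((IsLocalRing.mem_maximalIdeal _).2 h1)
      simpa using add_mem hr this
  · refine IsLocalRing.le_maximalIdeal fun h1 => ?_
    have h2 : (1 : A) ∈ (maximalIdeal R).map (algebraMap R A) := h1 ▸ Submodule.mem_top
    refine h.ne ?_
    rw [← one_smul A e0]
    exact map_smul_zero h.kill h2

theorem MD.hullA (h : MD R A E e0) [IsLocalRing A]
    (hm : maximalIdeal A = (maximalIdeal R).map (algebraMap R A)) : Hull A E e0 where
  inj := h.injA
  tors e := by rw [hm]; exact gam_algebra.2 (h.tors e)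
  ne := h.ne
  kill r hr := map_smul_zero h.kill (hm ▸ hr)
  soc e he := by
    obtain ⟨r, hr⟩ := h.soc e fun r hr => by
      rw [← algebraMap_smul A r e]
      exact he _ (hm ▸ Ideal.mem_map_of_mem _ hr)
    exact ⟨algebraMap R A r, by rw [algebraMap_smul, hr]⟩

theorem MD.mdA (h : MD R A E e0) [IsLocalRing A]
    (hm : maximalIdeal A = (maximalIdeal R).map (algebraMap R A)) : MD A A E e0 where
  toHull := h.hullA hm
  endo f := h.endo (f.restrictScalars R)
  faith := h.faith
  dens k a := ⟨a, fun e _ => rfl⟩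
end MDFacts
end GidAux

namespace GidAux
section GoodSec
variable {R : Type u} [CommRing R]

def Gd (s : R) (K : Type u) [AddCommGroup K] [Module R K] : Prop :=
  ∀ k : K, ∃ (l : ℕ) (k' : K), s ^ l • k = s ^ (l+1) • k'

theorem Gd.iter {s : R} {K : Type u} [AddCommGroup K] [Module R K] (h : Gd s K) (n : ℕ) (k : K) :
    ∃ (l : ℕ) (k' : K), s ^ l • k = s ^ (l+n) • k' := by
  induction n with
  | zero => exact ⟨0, k, rfl⟩
  | succ n ih =>
    obtain ⟨l, k', h1⟩ := ih
    obtain ⟨l', k'', h2⟩ := h k'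
    refine ⟨l + l', k'', ?_⟩
    rw [add_comm l l', pow_add, mul_smul, h1, ← mul_smul, ← pow_add,
      show l' + (l + n) = (l + n) + l' by ring, pow_add, mul_smul, h2, ← mul_smul, ← pow_add]
    congr 2; ring

theorem gam_span_surj {s : R} {K I L : Type u} [AddCommGroup K] [Module R K] [AddCommGroup I]
    [Module R I] [AddCommGroup L] [Module R L] {i : K →ₗ[R] I} {p : I →ₗ[R] L} (h : SE i p)
    (hK : Gd s K) {y : L} (hy : y ∈ gam (Ideal.span {s}) L) :
    ∃ z ∈ gam (Ideal.span {s}) I, p z = y := by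
  obtain ⟨n, hn⟩ := mem_gam_span.1 hy
  obtain ⟨z, rfl⟩ := h.2.2 y
  rw [← map_smul] at hn
  obtain ⟨k, hk⟩ := (h.2.1 _).1 hn
  obtain ⟨l, k', hl⟩ := hK.iter n k
  refine ⟨z - i k', mem_gam_span.2 ⟨l + n, ?_⟩, ?_⟩
  · rw [smul_sub, ← map_smul, ← hl, map_smul, hk, ← mul_smul, ← pow_add, sub_self]
  · rw [map_sub, h.zero, sub_zero]

def gamMap (b : Ideal R) {X Y : Type u} [AddCommGroup X] [Module R X] [AddCommGroup Y] [Module R Y]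
    (f : X →ₗ[R] Y) : gam b X →ₗ[R] gam b Y := f.restrict (fun _ hx => gam_map f hx)

theorem gamMap_coe (b : Ideal R) {X Y : Type u} [AddCommGroup X] [Module R X] [AddCommGroup Y]
    [Module R Y] (f : X →ₗ[R] Y) (x : gam b X) : (gamMap b f x : Y) = f x := rfl

theorem gam_se {b : Ideal R} {K I L : Type u} [AddCommGroup K] [Module R K] [AddCommGroup I]
    [Module R I] [AddCommGroup L] [Module R L] {i : K →ₗ[R] I} {p : I →ₗ[R] L} (h : SE i p)
    (hs : ∀ y ∈ gam b L, ∃ z ∈ gam b I, p z = y) : SE (gamMap b i) (gamMap b p) := by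
  refine SE.mk' (fun a ha => Subtype.ext (h.1 ((congrArg Subtype.val ha).trans (map_zero i).symm)))
    (fun a => Subtype.ext (h.zero _)) (fun z hz => ?_) (fun y => ?_)
  · obtain ⟨k, hk⟩ := (h.2.1 _).1 (congrArg Subtype.val hz)
    exact ⟨⟨k, gam_of_inj i h.1 (by rw [hk]; exact z.2)⟩, Subtype.ext hk⟩
  · obtain ⟨z, hz, hzy⟩ := hs y y.2
    exact ⟨⟨z, hz⟩, Subtype.ext hzy⟩

def GdL : List R → (K : ModuleCat.{u} R) → Prop
  | [], _ => True
  | s :: S, K => Gd s K ∧ GdL S (ModuleCat.of R (gam (Ideal.span {s}) K))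

theorem gdl_lift (S : List R) : ∀ {K I L : ModuleCat.{u} R} {i : K →ₗ[R] I} {p : I →ₗ[R] L},
    SE i p → GdL S K → ∀ y : L, (∀ s ∈ S, y ∈ gam (Ideal.span {s}) L) →
    ∃ z : I, (∀ s ∈ S, z ∈ gam (Ideal.span {s}) I) ∧ p z = y := by
  induction S with
  | nil => intro K I L i p h _ y _
           obtain ⟨z, hz⟩ := h.2.2 y
           exact ⟨z, by simp, hz⟩
  | cons s S ih =>
    intro K I L i p h hK y hy
    have h1 := gam_se h (fun y hy => gam_span_surj h hK.1 hy)
    obtain ⟨z, hz, hzy⟩ := ih (K := ModuleCat.of R (gam (Ideal.span {s}) K))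
      (I := ModuleCat.of R (gam (Ideal.span {s}) I)) (L := ModuleCat.of R (gam (Ideal.span {s}) L))
      h1 hK.2 ⟨y, hy s (by simp)⟩ (fun t ht => gam_of_inj (Submodule.subtype _)
        (Submodule.subtype_injective _) (hy t (by simp [ht])))
    refine ⟨z.1, ?_, congrArg Subtype.val hzy⟩
    intro t ht
    rcases List.mem_cons.1 ht with rfl | ht
    · exact z.2
    · exact gam_map (Submodule.subtype _) (hz t ht)

theorem gdl_injective [IsNoetherianRing R] (S : List R) : ∀ {I : ModuleCat.{u} R},
    Module.Injective R I → GdL S I := by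
  induction S with
  | nil => intro I _; trivial
  | cons s S ih => intro I hI; exact ⟨inj_good s hI, ih (injective_gam _ hI)⟩

theorem gdl_quot (S : List R) : ∀ {K I L : ModuleCat.{u} R} {i : K →ₗ[R] I} {p : I →ₗ[R] L},
    SE i p → GdL S.dropLast K → GdL S I → GdL S L := by
  induction S with
  | nil => intros; trivial
  | cons s S ih =>
    intro K I L i p h hK hI
    have h0 : Gd s L := fun y => by
      obtain ⟨z, rfl⟩ := h.2.2 y
      obtain ⟨l, z', hz⟩ := hI.1 z
      exact ⟨l, p z', by rw [← map_smul, ← map_smul, hz]⟩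
    refine ⟨h0, ?_⟩
    cases S with
    | nil => trivial
    | cons t S =>
      have hK' : Gd s K ∧ GdL (t :: S).dropLast (ModuleCat.of R (gam (Ideal.span {s}) K)) := hK
      exact ih (K := ModuleCat.of R (gam (Ideal.span {s}) K))
        (I := ModuleCat.of R (gam (Ideal.span {s}) I)) (L := ModuleCat.of R (gam (Ideal.span {s}) L))
        (gam_se h (fun y hy => gam_span_surj h hK'.1 hy)) hK'.2 hI.2

theorem gdl_gi [IsNoetherianRing R] (n : ℕ) : ∀ (S : List R), S.length ≤ n →
    ∀ {K : ModuleCat.{u} R}, GI R K → GdL S K := by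
  induction n with
  | zero => intro S hS K _
            rw [List.length_eq_zero_iff.1 (Nat.le_zero.1 hS)]; trivial
  | succ n ih =>
    intro S hS K hK
    obtain ⟨L, hL, I, i, p, hI, hs⟩ := hK.left
    exact gdl_quot S hs (ih _ (by simp; omega) hL) (gdl_injective S hI)

theorem mem_gam_list [IsNoetherianRing R] {S : List R} {b : Ideal R}
    (hS : Ideal.span {s | s ∈ S} = b) {Y : Type u} [AddCommGroup Y] [Module R Y] {y : Y} :
    y ∈ gam b Y ↔ ∀ s ∈ S, y ∈ gam (Ideal.span {s}) Y := by
  constructor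
  · intro hy s hs
    refine gam_mono ?_ hy
    rw [← hS]; exact Ideal.span_mono (by simpa using hs)
  · intro h
    let a : Ideal R := LinearMap.ker (LinearMap.toSpanSingleton R Y y)
    have h1 : b ≤ a.radical := by
      rw [← hS, Ideal.span_le]
      intro s hs
      obtain ⟨n, hn⟩ := mem_gam_span.1 (h s hs)
      exact ⟨n, hn⟩
    obtain ⟨n, hn⟩ := Ideal.exists_pow_le_of_le_radical_of_fg h1
      ((isNoetherianRing_iff_ideal_fg R).1 inferInstance b)
    exact ⟨n, fun r hr => hn hr⟩

theorem exists_list [IsNoetherianRing R] (b : Ideal R) : ∃ S : List R, Ideal.span {s | s ∈ S} = b := by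
  obtain ⟨T, hT⟩ := (isNoetherianRing_iff_ideal_fg R).1 inferInstance b
  exact ⟨T.toList, by simpa using hT⟩

/-- torsion functors are exact on short exact sequences starting at a Gorenstein injective. -/
theorem gi_gam_lift [IsNoetherianRing R] (b : Ideal R) {K I L : Type u} [AddCommGroup K]
    [Module R K] [AddCommGroup I] [Module R I] [AddCommGroup L] [Module R L] {i : K →ₗ[R] I}
    {p : I →ₗ[R] L} (h : SE i p) (hK : GI R K) : ∀ y ∈ gam b L, ∃ z ∈ gam b I, p z = y := by
  intro y hy
  obtain ⟨S, hS⟩ := exists_list b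
  obtain ⟨z, hz, hzy⟩ := gdl_lift S (K := ModuleCat.of R K) (I := ModuleCat.of R I)
    (L := ModuleCat.of R L) h (gdl_gi _ S le_rfl hK) y ((mem_gam_list hS).1 hy)
  exact ⟨z, (mem_gam_list hS).2 hz, hzy⟩

theorem gi_prod {A B : Type u} [AddCommGroup A] [Module R A] [AddCommGroup B] [Module R B]
    (hA : GI R A) (hB : GI R B) : GI R (A × B) := gi_ext (se_inl_snd A B) hA hB
end GoodSec
end GidAux

namespace GidAux
section PVSec
variable {R A E : Type u} [CommRing R] [IsLocalRing R] [IsNoetherianRing R] [CommRing A]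
  [IsNoetherianRing A] [Algebra R A] [AddCommGroup E] [Module R E] [Module A E]
  [IsScalarTower R A E] {e0 : E}

theorem MD.dualPi (h : MD R A E e0) (a : ℕ) :
    ∃ e : (Fin a → A) ≃ₗ[A] ((Fin a → E) →ₗ[R] E), ∀ w x, e w x = ∑ i, w i • x i := by
  let f : (Fin a → A) →ₗ[A] ((Fin a → E) →ₗ[R] E) :=
    { toFun := fun w => ∑ i, (Algebra.lsmul R R E (w i)).comp (LinearMap.proj i)
      map_add' := fun v w => by ext; simp [Finset.sum_add_distrib, add_smul]
      map_smul' := fun v w => by ext; simp [mul_smul, Finset.smul_sum] }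
  have hf : ∀ w x, f w x = ∑ i, w i • x i := fun w x => by simp [f]
  refine ⟨LinearEquiv.ofBijective f ⟨?_, ?_⟩, hf⟩
  · refine (injective_iff_map_eq_zero f).2 fun w hw => funext fun i => h.faith _ fun e => ?_
    have := LinearMap.congr_fun hw (Pi.single i e)
    rw [hf, Finset.sum_eq_single i (fun j _ hj => by simp [Pi.single_eq_of_ne hj])
      (fun hh => absurd (Finset.mem_univ i) hh)] at this
    simpa using this
  · intro g
    choose c hc using fun i => h.endo (g.comp (LinearMap.single R (fun _ => E) i))
    refine ⟨c, LinearMap.ext fun x => ?_⟩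
    rw [hf]
    conv_rhs => rw [← Finset.univ_sum_single x, map_sum]
    exact Finset.sum_congr rfl fun i _ => (hc i (x i)).symm

theorem MD.refl (h : MD R A E e0) {V : Type u} [AddCommGroup V] [Module R V] {c : ℕ}
    (j : V →ₗ[R] (Fin c → E)) (hj : Function.Injective j) (φ : (V →ₗ[R] E) →ₗ[A] A) :
    ∃ g : E →ₗ[R] V, ∀ (v : V →ₗ[R] E) (e : E), v (g e) = φ v • e := by
  obtain ⟨D, hD⟩ := h.dualPi c
  have hex : ∀ w : Fin c → A, φ ((D w).comp j) = ∑ i, w i * φ ((LinearMap.proj i).comp j) := by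
    intro w
    have : (D w).comp j = ∑ i, w i • ((LinearMap.proj i).comp j : V →ₗ[R] E) := by
      ext v; simp [hD]
    rw [this, map_sum]; simp
  let G : E →ₗ[R] (Fin c → E) :=
    LinearMap.pi fun i => Algebra.lsmul R R E (φ ((LinearMap.proj i).comp j))
  have hG : ∀ w e, D w (G e) = φ ((D w).comp j) • e := by
    intro w e
    rw [hD, hex, Finset.sum_smul]
    exact Finset.sum_congr rfl fun i _ => by rw [mul_smul]; rfl
  obtain ⟨g, hg⟩ := exists_cofactor j hj G (fun e => by
    by_contra h0
    have h1 : (LinearMap.range j).mkQ (G e) ≠ 0 := fun h2 =>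
      h0 (by simpa using (Submodule.Quotient.mk_eq_zero _).1 h2)
    obtain ⟨f, hf⟩ := h.cogen h1
    refine hf ?_
    obtain ⟨w, hw⟩ := D.surjective (f.comp (LinearMap.range j).mkQ)
    have h2 := hG w e
    have h3 : (D w).comp j = 0 := by
      rw [hw]; ext v
      exact (congrArg f ((se_mkQ j hj).zero v)).trans (map_zero f)
    rw [h3, map_zero, zero_smul, hw] at h2
    exact h2)
  refine ⟨g, fun v e => ?_⟩
  obtain ⟨f, hf⟩ := inj_extend h.inj j hj v
  obtain ⟨w, rfl⟩ := D.surjective f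
  have : (D w).comp j = v := LinearMap.ext hf
  rw [← hf, hg, hG, this]

theorem MD.finite_dual (h : MD R A E e0) {V : Type u} [AddCommGroup V] [Module R V] {c : ℕ}
    (j : V →ₗ[R] (Fin c → E)) (hj : Function.Injective j) : Module.Finite A (V →ₗ[R] E) := by
  obtain ⟨D, hD⟩ := h.dualPi c
  refine Module.Finite.of_surjective ((LinearMap.lcomp A E j).comp D.toLinearMap) fun v => ?_
  obtain ⟨f, hf⟩ := inj_extend h.inj j hj v
  obtain ⟨w, rfl⟩ := D.surjective f
  exact ⟨w, LinearMap.ext hf⟩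

theorem MD.embed_quot (h : MD R A E e0) {V : Type u} [AddCommGroup V] [Module R V] {a : ℕ}
    (p : (Fin a → E) →ₗ[R] V) (hp : Function.Surjective p) :
    ∃ (c : ℕ) (j : V →ₗ[R] (Fin c → E)), Function.Injective j := by
  obtain ⟨D, hD⟩ := h.dualPi a
  have hfin : Module.Finite A (V →ₗ[R] E) := by
    refine Module.Finite.of_injective (D.symm.toLinearMap.comp (LinearMap.lcomp A E p)) ?_
    refine D.symm.injective.comp ?_
    refine (injective_iff_map_eq_zero _).2 fun f hf => LinearMap.ext fun v => ?_
    obtain ⟨x, rfl⟩ := hp v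
    exact LinearMap.congr_fun hf x
  obtain ⟨c, w, hw⟩ := Module.Finite.exists_fin (R := A) (M := V →ₗ[R] E)
  refine ⟨c, LinearMap.pi w, (injective_iff_map_eq_zero _).2 fun v hv => ?_⟩
  by_contra h0
  obtain ⟨f, hf⟩ := h.cogen h0
  refine hf ?_
  have : f ∈ Submodule.span A (Set.range w) := hw ▸ Submodule.mem_top
  refine Submodule.span_induction (p := fun f _ => f v = 0) ?_ ?_ ?_ ?_ this
  · rintro _ ⟨i, rfl⟩; exact congrFun hv i
  · rfl
  · intro f g _ _ hf hg; rw [LinearMap.add_apply, hf, hg, add_zero]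
  · intro a f _ hf; rw [LinearMap.smul_apply, hf, smul_zero]

theorem Hull.tors_pi {R E : Type u} [CommRing R] [IsLocalRing R] [AddCommGroup E] [Module R E]
    {e0 : E} (h : Hull R E e0) {a : ℕ} (x : Fin a → E) : x ∈ gam (maximalIdeal R) (Fin a → E) := by
  choose n hn using fun i => h.tors (x i)
  refine ⟨Finset.univ.sup n, fun r hr => funext fun i => hn i r ?_⟩
  exact Ideal.pow_le_pow_right (Finset.le_sup (Finset.mem_univ i)) hr

theorem injective_fin {R E : Type u} [CommRing R] [AddCommGroup E] [Module R E]
    (h : Module.Injective R E) (a : ℕ) : Module.Injective R (Fin a → E) := by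
  have h1 : Module.Injective R (ULift.{u} (Fin a) → E) := injective_pi (fun _ => h)
  exact injective_of_equiv h1 (LinearEquiv.funCongrLeft R E Equiv.ulift.symm)

/-- torsion modules embedded in a power of `E` that are retracts of torsion submodules of
Gorenstein injectives. -/
def PV (R E : Type u) [CommRing R] [IsLocalRing R] [AddCommGroup E] [Module R E]
    (V : Type u) [AddCommGroup V] [Module R V] : Prop :=
  (∃ (c : ℕ) (j : V →ₗ[R] (Fin c → E)), Function.Injective j) ∧
  ∃ (K : ModuleCat.{u} R) (i : V →ₗ[R] gam (maximalIdeal R) K) (ρ : gam (maximalIdeal R) K →ₗ[R] V),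
    GI R K ∧ ∀ v, ρ (i v) = v

def toGam {R : Type u} [CommRing R] (b : Ideal R) {X Y : Type u} [AddCommGroup X] [Module R X]
    [AddCommGroup Y] [Module R Y] (hX : ∀ x : X, x ∈ gam b X) (f : X →ₗ[R] Y) : X →ₗ[R] gam b Y :=
  f.codRestrict _ (fun x => gam_map f (hX x))

theorem pv_right (h : MD R A E e0) {V : Type u} [AddCommGroup V] [Module R V] (hV : PV R E V) :
    ∃ (a : ℕ) (V1 : ModuleCat.{u} R) (j : V →ₗ[R] (Fin a → E)) (π : (Fin a → E) →ₗ[R] V1),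
      PV R E V1 ∧ SE j π ∧ ∀ g : E →ₗ[R] V1, ∃ g' : E →ₗ[R] (Fin a → E), ∀ e, π (g' e) = g e := by
  obtain ⟨⟨a, j, hj⟩, K, i, ρ, hK, hρ⟩ := hV
  obtain ⟨K1, hK1, I, k, q, hI, hs⟩ := hK.right
  let π := (LinearMap.range j).mkQ
  have hjπ : SE j π := se_mkQ j hj
  have hgs : SE (gamMap (maximalIdeal R) k) (gamMap (maximalIdeal R) q) := gam_se hs (gi_gam_lift (maximalIdeal R) hs hK)
  have hEa := injective_fin h.inj a
  have hIΓ : Module.Injective R (gam (maximalIdeal R) I) := injective_gam (maximalIdeal R) hI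
  obtain ⟨α, hα⟩ := inj_extend hIΓ j hj ((gamMap (maximalIdeal R) k).comp i)
  obtain ⟨γ, hγ⟩ := inj_extend hEa (gamMap (maximalIdeal R) k) hgs.1 (j.comp ρ)
  obtain ⟨θ, hθ⟩ := exists_factor π hjπ.2.2 (γ.comp α - LinearMap.id) (fun x hx => by
    obtain ⟨v, rfl⟩ := (hjπ.2.1 x).1 hx
    have : γ (α (j v)) = j v := by rw [hα]; exact (hγ (i v)).trans (congrArg j (hρ v))
    simp [this])
  obtain ⟨β1, hβ1⟩ := exists_factor π hjπ.2.2 ((gamMap (maximalIdeal R) q).comp α) (fun x hx => by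
    obtain ⟨v, rfl⟩ := (hjπ.2.1 x).1 hx
    rw [LinearMap.comp_apply, hα]; exact hgs.zero _)
  obtain ⟨β2, hβ2⟩ := exists_factor (gamMap (maximalIdeal R) q) hgs.2.2 (π.comp γ) (fun x hx => by
    obtain ⟨v, rfl⟩ := (hgs.2.1 x).1 hx
    rw [LinearMap.comp_apply, hγ]; exact hjπ.zero _)
  have key : ∀ v, β2 (β1 v) = v + π (θ v) := by
    intro v
    obtain ⟨x, rfl⟩ := hjπ.2.2 v
    rw [hβ1, LinearMap.comp_apply, hβ2, hθ]
    simp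
  have htor : ∀ v : (Fin a → E) ⧸ LinearMap.range j, v ∈ gam (maximalIdeal R) _ := fun v => by
    obtain ⟨x, rfl⟩ := hjπ.2.2 v
    exact gam_map π (h.tors_pi x)
  refine ⟨a, ModuleCat.of R ((Fin a → E) ⧸ LinearMap.range j), j, π,
    ⟨h.embed_quot π hjπ.2.2, ModuleCat.of R (K1 × (Fin a → E)),
      toGam (maximalIdeal R) htor (((gam (maximalIdeal R) K1).subtype.comp β1).prod θ), β2.comp (gamMap (maximalIdeal R) (LinearMap.fst R K1 (Fin a → E))) -
      π.comp ((LinearMap.snd R K1 (Fin a → E)).comp (Submodule.subtype _)),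
      gi_prod hK1 (gi_of_injective hEa), fun v => ?_⟩, hjπ, fun g => ?_⟩
  · have h1 : gamMap (maximalIdeal R) (LinearMap.fst R K1 (Fin a → E))
        (toGam (maximalIdeal R) htor (((gam (maximalIdeal R) K1).subtype.comp β1).prod θ) v) = β1 v := Subtype.ext rfl
    change β2 (gamMap (maximalIdeal R) (LinearMap.fst R K1 (Fin a → E))
        (toGam (maximalIdeal R) htor (((gam (maximalIdeal R) K1).subtype.comp β1).prod θ) v)) - π (θ v) = v
    rw [h1, key, add_sub_cancel_right]
  · obtain ⟨l, hl⟩ := hK.liftP.lift h.inj hs ((gam (maximalIdeal R) K1).subtype.comp (β1.comp g))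
    refine ⟨γ.comp (toGam (maximalIdeal R) h.tors l) - θ.comp g, fun e => ?_⟩
    have h1 : gamMap (maximalIdeal R) q (toGam (maximalIdeal R) h.tors l e) = β1 (g e) := Subtype.ext (hl e)
    have h2 := hβ2 (toGam (maximalIdeal R) h.tors l e)
    rw [h1, key, LinearMap.comp_apply] at h2
    rw [LinearMap.sub_apply, map_sub, LinearMap.comp_apply, LinearMap.comp_apply, ← h2,
      add_sub_cancel_right]

theorem pv_left (h : MD R A E e0) {V : Type u} [AddCommGroup V] [Module R V] (hV : PV R E V) :
    ∃ (b : ℕ) (V1 : ModuleCat.{u} R) (j : V1 →ₗ[R] (Fin b → E)) (p : (Fin b → E) →ₗ[R] V),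
      PV R E V1 ∧ SE j p := by
  obtain ⟨⟨a, j, hj⟩, K, i, ρ, hK, hρ⟩ := hV
  obtain ⟨K1, hK1, I, k, q, hI, hs⟩ := hK.left
  have hgs : SE (gamMap (maximalIdeal R) k) (gamMap (maximalIdeal R) q) := gam_se hs (gi_gam_lift (maximalIdeal R) hs hK1)
  have hIΓ : Module.Injective R (gam (maximalIdeal R) I) := injective_gam (maximalIdeal R) hI
  have hTt : ∀ t : gam (maximalIdeal R) I, t ∈ gam (maximalIdeal R) (gam (maximalIdeal R) I) := fun t =>
    gam_of_inj (Submodule.subtype _) (Submodule.subtype_injective _) t.2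
  let τ : gam (maximalIdeal R) I →ₗ[R] V := ρ.comp (gamMap (maximalIdeal R) q)
  have hτ : Function.Surjective τ := fun v => by
    obtain ⟨t, ht⟩ := hgs.2.2 (i v)
    exact ⟨t, by rw [LinearMap.comp_apply, ht, hρ]⟩
  haveI := h.flat_dual hTt hIΓ
  haveI := h.finite_dual j hj
  haveI : Module.FinitePresentation A (V →ₗ[R] E) := Module.finitePresentation_of_finite A _
  obtain ⟨b, u, w, huw⟩ := Module.Flat.exists_factorization_of_finitePresentation
    (LinearMap.lcomp A E τ)
  choose g hg using fun k => h.refl j hj ((Finsupp.lapply k).comp u)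
  let t : Fin b → (gam (maximalIdeal R) I →ₗ[R] E) := fun k => w (Finsupp.single k 1)
  let γ : gam (maximalIdeal R) I →ₗ[R] (Fin b → E) := LinearMap.pi t
  let p : (Fin b → E) →ₗ[R] V := ∑ k, (g k).comp (LinearMap.proj k)
  have hp : ∀ x, p x = ∑ k, g k (x k) := fun x => by simp [p]
  have hpγ : ∀ y, p (γ y) = τ y := by
    intro y
    by_contra hne
    obtain ⟨v, hv⟩ := h.cogen (sub_ne_zero.2 hne)
    refine hv ?_
    rw [map_sub, hp, map_sum, sub_eq_zero]
    have h1 : v (τ y) = w (u v) y := by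
      have := LinearMap.congr_fun (LinearMap.congr_fun huw v) y
      exact this
    have h2 : u v = ∑ k, u v k • Finsupp.single k (1 : A) := by
      ext k; simp [Finsupp.single_apply]
    rw [h1, h2, map_sum, LinearMap.sum_apply]
    refine Finset.sum_congr rfl fun k _ => ?_
    rw [hg, map_smul]; rfl
  have hps : Function.Surjective p := fun v => by
    obtain ⟨y, hy⟩ := hτ v
    exact ⟨γ y, by rw [hpγ, hy]⟩
  have hEb := injective_fin h.inj b
  obtain ⟨l, hl⟩ := hK1.liftP.lift hEb hs ((gam (maximalIdeal R) K).subtype.comp (i.comp p))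
  let α := toGam (maximalIdeal R) h.tors_pi l
  have hα : ∀ x, gamMap (maximalIdeal R) q (α x) = i (p x) := fun x => Subtype.ext (hl x)
  have hker := se_ker p hps
  obtain ⟨δ, hδ⟩ := exists_cofactor (LinearMap.ker p).subtype hker.1 (γ.comp α - LinearMap.id)
    (fun x => (hker.2.1 _).1 (by
      rw [LinearMap.sub_apply, map_sub, LinearMap.comp_apply, hpγ, LinearMap.comp_apply, hα, hρ]
      simp))
  obtain ⟨i1, hi1⟩ := exists_cofactor (gamMap (maximalIdeal R) k) hgs.1
    (α.comp (LinearMap.ker p).subtype) (fun x => (hgs.2.1 _).1 (by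
      rw [LinearMap.comp_apply, hα, hker.zero, map_zero]))
  obtain ⟨r1, hr1⟩ := exists_cofactor (LinearMap.ker p).subtype hker.1
    (γ.comp (gamMap (maximalIdeal R) k)) (fun x => (hker.2.1 _).1 (by
      rw [LinearMap.comp_apply, hpγ, LinearMap.comp_apply, hgs.zero, map_zero]))
  have htor : ∀ v : LinearMap.ker p, v ∈ gam (maximalIdeal R) _ := fun v =>
    gam_of_inj _ hker.1 (h.tors_pi _)
  refine ⟨b, ModuleCat.of R (LinearMap.ker p), (LinearMap.ker p).subtype, p,
    ⟨⟨b, _, hker.1⟩, ModuleCat.of R (K1 × (Fin b → E)),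
      toGam (maximalIdeal R) htor (((gam (maximalIdeal R) K1).subtype.comp i1).prod
        (LinearMap.ker p).subtype),
      r1.comp (gamMap (maximalIdeal R) (LinearMap.fst R K1 (Fin b → E))) -
      δ.comp ((LinearMap.snd R K1 (Fin b → E)).comp (Submodule.subtype _)),
      gi_prod hK1 (gi_of_injective hEb), fun v => ?_⟩, hker⟩
  have h1 : gamMap (maximalIdeal R) (LinearMap.fst R K1 (Fin b → E))
      (toGam (maximalIdeal R) htor (((gam (maximalIdeal R) K1).subtype.comp i1).prod
        (LinearMap.ker p).subtype) v) = i1 v := Subtype.ext rfl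
  change r1 (gamMap (maximalIdeal R) (LinearMap.fst R K1 (Fin b → E))
      (toGam (maximalIdeal R) htor (((gam (maximalIdeal R) K1).subtype.comp i1).prod
        (LinearMap.ker p).subtype) v)) - δ v.1 = v
  rw [h1]
  refine hker.1 ?_
  rw [map_sub, hr1, hδ, LinearMap.comp_apply, hi1]
  simp

theorem pv_tr (h : MD R A E e0) {V : Type u} [AddCommGroup V] [Module R V] (hV : PV R E V) :
    TR A (V →ₗ[R] E) := by
  refine ⟨fun G => ∃ V : ModuleCat.{u} R, PV R E V ∧ Nonempty (G ≃ₗ[A] (V →ₗ[R] E)), ?_,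
    ModuleCat.of R V, hV, ⟨LinearEquiv.refl _ _⟩⟩
  rintro G ⟨V, hV, ⟨ε⟩⟩
  constructor
  · obtain ⟨a, V1, j, π, hV1, hs, hl⟩ := pv_right h hV
    obtain ⟨D, hD⟩ := h.dualPi a
    have hh := se_hom (B := A) h.inj hs
    refine ⟨a, ModuleCat.of A (V1 →ₗ[R] E), D.symm.toLinearMap.comp (LinearMap.lcomp A E π),
      ε.symm.toLinearMap.comp ((LinearMap.lcomp A E j).comp D.toLinearMap),
      ⟨V1, hV1, ⟨LinearEquiv.refl _ _⟩⟩, ?_, fun f => ?_⟩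
    · refine SE.mk' (fun v hv => hh.inj0 ((map_eq_zero_iff _ D.symm.injective).1 hv)) (fun v => ?_)
        (fun w hw => ?_) (fun g => ?_)
      · have := hh.zero v
        simp only [LinearMap.comp_apply, LinearEquiv.coe_coe, LinearEquiv.apply_symm_apply]
        rw [this, map_zero]
      · obtain ⟨v, hv⟩ := hh.lift ((map_eq_zero_iff _ ε.symm.injective).1 hw)
        exact ⟨v, D.injective (by
          simp only [LinearMap.comp_apply, LinearEquiv.coe_coe, LinearEquiv.apply_symm_apply]
          exact hv)⟩
      · obtain ⟨w, hw⟩ := hh.2.2 (ε g)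
        exact ⟨D.symm w, by
          simp only [LinearMap.comp_apply, LinearEquiv.coe_coe, LinearEquiv.apply_symm_apply]
          rw [hw, ε.symm_apply_apply]⟩
    · obtain ⟨⟨c, j1, hj1⟩, -⟩ := hV1
      obtain ⟨g, hg⟩ := h.refl j1 hj1 f
      obtain ⟨g', hg'⟩ := hl g
      choose b hb using fun i => h.endo ((LinearMap.proj i).comp g')
      refine ⟨∑ i, (LinearMap.mulRight A (b i)).comp (LinearMap.proj i), fun v => ?_⟩
      rw [← sub_eq_zero]
      refine h.faith _ fun e => ?_
      rw [sub_smul, sub_eq_zero]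
      have h1 : f v • e = v (π (g' e)) := by rw [hg', hg]
      have h2 : D (D.symm (v.comp π)) (g' e) = v (π (g' e)) := by
        rw [LinearEquiv.apply_symm_apply]; rfl
      rw [hD] at h2
      rw [h1, ← h2, LinearMap.sum_apply, Finset.sum_smul]
      refine Finset.sum_congr rfl fun i _ => ?_
      have := hb i e
      change (D.symm (v.comp π) i * b i) • e = D.symm (v.comp π) i • g' e i
      rw [mul_smul, ← this]; rfl
  · obtain ⟨b, V1, j, p, hV1, hs⟩ := pv_left h hV
    obtain ⟨D, hD⟩ := h.dualPi b
    have hh := se_hom (B := A) h.inj hs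
    refine ⟨b, ModuleCat.of A (V1 →ₗ[R] E),
      D.symm.toLinearMap.comp ((LinearMap.lcomp A E p).comp ε.toLinearMap),
      (LinearMap.lcomp A E j).comp D.toLinearMap, ⟨V1, hV1, ⟨LinearEquiv.refl _ _⟩⟩, ?_⟩
    refine SE.mk' (fun v hv => ?_) (fun v => ?_) (fun w hw => ?_) (fun g => ?_)
    · exact (map_eq_zero_iff _ ε.injective).1 (hh.inj0 ((map_eq_zero_iff _ D.symm.injective).1 hv))
    · simp only [LinearMap.comp_apply, LinearEquiv.coe_coe, LinearEquiv.apply_symm_apply]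
      exact hh.zero _
    · obtain ⟨v, hv⟩ := hh.lift hw
      exact ⟨ε.symm v, D.injective (by
        simp only [LinearMap.comp_apply, LinearEquiv.coe_coe, LinearEquiv.apply_symm_apply]
        exact hv)⟩
    · obtain ⟨w, hw⟩ := hh.2.2 g
      exact ⟨D.symm w, by
        simp only [LinearMap.comp_apply, LinearEquiv.coe_coe, LinearEquiv.apply_symm_apply]
        exact hw⟩
end PVSec
end GidAux

namespace GidAux
section TX
variable {R : Type u} [CommRing R] {x : R} {S : Type u} [CommRing S] [Algebra R S]
variable {C D E J N : Type u} [AddCommGroup C] [Module R C] [AddCommGroup D] [Module R D]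
  [AddCommGroup E] [Module R E] [AddCommGroup J] [Module R J] [AddCommGroup N] [Module S N]

theorem Dv.pow (h : Dv x C) (n : ℕ) (a : C) : ∃ b, x ^ n • b = a := by
  induction n generalizing a with
  | zero => exact ⟨a, by simp⟩
  | succ n ih =>
    obtain ⟨b, rfl⟩ := ih a
    obtain ⟨c, rfl⟩ := h b
    exact ⟨c, by rw [pow_succ, mul_smul]⟩

theorem tstep (hx : IsSMulRegular R x) (hS : IsQ x S) {i : C →ₗ[R] E} {p : E →ₗ[R] D} (hs : SE i p)
    (hE : Module.Injective R E) (hC : Dv x C) {jC : N →+ C} (hT : IsT x S N C jC) (hN : GI S N)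
    (hJ : Module.Injective R J) (n : ℕ) (d : J →ₗ[R] D) (hd : ∀ y, x ^ n • y = 0 → d y = 0) :
    ∃ h : J →ₗ[R] E, (∀ y, x ^ n • y = 0 → h y = 0) ∧ ∀ y, x ^ (n+1) • y = 0 → p (h y) = d y := by
  obtain ⟨T, jT, hTJ⟩ := exists_isT hS J
  obtain ⟨TE, jE, hTE⟩ := exists_isT hS E
  obtain ⟨TD, jD, hTD⟩ := exists_isT hS D
  have hTi := injective_tor hS hJ hTJ
  letI : Module R T := Module.compHom T (algebraMap R S)
  let K : Submodule R J := LinearMap.ker (mulx (x ^ (n+1)) J)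
  let j' : T →ₗ[R] J := ⟨jT.toAddHom, hTJ.smul⟩
  obtain ⟨m, hm⟩ := exists_cofactor j' hTJ.inj ((mulx (x ^ n) J).comp K.subtype) (fun y => by
    refine (hTJ.range _).1 ?_
    have : x ^ (n+1) • y.1 = 0 := y.2
    change x • x ^ n • y.1 = 0
    rw [← mul_smul, ← pow_succ', this])
  have hms : Function.Surjective m := fun t => by
    obtain ⟨z, hz⟩ := (dv_of_injective hx hJ).pow n (jT t)
    refine ⟨⟨z, ?_⟩, hTJ.inj ?_⟩
    · change x ^ (n+1) • z = 0
      rw [pow_succ', mul_smul, hz, hTJ.kill]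
    · exact (hm _).trans hz
  obtain ⟨e, he⟩ := exists_factor m hms (d.comp K.subtype) (fun y hy => hd _ (by
    have := hm y
    rw [hy, map_zero] at this
    exact this.symm))
  obtain ⟨e1, he1⟩ := exists_toT hS hTD e.toAddMonoidHom (fun r t => e.map_smul r t)
  obtain ⟨u, v, huv, hu, hv⟩ := tor_se hS hs hC hT hTE hTD
  obtain ⟨e2, he2⟩ := hN.liftP.lift hTi huv e1
  let e3 : T →ₗ[R] E := ⟨(jE.comp e2.toAddMonoidHom).toAddHom, fun r t => by
    change jE (e2 (algebraMap R S r • t)) = r • jE (e2 t)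
    rw [map_smul, hTE.smul]⟩
  obtain ⟨h, hh⟩ := inj_extend hE K.subtype (Submodule.subtype_injective _) (e3.comp m)
  refine ⟨h, fun y hy => ?_, fun y hy => ?_⟩
  · have h1 : x ^ (n+1) • y = 0 := by rw [pow_succ', mul_smul, hy, smul_zero]
    have h2 := hh ⟨y, h1⟩
    have h3 : m ⟨y, h1⟩ = 0 := hTJ.inj (by
      refine (hm _).trans ?_
      rw [map_zero]; exact hy)
    rw [LinearMap.comp_apply, h3, map_zero] at h2
    exact h2
  · have h2 := hh ⟨y, hy⟩
    have h4 : p (e3 (m ⟨y, hy⟩)) = d y := by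
      change p (jE (e2 (m ⟨y, hy⟩))) = d y
      rw [← hv, he2, he1]
      exact he _
    rw [← h4]
    exact congrArg p h2

theorem tlift (hx : IsSMulRegular R x) (hS : IsQ x S) {i : C →ₗ[R] E} {p : E →ₗ[R] D} (hs : SE i p)
    (hE : Module.Injective R E) (hC : Dv x C) {jC : N →+ C} (hT : IsT x S N C jC) (hN : GI S N)
    (hJ : Module.Injective R J) (htor : ∀ y : J, ∃ n : ℕ, x ^ n • y = 0) (g : J →ₗ[R] D)
    (m : ℕ) (f1 : J →ₗ[R] E) (hf1 : ∀ y, x ^ m • y = 0 → p (f1 y) = g y) :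
    ∃ f : J →ₗ[R] E, (∀ y, p (f y) = g y) ∧ ∀ y, x ^ m • y = 0 → f y = f1 y := by
  have hstep : ∀ (n : ℕ) (f : {f : J →ₗ[R] E // ∀ y, x ^ (n + m) • y = 0 → p (f y) = g y}),
      ∃ f' : {f : J →ₗ[R] E // ∀ y, x ^ (n + 1 + m) • y = 0 → p (f y) = g y},
        ∀ y, x ^ (n + m) • y = 0 → f'.1 y = f.1 y := by
    rintro n ⟨f, hf⟩
    obtain ⟨h, h1, h2⟩ := tstep hx hS hs hE hC hT hN hJ (n + m) (g - p.comp f) (fun y hy => by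
      simp [hf y hy])
    refine ⟨⟨f + h, fun y hy => ?_⟩, fun y hy => ?_⟩
    · rw [LinearMap.add_apply, map_add, h2 y (by rw [← hy]; congr 2; ring)]
      simp
    · simp [h1 y hy]
  choose st hst using hstep
  let F : ∀ n : ℕ, {f : J →ₗ[R] E // ∀ y, x ^ (n + m) • y = 0 → p (f y) = g y} := fun n =>
    Nat.rec ⟨f1, fun y hy => hf1 y (by simpa using hy)⟩ (fun k f => st k f) n
  have hF1 : ∀ n y, x ^ (n + m) • y = 0 → (F (n+1)).1 y = (F n).1 y := fun n y hy => hst n (F n) y hy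
  have hz : ∀ (n k : ℕ) (y : J), x ^ n • y = 0 → x ^ (n + k) • y = 0 := fun n k y hy => by
    rw [add_comm, pow_add, mul_smul, hy, smul_zero]
  have hF : ∀ k n y, x ^ (n + m) • y = 0 → (F (n+k)).1 y = (F n).1 y := by
    intro k
    induction k with
    | zero => intro n y _; rfl
    | succ k ih =>
      intro n y hy
      rw [← ih n y hy]
      exact hF1 (n + k) y (by rw [show n + k + m = n + m + k by ring]; exact hz _ _ _ hy)
  choose N0 hN0 using htor
  have hval : ∀ n y, x ^ (n + m) • y = 0 → (F (N0 y)).1 y = (F n).1 y := by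
    intro n y hy
    rw [← hF n (N0 y) y (hz _ _ _ (hN0 y)), ← hF (N0 y) n y hy]
    exact congrArg (fun k => (F k).1 y) (add_comm _ _)
  have hadd : ∀ n k (y : J), x ^ n • y = 0 → x ^ (n + k + m) • y = 0 := fun n k y hy => by
    rw [add_assoc]; exact hz _ _ _ hy
  refine ⟨{ toFun := fun y => (F (N0 y)).1 y, map_add' := fun y z => ?_, map_smul' := fun r y => ?_ },
    fun y => ?_, fun y hy => ?_⟩
  · have hy := hadd _ (N0 z) _ (hN0 y)
    have hz' := hadd _ (N0 y) _ (hN0 z)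
    rw [add_comm (N0 z)] at hz'
    rw [hval _ _ hy, hval _ _ hz', hval (N0 y + N0 z) (y + z) (by rw [smul_add, hy, hz', add_zero]),
      map_add]
  · have hy := hadd _ 0 _ (hN0 y)
    rw [hval _ _ hy, hval (N0 y + 0) (r • y) (by rw [smul_comm, hy, smul_zero]), map_smul]; rfl
  · exact (F (N0 y)).2 y (hz _ _ _ (hN0 y))
  · exact hval 0 y (by simpa using hy)

theorem inv_split [IsNoetherianRing R] (hx : IsSMulRegular R x) (hJ : Module.Injective R J) :
    ∃ (W : ModuleCat.{u} R) (σ : W →ₗ[R] J) (π : J →ₗ[R] W) (ρ : J →ₗ[R] gam (Ideal.span {x}) J),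
      Module.Injective R W ∧ Inv x W ∧ (∀ w, π (σ w) = w) ∧
      ∀ y, y = (ρ y).1 + σ (π y) := by
  have hs := se_mkQ (gam (Ideal.span {x}) J).subtype (Submodule.subtype_injective _)
  have hG := injective_gam (Ideal.span {x}) hJ
  obtain ⟨σ, hσ⟩ := hs.section hG
  have hW := hs.injective_right hG hJ
  let π := (LinearMap.range (gam (Ideal.span {x}) J).subtype).mkQ
  obtain ⟨ρ, hρ⟩ := exists_cofactor (gam (Ideal.span {x}) J).subtype (Submodule.subtype_injective _)
    (LinearMap.id - σ.comp π) (fun y => (hs.2.1 _).1 (by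
      rw [LinearMap.sub_apply, map_sub, LinearMap.comp_apply, hσ]; simp [π]))
  refine ⟨ModuleCat.of R (J ⧸ LinearMap.range (gam (Ideal.span {x}) J).subtype), σ, π, ρ, hW, ⟨?_, ?_⟩, hσ, fun y => ?_⟩
  · have : Function.Injective (mulx x (J ⧸ LinearMap.range (gam (Ideal.span {x}) J).subtype)) := by
      refine (injective_iff_map_eq_zero _).2 fun w hw => ?_
      obtain ⟨y, rfl⟩ := hs.2.2 w
      have h1 : π (x • y) = 0 := by rw [map_smul]; exact hw
      obtain ⟨t, ht⟩ := hs.lift h1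
      obtain ⟨n, hn⟩ := mem_gam_span.1 t.2
      have h2 : y ∈ gam (Ideal.span {x}) J := mem_gam_span.2 ⟨n+1, by
        rw [pow_succ, mul_smul, ← ht]; exact hn⟩
      exact hs.zero ⟨y, h2⟩
    exact this
  · exact dv_of_injective hx hW
  · have := hρ y
    change (ρ y).1 = y - σ (π y) at this
    rw [this]; abel

/-- Modules to which Theorem X applies -/
def XC (x : R) (S : Type u) [CommRing S] [Algebra R S] (C : Type u) [AddCommGroup C] [Module R C] : Prop :=
  Dv x C ∧ (∃ (N : ModuleCat.{u} S) (j : N →+ C), IsT x S N C j ∧ GI S N) ∧ Module.Injective R (co x C)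

theorem xc_liftP [IsNoetherianRing R] (hx : IsSMulRegular R x) (hS : IsQ x S) (h : XC x S C) :
    LiftP R C := by
  obtain ⟨hd, ⟨N, jC, hT, hN⟩, hco⟩ := h
  obtain ⟨E, i, hE, hi⟩ := exists_embed (R := R) C
  have hs := se_mkQ i hi
  refine liftP_of_one hE hs fun J hJ g => ?_
  obtain ⟨W, σ, π, ρ, hW, hWi, hσ, hdec⟩ := inv_split hx hJ
  obtain ⟨f1, hf1, -⟩ := tlift hx hS hs hE hd hT hN (injective_gam (Ideal.span {x}) hJ)
    (fun y => by
      obtain ⟨n, hn⟩ := mem_gam_span.1 y.2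
      exact ⟨n, Subtype.ext hn⟩) (g.comp (Submodule.subtype _)) 0 0 (fun y hy => by
      have : y = 0 := by simpa using hy
      rw [this]; simp)
  obtain ⟨g', hg'⟩ := exists_toCo hWi (g.comp σ)
  obtain ⟨τ, hτ⟩ := (co_se (s := x) hs hd.a2).section hco
  refine ⟨f1.comp ρ + (ev0 x E).comp (τ.comp (g'.comp π)), fun y => ?_⟩
  rw [LinearMap.add_apply, map_add, LinearMap.comp_apply, hf1]
  have h2 : (LinearMap.range i).mkQ (ev0 x E (τ (g' (π y)))) = g (σ (π y)) := by
    have := congrFun (congrArg Subtype.val (hτ (g' (π y)))) 0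
    rw [hg'] at this
    exact this
  conv_rhs => rw [hdec y, map_add]
  exact congrArg₂ _ rfl h2

theorem inv_dv_co (hW : Inv x C) : Nonempty (C ≃ₗ[R] co x C) := by
  obtain ⟨f, hf⟩ := exists_toCo hW LinearMap.id
  refine ⟨LinearEquiv.ofBijective f ⟨fun a b h => ?_, fun y => ?_⟩⟩
  · have := congrFun (congrArg Subtype.val h) 0
    rwa [hf, hf] at this
  · refine ⟨y.1 0, ?_⟩
    ext k
    induction k with
    | zero => exact hf _
    | succ k ih =>
      refine hW.1 ?_
      change x • (f (y.1 0)).1 (k+1) = x • y.1 (k+1)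
      rw [← co.eq, ← co.eq, ih]

theorem co_shift (k : ℕ) (y : co x C) : ∃ y' : co x C, x ^ k • y' = y ∧ ∀ l, y'.1 l = y.1 (k + l) :=
  ⟨⟨fun l => y.1 (k + l), fun l => co.eq y (k + l)⟩, Subtype.ext (funext fun l => co.pow y k l),
    fun _ => rfl⟩

theorem co_pow0 (k : ℕ) (y : co x C) : (x ^ k • y).1 k = y.1 0 := co.pow y k 0

theorem xc_right (hx : IsSMulRegular R x) (hS : IsQ x S) (h : XC x S C) :
    ∃ D : ModuleCat.{u} R, XC x S D ∧ Link R C D := by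
  obtain ⟨hd, ⟨N, jC, hT, hN⟩, hco⟩ := h
  obtain ⟨E, i, hE, hi⟩ := exists_embed (R := R) C
  have hs := se_mkQ i hi
  have hdE := dv_of_injective hx hE
  obtain ⟨TE, jE, hTE⟩ := exists_isT hS E
  obtain ⟨TD, jD, hTD⟩ := exists_isT hS (E ⧸ LinearMap.range i)
  obtain ⟨u, v, huv, hu, hv⟩ := tor_se hS hs hd hT hTE hTD
  exact ⟨ModuleCat.of R (E ⧸ LinearMap.range i), ⟨hdE.of_surj _ hs.2.2,
    ⟨TD, jD, hTD, gi_coker huv hN (gi_of_injective (injective_tor hS hE hTE))⟩,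
    (co_se (s := x) hs hd.a2).injective_right hco (injective_co hE)⟩, E, i, _, hE, hs⟩

theorem co_ker_inj {I L P : Type u} [AddCommGroup I] [Module R I] [AddCommGroup L] [Module R L]
    [AddCommGroup P] [Module R P] (hP : Module.Injective R P)
    (φ : I →ₗ[R] C) (e : P ≃ₗ[R] I × co x C) (κ : L →ₗ[R] P) (hκ : Function.Injective κ)
    (hk0 : ∀ l, φ (e (κ l)).1 + (e (κ l)).2.1 0 = 0)
    (hk1 : ∀ z : P, φ (e z).1 + (e z).2.1 0 = 0 → ∃ l, κ l = z) :
    Module.Injective R (co x L) := by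
  have hinj : Function.Injective (coMap x κ) := fun y z h => Subtype.ext (funext fun k =>
    hκ (congrFun (congrArg Subtype.val h) k))
  have heq : ∀ (y : co x P) k, (e (y.1 k)).1 = x • (e (y.1 (k + 1))).1 := fun y k => by
    have h := congrArg (fun z => (e z).1) (co.eq y k)
    simp only [map_smul, Prod.smul_fst] at h
    exact h
  have hlin : ∀ (y : co x P) k l, - φ (e (y.1 (k + l))).1 = x • - φ (e (y.1 (k + (l + 1)))).1 :=
    fun y k l => by
      rw [heq y (k + l), map_smul, smul_neg]; rfl
  let r0 : co x P → ℕ → co x C := fun y k => ⟨fun l => - φ (e (y.1 (k + l))).1, fun l => hlin y k l⟩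
  have hr0 : ∀ y k, r0 y k = x • r0 y (k + 1) := fun y k => Subtype.ext (funext fun l => by
    change - φ (e (y.1 (k + l))).1 = x • - φ (e (y.1 (k + 1 + l))).1
    rw [hlin, show k + (l + 1) = k + 1 + l by ring])
  have hre : ∀ (y : co x P) k, e.symm ((e (y.1 k)).1, r0 y k)
      = x • e.symm ((e (y.1 (k + 1))).1, r0 y (k + 1)) := fun y k => by
    rw [heq y k, hr0 y k, ← map_smul]; rfl
  let r : co x P →ₗ[R] co x P :=
    { toFun := fun y => ⟨fun k => e.symm ((e (y.1 k)).1, r0 y k), fun k => hre y k⟩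
      map_add' := fun y z => by
        refine Subtype.ext (funext fun k => ?_)
        change e.symm ((e (y.1 k + z.1 k)).1, r0 (y + z) k) =
          e.symm ((e (y.1 k)).1, r0 y k) + e.symm ((e (z.1 k)).1, r0 z k)
        rw [← map_add]
        refine congrArg _ (Prod.ext (by simp) (Subtype.ext (funext fun l => ?_)))
        change - φ (e (y.1 (k + l) + z.1 (k + l))).1 = - φ (e (y.1 (k + l))).1 + - φ (e (z.1 (k + l))).1
        rw [map_add, Prod.fst_add, map_add]; abel
      map_smul' := fun r y => by
        refine Subtype.ext (funext fun k => ?_)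
        change e.symm ((e (r • y.1 k)).1, r0 (r • y) k) = r • e.symm ((e (y.1 k)).1, r0 y k)
        rw [← map_smul]
        refine congrArg _ (Prod.ext (by simp) (Subtype.ext (funext fun l => ?_)))
        change - φ (e (r • y.1 (k + l))).1 = r • - φ (e (y.1 (k + l))).1
        rw [map_smul, Prod.smul_fst, map_smul, smul_neg] }
  have hrv : ∀ y k, e ((r y).1 k) = ((e (y.1 k)).1, r0 y k) := fun y k =>
    e.apply_symm_apply _
  have hr : ∀ y k, φ (e ((r y).1 k)).1 + (e ((r y).1 k)).2.1 0 = 0 := fun y k => by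
    rw [hrv]
    change φ (e (y.1 k)).1 + - φ (e (y.1 (k + 0))).1 = 0
    simp
  obtain ⟨c, hc⟩ := exists_cofactor (coMap x κ) hinj r (fun y => by
    choose g hg using fun k => hk1 _ (hr y k)
    refine ⟨⟨g, fun k => hκ ?_⟩, Subtype.ext (funext fun k => hg k)⟩
    rw [map_smul, hg, hg]; exact co.eq (r y) k)
  refine injective_retract (injective_co (s := x) hP) (coMap x κ) c
    (fun y => hinj ?_)
  rw [hc]
  refine Subtype.ext (funext fun k => e.injective ?_)
  rw [hrv]
  refine Prod.ext rfl (Subtype.ext (funext fun l => ?_))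
  change - φ (e (κ (y.1 (k + l)))).1 = (e (κ (y.1 k))).2.1 l
  have h1 := hk0 (y.1 (k + l))
  have h2 : x ^ l • (e (κ (y.1 (l + k)))).2 = (e (κ (y.1 k))).2 := by
    rw [← co.pow y l k, map_smul, map_smul]; rfl
  rw [← h2, co_pow0, add_comm l k]
  exact (eq_neg_of_add_eq_zero_right h1).symm

theorem xc_left [IsNoetherianRing R] (hx : IsSMulRegular R x) (hS : IsQ x S) (h : XC x S C) :
    ∃ D : ModuleCat.{u} R, XC x S D ∧ Link R D C := by
  obtain ⟨hd, ⟨N, jC, hT, hN⟩, hco⟩ := h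
  obtain ⟨N', hN', Ib, ib, pb, hIb, hsb⟩ := hN.left
  obtain ⟨E0, T0, j0, e, hE0, hT0, he⟩ := exists_embedT hS Ib
  obtain ⟨ρ, hρ⟩ := inj_extend hIb e he LinearMap.id
  let I := gam (Ideal.span {x}) E0
  have hI : Module.Injective R I := injective_gam _ hE0
  obtain ⟨T, jT, hTI⟩ := exists_isT hS I
  obtain ⟨a, ha⟩ := exists_tmap hS hTI hT0 I.subtype
  have hj0 : ∀ t, j0 t ∈ I := fun t => mem_gam_span.2 ⟨1, (pow_one x).symm ▸ hT0.kill t⟩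
  obtain ⟨b, hb⟩ := exists_toT hS hTI (j0.codRestrict I.toAddSubmonoid hj0 : T0 →+ I)
      (fun r t => Subtype.ext (hT0.smul r t))
  have hab : ∀ t, a (b t) = t := fun t => hT0.inj (by rw [ha, hb]; rfl)
  -- surjection T -> N
  let w : T →ₗ[S] Ib := ρ.comp a
  have hw : Function.Surjective w := fun t => ⟨b (e t), by
    change ρ (a (b (e t))) = t
    rw [hab]; exact hρ t⟩
  let τ : T →ₗ[S] N := pb.comp w
  have hτ : Function.Surjective τ := hsb.2.2.comp hw
  have hTinj := injective_tor hS hI hTI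
  have hK0 : GI S (LinearMap.ker τ) := by
    have hsw := se_ker w hw
    have hwinj : Module.Injective S (LinearMap.ker w) := by
      obtain ⟨c, hc⟩ := exists_cofactor (LinearMap.ker w).subtype hsw.1
        (LinearMap.id - (b.comp e).comp w) (fun t => (hsw.2.1 _).1 (by
          change w (t - b (e (w t))) = 0
          rw [map_sub, sub_eq_zero]
          change w t = ρ (a (b (e (w t))))
          rw [hab]; exact (hρ _).symm))
      refine injective_retract hTinj (LinearMap.ker w).subtype c (fun t => hsw.1 ?_)
      have h1 : w t.1 = 0 := t.2
      rw [hc]; simp [h1]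
    obtain ⟨u, hu⟩ := exists_cofactor ib hsb.1 (w.comp (LinearMap.ker τ).subtype)
      (fun t => (hsb.2.1 _).1 t.2)
    have hle : LinearMap.ker w ≤ LinearMap.ker τ := fun t ht => by
      change pb (w t) = 0
      rw [show w t = 0 from ht, map_zero]
    have hsu : SE (Submodule.inclusion hle) u := by
      refine SE.mk' (fun t ht => Subtype.ext (congrArg (fun z => z.1) ht)) (fun t => hsb.1 ?_) (fun t ht => ?_)
        (fun n => ?_)
      · refine (hu _).trans ?_
        rw [map_zero]; exact t.2
      · have := hu t
        rw [ht, map_zero] at this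
        exact ⟨⟨t.1, this.symm⟩, rfl⟩
      · obtain ⟨t, ht⟩ := hw (ib n)
        refine ⟨⟨t, by change pb (w t) = 0; rw [ht]; exact hsb.zero n⟩, hsb.1 ?_⟩
        rw [hu]; exact ht
    exact gi_ext hsu (gi_of_injective hwinj) hN'
  -- extend to φ : I -> C
  obtain ⟨E, i, hE, hi⟩ := exists_embed (R := R) C
  have hs := se_mkQ i hi
  letI : Module R T := Module.compHom T (algebraMap R S)
  let jT' : T →ₗ[R] I := ⟨jT.toAddHom, hTI.smul⟩
  let τ' : T →ₗ[R] C := ⟨(jC.comp τ.toAddMonoidHom).toAddHom, fun r t => by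
    change jC (τ (algebraMap R S r • t)) = r • jC (τ t)
    rw [map_smul, hT.smul]⟩
  obtain ⟨f1, hf1⟩ := inj_extend hE jT' hTI.inj (i.comp τ')
  obtain ⟨f, hf, hf2⟩ := tlift hx hS hs hE hd hT hN hI (fun y => by
      obtain ⟨n, hn⟩ := mem_gam_span.1 y.2
      exact ⟨n, Subtype.ext hn⟩) 0 1 f1 (fun y hy => by
      obtain ⟨t, rfl⟩ := (hTI.range y).1 (by rw [pow_one] at hy; exact hy)
      have : f1 (jT t) = i (τ' t) := hf1 t
      rw [this]; exact hs.zero _)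
  obtain ⟨φ, hφ⟩ := exists_cofactor i hi f (fun y => (hs.2.1 _).1 (hf y))
  have hφT : ∀ t, φ (jT t) = jC (τ t) := fun t => hi (by
    rw [hφ, hf2 _ (by rw [pow_one]; exact hTI.kill t)]; exact hf1 t)
  let P : (I × co x C) →ₗ[R] C := φ.coprod (ev0 x C)
  have hP : ∀ z, P z = φ z.1 + z.2.1 0 := fun z => rfl
  have hPs : Function.Surjective P := fun c => by
    obtain ⟨y, hy⟩ := ev0_surj hd c
    exact ⟨(0, y), by rw [hP, map_zero, zero_add]; exact hy⟩
  have hsP := se_ker P hPs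
  have hdI := dv_of_injective hx hI
  refine ⟨ModuleCat.of R (LinearMap.ker P), ⟨?_, ⟨ModuleCat.of S (LinearMap.ker τ),
    { toFun := fun t => ⟨(jT t.1, 0), ?_⟩, map_zero' := ?_, map_add' := ?_ }, ⟨?_, ?_, ?_⟩, hK0⟩, ?_⟩,
    ModuleCat.of R (I × co x C), _, P, injective_prod hI hco, hsP⟩
  · rintro ⟨⟨y, z⟩, hyz⟩
    have hyz' : φ y + z.1 0 = 0 := hyz
    obtain ⟨y0, rfl⟩ := hdI y
    obtain ⟨z0, rfl⟩ := (co_inv (s := x) (C := C)).2 z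
    have h0 : x • (φ y0 + z0.1 0) = 0 := by rw [smul_add, ← map_smul]; exact hyz'
    obtain ⟨n, hn⟩ := (hT.range _).1 h0
    obtain ⟨t, rfl⟩ := hτ n
    refine ⟨⟨(y0 - jT t, z0), ?_⟩, Subtype.ext (Prod.ext ?_ rfl)⟩
    · change φ (y0 - jT t) + z0.1 0 = 0
      rw [map_sub, hφT, hn]; abel
    · change x • (y0 - jT t) = x • y0
      rw [smul_sub, hTI.kill, sub_zero]
  · change φ (jT t.1) + 0 = 0
    rw [hφT, show τ t.1 = 0 from t.2, map_zero, add_zero]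
  · refine Subtype.ext (Prod.ext ?_ rfl); exact map_zero jT
  · intro t t'
    refine Subtype.ext (Prod.ext ?_ ?_)
    · exact map_add jT _ _
    · exact (add_zero _).symm
  · intro t t' htt
    exact Subtype.ext (hTI.inj (congrArg (fun z => z.1.1) htt))
  · intro r t
    refine Subtype.ext (Prod.ext ?_ ?_)
    · exact hTI.smul r t.1
    · exact (smul_zero _).symm
  · rintro ⟨⟨y, z⟩, hyz⟩
    have hyz' : φ y + z.1 0 = 0 := hyz
    constructor
    · intro h0
      have h1 : x • y = 0 := congrArg (fun z => z.1.1) h0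
      have h2 : x • z = 0 := congrArg (fun z => z.1.2) h0
      have h3 : z = 0 := (co_inv (s := x) (C := C)).1 (by
        change x • z = x • 0
        rw [h2, smul_zero])
      subst h3
      obtain ⟨t, rfl⟩ := (hTI.range _).1 h1
      refine ⟨⟨t, hT.inj ?_⟩, rfl⟩
      rw [← hφT, map_zero]
      simpa using hyz'
    · rintro ⟨t, ht⟩
      rw [← ht]
      refine Subtype.ext (Prod.ext ?_ ?_)
      · exact hTI.kill t.1
      · exact smul_zero _
  · exact co_ker_inj (injective_prod hI hco) φ (LinearEquiv.refl R _) (LinearMap.ker P).subtype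
      (Submodule.subtype_injective _) (fun l => l.2) (fun z hz => ⟨⟨z, hz⟩, rfl⟩)

theorem xc_gi [IsNoetherianRing R] (hx : IsSMulRegular R x) (hS : IsQ x S) (h : XC x S C) :
    GI R C := by
  refine gi_of_closed (P := fun C => XC x S C) (fun C hC => ?_) (ModuleCat.of R C) h
  exact ⟨xc_liftP hx hS hC, xc_left hx hS hC, xc_right hx hS hC⟩

theorem exists_gi_hull [IsNoetherianRing R] (hx : IsSMulRegular R x) (hS : IsQ x S) (hd : Dv x C)
    {jC : N →+ C} (hT : IsT x S N C jC) (hN : GI S N) :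
    ∃ (K : ModuleCat.{u} R) (i : C →ₗ[R] K), Function.Injective i ∧ GI R K ∧
      ∀ (n : ℕ) (z : K), x ^ n • z = 0 → ∃ c, i c = z := by
  obtain ⟨J0, ι0, hJ0, hι0⟩ := exists_embed (R := R) (co x C)
  obtain ⟨ι, hι⟩ := exists_toCo (co_inv (s := x) (C := C)) ι0
  let J := co x J0
  have hιi : Function.Injective ι := fun y z h => hι0 (by rw [← hι, ← hι, h])
  have hJ : Module.Injective R J := injective_co hJ0
  have hJx : ∀ (n : ℕ), Inv (x ^ n) J := fun n => by
    rw [inv_iff_unit, map_pow]; exact (inv_iff_unit.1 co_inv).pow n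
  let r : co x C →ₗ[R] C × J := (ev0 x C).prod (-ι)
  have hr : Function.Injective r := fun y z h => hιi (by
    have : - ι y = - ι z := congrArg Prod.snd h
    exact neg_injective this)
  have hs := se_mkQ r hr
  let q := (LinearMap.range r).mkQ
  have hq0 : ∀ c j, q (c, j) = 0 → ∃ y : co x C, y.1 0 = c ∧ - ι y = j := fun c j h => by
    obtain ⟨y, hy⟩ := hs.lift h
    exact ⟨y, congrArg Prod.fst hy, congrArg Prod.snd hy⟩
  have hqr : ∀ y : co x C, q (y.1 0, - ι y) = 0 := fun y => hs.zero y
  let i : C →ₗ[R] ((C × J) ⧸ LinearMap.range r) := q.comp (LinearMap.inl R C J)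
  have hi : Function.Injective i := (injective_iff_map_eq_zero i).2 fun c hc => by
    obtain ⟨y, h1, h2⟩ := hq0 c 0 hc
    have : y = 0 := hιi (by rw [map_zero]; exact neg_eq_zero.1 h2)
    rw [← h1, this]; rfl
  have htor : ∀ (n : ℕ) (z : (C × J) ⧸ LinearMap.range r), x ^ n • z = 0 → ∃ c, i c = z := by
    intro n z hz
    obtain ⟨⟨c, j⟩, rfl⟩ := hs.2.2 z
    obtain ⟨y, h1, h2⟩ := hq0 (x ^ n • c) (x ^ n • j) (by
      have : q (x ^ n • (c, j)) = 0 := by rw [map_smul]; exact hz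
      exact this)
    obtain ⟨y', rfl, -⟩ := co_shift n y
    have h3 : - ι y' = j := (hJx n).1 (by
      change x ^ n • (- ι y') = x ^ n • j
      rw [← h2, map_smul, smul_neg])
    refine ⟨c - y'.1 0, ?_⟩
    rw [← sub_eq_zero]
    change q (c - y'.1 0, 0) - q (c, j) = 0
    rw [← map_sub, ← neg_eq_zero, ← map_neg, ← hqr y']
    congr 1
    refine Prod.ext ?_ ?_
    · simp
    · simp [h3]
  have hdJ : Dv x J := co_inv.2
  have hdK : Dv x ((C × J) ⧸ LinearMap.range r) := by
    refine Dv.of_surj (A := C × J) ?_ q hs.2.2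
    rintro ⟨c, j⟩
    obtain ⟨c', rfl⟩ := hd c
    obtain ⟨j', rfl⟩ := hdJ j
    exact ⟨(c', j'), rfl⟩
  refine ⟨ModuleCat.of R ((C × J) ⧸ LinearMap.range r), i, hi, xc_gi hx hS ⟨hdK, ⟨ModuleCat.of S N,
    i.toAddMonoidHom.comp jC, ⟨hi.comp hT.inj, fun r n => ?_, fun z => ⟨fun hz => ?_, ?_⟩⟩, hN⟩, ?_⟩, htor⟩
  · change i (jC _) = r • i (jC _)
    rw [hT.smul, map_smul]
  · obtain ⟨c, rfl⟩ := htor 1 z (by rwa [pow_one])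
    obtain ⟨n, rfl⟩ := (hT.range c).1 (hi (by rw [map_smul, map_zero]; exact hz))
    exact ⟨n, rfl⟩
  · rintro ⟨n, rfl⟩
    change x • i (jC n) = 0
    rw [← map_smul, hT.kill, map_zero]
  · obtain ⟨f, hf⟩ := exists_toCo (s := x) (W := J) co_inv (q.comp (LinearMap.inr R C J))
    have hfk : ∀ k w, (f (x ^ k • w)).1 k = q (0, w) := fun k w => by
      rw [map_smul, co_pow0, hf]; rfl
    refine injective_of_equiv hJ (LinearEquiv.ofBijective f ⟨?_, fun z => ?_⟩)
    · refine (injective_iff_map_eq_zero f).2 fun w hw => ?_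
      obtain ⟨y, h1, rfl⟩ := hq0 0 w (by
        have := hf w
        rw [hw] at this; exact this.symm)
      have hy : y = 0 := by
        refine Subtype.ext (funext fun k => ?_)
        obtain ⟨y', h2, h3⟩ := co_shift k y
        have h4 := hfk k (- ι y')
        rw [smul_neg, ← map_smul, h2, hw] at h4
        obtain ⟨y2, h5, h6⟩ := hq0 0 _ h4.symm
        have h7 : y2 = y' := hιi (neg_injective h6)
        rw [h7, h3 0] at h5
        exact h5
      rw [hy, map_zero, neg_zero]
    · have hdc : Dv x (co x C) := co_inv.2
      obtain ⟨v, rfl⟩ := (co_se (s := x) hs hdc.a2).2.2 z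
      let c := coMap x (LinearMap.fst R C J) v
      refine ⟨(v.1 0).2 + ι c, Subtype.ext (funext fun k => ?_)⟩
      obtain ⟨c', h2, h3⟩ := co_shift k c
      have h4 : x ^ k • (v.1 k).2 = (v.1 0).2 := congrArg Prod.snd (co.pow v k 0)
      rw [← h4, ← h2, map_smul, ← smul_add, hfk]
      change q (0, (v.1 k).2 + ι c') = q (v.1 k)
      rw [← sub_eq_zero, ← map_sub, ← neg_eq_zero, ← map_neg, ← hqr c']
      congr 1
      refine Prod.ext ?_ ?_
      · simp [h3 0, c]
      · simp
end TX
end GidAux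

namespace GidAux
open scoped TensorProduct

section FlatBaer
variable {R : Type u} [CommRing R] [IsNoetherianRing R]
variable {I F : Type u} [AddCommGroup I] [Module R I] [AddCommGroup F] [Module R F]

theorem flat_baer (hI : Module.Injective R I) [Module.Flat R F] {m : ℕ} (s : Fin m → R)
    (t : Fin m → F ⊗[R] I) (ht : ∀ c : Fin m → R, ∑ i, c i * s i = 0 → ∑ i, c i • t i = 0) :
    ∃ y, ∀ i, s i • y = t i := by
  let q : (Fin m → R) →ₗ[R] R := ∑ i, (LinearMap.proj i).smulRight (s i)
  have hq : ∀ c, q c = ∑ i, c i * s i := fun c => by simp [q]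
  obtain ⟨l, c, hc⟩ := Submodule.fg_iff_exists_fin_generating_family.1
    (IsNoetherian.noetherian (LinearMap.ker q))
  let α : I →ₗ[R] (Fin m → I) := LinearMap.pi fun i => s i • LinearMap.id
  let β : (Fin m → I) →ₗ[R] (Fin l → I) := LinearMap.pi fun j => ∑ i, c j i • LinearMap.proj i
  have hex : Function.Exact α β := by
    intro y
    constructor
    · intro hy
      let f : (Fin m → R) →ₗ[R] I := ∑ i, (LinearMap.proj i).smulRight (y i)
      have hf : ∀ c, f c = ∑ i, c i • y i := fun c => by simp [f]
      have hle : LinearMap.ker q ≤ LinearMap.ker f := by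
        rw [← hc, Submodule.span_le]
        rintro _ ⟨j, rfl⟩
        have := congrFun hy j
        simpa [β, hf] using this
      obtain ⟨g, hg⟩ := inj_extend' hI q f (fun z hz => hle hz)
      refine ⟨g 1, funext fun i => ?_⟩
      have h1 := hg (Pi.single i 1)
      have h2 : q (Pi.single i 1) = s i • 1 := by simp [hq, Pi.single_apply]
      rw [h2, map_smul, hf] at h1
      simpa [α, Pi.single_apply] using h1
    · rintro ⟨y, rfl⟩
      funext j
      have hj : c j ∈ LinearMap.ker q := by rw [← hc]; exact Submodule.subset_span ⟨j, rfl⟩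
      have hj : ∑ i, c j i * s i = 0 := by rw [← hq]; exact hj
      have : ∑ i, c j i • s i • y = (∑ i, c j i * s i) • y := by
        simp [Finset.sum_smul, mul_smul]
      simp [α, β, this, hj]
  have hex' := Module.Flat.lTensor_exact F hex
  let τ : F ⊗[R] (Fin m → I) := ∑ i, LinearMap.lTensor F (LinearMap.single R (fun _ => I) i) (t i)
  have hτ : LinearMap.lTensor F β τ = 0 := by
    have h1 : ∀ i, β ∘ₗ LinearMap.single R (fun _ => I) i =
        ∑ j, c j i • LinearMap.single R (fun _ : Fin l => I) j := by
      intro i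
      refine LinearMap.ext fun y => funext fun k => ?_
      simp [β, Pi.single_apply, Finset.sum_apply, LinearMap.sum_apply, smul_ite]
    have h2 : ∀ i, LinearMap.lTensor F β (LinearMap.lTensor F (LinearMap.single R (fun _ => I) i) (t i)) =
        ∑ j, c j i • LinearMap.lTensor F (LinearMap.single R (fun _ : Fin l => I) j) (t i) := by
      intro i
      rw [← LinearMap.comp_apply, ← LinearMap.lTensor_comp, h1]
      have : LinearMap.lTensor F (∑ j, c j i • LinearMap.single R (fun _ : Fin l => I) j) =
          ∑ j, c j i • LinearMap.lTensor F (LinearMap.single R (fun _ : Fin l => I) j) := by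
        rw [← LinearMap.coe_lTensorHom, map_sum]; simp
      rw [this]; simp [LinearMap.sum_apply]
    simp only [τ, map_sum, h2]
    rw [Finset.sum_comm]
    refine Finset.sum_eq_zero fun j _ => ?_
    have hj : c j ∈ LinearMap.ker q := by rw [← hc]; exact Submodule.subset_span ⟨j, rfl⟩
    have := ht (c j) (by rw [← hq]; exact hj)
    have h3 := congrArg (LinearMap.lTensor F (LinearMap.single R (fun _ : Fin l => I) j)) this
    simpa [map_sum] using h3
  obtain ⟨y, hy⟩ := (hex' τ).1 hτ
  refine ⟨y, fun i => ?_⟩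
  have h4 := congrArg (LinearMap.lTensor F (LinearMap.proj (R := R) (φ := fun _ : Fin m => I) i)) hy
  rw [← LinearMap.comp_apply, ← LinearMap.lTensor_comp] at h4
  have h5 : LinearMap.proj (R := R) (φ := fun _ : Fin m => I) i ∘ₗ α = s i • LinearMap.id := by
    ext; simp [α]
  have h6 : ∀ k, LinearMap.lTensor F (LinearMap.proj (R := R) (φ := fun _ : Fin m => I) i)
      (LinearMap.lTensor F (LinearMap.single R (fun _ => I) k) (t k)) = if k = i then t k else 0 := by
    intro k
    rw [← LinearMap.comp_apply, ← LinearMap.lTensor_comp]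
    split_ifs with h
    · subst h
      rw [show LinearMap.proj (R := R) (φ := fun _ : Fin m => I) k ∘ₗ LinearMap.single R (fun _ => I) k
        = LinearMap.id by ext; simp]
      simp
    · rw [show LinearMap.proj (R := R) (φ := fun _ : Fin m => I) i ∘ₗ LinearMap.single R (fun _ => I) k
        = 0 by ext; simp [Pi.single_apply, Ne.symm h]]
      simp
  rw [h5] at h4
  simp only [τ, map_sum, h6] at h4
  simpa using h4

/-- Flat base change of an injective module is injective. -/
theorem injective_flat (hI : Module.Injective R I) [Module.Flat R F] : Module.Injective R (F ⊗[R] I) := by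
  refine Module.Baer.injective fun a g => ?_
  obtain ⟨m, s, hs⟩ := Submodule.fg_iff_exists_fin_generating_family.1 (IsNoetherian.noetherian a)
  have hsa : ∀ i, s i ∈ a := fun i => by rw [← hs]; exact Submodule.subset_span ⟨i, rfl⟩
  obtain ⟨y, hy⟩ := flat_baer hI (F := F) s (fun i => g ⟨s i, hsa i⟩) (fun c hc => by
    have : ∑ i, c i • (⟨s i, hsa i⟩ : a) = 0 := Subtype.ext (by simpa using hc)
    rw [← map_zero g, ← this, map_sum]
    exact Finset.sum_congr rfl fun i _ => (map_smul g _ _).symm)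
  refine ⟨LinearMap.toSpanSingleton R _ y, fun r hr => ?_⟩
  have : ∀ r (hr : r ∈ Submodule.span R (Set.range s)) (hr' : r ∈ a), r • y = g ⟨r, hr'⟩ := by
    intro r hr
    induction hr using Submodule.span_induction with
    | mem _ h => obtain ⟨i, rfl⟩ := h; intro h'; exact hy i
    | zero => intro h'; rw [zero_smul]; exact (map_zero g).symm
    | add u v hu hv h1 h2 =>
      intro h'
      rw [hs] at hu hv
      rw [add_smul, h1 hu, h2 hv, ← map_add]; rfl
    | smul c u hu h1 =>
      intro h'
      rw [hs] at hu
      rw [smul_assoc, h1 hu, ← map_smul]; rfl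
  exact this r (hs ▸ hr) hr
end FlatBaer
end GidAux

namespace GidAux
open scoped TensorProduct

/-- `C` is an `n`-th cosyzygy of `X`. -/
def Cz (R : Type u) [CommRing R] (X : ModuleCat.{u} R) : ℕ → ModuleCat.{u} R → Prop
  | 0, C => Nonempty (X ≃ₗ[R] C)
  | n + 1, C => ∃ D : ModuleCat.{u} R, Cz R X n D ∧ Link R D C

theorem exists_cz (R : Type u) [CommRing R] (X : ModuleCat.{u} R) (n : ℕ) : ∃ C, Cz R X n C := by
  induction n with
  | zero => exact ⟨X, ⟨LinearEquiv.refl R X⟩⟩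
  | succ n ih =>
    obtain ⟨D, hD⟩ := ih
    obtain ⟨C, hC⟩ := exists_link (R := R) D
    exact ⟨C, D, hD, hC⟩

theorem retract_step {R : Type u} [CommRing R] {X I C X' I' C' : Type u} [AddCommGroup X] [Module R X]
    [AddCommGroup I] [Module R I] [AddCommGroup C] [Module R C] [AddCommGroup X'] [Module R X']
    [AddCommGroup I'] [Module R I'] [AddCommGroup C'] [Module R C']
    {i : X →ₗ[R] I} {p : I →ₗ[R] C} (hs : SE i p) {i' : X' →ₗ[R] I'} {p' : I' →ₗ[R] C'} (hs' : SE i' p')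
    (hI : Module.Injective R I) (hI' : Module.Injective R I')
    (a : X →ₗ[R] X') (b : X' →ₗ[R] X) (hab : ∀ y, b (a y) = y) :
    ∃ (u : C →ₗ[R] C' × I) (v : C' × I →ₗ[R] C), ∀ c, v (u c) = c := by
  obtain ⟨f, hf⟩ := inj_extend hI' i hs.1 (i'.comp a)
  obtain ⟨g, hg⟩ := inj_extend hI i' hs'.1 (i.comp b)
  obtain ⟨f1, hf1⟩ := exists_factor p hs.2.2 (p'.comp f) (fun y hy => by
    obtain ⟨z, rfl⟩ := hs.lift hy
    rw [LinearMap.comp_apply, hf, LinearMap.comp_apply, hs'.zero])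
  obtain ⟨g1, hg1⟩ := exists_factor p' hs'.2.2 (p.comp g) (fun y hy => by
    obtain ⟨z, rfl⟩ := hs'.lift hy
    rw [LinearMap.comp_apply, hg, LinearMap.comp_apply, hs.zero])
  obtain ⟨h, hh⟩ := exists_factor p hs.2.2 (LinearMap.id - g.comp f) (fun y hy => by
    obtain ⟨z, rfl⟩ := hs.lift hy
    simp [hf, hg, hab])
  refine ⟨f1.prod h, g1.coprod p, fun c => ?_⟩
  obtain ⟨y, rfl⟩ := hs.2.2 c
  simp [hf1, hg1, hh]

section Comp
variable {R A E : Type u} [CommRing R] [IsNoetherianRing R] [IsLocalRing R] [CommRing A] [Algebra R A]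
  [IsNoetherianRing A] [AddCommGroup E] [Module R E] [Module A E] [IsScalarTower R A E] {e0 : E}

theorem MD.gam_tensor (h : MD R A E e0) {X : Type u} [AddCommGroup X] [Module R X] (z : A ⊗[R] X)
    (hz : z ∈ gam (maximalIdeal R) (A ⊗[R] X)) : ∃ y ∈ gam (maximalIdeal R) X, (1 : A) ⊗ₜ[R] y = z := by
  have := h.flat
  obtain ⟨k, hk⟩ := hz
  obtain ⟨m, s, hs⟩ := Submodule.fg_iff_exists_fin_generating_family.1
    (IsNoetherian.noetherian (maximalIdeal R ^ k))
  have hsa : ∀ i, s i ∈ maximalIdeal R ^ k := fun i => by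
    rw [← hs]; exact Submodule.subset_span ⟨i, rfl⟩
  let N := kil (maximalIdeal R ^ k) X
  let α : X →ₗ[R] (Fin m → X) := ∑ i, s i • LinearMap.single R (fun _ => X) i
  have hα : ∀ y j, α y j = s j • y := fun y j => by
    simp [α, LinearMap.sum_apply, Finset.sum_apply, Pi.single_apply]
  have hex : Function.Exact N.subtype α := by
    intro y
    constructor
    · intro hy
      refine ⟨⟨y, fun r hr => ?_⟩, rfl⟩
      rw [← hs] at hr
      induction hr using Submodule.span_induction with
      | mem _ h => obtain ⟨i, rfl⟩ := h; rw [← hα, hy]; rfl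
      | zero => rw [zero_smul]
      | add u v _ _ h1 h2 => rw [add_smul, h1, h2, add_zero]
      | smul c u _ h1 => rw [smul_assoc, h1, smul_zero]
    · rintro ⟨y, rfl⟩
      funext j
      rw [hα]; exact y.2 _ (hsa j)
  have h1 : LinearMap.lTensor A α z = 0 := by
    have : LinearMap.lTensor A α = ∑ i, s i • LinearMap.lTensor A (LinearMap.single R (fun _ => X) i) := by
      rw [← LinearMap.coe_lTensorHom, map_sum]; simp
    rw [this, LinearMap.sum_apply]
    refine Finset.sum_eq_zero fun i _ => ?_
    rw [LinearMap.smul_apply, ← map_smul, hk _ (hsa i), map_zero]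
  obtain ⟨w, hw⟩ := (Module.Flat.lTensor_exact A hex z).1 h1
  obtain ⟨t, rfl⟩ := (h.tensor (T := N) (fun t => ⟨k, fun r hr => Subtype.ext (t.2 r hr)⟩)).2 w
  exact ⟨t, ⟨k, t.2⟩, by simpa using hw⟩

theorem cz_compare (h : MD R A E e0) {M : Type u} [AddCommGroup M] [Module R M] (n : ℕ) :
    ∀ (C : ModuleCat.{u} A) [Module R C] [IsScalarTower R A C], Cz A (ModuleCat.of A (A ⊗[R] M)) n C →
    ∃ C' J : ModuleCat.{u} R, Cz R (ModuleCat.of R M) n C' ∧ Module.Injective R J ∧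
      ∃ (u : C →ₗ[R] (A ⊗[R] C') × J) (v : (A ⊗[R] C') × J →ₗ[R] C), ∀ c, v (u c) = c := by
  have := h.flat
  induction n with
  | zero =>
    intro C i1 i2 hC
    obtain ⟨e0⟩ := hC
    let e : (A ⊗[R] M) ≃ₗ[R] C := e0.restrictScalars R
    refine ⟨ModuleCat.of R M, ModuleCat.of R PUnit, ⟨LinearEquiv.refl R M⟩,
      ⟨fun X Y _ _ _ _ f hf g => ⟨0, fun _ => Subsingleton.elim _ _⟩⟩,
      (LinearMap.inl R (A ⊗[R] M) PUnit.{u+1}).comp e.symm.toLinearMap,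
      e.toLinearMap.comp (LinearMap.fst R (A ⊗[R] M) PUnit.{u+1}), fun c => ?_⟩
    exact e.apply_symm_apply c
  | succ n ih =>
    rintro C i1 i2 ⟨D, hD, I, i, p, hI, hs⟩
    letI : Module R D := Module.compHom D (algebraMap R A)
    haveI : IsScalarTower R A D := ⟨fun r a d => by
      rw [Algebra.smul_def, mul_smul]; rfl⟩
    letI : Module R I := Module.compHom I (algebraMap R A)
    haveI : IsScalarTower R A I := ⟨fun r a d => by
      rw [Algebra.smul_def, mul_smul]; rfl⟩
    obtain ⟨D', J, hD', hJ, a, b, hab⟩ := ih D hD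
    obtain ⟨C', hC'⟩ := exists_link (R := R) D'
    obtain ⟨I', i', p', hI', hs'⟩ := id hC'
    have hs1 : SE (i.restrictScalars R) (p.restrictScalars R) := hs
    have hs2 : SE (LinearMap.prodMap (LinearMap.lTensor A i') (LinearMap.id : J →ₗ[R] J))
        ((LinearMap.lTensor A p').comp (LinearMap.fst R (A ⊗[R] I') J)) := by
      have hi := Module.Flat.lTensor_preserves_injective_linearMap (M := A) i' hs'.1
      have he := Module.Flat.lTensor_exact A hs'.2.1
      refine SE.mk' ?_ ?_ ?_ ?_
      · rintro ⟨y, j⟩ hy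
        rw [Prod.ext_iff] at hy
        exact Prod.ext (hi (hy.1.trans (map_zero _).symm)) hy.2
      · rintro ⟨y, j⟩
        exact (he _).2 ⟨y, rfl⟩
      · rintro ⟨y, j⟩ hy
        obtain ⟨w, hw⟩ := (he y).1 hy
        exact ⟨(w, j), Prod.ext hw rfl⟩
      · intro c
        obtain ⟨y, hy⟩ := LinearMap.lTensor_surjective A hs'.2.2 c
        exact ⟨(y, 0), hy⟩
    have hI1 : Module.Injective R I := injective_restrict (B := A) hI
    obtain ⟨u, v, huv⟩ := retract_step hs1 hs2 hI1 (injective_prod (injective_flat hI') hJ) a b hab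
    exact ⟨C', ModuleCat.of R I, ⟨D', hD', hC'⟩, hI1, u, v, huv⟩

theorem cz_dv {x : R} (hx : IsSMulRegular R x) {X : ModuleCat.{u} R} {n : ℕ} {C : ModuleCat.{u} R}
    (hC : Cz R X (n+1) C) : Dv x C := by
  obtain ⟨D, -, I, i, p, hI, hs⟩ := hC
  exact (dv_of_injective hx hI).of_surj p hs.2.2

theorem cz_tor {x : R} (hx : IsSMulRegular R x) {S : Type u} [CommRing S] [Algebra R S] (hS : IsQ x S)
    {M : Type u} [AddCommGroup M] [Module R M] (hM : IsSMulRegular M x)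
    {N : Type u} [AddCommGroup N] [Module S N] (π : M →+ N) (hπ : Function.Surjective π)
    (hl : ∀ (r : R) m, π (r • m) = algebraMap R S r • π m)
    (hk : ∀ m, π m = 0 ↔ ∃ m', x • m' = m) (n k : ℕ) (h : GD S (n + k) N) :
    ∀ (C : ModuleCat.{u} R), Cz R (ModuleCat.of R M) (n+1) C →
      ∀ (T : Type u) [AddCommGroup T] [Module S T] (j : T →+ C), IsT x S T C j → GD S k T := by
  induction n generalizing k with
  | zero =>
    rintro C ⟨D, hD, I, i, p, hI, hs⟩ T _ _ j hT
    obtain ⟨e⟩ := hD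
    have hs : SE (i.comp e.toLinearMap) p := ⟨hs.1.comp e.injective, fun y => (hs.2.1 y).trans
      ⟨fun ⟨d, hd⟩ => ⟨e.symm d, by simpa using hd⟩, fun ⟨d, hd⟩ => ⟨e d, hd⟩⟩, hs.2.2⟩
    obtain ⟨NI, jI, hNI⟩ := exists_isT hS I
    obtain ⟨u, δ, hse⟩ := tor_conn hS hM hs (dv_of_injective hx hI) π hπ hl hk hNI hT
    exact gd_ext hse (gi_gd (gi_of_injective (injective_tor hS hI hNI))) (by simpa using h)
  | succ n ih =>
    rintro C ⟨D, hD, I, i, p, hI, hs⟩ T _ _ j hT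
    obtain ⟨NI, jI, hNI⟩ := exists_isT hS I
    obtain ⟨ND, jD, hND⟩ := exists_isT hS D
    obtain ⟨u, v, huv, -, -⟩ := tor_se hS hs (cz_dv hx hD) hND hNI hT
    exact gd_cosyz (injective_tor hS hI hNI) huv
      (ih (k+1) (by rwa [show n + (k+1) = n + 1 + k by omega]) D hD ND jD hND)

/-- the torsion submodule of a high cosyzygy of the completed module is a retract of
the torsion of a Gorenstein injective module. -/
theorem cz_retract (h : MD R A E e0) {x : R} (hxm : x ∈ maximalIdeal R) (hx : IsSMulRegular R x)
    {S : Type u} [CommRing S] [Algebra R S] (hS : IsQ x S)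
    {M : Type u} [AddCommGroup M] [Module R M] (hM : IsSMulRegular M x)
    {N : Type u} [AddCommGroup N] [Module S N] (π : M →+ N) (hπ : Function.Surjective π)
    (hl : ∀ (r : R) m, π (r • m) = algebraMap R S r • π m)
    (hk : ∀ m, π m = 0 ↔ ∃ m', x • m' = m) (n : ℕ) (hN : GD S n N)
    (C : ModuleCat.{u} A) [Module R C] [IsScalarTower R A C]
    (hC : Cz A (ModuleCat.of A (A ⊗[R] M)) (n+1) C) :
    ∃ (K : ModuleCat.{u} R) (i : gam (maximalIdeal R) C →ₗ[R] gam (maximalIdeal R) K)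
      (ρ : gam (maximalIdeal R) K →ₗ[R] gam (maximalIdeal R) C), GI R K ∧ ∀ v, ρ (i v) = v := by
  obtain ⟨C', J, hC', hJ, u, v, huv⟩ := cz_compare h (n+1) C hC
  obtain ⟨T, j, hT⟩ := exists_isT hS C'
  have hGT := cz_tor hx hS hM π hπ hl hk n 0 (by simpa using hN) C' hC' T j hT
  obtain ⟨K, ι, hι, hK, hKx⟩ := exists_gi_hull hx hS (cz_dv hx hC') hT hGT
  let m := maximalIdeal R
  -- torsion of `K × J` maps to the torsion of `(A ⊗ C') × J`
  let κ : C' × J →ₗ[R] K × J := LinearMap.prodMap ι LinearMap.id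
  let θ : C' × J →ₗ[R] (A ⊗[R] C') × J := LinearMap.prodMap (TensorProduct.mk R A C' 1) LinearMap.id
  have hκi : Function.Injective κ := fun a b hab => by
    rw [Prod.ext_iff] at hab
    exact Prod.ext (hι hab.1) hab.2
  have hκs : ∀ z ∈ gam m (K × J), ∃ y, κ y = z := by
    rintro ⟨z, w⟩ ⟨k, hz⟩
    obtain ⟨c, hc⟩ := hKx k z (congrArg Prod.fst (hz _ (Ideal.pow_mem_pow hxm k)))
    exact ⟨(c, w), Prod.ext hc rfl⟩
  have hθ : ∀ z ∈ gam m ((A ⊗[R] C') × J), ∃ y ∈ gam m (C' × J), θ y = z := by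
    rintro ⟨z, w⟩ ⟨k, hz⟩
    obtain ⟨c, ⟨l, hc⟩, hcz⟩ := h.gam_tensor z ⟨k, fun r hr => congrArg Prod.fst (hz r hr)⟩
    refine ⟨(c, w), ⟨k + l, fun r hr => Prod.ext (hc r ?_) ?_⟩, Prod.ext hcz rfl⟩
    · exact Ideal.pow_le_pow_right (by omega) hr
    · exact (congrArg Prod.snd (hz r (Ideal.pow_le_pow_right (by omega) hr)) :)
  have hθi : ∀ y ∈ gam m (C' × J), θ y = 0 → y = 0 := by
    rintro ⟨c, w⟩ ⟨k, hy⟩ h0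
    rw [Prod.ext_iff] at h0
    refine Prod.ext ?_ h0.2
    have hc : c ∈ gam m C' := ⟨k, fun r hr => congrArg Prod.fst (hy r hr)⟩
    have hflat := h.flat
    have h1 : (1 : A) ⊗ₜ[R] (⟨c, hc⟩ : gam m C') = 0 := by
      refine Module.Flat.lTensor_preserves_injective_linearMap (M := A) (gam m C').subtype
        (Submodule.subtype_injective _) ?_
      rw [map_zero]; exact h0.1
    have h2 := (h.tensor (T := gam m C') (fun t => gam_of_inj (Submodule.subtype _)
      (Submodule.subtype_injective _) t.2)).1 (a₁ := ⟨c, hc⟩) (a₂ := 0)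
      (by rw [map_zero]; exact h1)
    exact congrArg Subtype.val h2
  -- the two isomorphisms
  let eκ := LinearEquiv.ofBijective (gamMap m κ) ⟨fun a b hab => Subtype.ext (hκi (congrArg Subtype.val hab)),
    fun z => by
      obtain ⟨y, hy⟩ := hκs z z.2
      exact ⟨⟨y, gam_of_inj κ hκi (by rw [hy]; exact z.2)⟩, Subtype.ext hy⟩⟩
  let eθ := LinearEquiv.ofBijective (gamMap m θ) ⟨(injective_iff_map_eq_zero _).2 fun a ha =>
      Subtype.ext (hθi a a.2 (congrArg Subtype.val ha)),
    fun z => by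
      obtain ⟨y, hy, hyz⟩ := hθ z z.2
      exact ⟨⟨y, hy⟩, Subtype.ext hyz⟩⟩
  refine ⟨ModuleCat.of R (K × J), eκ.toLinearMap.comp (eθ.symm.toLinearMap.comp (gamMap m u)),
    (gamMap m v).comp (eθ.toLinearMap.comp eκ.symm.toLinearMap), gi_prod hK (gi_of_injective hJ), fun c => ?_⟩
  have : gamMap m v (gamMap m u c) = c := Subtype.ext (huv c)
  simpa using this
end Comp
end GidAux

namespace GidAux

theorem finite_of_ker {A Q X Z : Type u} [CommRing A] [IsNoetherianRing A] [AddCommGroup Q] [Module A Q]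
    [AddCommGroup X] [Module A X] [AddCommGroup Z] [Module A Z] (hZ : Module.Finite A Z)
    (α : Q →ₗ[A] X) (hα : Function.Surjective α) (β : Q →ₗ[A] Z) (h : ∀ u, β u = 0 → α u = 0) :
    Module.Finite A X := by
  obtain ⟨g, hg⟩ := exists_factor β.rangeRestrict (LinearMap.surjective_rangeRestrict _) α
    (fun a ha => h a (congrArg Subtype.val ha))
  exact Module.Finite.of_surjective g fun x => by
    obtain ⟨u, rfl⟩ := hα x
    exact ⟨_, hg u⟩

section FinSoc
variable {A : Type u} [CommRing A] [IsNoetherianRing A]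

/-- `Ext¹(-, Y)` is finitely generated on finitely generated modules. -/
def DF (A : Type u) [CommRing A] (Y : Type u) [AddCommGroup Y] [Module A Y] : Prop :=
  ∀ (K F : ModuleCat.{u} A) (ι : K →ₗ[A] F), Function.Injective ι → Module.Finite A F →
    Module.Finite A ((K →ₗ[A] Y) ⧸ LinearMap.range (LinearMap.lcomp A Y ι))

theorem df_finite {Y : Type u} [AddCommGroup Y] [Module A Y] [Module.Finite A Y] : DF A Y := by
  intro K F ι hι hF
  have hK : Module.Finite A K := Module.Finite.of_injective ι hι
  obtain ⟨k, q, hq⟩ := Module.Finite.exists_fin' A K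
  have : Module.Finite A (K →ₗ[A] Y) := Module.Finite.of_injective (LinearMap.lcomp A Y q)
    (fun f g hfg => LinearMap.ext fun y => by
      obtain ⟨z, rfl⟩ := hq y
      exact LinearMap.congr_fun hfg z)
  infer_instance

theorem df_step {Y I C : Type u} [AddCommGroup Y] [Module A Y] [AddCommGroup I] [Module A I]
    [AddCommGroup C] [Module A C] {i : Y →ₗ[A] I} {p : I →ₗ[A] C} (hs : SE i p)
    (hI : Module.Injective A I) (hY : DF A Y) : DF A C := by
  intro K F ι hι hF
  have hK : Module.Finite A K := Module.Finite.of_injective ι hι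
  obtain ⟨k, q0, hq0⟩ := Module.Finite.exists_fin' A K
  let F1 : ModuleCat.{u} A := ModuleCat.of A (Fin k → A)
  let q : F1 →ₗ[A] K := q0
  have hq : Function.Surjective q := hq0
  let K1 : ModuleCat.{u} A := ModuleCat.of A (LinearMap.ker q)
  let ι1 : K1 →ₗ[A] F1 := (LinearMap.ker q).subtype
  have hι1 : Function.Injective ι1 := Submodule.subtype_injective _
  have hqι : ∀ y, q (ι1 y) = 0 := fun y => y.2
  have hqe : ∀ z, q z = 0 → ∃ y, ι1 y = z := fun z hz => ⟨⟨z, hz⟩, rfl⟩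
  have hfin := hY K1 F1 ι1 hι1 (inferInstanceAs (Module.Finite A (Fin k → A)))
  have hproj : Module.Projective A F1 := inferInstanceAs (Module.Projective A (Fin k → A))
  let Q : Submodule A (F1 →ₗ[A] I) :=
    LinearMap.ker ((LinearMap.lcomp A C ι1).comp (LinearMap.compRight A p))
  have hQ : ∀ (u : Q) y, p (u.1 (ι1 y)) = 0 := fun u y => LinearMap.congr_fun u.2 y
  obtain ⟨α, hα⟩ := exists_cofactor (LinearMap.lcomp A C q) (fun f g hfg => LinearMap.ext fun y => by
      obtain ⟨z, rfl⟩ := hq y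
      exact LinearMap.congr_fun hfg z) ((LinearMap.compRight A p).comp Q.subtype) (fun u => by
      obtain ⟨f, hf⟩ := exists_factor q hq (p.comp u.1) (fun z hz => by
        obtain ⟨y, rfl⟩ := hqe z hz
        exact hQ u y)
      exact ⟨f, LinearMap.ext hf⟩)
  obtain ⟨β, hβ⟩ := exists_cofactor (LinearMap.compRight A (M := K1) i) (fun f g hfg => LinearMap.ext fun y =>
      hs.1 (LinearMap.congr_fun hfg y)) ((LinearMap.lcomp A I ι1).comp Q.subtype) (fun u => by
      obtain ⟨f, hf⟩ := exists_cofactor i hs.1 (u.1.comp ι1) (fun y => (hs.2.1 _).1 (hQ u y))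
      exact ⟨f, LinearMap.ext hf⟩)
  have hα' : ∀ u z, α u (q z) = p (u.1 z) := fun u z => LinearMap.congr_fun (hα u) z
  have hβ' : ∀ u y, i (β u y) = u.1 (ι1 y) := fun u y => LinearMap.congr_fun (hβ u) y
  refine finite_of_ker hfin ((LinearMap.range (LinearMap.lcomp A C ι)).mkQ.comp α) ?_
    ((LinearMap.range (LinearMap.lcomp A Y ι1)).mkQ.comp β) ?_
  · refine (Submodule.mkQ_surjective _).comp fun f => ?_
    obtain ⟨u, hu⟩ := Module.projective_lifting_property p (f.comp q) hs.2.2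
    refine ⟨⟨u, LinearMap.ext fun y => ?_⟩, LinearMap.ext fun y => ?_⟩
    · have := LinearMap.congr_fun hu (ι1 y)
      simp only [LinearMap.comp_apply, hqι, map_zero] at this
      exact this
    · obtain ⟨z, rfl⟩ := hq y
      rw [hα']; exact LinearMap.congr_fun hu z
  · intro u hu
    obtain ⟨g, hg⟩ := (Submodule.Quotient.mk_eq_zero _).1 hu
    have hg' : ∀ y, g (ι1 y) = β u y := fun y => LinearMap.congr_fun hg y
    obtain ⟨w, hw⟩ := exists_factor q hq (u.1 - i.comp g) (fun z hz => by
      obtain ⟨y, rfl⟩ := hqe z hz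
      rw [LinearMap.sub_apply, LinearMap.comp_apply, hg', hβ', sub_self])
    obtain ⟨W, hW⟩ := inj_extend hI ι hι w
    refine (Submodule.Quotient.mk_eq_zero _).2 ⟨p.comp W, LinearMap.ext fun y => ?_⟩
    obtain ⟨z, rfl⟩ := hq y
    rw [hα']
    change p (W (ι (q z))) = _
    rw [hW, hw, LinearMap.sub_apply, map_sub, LinearMap.comp_apply, hs.zero, sub_zero]

variable [IsLocalRing A]

theorem soc_step {Y I C : Type u} [AddCommGroup Y] [Module A Y] [AddCommGroup I] [Module A I]
    [AddCommGroup C] [Module A C] {i : Y →ₗ[A] I} {p : I →ₗ[A] C} (hs : SE i p) (hY : DF A Y)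
    (hI : Module.Finite A (kil (maximalIdeal A) I)) : Module.Finite A (kil (maximalIdeal A) C) := by
  have hfin := hY (ModuleCat.of A (maximalIdeal A)) (ModuleCat.of A A) (maximalIdeal A).subtype
    (Submodule.subtype_injective _) (inferInstanceAs (Module.Finite A A))
  let Q : Submodule A I := (kil (maximalIdeal A) C).comap p
  let α : Q →ₗ[A] kil (maximalIdeal A) C := p.restrict (fun u hu => hu)
  have hαs : Function.Surjective α := fun c => by
    obtain ⟨u, hu⟩ := hs.2.2 c
    exact ⟨⟨u, by change p u ∈ kil (maximalIdeal A) C; rw [hu]; exact c.2⟩, Subtype.ext hu⟩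
  let ν : kil (maximalIdeal A) I →ₗ[A] kil (maximalIdeal A) C :=
    p.restrict (fun u hu r hr => by rw [← map_smul, hu r hr, map_zero])
  let γ : I →ₗ[A] ((maximalIdeal A) →ₗ[A] I) :=
    (LinearMap.lcomp A I (maximalIdeal A).subtype).comp (LinearMap.ringLmapEquivSelf A A I).symm.toLinearMap
  have hγ : ∀ u r, γ u r = r.1 • u := fun u r => by simp [γ]
  obtain ⟨β, hβ⟩ := exists_cofactor (LinearMap.compRight A (M := maximalIdeal A) i)
    (fun f g hfg => LinearMap.ext fun y => hs.1 (LinearMap.congr_fun hfg y)) (γ.comp Q.subtype) (fun u => by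
      obtain ⟨f, hf⟩ := exists_cofactor i hs.1 (γ u.1) (fun r => (hs.2.1 _).1 (by
        rw [hγ, map_smul]; exact u.2 r r.2))
      exact ⟨f, LinearMap.ext hf⟩)
  have hβ' : ∀ u r, i (β u r) = r.1 • u.1 := fun u r => (LinearMap.congr_fun (hβ u) r).trans (hγ _ _)
  have h1 : Module.Finite A ((kil (maximalIdeal A) C) ⧸ LinearMap.range ν) := by
    refine finite_of_ker hfin ((LinearMap.range ν).mkQ.comp α)
      ((Submodule.mkQ_surjective _).comp hαs) ((LinearMap.range _).mkQ.comp β) ?_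
    intro u hu
    obtain ⟨g, hg⟩ := (Submodule.Quotient.mk_eq_zero _).1 hu
    have hg' : ∀ r : maximalIdeal A, g r.1 = β u r := fun r => LinearMap.congr_fun hg r
    refine (Submodule.Quotient.mk_eq_zero _).2 ⟨⟨u.1 - i (g 1), fun r hr => ?_⟩, Subtype.ext ?_⟩
    · have h2 := hβ' u ⟨r, hr⟩
      have h3 : g r = r • g 1 := by rw [← map_smul, smul_eq_mul, mul_one]
      rw [← hg', h3, map_smul] at h2
      rw [smul_sub, h2, sub_self]
    · change p (u.1 - i (g 1)) = p u.1
      rw [map_sub, hs.zero, sub_zero]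
  have h2 : Module.Finite A (LinearMap.range ν) := inferInstance
  exact Module.Finite.of_submodule_quotient (LinearMap.range ν)

theorem Hull.embed_soc {E : Type u} [AddCommGroup E] [Module A E] {e0 : E} (h : Hull A E e0)
    {Y : Type u} [AddCommGroup Y] [Module A Y] (hY : Module.Finite A (kil (maximalIdeal A) Y)) :
    ∃ (c : ℕ) (f : Y →ₗ[A] (Fin c → E)), ∀ y ∈ gam (maximalIdeal A) Y, f y = 0 → y = 0 := by
  let V := kil (maximalIdeal A) Y
  have hE1 : Module.Finite A (kil (maximalIdeal A) E) := by
    refine Module.Finite.of_surjective (LinearMap.toSpanSingleton A (kil (maximalIdeal A) E) ⟨e0, h.kill⟩) ?_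
    rintro ⟨e, he⟩
    obtain ⟨r, rfl⟩ := h.soc e he
    exact ⟨r, rfl⟩
  obtain ⟨b, q, hq⟩ := Module.Finite.exists_fin' A V
  have hD : Module.Finite A (V →ₗ[A] E) := by
    let ev : (V →ₗ[A] E) →ₗ[A] (Fin b → kil (maximalIdeal A) E) := LinearMap.pi fun k =>
      (LinearMap.applyₗ (q (Pi.single k 1))).codRestrict (kil (maximalIdeal A) E) (fun f r hr => by
        change r • f (q (Pi.single k 1)) = 0
        rw [← map_smul]
        have : r • q (Pi.single k 1) = 0 := Subtype.ext ((q (Pi.single k 1)).2 r hr)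
        rw [this, map_zero])
    refine Module.Finite.of_injective ev ((injective_iff_map_eq_zero ev).2 fun f hf => ?_)
    have : f.comp q = 0 := by
      refine (Pi.basisFun A (Fin b)).ext fun k => ?_
      rw [Pi.basisFun_apply]
      exact congrArg Subtype.val (congrFun hf k)
    refine LinearMap.ext fun v => ?_
    obtain ⟨w, rfl⟩ := hq v
    exact LinearMap.congr_fun this w
  obtain ⟨c, f, hf⟩ := Submodule.fg_iff_exists_fin_generating_family.1 hD.1
  let j : V →ₗ[A] (Fin c → E) := LinearMap.pi f
  have hj : ∀ v, j v = 0 → v = 0 := by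
    intro v hv
    by_contra hne
    obtain ⟨g, hg⟩ := h.cogen hne
    have : g ∈ Submodule.span A (Set.range f) := by rw [hf]; trivial
    have hle : Submodule.span A (Set.range f) ≤ LinearMap.ker (LinearMap.applyₗ (R := A) v : (V →ₗ[A] E) →ₗ[A] E) := by
      rw [Submodule.span_le]
      rintro _ ⟨k, rfl⟩
      exact congrFun hv k
    exact hg (hle this)
  obtain ⟨f', hf'⟩ := inj_extend (injective_fin h.inj c) V.subtype (Submodule.subtype_injective _) j
  refine ⟨c, f', fun y hy h0 => ?_⟩
  by_contra hne
  obtain ⟨r, h1, h2⟩ := exists_soc hy hne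
  have h3 := hj ⟨r • y, fun s hs => h2 s hs⟩ (by
    rw [← hf']; change f' (r • y) = 0; rw [map_smul, h0, smul_zero])
  exact h1 (congrArg Subtype.val h3)

theorem gam_quot {A : Type u} [CommRing A] [IsNoetherianRing A] (b : Ideal A) {J : Type u}
    [AddCommGroup J] [Module A J] (y : J)
    (hy : (gam b J).mkQ y ∈ gam b (J ⧸ gam b J)) : y ∈ gam b J := by
  obtain ⟨k, hk⟩ := hy
  have hmem : ∀ r ∈ b ^ k, r • y ∈ gam b J := fun r hr => by
    have := hk r hr
    rw [← map_smul] at this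
    exact (Submodule.Quotient.mk_eq_zero _).1 this
  let f : (b ^ k : Ideal A) →ₗ[A] gam b J :=
    ((LinearMap.toSpanSingleton A J y).comp (Submodule.subtype _)).codRestrict _ (fun r => hmem r.1 r.2)
  have : Module.Finite A (b ^ k : Ideal A) := inferInstance
  obtain ⟨l, hl⟩ := fg_bound b ((gam b J).subtype.comp f) (fun t => (f t).2)
  refine ⟨l + k, fun r hr => ?_⟩
  rw [pow_add] at hr
  refine Submodule.mul_induction_on hr (fun s hs t ht => ?_) (fun u v hu hv => by rw [add_smul, hu, hv, add_zero])
  rw [mul_smul]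
  exact hl s hs ⟨t, ht⟩

theorem exists_cz_fin {E : Type u} [AddCommGroup E] [Module A E] {e0 : E} (h : Hull A E e0)
    (Y : ModuleCat.{u} A) (hY : Module.Finite A Y) (n : ℕ) :
    ∃ C : ModuleCat.{u} A, Cz A Y n C ∧ DF A C ∧ Module.Finite A (kil (maximalIdeal A) C) := by
  induction n with
  | zero => exact ⟨Y, ⟨LinearEquiv.refl A Y⟩, df_finite, inferInstance⟩
  | succ n ih =>
    obtain ⟨D, hD, hDF, hDs⟩ := ih
    obtain ⟨c, f, hf⟩ := h.embed_soc hDs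
    obtain ⟨J0, g, hJ0, hg⟩ := exists_embed (R := A) D
    let J := J0 ⧸ gam (maximalIdeal A) J0
    have hJ : Module.Injective A J := SE.injective_right (i := (gam (maximalIdeal A) J0).subtype)
      (p := (gam (maximalIdeal A) J0).mkQ) ⟨Submodule.subtype_injective _, LinearMap.exact_subtype_mkQ _,
        Submodule.mkQ_surjective _⟩ (injective_gam _ hJ0) hJ0
    let i : D →ₗ[A] (Fin c → E) × J := f.prod ((gam (maximalIdeal A) J0).mkQ.comp g)
    have hi : Function.Injective i := by
      refine (injective_iff_map_eq_zero i).2 fun d hd => ?_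
      rw [Prod.ext_iff] at hd
      refine hf d (gam_of_inj g hg ?_) hd.1
      exact (Submodule.Quotient.mk_eq_zero _).1 hd.2
    have hI := injective_prod (injective_fin h.inj c) hJ
    have hse := se_mkQ i hi
    refine ⟨ModuleCat.of A _, ⟨D, hD, ModuleCat.of A _, i, _, hI, hse⟩, df_step hse hI hDF, soc_step hse hDF ?_⟩
    have hE1 : Module.Finite A (kil (maximalIdeal A) E) := by
      refine Module.Finite.of_surjective (LinearMap.toSpanSingleton A (kil (maximalIdeal A) E) ⟨e0, h.kill⟩) ?_
      rintro ⟨e, he⟩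
      obtain ⟨r, rfl⟩ := h.soc e he
      exact ⟨r, rfl⟩
    let φ : kil (maximalIdeal A) ((Fin c → E) × J) →ₗ[A] (Fin c → kil (maximalIdeal A) E) :=
      LinearMap.pi fun k => ((LinearMap.proj k).comp (LinearMap.fst A (Fin c → E) J)).restrict
        (fun z hz r hr => congrFun (congrArg Prod.fst (hz r hr)) k)
    refine Module.Finite.of_injective φ ((injective_iff_map_eq_zero φ).2 ?_)
    rintro ⟨⟨z, w⟩, hz⟩ h0
    refine Subtype.ext (Prod.ext (funext fun k => congrArg Subtype.val (congrFun h0 k)) ?_)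
    obtain ⟨y, rfl⟩ := Submodule.mkQ_surjective _ w
    exact (Submodule.Quotient.mk_eq_zero _).2 (gam_quot _ y ⟨1, fun r hr => by
      rw [pow_one] at hr; exact congrArg Prod.snd (hz r hr)⟩)
end FinSoc
end GidAux

namespace GidAux
open scoped TensorProduct

section HomTensor
variable {A : Type u} [CommRing A] [IsNoetherianRing A]

theorem hom_tensor_bij {G J F : Type u} [AddCommGroup G] [Module A G] [Module.Finite A G]
    [AddCommGroup J] [Module A J] [AddCommGroup F] [Module A F] [Module.Flat A F] :
    Function.Bijective (TensorProduct.lTensorHomToHomLTensor (.id A) G F J) := by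
  obtain ⟨a, g, hg⟩ := Module.Finite.exists_fin' A G
  obtain ⟨b, f0, hf0⟩ := Module.Finite.exists_fin' A (LinearMap.ker g)
  let f : (Fin b → A) →ₗ[A] (Fin a → A) := (LinearMap.ker g).subtype.comp f0
  have hgf : ∀ w, g (f w) = 0 := fun w => (f0 w).2
  have hfree : ∀ c : ℕ, Function.Bijective (TensorProduct.lTensorHomToHomLTensor (.id A) (Fin c → A) F J) := fun c => by
    rw [← lTensorHomEquivHomLTensor_toLinearMap]
    exact (lTensorHomEquivHomLTensor A (Fin c → A) F J).bijective
  have nat : ∀ {X Y : Type u} [AddCommGroup X] [Module A X] [AddCommGroup Y] [Module A Y]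
      (q : X →ₗ[A] Y) (z : F ⊗[A] (Y →ₗ[A] J)),
      TensorProduct.lTensorHomToHomLTensor (.id A) X F J ((LinearMap.lcomp A J q).lTensor F z)
        = (TensorProduct.lTensorHomToHomLTensor (.id A) Y F J z).comp q := by
    intro X Y _ _ _ _ q z
    induction z with
    | zero => ext; simp
    | tmul x y => ext; simp
    | add x y hx hy => rw [map_add, map_add, hx, hy, map_add]; rfl
  have hex : Function.Exact (LinearMap.lcomp A J g) (LinearMap.lcomp A J f) := by
    intro φ
    constructor
    · intro hφ
      obtain ⟨ψ, hψ⟩ := exists_factor g hg φ (fun y hy => by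
        obtain ⟨w, hw⟩ := hf0 ⟨y, hy⟩
        have h1 : f w = y := congrArg Subtype.val hw
        rw [← h1]; exact LinearMap.congr_fun hφ w)
      exact ⟨ψ, LinearMap.ext hψ⟩
    · rintro ⟨ψ, rfl⟩
      refine LinearMap.ext fun w => ?_
      change ψ (g (f w)) = 0
      rw [hgf, map_zero]
  have hinj : Function.Injective (LinearMap.lcomp A J g) := fun φ ψ h => LinearMap.ext fun y => by
    obtain ⟨w, rfl⟩ := hg y
    exact LinearMap.congr_fun h w
  refine ⟨(injective_iff_map_eq_zero _).2 fun z hz => ?_, fun φ => ?_⟩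
  · have h1 := nat g z
    rw [hz, LinearMap.zero_comp] at h1
    have h2 := (hfree a).1 (h1.trans (map_zero _).symm)
    exact Module.Flat.lTensor_preserves_injective_linearMap _ hinj (h2.trans (map_zero _).symm)
  · obtain ⟨w, hw⟩ := (hfree a).2 (φ.comp g)
    have h1 := nat f w
    rw [hw] at h1
    have h2 : (φ.comp g).comp f = 0 := LinearMap.ext fun y => by
      change φ (g (f y)) = 0
      rw [hgf, map_zero]
    rw [h2] at h1
    obtain ⟨z, rfl⟩ := (Module.Flat.lTensor_exact F hex w).1 ((hfree b).1 (h1.trans (map_zero _).symm))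
    rw [nat g z] at hw
    refine ⟨z, LinearMap.ext fun y => ?_⟩
    obtain ⟨v, rfl⟩ := hg y
    exact LinearMap.congr_fun hw v

theorem a2_hom {s : A} {G J : Type u} [AddCommGroup G] [Module A G] [AddCommGroup J] [Module A J]
    (hJ : Module.Injective A J) : A2 s (G →ₗ[A] J) := by
  intro y
  let d : (ℕ →₀ G) →ₗ[A] (ℕ →₀ G) := LinearMap.id - s • Finsupp.lmapDomain G A Nat.succ
  have hd : Function.Injective d := by
    refine (injective_iff_map_eq_zero d).2 fun f hf => Finsupp.ext fun k => ?_
    have h0 : ∀ k, f k = s • Finsupp.mapDomain Nat.succ f k := fun k => by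
      have := DFunLike.congr_fun hf k
      exact sub_eq_zero.1 this
    induction k with
    | zero => rw [h0, Finsupp.mapDomain_notin_range _ _ (by simp)]; simp
    | succ k ih => rw [h0, Finsupp.mapDomain_apply Nat.succ_injective, ih]; simp
  obtain ⟨z, hz⟩ := inj_extend hJ d hd (Finsupp.lsum A y)
  refine ⟨fun k => z.comp (Finsupp.lsingle k), fun k => LinearMap.ext fun g => ?_⟩
  have := hz (Finsupp.single k g)
  simp only [d, LinearMap.sub_apply, LinearMap.id_apply, LinearMap.smul_apply, Finsupp.lmapDomain_apply,
    Finsupp.mapDomain_single, map_sub, map_smul, Finsupp.lsum_single] at this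
  exact this.symm

theorem a2_inj {s : A} {J : Type u} [AddCommGroup J] [Module A J] (hJ : Module.Injective A J) : A2 s J :=
  (a2_hom (G := A) hJ).of_surj (LinearMap.ringLmapEquivSelf A A J).toLinearMap
    (LinearMap.ringLmapEquivSelf A A J).surjective

theorem a2_ext {s : A} {X Y Z : Type u} [AddCommGroup X] [Module A X] [AddCommGroup Y] [Module A Y]
    [AddCommGroup Z] [Module A Z] {i : X →ₗ[A] Y} {p : Y →ₗ[A] Z} (h : SE i p) (hX : A2 s X)
    (hZ : A2 s Z) : A2 s Y := by
  intro y
  obtain ⟨z, hz⟩ := hZ (fun k => p (y k))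
  choose w hw using fun k => h.2.2 (z k)
  choose x hx using fun k => h.lift (show p (y k - (w k - s • w (k+1))) = 0 by
    rw [map_sub, map_sub, map_smul, hw, hw, hz, sub_self])
  obtain ⟨v, hv⟩ := hX x
  refine ⟨fun k => i (v k) + w k, fun k => ?_⟩
  have := hx k
  rw [hv, map_sub, map_smul, eq_sub_iff_add_eq] at this
  rw [← this, smul_add]; module

def Tp (A : Type u) [CommRing A] (Y : Type u) [AddCommGroup Y] [Module A Y] : Prop :=
  ∃ n, ∀ F : ModuleCat.{u} A, Module.Flat A F → GD A n (F ⊗[A] Y)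

variable {X Y Z : Type u} [AddCommGroup X] [Module A X] [AddCommGroup Y] [Module A Y]
    [AddCommGroup Z] [Module A Z]

theorem se_lT (F : Type u) [AddCommGroup F] [Module A F] [Module.Flat A F] {i : X →ₗ[A] Y}
    {p : Y →ₗ[A] Z} (h : SE i p) : SE (i.lTensor F) (p.lTensor F) :=
  ⟨Module.Flat.lTensor_preserves_injective_linearMap _ h.1, Module.Flat.lTensor_exact F h.2.1,
    LinearMap.lTensor_surjective F h.2.2⟩

theorem tp_inj (h : Module.Injective A Y) : Tp A Y :=
  ⟨0, fun F hF => gi_of_injective (injective_flat h)⟩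

theorem tp_ext {i : X →ₗ[A] Y} {p : Y →ₗ[A] Z} (h : SE i p) (hX : Tp A X) (hZ : Tp A Z) : Tp A Y := by
  obtain ⟨n, hn⟩ := hX
  obtain ⟨k, hk⟩ := hZ
  exact ⟨n + k, fun F hF => gd_ext (se_lT F h) ((hn F hF).mono_le (by omega)) ((hk F hF).mono_le (by omega))⟩

theorem tp_coker {i : X →ₗ[A] Y} {p : Y →ₗ[A] Z} (h : SE i p) (hX : Tp A X) (hY : Tp A Y) : Tp A Z := by
  obtain ⟨n, hn⟩ := hX
  obtain ⟨k, hk⟩ := hY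
  exact ⟨n + k, fun F hF => gd_coker' (se_lT F h) ((hn F hF).mono_le (by omega)) ((hk F hF).mono_le (by omega))⟩

theorem tp_ker {i : X →ₗ[A] Y} {p : Y →ₗ[A] Z} (h : SE i p) (hY : Tp A Y) (hZ : Tp A Z) : Tp A X := by
  obtain ⟨n, hn⟩ := hY
  obtain ⟨k, hk⟩ := hZ
  exact ⟨n + k + 1, fun F hF => gd_ker (se_lT F h) ((hn F hF).mono_le (by omega)) ((hk F hF).mono_le (by omega))⟩

theorem se_of_equiv (e : Y ≃ₗ[A] Z) : SE (0 : PUnit.{u+1} →ₗ[A] Y) e.toLinearMap :=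
  SE.mk' (fun _ _ => rfl) (fun _ => map_zero _) (fun b hb => ⟨0, by
    rw [LinearMap.zero_apply]; exact (e.map_eq_zero_iff.1 hb).symm⟩) e.surjective

theorem injective_sub [Subsingleton Y] : Module.Injective A Y :=
  ⟨fun _ _ _ _ _ _ _ _ _ => ⟨0, fun _ => Subsingleton.elim _ _⟩⟩

def HL : List A → (Y : ModuleCat.{u} A) → Prop
  | [], _ => True
  | s :: L, Y => A2 s Y ∧ Tp A (co s Y) ∧ HL L (ModuleCat.of A (co s Y)) ∧ HL L Y

theorem hl_coker (L : List A) : ∀ {X Y Z : ModuleCat.{u} A} {i : X →ₗ[A] Y} {p : Y →ₗ[A] Z},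
    SE i p → HL L X → HL L Y → HL L Z := by
  induction L with
  | nil => intros; trivial
  | cons s L ih =>
    rintro X Y Z i p h ⟨a1, b1, c1, d1⟩ ⟨a2, b2, c2, d2⟩
    have h' := co_se h a1
    exact ⟨a2.of_surj p h.2.2, tp_coker h' b1 b2, ih (X := ModuleCat.of A (co s X))
      (Y := ModuleCat.of A (co s Y)) (Z := ModuleCat.of A (co s Z)) h' c1 c2, ih h d1 d2⟩

theorem hl_ext (L : List A) : ∀ {X Y Z : ModuleCat.{u} A} {i : X →ₗ[A] Y} {p : Y →ₗ[A] Z},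
    SE i p → HL L X → HL L Z → HL L Y := by
  induction L with
  | nil => intros; trivial
  | cons s L ih =>
    rintro X Y Z i p h ⟨a1, b1, c1, d1⟩ ⟨a2, b2, c2, d2⟩
    have h' := co_se h a1
    exact ⟨a2_ext h a1 a2, tp_ext h' b1 b2, ih (X := ModuleCat.of A (co s X))
      (Y := ModuleCat.of A (co s Y)) (Z := ModuleCat.of A (co s Z)) h' c1 c2, ih h d1 d2⟩

theorem hl_inj (L : List A) : ∀ {Y : ModuleCat.{u} A}, Module.Injective A Y → HL L Y := by
  induction L with
  | nil => intros; trivial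
  | cons s L ih =>
    intro Y h
    exact ⟨a2_inj h, tp_inj (injective_co h), ih (injective_co h), ih h⟩

theorem hl_of_co (L : List A) {Y : ModuleCat.{u} A}
    (h : ∀ s ∈ L, A2 s Y ∧ Module.Injective A (co s Y)) : HL L Y := by
  induction L with
  | nil => trivial
  | cons s L ih =>
    have h1 := h s (by simp)
    exact ⟨h1.1, tp_inj h1.2, hl_inj L h1.2, ih fun t ht => h t (by simp [ht])⟩

theorem hl_equiv (L : List A) {Y Z : ModuleCat.{u} A} (e : Y ≃ₗ[A] Z) (h : HL L Y) : HL L Z :=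
  hl_coker L (X := ModuleCat.of A PUnit.{u+1}) (se_of_equiv e) (hl_inj L (injective_sub (Y := PUnit.{u+1}))) h

theorem tp_equiv (e : Y ≃ₗ[A] Z) (h : Tp A Y) : Tp A Z :=
  tp_coker (se_of_equiv e) (tp_inj injective_sub) h

theorem tp_hom {G J : Type u} [AddCommGroup G] [Module A G] (hG : TR A G) [AddCommGroup J] [Module A J]
    (hJ : Module.Injective A J) : Tp A (G →ₗ[A] J) := by
  have := hG.finite
  refine ⟨0, fun F hF => ?_⟩
  have h1 : GI A (G →ₗ[A] F ⊗[A] J) := tr_gi (B := A) hG (injective_flat hJ)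
  exact h1.of_equiv (LinearEquiv.ofBijective _ (hom_tensor_bij (G := G) (J := J) (F := F))).symm

def coHom (s : A) (G J : Type u) [AddCommGroup G] [Module A G] [AddCommGroup J] [Module A J] :
    (G →ₗ[A] co s J) ≃ₗ[A] co s (G →ₗ[A] J) where
  toFun f := ⟨fun k => (LinearMap.proj k).comp ((co s J).subtype.comp f), fun k => LinearMap.ext fun g => (f g).2 k⟩
  map_add' f g := rfl
  map_smul' c f := rfl
  invFun y := LinearMap.codRestrict _ (LinearMap.pi y.1) fun g k => LinearMap.congr_fun (y.2 k) g
  left_inv f := rfl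
  right_inv y := rfl

theorem hl_hom (L : List A) {G : Type u} [AddCommGroup G] [Module A G] (hG : TR A G) :
    ∀ {J : Type u} [AddCommGroup J] [Module A J], Module.Injective A J → HL L (ModuleCat.of A (G →ₗ[A] J)) := by
  induction L with
  | nil => intros; trivial
  | cons s L ih =>
    intro J _ _ hJ
    exact ⟨a2_hom hJ, tp_equiv (coHom s G J) (tp_hom hG (injective_co hJ)),
      hl_equiv L (Y := ModuleCat.of A (G →ₗ[A] co s J)) (Z := ModuleCat.of A (co s (G →ₗ[A] J)))
        (coHom s G J) (ih (injective_co hJ)), ih hJ⟩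

def Ac : List A → (Y : ModuleCat.{u} A) → Prop
  | [], Y => Module.Injective A Y
  | s :: L, Y => A2 s Y ∧ ∃ (J Z : ModuleCat.{u} A) (i : co s Y →ₗ[A] Y × J) (p : Y × J →ₗ[A] Z),
      Module.Injective A J ∧ (∀ w, (i w).1 = w.1 0) ∧ SE i p ∧ Ac L Z

theorem tp_of_ac (L : List A) : ∀ {Y : ModuleCat.{u} A}, HL L Y → Ac L Y → Tp A Y := by
  induction L with
  | nil => intro Y _ h; exact tp_inj h
  | cons s L ih =>
    rintro Y ⟨a, b, c, d⟩ ⟨-, J, Z, i, p, hJ, -, hs, hZ⟩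
    have h1 : HL L (ModuleCat.of A (Y × J)) := hl_ext L (Z := J) (se_inl_snd Y J) d (hl_inj L hJ)
    have h2 := ih (hl_coker L (X := ModuleCat.of A (co s Y)) (Y := ModuleCat.of A (Y × J)) hs c h1) hZ
    exact tp_ker (se_inl_snd Y J) (tp_ext hs b h2) (tp_inj hJ)

theorem ac_inj (L : List A) : ∀ {Y : ModuleCat.{u} A}, Module.Injective A Y → Ac L Y := by
  induction L with
  | nil => intro Y h; exact h
  | cons s L ih =>
    intro Y h
    refine ⟨a2_inj h, ModuleCat.of A (co s Y), Y, (ev0 s Y).prod LinearMap.id,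
      (LinearMap.fst A Y _) - (ev0 s Y).comp (LinearMap.snd A Y _), injective_co h, fun w => rfl,
      SE.mk' (fun a ha => congrArg Prod.snd ha) (fun a => ?_) (fun b hb => ⟨b.2, Prod.ext ?_ rfl⟩)
      (fun c => ⟨(c, 0), ?_⟩), ih h⟩
    · exact sub_self _
    · exact (sub_eq_zero.1 hb).symm
    · simp

theorem ac_ext (L : List A) : ∀ {X Y Z : ModuleCat.{u} A} {i : X →ₗ[A] Y} {p : Y →ₗ[A] Z},
    SE i p → Ac L X → Ac L Z → Ac L Y := by
  induction L with
  | nil =>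
    intro X Y Z i p h hX hZ
    have hX : Module.Injective A X := hX
    obtain ⟨r, hr⟩ := inj_extend hX i h.1 LinearMap.id
    obtain ⟨σ, hσ⟩ := h.section hX
    refine injective_retract (injective_prod hX hZ) ((r.comp (LinearMap.id - σ.comp p)).prod p)
      (i.coprod σ) fun y => ?_
    obtain ⟨x, hx⟩ := h.lift (show p (y - σ (p y)) = 0 by rw [map_sub, hσ, sub_self])
    change i (r (y - σ (p y))) + σ (p y) = y
    rw [← hx, hr, LinearMap.id_apply, hx, sub_add_cancel]
  | cons s L ih =>
    rintro X Y Z i p h ⟨a1, J1, W1, i1, p1, hJ1, e1, s1, w1⟩ ⟨a3, J3, W3, i3, p3, hJ3, e3, s3, w3⟩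
    have h' := co_se h a1
    obtain ⟨j, hj⟩ := inj_extend hJ1 (coMap s i) h'.1 ((LinearMap.snd A X J1).comp i1)
    let i2 : co s Y →ₗ[A] Y × (J1 × J3) :=
      (ev0 s Y).prod (j.prod ((LinearMap.snd A Z J3).comp (i3.comp (coMap s p))))
    have hi2 : Function.Injective i2 := by
      refine (injective_iff_map_eq_zero i2).2 fun w hw => ?_
      have h1 : w.1 0 = 0 := congrArg Prod.fst hw
      have h2 : j w = 0 := congrArg (fun z => z.2.1) hw
      have h3 : (i3 (coMap s p w)).2 = 0 := congrArg (fun z => z.2.2) hw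
      have h4 : coMap s p w = 0 := s3.inj0 (Prod.ext (by rw [e3, coMap_apply, h1, map_zero]; rfl) h3)
      obtain ⟨v, rfl⟩ := h'.lift h4
      rw [hj] at h2
      rw [coMap_apply] at h1
      rw [s1.inj0 (a := v) (Prod.ext (by rw [e1]; exact h.inj0 h1) h2), map_zero]
    have s2 := se_mkQ i2 hi2
    have hP : SE (LinearMap.prodMap i (LinearMap.inl A J1 J3)) (LinearMap.prodMap p (LinearMap.snd A J1 J3)) := by
      have hh := se_inl_snd (R := A) J1 J3
      refine SE.mk' (fun a ha => Prod.ext (h.inj0 (congrArg Prod.fst ha)) (hh.inj0 (congrArg Prod.snd ha)))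
        (fun a => Prod.ext (h.zero _) (hh.zero _)) (fun b hb => ?_) (fun c => ?_)
      · obtain ⟨y, hy⟩ := h.lift (congrArg Prod.fst hb)
        obtain ⟨z, hz⟩ := hh.lift (congrArg Prod.snd hb)
        exact ⟨(y, z), Prod.ext hy hz⟩
      · obtain ⟨y, hy⟩ := h.2.2 c.1
        exact ⟨(y, (0, c.2)), Prod.ext hy rfl⟩
    obtain ⟨u, v, huv⟩ := nine_coker h' hP s1 s2 s3 (fun w => Prod.ext (by
        change i (w.1 0) = i (i1 w).1
        rw [e1]) (Prod.ext (hj w) (by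
        change (i3 (coMap s p (coMap s i w))).2 = 0
        rw [h'.zero, map_zero]; rfl))) (fun w => Prod.ext (by rw [e3]; rfl) rfl)
    exact ⟨a2_ext h a1 a3, ModuleCat.of A (J1 × J3), ModuleCat.of A _, i2, _, injective_prod hJ1 hJ3,
      fun w => rfl, s2, ih (X := W1) (Y := ModuleCat.of A _) (Z := W3) huv w1 w3⟩

theorem inv_coker {t : A} {i : X →ₗ[A] Y} {p : Y →ₗ[A] Z} (h : SE i p) (hX : Inv t X) (hY : Inv t Y) :
    Inv t Z := by
  refine ⟨(injective_iff_map_eq_zero (LinearMap.lsmul A Z t)).2 fun z hz => ?_, fun z => ?_⟩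
  · obtain ⟨y, rfl⟩ := h.2.2 z
    obtain ⟨x, hx⟩ := h.lift (show p (t • y) = 0 by rw [map_smul]; exact hz)
    obtain ⟨x', rfl⟩ := hX.2 x
    have : t • i x' = t • y := by rw [← map_smul]; exact hx
    rw [← hY.1 this, h.zero]
  · obtain ⟨y, rfl⟩ := h.2.2 z
    obtain ⟨y', rfl⟩ := hY.2 y
    exact ⟨p y', (map_smul p t y').symm⟩

theorem ac_inv (L : List A) {t : A} (ht : t ∈ L) : ∀ {Y : ModuleCat.{u} A}, Inv t Y → (∀ s ∈ L, A2 s Y) → Ac L Y := by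
  induction L with
  | nil => simp at ht
  | cons s L ih =>
    intro Y hY hA
    obtain ⟨J0, g, hJ0, hg⟩ := exists_embed (R := A) (co s Y)
    have hco : Inv t (co s Y) := by
      constructor
      · intro y z hyz
        ext k
        exact hY.1 (congrFun (congrArg Subtype.val hyz) k)
      · intro y
        choose d hd using hY.2
        refine ⟨⟨fun k => d (y.1 k), fun k => hY.1 ?_⟩, ?_⟩
        · change t • d (y.1 k) = t • s • d (y.1 (k+1))
          rw [smul_comm]
          exact (hd _).trans ((co.eq y k).trans (congrArg _ (hd _).symm))
        · ext k; exact hd _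
    by_cases hts : t = s
    · subst hts
      obtain ⟨r, hr⟩ := exists_toCo hY (LinearMap.id : Y →ₗ[A] Y)
      have hr' : ∀ w : co t Y, r (w.1 0) = w := by
        have he : Function.Injective (ev0 t Y) := by
          refine (injective_iff_map_eq_zero _).2 fun w hw => ?_
          ext k
          have h1 := co.pow w k 0
          have h2 : ∀ k (y : Y), t ^ k • y = 0 → y = 0 := by
            intro k
            induction k with
            | zero => intro y hy; simpa using hy
            | succ k ih => intro y hy
                           rw [pow_succ, mul_smul] at hy
                           exact hY.1 ((ih _ hy).trans (smul_zero t).symm)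
          exact h2 k _ (h1.trans hw)
        intro w
        exact he (hr _)
      let i : co t Y →ₗ[A] Y × J0 := (ev0 t Y).prod g
      refine ⟨hA t (by simp), J0, J0, i, (LinearMap.snd A Y J0) - g.comp (r.comp (LinearMap.fst A Y J0)), hJ0,
        fun w => rfl, SE.mk' (fun a ha => hg ((congrArg Prod.snd ha).trans (map_zero g).symm))
        (fun a => ?_) (fun b hb => ⟨r b.1, Prod.ext (hr _) (sub_eq_zero.1 hb).symm⟩) (fun c => ⟨(0, c), by simp⟩), ac_inj L hJ0⟩
      change g a - g (r (a.1 0)) = 0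
      rw [hr', sub_self]
    · have htL : t ∈ L := by
        rcases List.mem_cons.1 ht with h | h
        · exact absurd h hts
        · exact h
      obtain ⟨g', hg'⟩ := exists_toCo hco g
      let i : co s Y →ₗ[A] Y × co t J0 := (ev0 s Y).prod g'
      have hi : Function.Injective i := by
        refine (injective_iff_map_eq_zero _).2 fun w hw => hg ?_
        rw [← hg', show g' w = 0 from congrArg Prod.snd hw, map_zero]; rfl
      have hs := se_mkQ i hi
      refine ⟨hA s (by simp), ModuleCat.of A (co t J0), ModuleCat.of A _, i, _, injective_co hJ0, fun w => rfl, hs,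
        ih htL ?_ (fun s' hs' => ?_)⟩
      · refine inv_coker hs hco ⟨fun a b hab => ?_, fun b => ?_⟩
        · exact Prod.ext (hY.1 (congrArg Prod.fst hab)) (co_inv.1 (congrArg Prod.snd hab))
        · obtain ⟨y, hy⟩ := hY.2 b.1
          obtain ⟨z, hz⟩ := (co_inv (s := t) (C := J0)).2 b.2
          exact ⟨(y, z), Prod.ext hy hz⟩
      · exact (a2_ext (se_inl_snd Y (co t J0)) (hA s' (by simp [hs'])) (a2_inj (injective_co hJ0))).of_surj _ hs.2.2
end HomTensor
end GidAux

namespace GidAux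
open scoped TensorProduct

section Filt
variable {A : Type u} [CommRing A] [IsNoetherianRing A]

def GA (L : List A) : List A → (K : ModuleCat.{u} A) → Prop
  | [], _ => True
  | s :: S, K => Gd s K ∧ (∀ t ∈ L, A2 t K) ∧ GA L S (ModuleCat.of A (gam (Ideal.span {s}) K))

theorem ga_quot (L S : List A) : ∀ {D I C : ModuleCat.{u} A} {i : D →ₗ[A] I} {p : I →ₗ[A] C},
    SE i p → GdL S D → Module.Injective A I → GA L S C := by
  induction S with
  | nil => intros; trivial
  | cons s S ih =>
    intro D I C i p h hD hI
    refine ⟨fun y => ?_, fun t _ => (a2_inj hI).of_surj p h.2.2, ?_⟩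
    · obtain ⟨z, rfl⟩ := h.2.2 y
      obtain ⟨l, z', hz⟩ := inj_good s hI z
      exact ⟨l, p z', by rw [← map_smul, ← map_smul, hz]⟩
    · exact ih (D := ModuleCat.of A (gam (Ideal.span {s}) D)) (I := ModuleCat.of A (gam (Ideal.span {s}) I))
        (C := ModuleCat.of A (gam (Ideal.span {s}) C)) (gam_se h (fun y hy => gam_span_surj h hD.1 hy)) hD.2
        (injective_gam _ hI)

theorem ga_ac (L S : List A) (hSL : ∀ s ∈ S, s ∈ L) : ∀ {V K Y : ModuleCat.{u} A} {i : V →ₗ[A] K}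
    {p : K →ₗ[A] Y}, SE i p → GA L S K →
    (∀ k : K, p k = 0 ↔ ∀ s ∈ S, k ∈ gam (Ideal.span {s}) K) → Ac L Y := by
  induction S with
  | nil =>
    intro V K Y i p h _ hk
    have : Subsingleton Y := ⟨fun a b => by
      obtain ⟨a, rfl⟩ := h.2.2 a
      obtain ⟨b, rfl⟩ := h.2.2 b
      rw [(hk a).2 (by simp), (hk b).2 (by simp)]⟩
    exact ac_inj L injective_sub
  | cons s S ih =>
    rintro V K Y i p h ⟨hg, hA, hG⟩ hk
    let b := Ideal.span {s}
    have hV : ∀ v, i v ∈ gam b K := fun v => (hk _).1 (h.zero v) s (by simp)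
    let i' : V →ₗ[A] gam b K := i.codRestrict _ hV
    have hi' : Function.Injective i' := fun v w hvw => h.1 (congrArg Subtype.val hvw)
    have h1 := se_mkQ i' hi'
    have h2 : SE (gam b K).subtype (gam b K).mkQ :=
      ⟨Submodule.subtype_injective _, LinearMap.exact_subtype_mkQ _, Submodule.mkQ_surjective _⟩
    obtain ⟨F, σ, u, v, h3, h4⟩ := se_third h1 h2
    have a1 := ih (fun t ht => hSL t (by simp [ht])) (V := V) (K := ModuleCat.of A (gam b K)) (Y := ModuleCat.of A _)
      h1 hG (fun k => by
        rw [h1.2.1 k]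
        constructor
        · rintro ⟨v, rfl⟩ t ht
          exact gam_of_inj (Submodule.subtype _) (Submodule.subtype_injective _) ((hk _).1 (h.zero v) t (by simp [ht]))
        · intro hh
          obtain ⟨v, hv⟩ := h.lift ((hk k.1).2 (fun t ht => by
            rcases List.mem_cons.1 ht with rfl | ht
            · exact k.2
            · exact gam_map (Submodule.subtype _) (hh t ht)))
          exact ⟨v, Subtype.ext hv⟩)
    have a2 : Ac L (ModuleCat.of A (K ⧸ gam b K)) := by
      refine ac_inv L (hSL s (by simp)) ⟨?_, ?_⟩ (fun t ht => (hA t ht).of_surj _ h2.2.2)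
      · refine (injective_iff_map_eq_zero (LinearMap.lsmul A (K ⧸ gam b K) s)).2 fun z hz => ?_
        obtain ⟨y, rfl⟩ := h2.2.2 z
        have h5 : s • y ∈ gam b K := (Submodule.Quotient.mk_eq_zero _).1 hz
        obtain ⟨n, hn⟩ := mem_gam_span.1 h5
        exact (Submodule.Quotient.mk_eq_zero _).2 (mem_gam_span.2 ⟨n+1, by rw [pow_succ, mul_smul, hn]⟩)
      · intro z
        obtain ⟨y, rfl⟩ := h2.2.2 z
        obtain ⟨l, y', hl⟩ := hg y
        refine ⟨(gam b K).mkQ y', ?_⟩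
        change s • (gam b K).mkQ y' = _
        rw [← map_smul, ← sub_eq_zero, ← map_sub]
        refine (Submodule.Quotient.mk_eq_zero _).2 (mem_gam_span.2 ⟨l, ?_⟩)
        rw [smul_sub, ← mul_smul, ← pow_succ, hl, sub_self]
    have a3 := ac_ext L (X := ModuleCat.of A _) (Y := F) (Z := ModuleCat.of A _) h4 a1 a2
    have e : F ≃ₗ[A] Y := by
      have hc : (gam b K).subtype.comp i' = i := rfl
      rw [hc] at h3
      exact (h3.coker_equiv h).some
    exact ac_ext L (X := ModuleCat.of A PUnit.{u+1}) (Y := Y) (Z := F) (se_of_equiv e.symm)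
      (ac_inj L injective_sub) a3

theorem cz_gdl {X : ModuleCat.{u} A} (n : ℕ) : ∀ (S : List A), S.length ≤ n →
    ∀ C : ModuleCat.{u} A, Cz A X n C → GdL S C := by
  induction n with
  | zero => intro S hS C _
            rw [List.length_eq_zero_iff.1 (Nat.le_zero.1 hS)]; trivial
  | succ n ih =>
    rintro S hS C ⟨D, hD, I, i, p, hI, hs⟩
    exact gdl_quot S hs (ih _ (by simp; omega) D hD) (gdl_injective S hI)

theorem cz_tp {X : ModuleCat.{u} A} {n : ℕ} {C : ModuleCat.{u} A} (hC : Cz A X n C) (h : Tp A C) : Tp A X := by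
  induction n generalizing C with
  | zero => exact tp_equiv hC.some.symm h
  | succ n ih =>
    obtain ⟨D, hD, I, i, p, hI, hs⟩ := hC
    exact ih hD (tp_ker hs (tp_inj hI) h)

theorem cz_co {X : ModuleCat.{u} A} {w : A} (h1 : A2 w X) (h2 : Module.Injective A (co w X)) {n : ℕ}
    {C : ModuleCat.{u} A} (hC : Cz A X n C) : A2 w C ∧ Module.Injective A (co w C) := by
  induction n generalizing C with
  | zero =>
    obtain ⟨e⟩ := hC
    exact ⟨h1.of_surj e.toLinearMap e.surjective,
      (co_se (se_of_equiv e) (a2_inj injective_sub)).injective_right (injective_co injective_sub) h2⟩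
  | succ n ih =>
    obtain ⟨D, hD, I, i, p, hI, hs⟩ := hC
    obtain ⟨a, b⟩ := ih hD
    exact ⟨(a2_inj hI).of_surj p hs.2.2, (co_se hs a).injective_right b (injective_co hI)⟩

theorem a2_fin {s : A} (hA : A2 s A) {Y : Type u} [AddCommGroup Y] [Module A Y] [Module.Finite A Y] : A2 s Y := by
  obtain ⟨c, q, hq⟩ := Module.Finite.exists_fin' A Y
  have : A2 s (Fin c → A) := fun y => by
    choose z hz using fun j : Fin c => hA (fun k => y k j)
    exact ⟨fun k j => z j k, fun k => funext fun j => hz j k⟩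
  exact this.of_surj q hq

theorem co_fin [IsLocalRing A] {s : A} (hs : s ∈ maximalIdeal A) {Y : Type u} [AddCommGroup Y] [Module A Y]
    [Module.Finite A Y] : Subsingleton (co s Y) := by
  refine subsingleton_of_forall_eq 0 fun y => ?_
  ext k
  have h1 : ∀ i, y.1 k ∈ (maximalIdeal A ^ i • ⊤ : Submodule A Y) := fun i => by
    rw [← co.pow y i k]
    exact Submodule.smul_mem_smul (Ideal.pow_mem_pow hs i) trivial
  have h2 := Ideal.iInf_pow_smul_eq_bot_of_isLocalRing (M := Y) (maximalIdeal A) (Ideal.IsPrime.ne_top inferInstance)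
  have h3 : y.1 k ∈ (⨅ i : ℕ, maximalIdeal A ^ i • ⊤ : Submodule A Y) := (Submodule.mem_iInf _).2 h1
  rw [h2] at h3
  exact h3
end Filt

section Star
variable {R A E : Type u} [CommRing R] [IsLocalRing R] [IsNoetherianRing R] [CommRing A] [Algebra R A]
  [IsNoetherianRing A] [AddCommGroup E] [Module R E] [Module A E] [IsScalarTower R A E] {e0 : E}

theorem MD.a2 (h : MD R A E e0) (s : A) : A2 s A := by
  obtain ⟨_, hm⟩ := h.local
  obtain ⟨e, -⟩ := (h.mdA hm).equiv
  exact (a2_hom h.injA).of_surj e.symm.toLinearMap e.symm.surjective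

theorem MD.bidual (h : MD R A E e0) {V : Type u} [AddCommGroup V] [Module R V] [Module A V]
    [IsScalarTower R A V] (hV : ∀ v : V, v ∈ gam (maximalIdeal R) V) {c : ℕ}
    (j : V →ₗ[R] (Fin c → E)) (hj : Function.Injective j) : Nonempty (V ≃ₗ[A] ((V →ₗ[R] E) →ₗ[A] E)) := by
  let ev : V →ₗ[A] ((V →ₗ[R] E) →ₗ[A] E) :=
    { toFun := fun v => { toFun := fun f => f v, map_add' := fun _ _ => rfl, map_smul' := fun _ _ => rfl }
      map_add' := fun v w => LinearMap.ext fun f => map_add f v w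
      map_smul' := fun a v => LinearMap.ext fun f => h.dns.linear hV f a v }
  refine ⟨LinearEquiv.ofBijective ev ⟨(injective_iff_map_eq_zero ev).2 fun v hv => ?_, fun φ => ?_⟩⟩
  · by_contra hne
    obtain ⟨f, hf⟩ := h.cogen hne
    exact hf (LinearMap.congr_fun hv f)
  · obtain ⟨D, hD⟩ := h.dualPi c
    let e : Fin c → E := fun i => φ ((LinearMap.proj i).comp j)
    have hex : ∀ w : Fin c → A, φ ((D w).comp j) = D w e := by
      intro w
      have : (D w).comp j = ∑ i, w i • ((LinearMap.proj i).comp j : V →ₗ[R] E) := by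
        ext v; simp [hD]
      rw [this, map_sum, hD]
      simp [e]
    have he : e ∈ LinearMap.range j := by
      by_contra hne
      obtain ⟨f, hf⟩ := h.cogen (t := (LinearMap.range j).mkQ e)
        (fun h0 => hne ((Submodule.Quotient.mk_eq_zero _).1 h0))
      have h1 := hex (D.symm (f.comp (LinearMap.range j).mkQ))
      rw [D.apply_symm_apply] at h1
      have h2 : (f.comp (LinearMap.range j).mkQ).comp j = 0 := LinearMap.ext fun v => by
        change f ((LinearMap.range j).mkQ (j v)) = 0
        rw [(se_mkQ j hj).zero, map_zero]
      rw [h2, map_zero] at h1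
      exact hf h1.symm
    obtain ⟨v, hv⟩ := he
    refine ⟨v, LinearMap.ext fun f => ?_⟩
    obtain ⟨g, hg⟩ := inj_extend (injective_fin h.inj c) j hj j
    obtain ⟨f', hf'⟩ := inj_extend h.inj j hj f
    have h1 := hex (D.symm f')
    rw [D.apply_symm_apply] at h1
    have h2 : f'.comp j = f := LinearMap.ext hf'
    rw [h2] at h1
    rw [h1, ← hv, hf']; rfl

theorem star (h : MD R A E e0) {x : R} (hxm : x ∈ maximalIdeal R) (hx : IsSMulRegular R x)
    {S : Type u} [CommRing S] [Algebra R S] (hS : IsQ x S)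
    {M : Type u} [AddCommGroup M] [Module R M] [Module.Finite R M] (hM : IsSMulRegular M x)
    {N : Type u} [AddCommGroup N] [Module S N] (π : M →+ N) (hπ : Function.Surjective π)
    (hl : ∀ (r : R) m, π (r • m) = algebraMap R S r • π m)
    (hk : ∀ m, π m = 0 ↔ ∃ m', x • m' = m) (n : ℕ) (hN : GD S n N) : Tp A (A ⊗[R] M) := by
  obtain ⟨_, hm⟩ := h.local
  obtain ⟨L, hL⟩ := exists_list (maximalIdeal A)
  have hLm : ∀ s ∈ L, s ∈ maximalIdeal A := fun s hs => by rw [← hL]; exact Ideal.subset_span hs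
  let n' := n + L.length
  have hfin : Module.Finite A (A ⊗[R] M) := inferInstance
  obtain ⟨C, hC, -, hsoc⟩ := exists_cz_fin (h.hullA hm) (ModuleCat.of A (A ⊗[R] M)) hfin (n'+1)
  letI : Module R C := Module.compHom C (algebraMap R A)
  haveI : IsScalarTower R A C := ⟨fun r a d => by rw [Algebra.smul_def, mul_smul]; rfl⟩
  obtain ⟨K, ι, ρ, hK, hρ⟩ := cz_retract h hxm hx hS hM π hπ hl hk n' (hN.mono_le (by omega)) C hC
  obtain ⟨c, f, hf⟩ := (h.hullA hm).embed_soc hsoc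
  have hmem : ∀ y : C, y ∈ gam (maximalIdeal A) C ↔ y ∈ gam (maximalIdeal R) C := fun y => by
    rw [hm]; exact gam_algebra
  let VA := gam (maximalIdeal A) C
  have htor : ∀ v : VA, v ∈ gam (maximalIdeal R) VA := fun v => gam_of_inj (VA.subtype.restrictScalars R)
    (Submodule.subtype_injective _) ((hmem _).1 v.2)
  let j : VA →ₗ[R] (Fin c → E) := (f.comp VA.subtype).restrictScalars R
  have hj : Function.Injective j := (injective_iff_map_eq_zero _).2 fun v hv => Subtype.ext (hf v.1 v.2 hv)
  have hPV : PV R E VA := by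
    let e : VA →ₗ[R] gam (maximalIdeal R) C :=
      (VA.subtype.restrictScalars R).codRestrict _ (fun v => (hmem _).1 v.2)
    let e' : gam (maximalIdeal R) C →ₗ[R] VA :=
      { toFun := fun v => ⟨v.1, (hmem _).2 v.2⟩, map_add' := fun _ _ => rfl, map_smul' := fun _ _ => rfl }
    exact ⟨⟨c, j, hj⟩, K, ι.comp e, e'.comp ρ, hK, fun v => by
      rw [LinearMap.comp_apply, LinearMap.comp_apply, hρ]; rfl⟩
  have hG := pv_tr h hPV
  obtain ⟨e⟩ := h.bidual htor j hj
  refine cz_tp hC ?_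
  have hs : SE VA.subtype VA.mkQ :=
    ⟨Submodule.subtype_injective _, LinearMap.exact_subtype_mkQ _, Submodule.mkQ_surjective _⟩
  refine tp_ext hs (tp_equiv e.symm (tp_hom hG h.injA)) ?_
  have hHV : HL L (ModuleCat.of A VA) :=
    hl_equiv L (Y := ModuleCat.of A ((VA →ₗ[R] E) →ₗ[A] E)) (Z := ModuleCat.of A VA) e.symm (hl_hom L hG h.injA)
  have hHC : HL L C := hl_of_co L fun s hs => by
    have := co_fin (hLm s hs) (Y := A ⊗[R] M)
    exact cz_co (X := ModuleCat.of A (A ⊗[R] M)) (a2_fin (h.a2 s)) injective_sub hC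
  refine tp_of_ac L (Y := ModuleCat.of A (C ⧸ VA))
    (hl_coker L (X := ModuleCat.of A VA) (Y := C) (Z := ModuleCat.of A (C ⧸ VA)) hs hHV hHC) ?_
  obtain ⟨D, hD, I, i, p, hI, hsI⟩ := hC
  refine ga_ac L L (fun s hs => hs) (V := ModuleCat.of A VA) (K := C) (Y := ModuleCat.of A (C ⧸ VA)) hs
    (ga_quot L L hsI (cz_gdl n' L (by omega) D hD) hI) fun k => ?_
  rw [← mem_gam_list hL]
  exact Submodule.Quotient.mk_eq_zero _
end Star
end GidAux

namespace GidAux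
open scoped TensorProduct

section Loc
variable {A B : Type u} [CommRing A] [IsNoetherianRing A] [CommRing B] [Algebra A B]

/-- Any `A`-linear map of `B`-modules is `B`-linear. -/
def Epi (A B : Type u) [CommRing A] [CommRing B] [Algebra A B] : Prop :=
  ∀ (X Y : ModuleCat.{u} B) [Module A X] [Module A Y] [IsScalarTower A B X] [IsScalarTower A B Y]
    (f : X →ₗ[A] Y) (b : B) (x : X), f (b • x) = b • f x

theorem epi_loc (S : Submonoid A) [IsLocalization S B] : Epi A B := fun X Y _ _ _ _ f b x =>
  (LinearMap.extendScalarsOfIsLocalization S B f).map_smul b x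

theorem Epi.lin (hE : Epi A B) {X Y : Type u} [AddCommGroup X] [AddCommGroup Y] [Module B X]
    [Module B Y] [Module A X] [Module A Y] [IsScalarTower A B X] [IsScalarTower A B Y]
    (f : X →ₗ[A] Y) : ∃ f' : X →ₗ[B] Y, ∀ x, f' x = f x :=
  ⟨{ f with map_smul' := fun b x => hE (ModuleCat.of B X) (ModuleCat.of B Y) f b x }, fun _ => rfl⟩

theorem Epi.inj (hE : Epi A B) {J : Type u} [AddCommGroup J] [Module B J] [Module A J]
    [IsScalarTower A B J] (hJ : Module.Injective A J) : Module.Injective B J := by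
  refine ⟨fun X Y _ _ _ _ f hf g => ?_⟩
  letI : Module A X := Module.compHom X (algebraMap A B)
  haveI : IsScalarTower A B X := ⟨fun r a d => by rw [Algebra.smul_def, mul_smul]; rfl⟩
  letI : Module A Y := Module.compHom Y (algebraMap A B)
  haveI : IsScalarTower A B Y := ⟨fun r a d => by rw [Algebra.smul_def, mul_smul]; rfl⟩
  obtain ⟨h, hh⟩ := inj_extend hJ (f.restrictScalars A) hf (g.restrictScalars A)
  obtain ⟨h', hh'⟩ := hE.lin h
  exact ⟨h', fun y => (hh' _).trans (hh y)⟩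

theorem Epi.gi [Module.Flat A B] (hE : Epi A B) {K : Type u} [AddCommGroup K] [Module B K]
    [Module A K] [IsScalarTower A B K] (hK : GI A K) : GI B K := by
  refine gi_of_closed (P := fun N => ∃ (_ : Module A N) (_ : IsScalarTower A B N), GI A N) ?_
    (ModuleCat.of B K) ⟨inferInstance, inferInstance, hK⟩
  rintro N ⟨_, _, hN⟩
  refine ⟨?_, ?_, ?_⟩
  · intro I X Y hI i p hs g
    letI : Module A I := Module.compHom I (algebraMap A B)
    haveI : IsScalarTower A B I := ⟨fun r a d => by rw [Algebra.smul_def, mul_smul]; rfl⟩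
    letI : Module A X := Module.compHom X (algebraMap A B)
    haveI : IsScalarTower A B X := ⟨fun r a d => by rw [Algebra.smul_def, mul_smul]; rfl⟩
    letI : Module A Y := Module.compHom Y (algebraMap A B)
    haveI : IsScalarTower A B Y := ⟨fun r a d => by rw [Algebra.smul_def, mul_smul]; rfl⟩
    obtain ⟨h, hh⟩ := hN.liftP.lift (injective_restrict (B := B) hI) (i := i.restrictScalars A)
      (p := p.restrictScalars A) hs (g.restrictScalars A)
    obtain ⟨h', hh'⟩ := hE.lin h
    exact ⟨h', fun y => by rw [hh']; exact hh y⟩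
  · obtain ⟨K1, hK1, J, i, p, hJ, hs⟩ := hN.left
    obtain ⟨l, hl⟩ := hK1.liftP.lift (injective_flat (F := B) hJ) hs
      ((LinearMap.liftBaseChange B p).restrictScalars A)
    let q := LinearMap.liftBaseChange B p
    have hq1 : ∀ j, q (1 ⊗ₜ j) = p j := fun j => by simp [q]
    have hl' : ∀ y, p (l y) = q y := hl
    have hq : Function.Surjective q := fun y => by
      obtain ⟨j, rfl⟩ := hs.2.2 y; exact ⟨1 ⊗ₜ j, hq1 j⟩
    refine ⟨ModuleCat.of B (LinearMap.ker q), ⟨inferInstanceAs (Module A (LinearMap.ker q)),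
      inferInstanceAs (IsScalarTower A B (LinearMap.ker q)), ?_⟩,
      ModuleCat.of B (B ⊗[A] J), _, q, hE.inj (injective_flat (F := B) hJ), se_ker q hq⟩
    change GI A (LinearMap.ker q)
    let w : LinearMap.ker p × (B ⊗[A] J) →ₗ[A] (B ⊗[A] J) :=
      LinearMap.snd A _ _ - (TensorProduct.mk A B J 1).comp
        (l.comp (LinearMap.snd A _ _) + (LinearMap.ker p).subtype.comp (LinearMap.fst A _ _))
    have hw : ∀ k b, w (k, b) = b - 1 ⊗ₜ (l b + k.1) := fun k b => rfl
    have hk1 : GI A (LinearMap.ker p) := hK1.of_equiv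
      ((LinearEquiv.ofInjective i hs.1).trans (LinearEquiv.ofEq _ _ (LinearMap.exact_iff.1 hs.2.1).symm))
    obtain ⟨w', hw'⟩ : ∃ w' : LinearMap.ker p × (B ⊗[A] J) →ₗ[A] LinearMap.ker q, ∀ z, (w' z).1 = w z :=
      ⟨w.codRestrict ((LinearMap.ker q).restrictScalars A) (fun ⟨k, b⟩ => by
        change q _ = 0
        rw [hw, map_sub, hq1, map_add, hl', k.2, add_zero, sub_self]), fun _ => rfl⟩
    let v : J →ₗ[A] LinearMap.ker p × (B ⊗[A] J) :=
      LinearMap.prod ((LinearMap.id - l.comp (TensorProduct.mk A B J 1)).codRestrict (LinearMap.ker p)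
        (fun j => by
          change p (j - l (1 ⊗ₜ j)) = 0
          rw [map_sub, hl', hq1, sub_self])) (TensorProduct.mk A B J 1)
    have hv : ∀ j, ((v j).1.1 = j - l (1 ⊗ₜ j)) ∧ (v j).2 = 1 ⊗ₜ j := fun j => ⟨rfl, rfl⟩
    refine gi_coker (i := v) (p := w') (SE.mk' ?_ ?_ ?_ ?_) (gi_of_injective hJ)
      (gi_ext (se_inl_snd _ _) hk1 (gi_of_injective (injective_flat (F := B) hJ)))
    · intro j hj
      have h1 := (hv j).1; have h2 := (hv j).2
      rw [hj] at h1 h2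
      rw [← h2] at h1
      simpa using h1.symm
    · intro j
      refine Subtype.ext ?_
      rw [hw', show v j = ((v j).1, (v j).2) from rfl, hw, (hv j).1, (hv j).2]
      simp
    · rintro ⟨k, b⟩ hb
      have := congrArg Subtype.val hb
      rw [hw', hw] at this
      have hb' : b = 1 ⊗ₜ (l b + k.1) := sub_eq_zero.1 this
      refine ⟨l b + k.1, Prod.ext (Subtype.ext ?_) ?_⟩
      · rw [(hv _).1, ← hb']; simp
      · rw [(hv _).2, ← hb']
    · intro b
      refine ⟨(⟨-l b.1, ?_⟩, b.1), Subtype.ext ?_⟩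
      · change p _ = 0
        rw [map_neg, hl', b.2, neg_zero]
      · rw [hw', hw]; simp
  · obtain ⟨C, J, i, p, hJ, hs⟩ := exists_link (R := B) N
    letI : Module A C := Module.compHom C (algebraMap A B)
    haveI : IsScalarTower A B C := ⟨fun r a d => by rw [Algebra.smul_def, mul_smul]; rfl⟩
    letI : Module A J := Module.compHom J (algebraMap A B)
    haveI : IsScalarTower A B J := ⟨fun r a d => by rw [Algebra.smul_def, mul_smul]; rfl⟩
    exact ⟨C, ⟨inferInstance, inferInstance, gi_coker (i := i.restrictScalars A)
      (p := p.restrictScalars A) hs hN (gi_of_injective (injective_restrict (B := B) hJ))⟩,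
      J, i, p, hJ, hs⟩

theorem Epi.gd [Module.Flat A B] (hE : Epi A B) {n : ℕ} : ∀ {Y : Type u} [AddCommGroup Y] [Module B Y]
    [Module A Y] [IsScalarTower A B Y] (hY : GD A n Y), GD B n Y := by
  induction n with
  | zero => exact fun hY => hE.gi hY
  | succ n ih =>
    intro Y _ _ _ _ hY
    obtain ⟨C, J, i, p, hJ, hs⟩ := exists_link (R := B) Y
    letI : Module A C := Module.compHom C (algebraMap A B)
    haveI : IsScalarTower A B C := ⟨fun r a d => by rw [Algebra.smul_def, mul_smul]; rfl⟩
    letI : Module A J := Module.compHom J (algebraMap A B)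
    haveI : IsScalarTower A B J := ⟨fun r a d => by rw [Algebra.smul_def, mul_smul]; rfl⟩
    refine gd_of_link ⟨J, i, p, hJ, hs⟩ (ih (gd_cosyz (j := i.restrictScalars A)
      (c := p.restrictScalars A) (injective_restrict (B := B) hJ) hs hY))

end Loc
end GidAux

namespace GidAux
open scoped TensorProduct

section Lift
variable {R : Type u} [CommRing R] {K E C J W X X1 I D : Type u} [AddCommGroup K] [Module R K]
  [AddCommGroup E] [Module R E] [AddCommGroup C] [Module R C] [AddCommGroup J] [Module R J]
  [AddCommGroup W] [Module R W] [AddCommGroup X] [Module R X] [AddCommGroup X1] [Module R X1]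
  [AddCommGroup I] [Module R I] [AddCommGroup D] [Module R D]

/-- acyclicity of `K` with respect to the elements of `L` -/
def Good (L : List R) (K : Type u) [AddCommGroup K] [Module R K] : Prop :=
  ∀ s ∈ L, A2 s K ∧ Module.Injective R (co s K)

theorem lift_inv {s : R} {i : K →ₗ[R] E} {p : E →ₗ[R] C} (h : SE i p) (h1 : A2 s K)
    (h2 : Module.Injective R (co s K)) (hJ : Inv s J) (f : J →ₗ[R] C) :
    ∃ g : J →ₗ[R] E, ∀ v, p (g v) = f v := by
  obtain ⟨f', hf'⟩ := exists_toCo hJ f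
  obtain ⟨σ, hσ⟩ := (co_se h h1).section h2
  refine ⟨(ev0 s E).comp (σ.comp f'), fun v => ?_⟩
  rw [← hf', ← congrFun (congrArg Subtype.val (hσ (f' v))) 0]; rfl

theorem inv_quot_gam [IsNoetherianRing R] (s : R) (hW : Module.Injective R W) :
    Inv s (W ⧸ gam (Ideal.span {s}) W) := by
  refine ⟨(injective_iff_map_eq_zero (LinearMap.lsmul R (W ⧸ gam (Ideal.span {s}) W) s)).2 fun z hz => ?_, fun z => ?_⟩
  · obtain ⟨y, rfl⟩ := Submodule.mkQ_surjective _ z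
    have h5 : s • y ∈ gam (Ideal.span {s}) W := (Submodule.Quotient.mk_eq_zero _).1 hz
    obtain ⟨n, hn⟩ := mem_gam_span.1 h5
    exact (Submodule.Quotient.mk_eq_zero _).2 (mem_gam_span.2 ⟨n+1, by rw [pow_succ, mul_smul, hn]⟩)
  · obtain ⟨y, rfl⟩ := Submodule.mkQ_surjective _ z
    obtain ⟨l, y', hl⟩ := inj_good s hW y
    refine ⟨(gam (Ideal.span {s}) W).mkQ y', ?_⟩
    change s • (gam (Ideal.span {s}) W).mkQ y' = _
    rw [← map_smul, ← sub_eq_zero, ← map_sub]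
    exact (Submodule.Quotient.mk_eq_zero _).2 (mem_gam_span.2 ⟨l, by
      rw [smul_sub, smul_smul, ← pow_succ, hl, sub_self]⟩)

theorem lift_tors [IsNoetherianRing R] {i : K →ₗ[R] E} {p : E →ₗ[R] C} (h : SE i p)
    (hE : Module.Injective R E) (L : List R) (hK : Good L K) : ∀ {W : Type u} [AddCommGroup W]
    [Module R W] (hW : Module.Injective R W) (f : W →ₗ[R] C) (g : W →ₗ[R] E)
    (hg : ∀ v, (∀ s ∈ L, ∃ n : ℕ, s ^ n • v = 0) → p (g v) = f v),
    ∃ g' : W →ₗ[R] E, ∀ v, p (g' v) = f v := by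
  induction L with
  | nil => exact fun hW f g hg => ⟨g, fun v => hg v (by simp)⟩
  | cons s L ih =>
    intro W _ _ hW f g hg
    have hsub : Function.Injective (gam (Ideal.span {s}) W).subtype := Submodule.subtype_injective _
    obtain ⟨g1, hg1⟩ := ih (fun t ht => hK t (by simp [ht])) (injective_gam (Ideal.span {s}) hW)
      (f.comp (Submodule.subtype _)) (g.comp (Submodule.subtype _)) (fun v hv => hg v.1 (fun t ht => by
        rcases List.mem_cons.1 ht with rfl | ht
        · exact mem_gam_span.1 v.2
        · obtain ⟨n, hn⟩ := hv t ht
          exact ⟨n, congrArg Subtype.val hn⟩))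
    obtain ⟨g2, hg2⟩ := inj_extend hE _ hsub g1
    obtain ⟨f2, hf2⟩ := exists_factor (gam (Ideal.span {s}) W).mkQ (Submodule.mkQ_surjective _)
      (f - p.comp g2) (fun v hv => by
        have hv' : v ∈ gam (Ideal.span {s}) W := (Submodule.Quotient.mk_eq_zero _).1 hv
        have := hg2 ⟨v, hv'⟩
        have h3 := hg1 ⟨v, hv'⟩
        simp only [LinearMap.sub_apply, LinearMap.comp_apply, Submodule.subtype_apply] at this h3 ⊢
        rw [this, h3, sub_self])
    obtain ⟨g3, hg3⟩ := lift_inv h (hK s (by simp)).1 (hK s (by simp)).2 (inv_quot_gam s hW) f2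
    refine ⟨g2 + g3.comp (Submodule.mkQ _), fun v => ?_⟩
    rw [LinearMap.add_apply, map_add, LinearMap.comp_apply, hg3, hf2]
    simp

/-- maps from `X` lift along quotients of injective modules by good modules -/
def PL (L : List R) (X : Type u) [AddCommGroup X] [Module R X] : Prop :=
  ∀ (K E C : ModuleCat.{u} R) (i : K →ₗ[R] E) (p : E →ₗ[R] C), SE i p → Module.Injective R E →
    Good L K → ∀ f : X →ₗ[R] C, ∃ g : X →ₗ[R] E, ∀ v, p (g v) = f v

theorem pl_inj [IsNoetherianRing R] {L : List R} (hW : Module.Injective R W)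
    (h0 : ∀ v : W, (∀ s ∈ L, ∃ n : ℕ, s ^ n • v = 0) → v = 0) : PL L W :=
  fun _ _ _ _ _ h hE hK f => lift_tors h hE L hK hW f 0 (fun v hv => by rw [h0 v hv]; simp)

theorem ext_of_pl {L : List R} {i : X →ₗ[R] J} {p : J →ₗ[R] X1} (h : SE i p) (h1 : PL L X1)
    (hC : Good L C) (f : X →ₗ[R] C) : ∃ f' : J →ₗ[R] C, ∀ v, f' (i v) = f v := by
  obtain ⟨C', E, a, b, hE, hs⟩ := exists_link (R := R) C
  obtain ⟨F, hF⟩ := inj_extend hE i h.1 (a.comp f)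
  obtain ⟨G, hG⟩ := exists_factor p h.2.2 (b.comp F) (fun v hv => by
    obtain ⟨w, rfl⟩ := h.lift hv
    rw [LinearMap.comp_apply, hF]; exact hs.zero _)
  obtain ⟨H, hH⟩ := h1 (ModuleCat.of R C) E C' a b hs hE hC G
  obtain ⟨f', hf'⟩ := exists_cofactor a hs.1 (F - H.comp p) (fun c => hs.lift (by
    rw [LinearMap.sub_apply, map_sub, LinearMap.comp_apply, hH, hG]; simp))
  refine ⟨f', fun v => hs.1 ?_⟩
  rw [hf']
  simp [hF, h.zero]

theorem pl_step [IsNoetherianRing R] {L : List R} {i : X →ₗ[R] J} {p : J →ₗ[R] X1} (h : SE i p)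
    (h1 : PL L X1) (hJ : PL L J) : PL L X := by
  intro K E C a b hs hE hK f
  obtain ⟨f', hf'⟩ := ext_of_pl h h1 (fun s hsL => ⟨(a2_inj hE).of_surj b hs.2.2,
    (co_se hs (hK s hsL).1).injective_right (hK s hsL).2 (injective_co hE)⟩) f
  obtain ⟨g, hg⟩ := hJ K E C a b hs hE hK f'
  exact ⟨g.comp i, fun v => by rw [LinearMap.comp_apply, hg, hf']⟩

theorem good_kill [IsNoetherianRing R] {L : List R} (hD : ∀ s ∈ L, ∀ d : D, s • d = 0) : Good L D := fun s hs =>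
  ⟨fun y => ⟨y, fun k => by rw [hD s hs, sub_zero]⟩,
    haveI : Subsingleton (co s D) := ⟨fun a b => Subtype.ext (funext fun k => by
      rw [co.eq a k, co.eq b k, hD s hs, hD s hs])⟩
    injective_sub⟩

theorem hom_zero {m : ℕ} (s : Fin m → R) (hJ : Module.Injective R J)
    (hD : ∀ i, ∀ d : D, s i • d = 0) (f : J →ₗ[R] D) (v : J)
    (h0 : ∀ c : R, (∀ i, c * s i = 0) → c • v = 0) : f v = 0 := by
  obtain ⟨g, hg⟩ := inj_extend' hJ (LinearMap.pi fun i => LinearMap.toSpanSingleton R R (s i) : R →ₗ[R] (Fin m → R))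
    (LinearMap.toSpanSingleton R J v) (fun c hc => h0 c (fun i => congrFun hc i))
  have h1 := hg 1
  rw [LinearMap.toSpanSingleton_apply, one_smul] at h1
  rw [← h1, pi_eq_sum_univ ((LinearMap.pi fun i => LinearMap.toSpanSingleton R R (s i)) (1 : R)),
    map_sum, map_sum]
  refine Finset.sum_eq_zero fun i _ => ?_
  rw [map_smul, map_smul]
  simp [hD]

theorem vs_section [IsLocalRing R] (f : X →ₗ[R] X1) (hf : Function.Surjective f)
    (hX : ∀ s ∈ maximalIdeal R, ∀ v : X, s • v = 0) : ∃ g : X1 →ₗ[R] X, ∀ v, f (g v) = v := by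
  have hX1 : ∀ s ∈ maximalIdeal R, ∀ v : X1, s • v = 0 := fun s hs v => by
    obtain ⟨w, rfl⟩ := hf v
    rw [← map_smul, hX s hs, map_zero]
  have t1 : Module.IsTorsionBySet R X (maximalIdeal R : Set R) := fun v s => hX s.1 s.2 v
  have t2 : Module.IsTorsionBySet R X1 (maximalIdeal R : Set R) := fun v s => hX1 s.1 s.2 v
  letI : Module (R ⧸ maximalIdeal R) X := t1.module
  letI : Module (R ⧸ maximalIdeal R) X1 := t2.module
  letI : Field (R ⧸ maximalIdeal R) := Ideal.Quotient.field _
  let f' : X →ₗ[R ⧸ maximalIdeal R] X1 := ⟨f.toAddHom, fun c v => by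
    obtain ⟨r, rfl⟩ := Ideal.Quotient.mk_surjective c
    exact f.map_smul r v⟩
  obtain ⟨g, hg⟩ := f'.exists_rightInverse_of_surjective (LinearMap.range_eq_top.2 hf)
  exact ⟨⟨g.toAddHom, fun r v => g.map_smul (Ideal.Quotient.mk _ r) v⟩, fun v => LinearMap.congr_fun hg v⟩

theorem gam_split [IsNoetherianRing R] [IsLocalRing R] {σ : R} (hσ : σ ≠ 0)
    (hq : ∀ s ∈ maximalIdeal R, s * σ = 0) {i : X →ₗ[R] I} {p : I →ₗ[R] X1} (h : SE i p)
    (hI : Module.Injective R I) (h1 : Module.Injective R (gam (maximalIdeal R) X1)) :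
    Module.Injective R (gam (maximalIdeal R) X) ∧
      ∀ y ∈ gam (maximalIdeal R) X1, ∃ z ∈ gam (maximalIdeal R) I, p z = y := by
  let Γ := gam (maximalIdeal R) X1
  let q := maximalIdeal R
  have kg : ∀ v ∈ kil q X1, v ∈ gam q X1 := fun v hv => ⟨1, by rw [pow_one]; exact hv⟩
  let f : kil q I →ₗ[R] kil q X1 := p.restrict (fun v hv s hs => by rw [← map_smul, hv s hs, map_zero])
  obtain ⟨g, hg⟩ := vs_section f (fun c => by
    obtain ⟨d, hd⟩ := inj_extend' h1 (LinearMap.toSpanSingleton R R σ)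
      (LinearMap.toSpanSingleton R Γ ⟨c.1, kg _ c.2⟩) (fun r hr => by
        have hr' : r * σ = 0 := hr
        have hrq : r ∈ q := (mem_maximalIdeal r).2 fun hu => hσ ((hu.mul_right_eq_zero).1 hr')
        exact Subtype.ext (c.2 r hrq))
    obtain ⟨w, hw⟩ := h.2.2 (d 1).1
    refine ⟨⟨σ • w, fun s hs => by rw [smul_smul, hq s hs, zero_smul]⟩, Subtype.ext ?_⟩
    change p (σ • w) = c.1
    have := congrArg Subtype.val (hd 1)
    rw [map_smul, hw]
    simpa [← Submodule.coe_smul, ← map_smul] using this) (fun s hs v => Subtype.ext (v.2 s hs))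
  obtain ⟨τ, hτ⟩ := inj_extend hI (kil q X1).subtype (Submodule.subtype_injective _) ((kil q I).subtype.comp g)
  have hτ' : ∀ v ∈ kil q X1, p (τ v) = v := fun v hv => by
    have := hτ ⟨v, hv⟩
    rw [Submodule.subtype_apply] at this
    change τ v = _ at this
    rw [this]
    exact congrArg Subtype.val (hg ⟨v, hv⟩)
  let β : Γ →ₗ[R] Γ := gamMap q (p.comp τ)
  have hβ : ∀ v : Γ, v.1 ∈ kil q X1 → β v = v := fun v hv => Subtype.ext (hτ' _ hv)
  have key : ∀ (φ : Γ →ₗ[R] Γ), (∀ v : Γ, v.1 ∈ kil q X1 → φ v = 0 → v = 0) → Function.Injective φ := by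
    intro φ hφ
    refine (injective_iff_map_eq_zero φ).2 fun v hv => by_contra fun h0 => ?_
    have h0' : v.1 ≠ 0 := fun h => h0 (Subtype.ext h)
    obtain ⟨r, hr, hr'⟩ := exists_soc v.2 h0'
    exact hr (congrArg Subtype.val (hφ (r • v) hr' (by rw [map_smul, hv, smul_zero])))
  obtain ⟨ρ, hρ⟩ := inj_extend h1 β (key β (fun v hv h0 => by rwa [hβ v hv] at h0)) LinearMap.id
  have hρi := key ρ (fun v hv h0 => by
    have := hρ v
    rw [hβ v hv, h0] at this
    exact this.symm)
  have hβρ : ∀ v, β (ρ v) = v := fun v => hρi (hρ _)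
  have hsurj : ∀ y ∈ gam q X1, ∃ z ∈ gam q I, p z = y := fun y hy =>
    ⟨τ (ρ ⟨y, hy⟩), gam_map τ (ρ ⟨y, hy⟩).2, congrArg Subtype.val (hβρ ⟨y, hy⟩)⟩
  refine ⟨?_, hsurj⟩
  have hs := gam_se h hsurj
  let s' : Γ →ₗ[R] gam q I := (gamMap q τ).comp ρ
  have hs' : ∀ v, gamMap q p (s' v) = v := hβρ
  obtain ⟨u, hu⟩ := exists_cofactor (gamMap q i) hs.1 (LinearMap.id - s'.comp (gamMap q p))
    (fun c => hs.lift (by rw [LinearMap.sub_apply, map_sub, LinearMap.comp_apply, hs']; simp))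
  refine injective_retract (injective_gam q hI) (gamMap q i) u (fun a => hs.1 ?_)
  rw [hu, LinearMap.sub_apply, LinearMap.comp_apply, hs.zero]
  simp

/-- finite injective dimension -/
def ID (R : Type u) [CommRing R] : ℕ → ModuleCat.{u} R → Prop
  | 0, X => Module.Injective R X
  | n+1, X => ∃ C : ModuleCat.{u} R, Link R X C ∧ ID R n C

theorem id_gam [IsNoetherianRing R] [IsLocalRing R] {σ : R} (hσ : σ ≠ 0)
    (hq : ∀ s ∈ maximalIdeal R, s * σ = 0) {L : List R} (hL : Ideal.span {s | s ∈ L} = maximalIdeal R)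
    (n : ℕ) : ∀ X : ModuleCat.{u} R, ID R n X → Module.Injective R (gam (maximalIdeal R) X) ∧
      PL L (X ⧸ gam (maximalIdeal R) X) ∧ ∀ (D : ModuleCat.{u} R), (∀ s ∈ L, ∀ d : D, s • d = 0) →
        ∀ (f : (X ⧸ gam (maximalIdeal R) X) →ₗ[R] D) v, f v = 0 := by
  have seg : ∀ X : ModuleCat.{u} R, SE (gam (maximalIdeal R) X).subtype (gam (maximalIdeal R) X).mkQ :=
    fun X => ⟨Submodule.subtype_injective _, LinearMap.exact_subtype_mkQ _, Submodule.mkQ_surjective _⟩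
  have base : ∀ X : ModuleCat.{u} R, Module.Injective R X → Module.Injective R (gam (maximalIdeal R) X) ∧
      PL L (X ⧸ gam (maximalIdeal R) X) ∧ ∀ (D : ModuleCat.{u} R), (∀ s ∈ L, ∀ d : D, s • d = 0) →
        ∀ (f : (X ⧸ gam (maximalIdeal R) X) →ₗ[R] D) v, f v = 0 := by
    intro X hX
    have hΓ := injective_gam (maximalIdeal R) hX
    have hW := (seg X).injective_right hΓ hX
    have h0 : ∀ v : X ⧸ gam (maximalIdeal R) X, (∀ s ∈ L, ∃ n : ℕ, s ^ n • v = 0) → v = 0 := fun v hv => by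
      have := (mem_gam_list hL).2 (fun s hs => mem_gam_span.2 (hv s hs))
      obtain ⟨y, rfl⟩ := Submodule.mkQ_surjective _ v
      exact (Submodule.Quotient.mk_eq_zero _).2 (gam_quot _ y this)
    exact ⟨hΓ, pl_inj hW h0, fun D hD f v => hom_zero (fun i => L.get i) hW (fun i => hD _ (List.get_mem _ _)) f v
      (fun c hc => h0 _ (fun s hs => by
      obtain ⟨i, rfl⟩ := List.mem_iff_get.1 hs
      exact ⟨1, by rw [pow_one, smul_smul, mul_comm, hc i, zero_smul]⟩))⟩
  induction n with
  | zero => exact base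
  | succ n ih =>
    rintro X ⟨X1, ⟨I, i, p, hI, hs⟩, hX1⟩
    obtain ⟨g1, g2, -⟩ := ih X1 hX1
    obtain ⟨b1, b2, b3⟩ := base I hI
    obtain ⟨hX, hsur⟩ := gam_split hσ hq hs hI g1
    obtain ⟨u, v, huv⟩ := nine_coker (gam_se hs hsur) hs (seg X) (seg I) (seg X1) (fun _ => rfl) (fun _ => rfl)
    refine ⟨hX, pl_step huv g2 b2, fun D hD f w => ?_⟩
    obtain ⟨f', hf'⟩ := ext_of_pl huv g2 (good_kill hD) f
    rw [← hf', b3 D hD]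

end Lift
end GidAux

namespace GidAux
open scoped TensorProduct

section Fibre
variable {A B : Type u} [CommRing A] [IsNoetherianRing A] [IsLocalRing A] [CommRing B]
  [IsNoetherianRing B] [IsLocalRing B] [Algebra A B] [Module.Flat A B]

/-- self-injectivity of `B ⧸ N` -/
def SI {B : Type u} [CommRing B] (N : Ideal B) : Prop :=
  ∀ (m : ℕ) (r d : Fin m → B), (∀ c : Fin m → B, ∑ i, c i * r i ∈ N → ∑ i, c i * d i ∈ N) →
    ∃ v, ∀ i, r i * v - d i ∈ N

/-- extension of the maximal ideal -/
abbrev mB (A B : Type u) [CommRing A] [IsLocalRing A] [CommRing B] [Algebra A B] : Ideal B :=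
  (maximalIdeal A).map (algebraMap A B)

theorem mB_kill {X : Type u} [AddCommGroup X] [Module A X] [Module B X] [IsScalarTower A B X] {v : X}
    (hv : ∀ s ∈ maximalIdeal A, s • v = 0) {b : B} (hb : b ∈ mB A B) : b • v = 0 := by
  have : mB A B ≤ (LinearMap.ker (LinearMap.toSpanSingleton B X v)) :=
    Ideal.map_le_iff_le_comap.2 fun s hs => by
      change algebraMap A B s • v = 0
      rw [algebraMap_smul]; exact hv s hs
  exact this hb

theorem ann_soc {σ : A} (hσ : σ ≠ 0) {b : B} (hb : σ • b = 0) : b ∈ mB A B := by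
  obtain ⟨k, a, y, hy, ha⟩ := Module.Flat.isTrivialRelation_of_sum_smul_eq_zero (R := A) (M := B)
    (ι := Fin 1) (f := fun _ => σ) (x := fun _ => b) (by simpa using hb)
  rw [show b = _ from hy 0]
  refine Ideal.sum_mem _ fun j _ => ?_
  rw [Algebra.smul_def]
  refine Ideal.mul_mem_right _ _ (Ideal.mem_map_of_mem _ ((mem_maximalIdeal _).2 fun hu => hσ ?_))
  have := ha j
  simp only [Finset.univ_unique, Finset.sum_singleton] at this
  first | exact (hu.mul_left_eq_zero).1 this | exact (hu.mul_right_eq_zero).1 this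

theorem si_of_inj {X : Type u} [AddCommGroup X] [Module B X] (hX : Module.Injective B X)
    (θ : X →ₗ[B] B ⧸ mB A B) (x : X) (hx : θ x = Ideal.Quotient.mk _ 1) : SI (mB A B) := by
  letI : Module A X := Module.compHom X (algebraMap A B)
  haveI : IsScalarTower A B X := ⟨fun r a d => by rw [Algebra.smul_def, mul_smul]; rfl⟩
  have hXA : Module.Injective A X := injective_restrict (B := B) hX
  intro m r d hrd
  let n0 := maximalIdeal A
  let Φ : kil n0 X →ₗ[A] (Fin m → X) :=
    (LinearMap.pi fun i => (LinearMap.lsmul B X (r i)).restrictScalars A).comp (kil n0 X).subtype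
  let Ψ : kil n0 A →ₗ[A] (Fin m → X) :=
    (LinearMap.pi fun i => LinearMap.toSpanSingleton A X (d i • x)).comp (kil n0 A).subtype
  obtain ⟨g0, hg0⟩ := vs_section Φ.rangeRestrict Φ.surjective_rangeRestrict
    (fun s hs v => Subtype.ext (v.2 s hs))
  have hr : ∀ c, ∃ v, Φ v = Ψ c := by
    intro c
    let t : (Fin m → B) →ₗ[B] B ⧸ mB A B := (mB A B).mkQ.comp (∑ i, (LinearMap.proj i).smulRight (r i))
    let f : (Fin m → B) →ₗ[B] X := ∑ i, (LinearMap.proj i).smulRight (d i • (c : A) • x)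
    have hcx : ∀ b ∈ mB A B, b • (c : A) • x = 0 := fun b hb => mB_kill (A := A) (fun s hs => by
      have := c.2 s hs
      rw [smul_smul]; rw [smul_eq_mul] at this; rw [this, zero_smul]) hb
    obtain ⟨f', hf'⟩ := inj_extend' hX t f (fun a ha => by
      have h1 : ∑ i, a i * r i ∈ mB A B := by
        have : (mB A B).mkQ (∑ i, a i * r i) = 0 := by simpa [t] using ha
        exact (Submodule.Quotient.mk_eq_zero _).1 this
      have h2 := hcx _ (hrd a h1)
      simpa [f, Finset.sum_smul, mul_smul] using h2)
    refine ⟨⟨f' (Ideal.Quotient.mk _ 1), fun s hs => ?_⟩, funext fun i => ?_⟩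
    · rw [← algebraMap_smul B s, ← map_smul]
      have : algebraMap A B s • (Ideal.Quotient.mk (mB A B) 1) = 0 := by
        rw [← Ideal.Quotient.mk_eq_mk, ← Submodule.Quotient.mk_smul]
        exact (Submodule.Quotient.mk_eq_zero _).2 (by simpa using Ideal.mem_map_of_mem _ hs)
      rw [this, map_zero]
    · change r i • f' (Ideal.Quotient.mk _ 1) = (c : A) • d i • x
      have h3 := hf' (Pi.single i 1)
      have h4 : t (Pi.single i 1) = r i • (Ideal.Quotient.mk (mB A B) 1) := by
        have : (∑ j, (Pi.single i (1:B) : Fin m → B) j * r j) = r i := by simp [Pi.single_apply]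
        rw [← Ideal.Quotient.mk_eq_mk, ← Submodule.Quotient.mk_smul, smul_eq_mul, mul_one]
        simp [t, this]
      rw [h4, map_smul] at h3
      rw [h3, smul_comm]
      simp [f, Pi.single_apply, ite_smul]
  obtain ⟨g, hg⟩ : ∃ g : kil n0 A →ₗ[A] X, ∀ c i, r i • g c = (c : A) • d i • x := by
    refine ⟨(kil n0 X).subtype.comp (g0.comp (Ψ.codRestrict _ (fun c => hr c))), fun c i => ?_⟩
    have := congrFun (congrArg Subtype.val (hg0 (Ψ.codRestrict _ (fun c => hr c) c))) i
    exact this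
  obtain ⟨e, he⟩ := inj_extend hXA (kil n0 A).subtype (Submodule.subtype_injective _) g
  obtain ⟨k, s, hs⟩ := Submodule.fg_iff_exists_fin_generating_family.1 (IsNoetherian.noetherian n0)
  have hsn : ∀ i, s i ∈ n0 := fun i => by rw [← hs]; exact Submodule.subset_span ⟨i, rfl⟩
  have hDk : ∀ i, ∀ z : B ⧸ mB A B, s i • z = 0 := fun i z => by
    obtain ⟨b, rfl⟩ := Ideal.Quotient.mk_surjective z
    rw [← algebraMap_smul B (s i), ← Ideal.Quotient.mk_eq_mk, ← Submodule.Quotient.mk_smul]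
    exact (Submodule.Quotient.mk_eq_zero _).2 (Ideal.mul_mem_right _ _ (Ideal.mem_map_of_mem _ (hsn i)))
  obtain ⟨v, hv⟩ := Ideal.Quotient.mk_surjective (θ (e 1))
  refine ⟨v, fun i => ?_⟩
  have hz : θ (r i • e 1 - d i • x) = 0 := hom_zero s hXA hDk (θ.restrictScalars A) _ (fun c hc => by
    have hck : c ∈ kil n0 A := fun a ha => by
      have h5 : n0 ≤ LinearMap.ker (LinearMap.toSpanSingleton A A c) := by
        rw [← hs, Submodule.span_le]
        rintro _ ⟨i, rfl⟩
        change s i * c = 0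
        rw [mul_comm, hc i]
      exact h5 ha
    have h6 : c • e 1 = g ⟨c, hck⟩ := by
      rw [← he ⟨c, hck⟩, ← map_smul]; simp
    rw [smul_sub, smul_comm, h6, hg, sub_self])
  rw [map_sub, map_smul, map_smul, ← hv, hx] at hz
  rw [← Ideal.Quotient.eq_zero_iff_mem, map_sub, map_mul]
  have h7 : ∀ a b : B, a • Ideal.Quotient.mk (mB A B) b = Ideal.Quotient.mk _ a * Ideal.Quotient.mk _ b := fun a b => rfl
  rw [h7, h7, map_one, mul_one] at hz
  exact hz

theorem si_depth0 {σ : A} (hσ : σ ≠ 0) (hs : ∀ s ∈ maximalIdeal A, s * σ = 0)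
    (hmq : mB A B ≤ maximalIdeal B) {k : ℕ} (hk : maximalIdeal B ^ k ≤ mB A B) {n : ℕ}
    (X : ModuleCat.{u} B) (hX : ID B n X) (θ : X →ₗ[B] B ⧸ mB A B) (hθ : Function.Surjective θ) :
    SI (mB A B) := by
  have h1 : (Ideal.Quotient.mk (mB A B) 1) ≠ 0 := fun h =>
    (maximalIdeal.isMaximal B).ne_top (Ideal.eq_top_of_isUnit_mem _ (hmq (Ideal.Quotient.eq_zero_iff_mem.1 h)) isUnit_one)
  have hsm : ∀ a b : B, a • Ideal.Quotient.mk (mB A B) b = Ideal.Quotient.mk _ (a * b) := fun a b => rfl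
  obtain ⟨τ, hτ, hτ'⟩ := exists_soc (b := maximalIdeal B) (t := Ideal.Quotient.mk (mB A B) 1)
    ⟨k, fun r hr => by rw [hsm, mul_one]; exact Ideal.Quotient.eq_zero_iff_mem.2 (hk hr)⟩ h1
  obtain ⟨L, hL⟩ := exists_list (maximalIdeal B)
  have hσk : ∀ b ∈ mB A B, b * (algebraMap A B σ) = 0 := fun b hb =>
    mB_kill (A := A) (X := B) (fun s hs' => by rw [Algebra.smul_def, ← map_mul, hs s hs', map_zero]) hb
  obtain ⟨g1, -, g3⟩ := id_gam (R := B) (σ := σ • τ) (fun h0 => hτ (by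
      rw [hsm, mul_one]; exact Ideal.Quotient.eq_zero_iff_mem.2 (ann_soc hσ h0)))
    (fun s hsq => by
      have h2 := hτ' s hsq
      rw [hsm, hsm, mul_one] at h2
      rw [Algebra.smul_def, mul_left_comm, mul_comm]
      exact hσk _ (Ideal.Quotient.eq_zero_iff_mem.1 h2)) hL n X hX
  let Γ := gam (maximalIdeal B) X
  let P : Submodule B (B ⧸ mB A B) := Γ.map θ ⊔ maximalIdeal B • ⊤
  obtain ⟨f, hf⟩ := exists_factor Γ.mkQ Γ.mkQ_surjective (P.mkQ.comp θ) (fun v hv =>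
    (Submodule.Quotient.mk_eq_zero _).2 (Submodule.mem_sup_left ⟨v, (Submodule.Quotient.mk_eq_zero _).1 hv, rfl⟩))
  have hPt : ⊤ ≤ P := fun z _ => by
    obtain ⟨v, rfl⟩ := hθ z
    have := hf v
    rw [g3 (ModuleCat.of B ((B ⧸ mB A B) ⧸ P)) (fun s hs d => by
      obtain ⟨d, rfl⟩ := P.mkQ_surjective d
      rw [← map_smul]
      exact (Submodule.Quotient.mk_eq_zero _).2 (Submodule.mem_sup_right
        (Submodule.smul_mem_smul (by rw [← hL]; exact Ideal.subset_span hs) trivial))) f] at this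
    exact (Submodule.Quotient.mk_eq_zero _).1 this.symm
  have := Submodule.le_of_le_smul_of_le_jacobson_bot (Module.Finite.fg_top)
    (IsLocalRing.maximalIdeal_le_jacobson _) hPt
  obtain ⟨x, hx, hx'⟩ := this (show (Ideal.Quotient.mk (mB A B) 1) ∈ ⊤ from trivial)
  exact si_of_inj g1 (θ.comp Γ.subtype) ⟨x, hx⟩ hx'

theorem id_tor {R S : Type u} [CommRing R] [CommRing S] [Algebra R S] {y : R} (hS : IsQ y S)
    (hy : IsSMulRegular R y) {n : ℕ} : ∀ {X : ModuleCat.{u} R} {N : ModuleCat.{u} S} {j : N →+ X},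
    ID R n X → Dv y X → IsT y S N X j → ID S n N := by
  induction n with
  | zero => exact fun hX _ h => injective_tor hS hX h
  | succ n ih =>
    rintro X N j ⟨C, ⟨I, i, p, hI, hs⟩, hC⟩ hX h
    obtain ⟨NI, jI, hNI⟩ := exists_isT hS I
    obtain ⟨NC, jC, hNC⟩ := exists_isT hS C
    obtain ⟨u, v, huv, -, -⟩ := tor_se hS hs hX h hNI hNC
    exact ⟨NC, ⟨NI, u, v, injective_tor hS hI hNI, huv⟩, ih hC ((dv_of_injective hy hI).of_surj p hs.2.2) hNC⟩

theorem si_all (n : ℕ) : ∀ (A B : Type u) [CommRing A] [IsNoetherianRing A] [IsLocalRing A] [CommRing B]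
    [IsNoetherianRing B] [IsLocalRing B] [Algebra A B] [Module.Flat A B]
    (hmq : mB A B ≤ maximalIdeal B) (hk : ∃ k, maximalIdeal B ^ k ≤ mB A B)
    (X : ModuleCat.{u} B) (hX : ID B n X) (θ : X →ₗ[B] B ⧸ mB A B) (hθ : Function.Surjective θ),
    SI (mB A B) := by
  induction n with
  | zero => ?_
  | succ n ih => ?_
  all_goals
    intro A B _ _ _ _ _ _ _ _ hmq ⟨k, hk⟩ X hX θ hθ
    by_cases hsoc : ∃ σ : A, σ ≠ 0 ∧ ∀ s ∈ maximalIdeal A, s * σ = 0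
    · obtain ⟨σ, h0, h1⟩ := hsoc
      exact si_depth0 h0 h1 hmq hk X hX θ hθ
    obtain ⟨y0, hy0, hreg⟩ := (IsSMulRegular.subsingleton_linearMap_iff (R := A) (N := A ⧸ maximalIdeal A) (M := A)).1
      ⟨fun f g => by
        have : ∀ f : A ⧸ maximalIdeal A →ₗ[A] A, f (Ideal.Quotient.mk _ 1) = 0 := fun f =>
          by_contra fun h => hsoc ⟨_, h, fun s hs => by
            rw [← smul_eq_mul, ← map_smul, ← map_zero f]
            congr 1
            exact (Submodule.Quotient.mk_eq_zero _).2 (by simpa using hs)⟩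
        refine LinearMap.ext fun z => ?_
        obtain ⟨a, rfl⟩ := Ideal.Quotient.mk_surjective z
        have e : Ideal.Quotient.mk (maximalIdeal A) a = a • Ideal.Quotient.mk (maximalIdeal A) 1 :=
          by
            change _ = Ideal.Quotient.mk _ (a * 1)
            rw [mul_one]
        rw [e, map_smul, map_smul, this, this]⟩
    rw [Ideal.annihilator_quotient] at hy0
    let y := algebraMap A B y0
    have hyN : y ∈ mB A B := Ideal.mem_map_of_mem _ hy0
    have hyreg : IsSMulRegular B y := fun a b hab => (hreg.of_flat (S := B)) hab
    have hyD : ∀ d : B ⧸ mB A B, y • d = 0 := fun d => by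
      obtain ⟨b, rfl⟩ := Ideal.Quotient.mk_surjective d
      exact (Submodule.Quotient.mk_eq_zero _).2 (Ideal.mul_mem_right _ _ hyN)
  · obtain ⟨x, hx⟩ := hθ (Ideal.Quotient.mk _ 1)
    obtain ⟨x', rfl⟩ := dv_of_injective hyreg hX x
    rw [map_smul, hyD] at hx
    exact absurd (hmq (Ideal.Quotient.eq_zero_iff_mem.1 hx.symm))
      ((Ideal.ne_top_iff_one _).1 (maximalIdeal.isMaximal B).ne_top)
  · obtain ⟨X1, ⟨I, i, p, hI, hs⟩, hX1⟩ := hX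
    let A' := A ⧸ Ideal.span {y0}
    let S := A' ⊗[A] B
    letI : Algebra B S := Algebra.TensorProduct.rightAlgebra
    have hal : ∀ b, algebraMap B S b = 1 ⊗ₜ b := fun b => rfl
    have hAsurj : Function.Surjective (algebraMap A A') := Ideal.Quotient.mk_surjective
    have hcomp : ∀ a : A, algebraMap A' S (algebraMap A A' a) = algebraMap B S (algebraMap A B a) := fun a => by
      rw [hal, Algebra.TensorProduct.algebraMap_apply, Algebra.algebraMap_self_apply,
        Algebra.algebraMap_eq_smul_one, Algebra.algebraMap_eq_smul_one, TensorProduct.smul_tmul]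
    have hSsurj : Function.Surjective (algebraMap B S) := fun z => by
      induction z using TensorProduct.induction_on with
      | zero => exact ⟨0, map_zero _⟩
      | add a b ha hb =>
        obtain ⟨a', rfl⟩ := ha
        obtain ⟨b', rfl⟩ := hb
        exact ⟨a' + b', map_add _ _ _⟩
      | tmul a b =>
        obtain ⟨r, rfl⟩ := hAsurj a
        exact ⟨r • b, by rw [hal, Algebra.algebraMap_eq_smul_one, TensorProduct.smul_tmul]⟩
    have hS : IsQ y S := ⟨hSsurj, fun b => by
      rw [hal, ← (TensorProduct.quotTensorEquivQuotSMul B (Ideal.span {y0})).map_eq_zero_iff,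
        TensorProduct.quotTensorEquivQuotSMul_mk_one_tmul, Submodule.Quotient.mk_eq_zero,
        Submodule.ideal_span_singleton_smul, Submodule.mem_smul_pointwise_iff_exists]
      simp only [Submodule.mem_top, true_and, Algebra.smul_def]; rfl⟩
    haveI : Nontrivial A' := Ideal.Quotient.nontrivial_iff.2 fun h =>
      (maximalIdeal.isMaximal A).ne_top (top_le_iff.1 (h ▸ (Ideal.span_le.2 (by simpa using hy0))))
    haveI : IsLocalRing A' := IsLocalRing.of_surjective' (algebraMap A A') hAsurj
    haveI : Nontrivial S := ⟨⟨1, 0, fun h => by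
      rw [← map_one (algebraMap B S)] at h
      obtain ⟨s, hs⟩ := (hS.ker 1).1 h
      exact (mem_maximalIdeal y).1 (hmq hyN) (IsUnit.of_mul_eq_one s hs)⟩⟩
    haveI : IsLocalRing S := IsLocalRing.of_surjective' (algebraMap B S) hSsurj
    haveI : IsNoetherianRing S := isNoetherianRing_of_surjective B S (algebraMap B S) hSsurj
    have hN : mB A' S = (mB A B).map (algebraMap B S) := by
      rw [mB, ← map_maximalIdeal_of_surjective (algebraMap A A') hAsurj, Ideal.map_map, Ideal.map_map]
      exact congrArg (fun f => Ideal.map f (maximalIdeal A)) (RingHom.ext hcomp)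
    have hq : (maximalIdeal B).map (algebraMap B S) = maximalIdeal S := map_maximalIdeal_of_surjective _ hSsurj
    have hmem : ∀ b, algebraMap B S b ∈ mB A' S ↔ b ∈ mB A B := fun b => by
      rw [hN, ← Ideal.mem_comap, Ideal.comap_map_of_surjective' _ hSsurj, sup_eq_left.2]
      intro r hr
      obtain ⟨s, rfl⟩ := (hS.ker r).1 hr
      exact Ideal.mul_mem_right _ _ hyN
    obtain ⟨T, j, hT⟩ := exists_isT hS X1
    have hIdv : Dv y I := dv_of_injective hyreg hI
    have hidT := id_tor hS hyreg hX1 (hIdv.of_surj p hs.2.2) hT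
    letI : Module B T := Module.compHom T (algebraMap B S)
    let jB : T →ₗ[B] X1 := ⟨j.toAddHom, fun r t => hT.smul r t⟩
    let U : Submodule B I := LinearMap.ker ((LinearMap.lsmul B X1 y).comp p)
    obtain ⟨α, hα⟩ := exists_cofactor i hs.1 ((LinearMap.lsmul B I y).comp U.subtype) (fun u => hs.lift (by
      have : y • p u.1 = 0 := u.2
      rw [LinearMap.comp_apply, LinearMap.lsmul_apply, map_smul]; exact this))
    obtain ⟨π, hπ⟩ := exists_cofactor jB hT.inj (p.comp U.subtype) (fun u => (hT.range _).1 u.2)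
    obtain ⟨ω, hω⟩ := exists_factor π (fun t => by
      obtain ⟨u, hu⟩ := hs.2.2 (j t)
      exact ⟨⟨u, by change y • p u = 0; rw [hu]; exact hT.kill t⟩, hT.inj ((hπ _).trans hu)⟩) (θ.comp α)
      (fun u hu => by
        have h1 : p u.1 = 0 := (hπ u).symm.trans (by rw [hu, map_zero])
        obtain ⟨a, ha⟩ := hs.lift h1
        have : α u = y • a := hs.1 (by rw [hα, map_smul, ha]; rfl)
        rw [LinearMap.comp_apply, this, map_smul, hyD])
    have hωs : Function.Surjective ω := fun d => by
      obtain ⟨a, rfl⟩ := hθ d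
      obtain ⟨u, hu⟩ := hIdv (i a)
      have huU : u ∈ U := by change y • p u = 0; rw [← map_smul, hu]; exact hs.zero a
      refine ⟨π ⟨u, huU⟩, ?_⟩
      rw [hω, LinearMap.comp_apply]
      congr 1
      exact hs.1 ((hα _).trans hu)
    let κ : (B ⧸ mB A B) →+* S ⧸ mB A' S := Ideal.quotientMap _ (algebraMap B S) (fun b hb => (hmem b).2 hb)
    have hκ : ∀ b, κ (Ideal.Quotient.mk _ b) = Ideal.Quotient.mk _ (algebraMap B S b) := fun b => rfl
    have hSI := ih A' S (by rw [hN, ← hq]; exact Ideal.map_mono hmq)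
      ⟨k, by rw [hN, ← hq, ← Ideal.map_pow]; exact Ideal.map_mono hk⟩ T hidT
      ⟨⟨fun t => κ (ω t), fun a b => by rw [map_add, map_add]⟩, fun s t => by
        obtain ⟨b, rfl⟩ := hSsurj s
        obtain ⟨c, hc⟩ := Ideal.Quotient.mk_surjective (ω t)
        change κ (ω (b • t)) = _
        rw [map_smul, ← hc]
        change κ (Ideal.Quotient.mk _ (b * c)) = algebraMap B S b • κ (ω t)
        rw [hκ, map_mul, ← hc, hκ]; rfl⟩ (fun z => by
        obtain ⟨s, rfl⟩ := Ideal.Quotient.mk_surjective z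
        obtain ⟨b, rfl⟩ := hSsurj s
        obtain ⟨t, ht⟩ := hωs (Ideal.Quotient.mk _ b)
        exact ⟨t, by change κ (ω t) = _; rw [ht, hκ]⟩)
    intro m r d hrd
    obtain ⟨v, hv⟩ := hSI m (fun i => algebraMap B S (r i)) (fun i => algebraMap B S (d i)) (fun c hc => by
      choose c' hc' using fun i => hSsurj (c i)
      simp only [← hc', ← map_mul, ← map_sum, hmem] at hc ⊢
      exact hrd c' hc)
    obtain ⟨v', rfl⟩ := hSsurj v
    exact ⟨v', fun i => by rw [← hmem, map_sub, map_mul]; exact hv i⟩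

end Fibre
end GidAux

namespace GidAux
open scoped TensorProduct

theorem approx {B : Type u} [CommRing B] (n : ℕ) : ∀ Y : ModuleCat.{u} B, GD B n Y →
    ∃ (X H : ModuleCat.{u} B) (i : H →ₗ[B] X) (p : X →ₗ[B] Y), SE i p ∧ GI B H ∧ ID B n X := by
  induction n with
  | zero =>
    intro Y hY
    obtain ⟨K, hK, I, i, p, hI, h⟩ := GI.left (N := Y) hY
    exact ⟨I, K, i, p, h, hK, hI⟩
  | succ n ih =>
    intro Y hY
    obtain ⟨C, I, i, p, hI, h⟩ := exists_link (R := B) Y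
    obtain ⟨X1, H1, i1, p1, h1, hH1, hX1⟩ := ih C (gd_cosyz hI h hY)
    let Q := LinearMap.ker (p.comp (LinearMap.fst B I X1) - p1.comp (LinearMap.snd B I X1))
    have hQ : ∀ z : Q, p z.1.1 = p1 z.1.2 := fun z => sub_eq_zero.1 z.2
    have hQ' : ∀ a b, p a = p1 b → (a, b) ∈ Q := fun a b h => sub_eq_zero.2 h
    have s1 : SE ((LinearMap.inr B I X1 ∘ₗ i1).codRestrict Q fun c => hQ' _ _ (by simp [h1.zero]))
        (LinearMap.fst B I X1 ∘ₗ Q.subtype) :=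
      SE.mk' (fun a ha => h1.inj0 (congrArg (fun z : Q => z.1.2) ha)) (fun a => rfl) (fun b hb => by
        obtain ⟨a, ha⟩ := h1.lift (b := b.1.2) (by rw [← hQ]; exact (congrArg p hb).trans (map_zero p))
        exact ⟨a, Subtype.ext (Prod.ext hb.symm ha)⟩) (fun c => by
        obtain ⟨b, hb⟩ := h1.2.2 (p c)
        exact ⟨⟨(c, b), hQ' _ _ hb.symm⟩, rfl⟩)
    obtain ⟨K, hK, J, k, c, hJ, hc⟩ := GI.left (gi_ext s1 hH1 (gi_of_injective hI))
    let f : J →ₗ[B] X1 := (LinearMap.snd B I X1 ∘ₗ Q.subtype) ∘ₗ c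
    have hf : Function.Surjective f := fun z => by
      obtain ⟨b, hb⟩ := h.2.2 (p1 z)
      obtain ⟨j, hj⟩ := hc.2.2 ⟨(b, z), hQ' _ _ hb⟩
      exact ⟨j, congrArg (fun z : Q => z.1.2) hj⟩
    obtain ⟨u, hu⟩ := exists_cofactor i h.1 ((LinearMap.fst B I X1 ∘ₗ Q.subtype) ∘ₗ c ∘ₗ (LinearMap.ker f).subtype)
      (fun z => h.lift (by
        change p (c z.1).1.1 = 0
        rw [hQ, show (c z.1).1.2 = 0 from z.2, map_zero]))
    refine ⟨ModuleCat.of B (LinearMap.ker f), K, k.codRestrict _ fun z => ?_, u,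
      SE.mk' (fun a ha => hc.inj0 (congrArg Subtype.val ha)) (fun a => ?_) (fun b hb => ?_) (fun y => ?_),
      hK, X1, ⟨J, _, f, hJ, se_ker f hf⟩, hX1⟩
    · exact congrArg (fun z : Q => z.1.2) (hc.zero z)
    · exact h.1 ((hu _).trans ((congrArg (fun z : Q => z.1.1) (hc.zero a)).trans (map_zero i).symm))
    · obtain ⟨a, ha⟩ := hc.lift (b := b.1) (Subtype.ext (Prod.ext
        ((hu b).symm.trans ((congrArg i hb).trans (map_zero i))) b.2))
      exact ⟨a, Subtype.ext ha⟩
    · obtain ⟨j, hj⟩ := hc.2.2 ⟨(i y, 0), hQ' _ _ (by rw [h.zero, map_zero])⟩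
      exact ⟨⟨j, congrArg (fun z : Q => z.1.2) hj⟩, h.1 ((hu _).trans (congrArg (fun z : Q => z.1.1) hj))⟩

theorem tensor_kil {A F X : Type u} [CommRing A] [IsNoetherianRing A] [AddCommGroup F] [Module A F]
    [Module.Flat A F] [AddCommGroup X] [Module A X] {b : Ideal A} (z : F ⊗[A] X)
    (hz : ∀ r ∈ b, r • z = 0) : ∃ w, LinearMap.lTensor F (kil b X).subtype w = z := by
  obtain ⟨m, s, hs⟩ := Submodule.fg_iff_exists_fin_generating_family.1 (IsNoetherian.noetherian b)
  have hsa : ∀ i, s i ∈ b := fun i => by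
    rw [← hs]; exact Submodule.subset_span ⟨i, rfl⟩
  let α : X →ₗ[A] (Fin m → X) := ∑ i, s i • LinearMap.single A (fun _ => X) i
  have hα : ∀ y j, α y j = s j • y := fun y j => by
    simp [α, LinearMap.sum_apply, Finset.sum_apply, Pi.single_apply]
  have hex : Function.Exact (kil b X).subtype α := by
    intro y
    constructor
    · intro hy
      refine ⟨⟨y, fun r hr => ?_⟩, rfl⟩
      have : b ≤ LinearMap.ker (LinearMap.toSpanSingleton A X y) := by
        rw [← hs, Submodule.span_le]
        rintro _ ⟨i, rfl⟩
        change s i • y = 0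
        rw [← hα, hy]; rfl
      exact this hr
    · rintro ⟨y, rfl⟩
      funext j
      rw [hα]; exact y.2 _ (hsa j)
  have h1 : LinearMap.lTensor F α z = 0 := by
    have : LinearMap.lTensor F α = ∑ i, s i • LinearMap.lTensor F (LinearMap.single A (fun _ => X) i) := by
      rw [← LinearMap.coe_lTensorHom, map_sum]; simp
    rw [this, LinearMap.sum_apply]
    refine Finset.sum_eq_zero fun i _ => ?_
    rw [LinearMap.smul_apply, ← map_smul, hz _ (hsa i), map_zero]
  exact (Module.Flat.lTensor_exact F hex z).1 h1

section InjTensor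
variable {A B : Type u} [CommRing A] [IsNoetherianRing A] [IsLocalRing A] [CommRing B]
  [IsNoetherianRing B] [IsLocalRing B] [Algebra A B] [Module.Flat A B]

theorem baer_q (hsi : SI (mB A B)) (hmq : mB A B ≤ maximalIdeal B)
    {J : Type u} [AddCommGroup J] [Module A J] (hJ : Module.Injective A J)
    (g : maximalIdeal B →ₗ[B] B ⊗[A] J) : ∃ y, ∀ z : maximalIdeal B, g z = (z : B) • y := by
  classical
  let n0 := maximalIdeal A
  obtain ⟨m, s, hs⟩ := Submodule.fg_iff_exists_fin_generating_family.1 (IsNoetherian.noetherian n0)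
  have hsn : ∀ i, s i ∈ n0 := fun i => by rw [← hs]; exact Submodule.subset_span ⟨i, rfl⟩
  have hsq : ∀ s ∈ n0, algebraMap A B s ∈ maximalIdeal B := fun i hi => hmq (Ideal.mem_map_of_mem _ hi)
  obtain ⟨y, hy⟩ := flat_baer (F := B) hJ s (fun i => g ⟨algebraMap A B (s i), hsq _ (hsn i)⟩) (fun c hc => by
    simp only [← algebraMap_smul B (c _), ← map_smul, ← map_sum]
    rw [← map_zero g]
    congr 1
    refine Subtype.ext ?_
    have := congrArg (algebraMap A B) hc
    simpa [Algebra.smul_def] using this)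
  let g' : maximalIdeal B →ₗ[B] B ⊗[A] J := g - (LinearMap.toSpanSingleton B _ y).comp (Submodule.subtype _)
  have hg' : ∀ z, g' z = g z - (z : B) • y := fun z => rfl
  have hk0 : ∀ s (hs : s ∈ n0), g' ⟨algebraMap A B s, hsq s hs⟩ = 0 := by
    have : n0 ≤ (Submodule.map ((maximalIdeal B).subtype.restrictScalars A)
        (LinearMap.ker (g'.restrictScalars A))).comap (Algebra.linearMap A B) := by
      rw [← hs, Submodule.span_le]
      rintro _ ⟨i, rfl⟩
      exact ⟨⟨_, hsq _ (hsn i)⟩, by change g' _ = 0; rw [hg', ← hy]; simp, rfl⟩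
    intro s hs
    obtain ⟨z, hz, hz'⟩ := this hs
    rw [← show z = ⟨algebraMap A B s, hsq s hs⟩ from Subtype.ext hz']
    exact hz
  have hk1 : ∀ z : maximalIdeal B, (z : B) ∈ mB A B → g' z = 0 := by
    have : mB A B ≤ (LinearMap.ker g').map (maximalIdeal B).subtype := Ideal.map_le_iff_le_comap.2 fun s hs =>
      ⟨⟨_, hsq s hs⟩, hk0 s hs, rfl⟩
    intro z hz
    obtain ⟨z', hz', h⟩ := this hz
    rw [← show z' = z from Subtype.ext h]
    exact hz'
  obtain ⟨l, r, hr⟩ := Submodule.fg_iff_exists_fin_generating_family.1 (IsNoetherian.noetherian (maximalIdeal B))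
  have hrq : ∀ i, r i ∈ maximalIdeal B := fun i => by rw [← hr]; exact Submodule.subset_span ⟨i, rfl⟩
  let ι : B ⊗[A] kil n0 J →ₗ[B] B ⊗[A] J := TensorProduct.AlgebraTensorModule.lTensor B B (kil n0 J).subtype
  have hι : Function.Injective ι :=
    Module.Flat.lTensor_preserves_injective_linearMap (M := B) (kil n0 J).subtype (Submodule.subtype_injective _)
  have hw : ∀ i, ∃ w, ι w = g' ⟨r i, hrq i⟩ := fun i => tensor_kil _ fun s hs => by
    rw [← algebraMap_smul B s, ← map_smul]
    exact hk1 _ (Ideal.mul_mem_right _ _ (Ideal.mem_map_of_mem _ hs))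
  choose w hw using hw
  have t1 : Module.IsTorsionBySet A (kil n0 J) (n0 : Set A) := fun v s => Subtype.ext (v.2 s.1 s.2)
  letI : Module (A ⧸ n0) (kil n0 J) := t1.module
  haveI : IsScalarTower A (A ⧸ n0) (kil n0 J) := t1.isScalarTower
  letI : Field (A ⧸ n0) := Ideal.Quotient.field n0
  let bs := Module.Basis.ofVectorSpace (A ⧸ n0) (kil n0 J)
  let Φ := (TensorProduct.AlgebraTensorModule.congr (LinearEquiv.refl B B) (bs.repr.restrictScalars A)).trans
    (TensorProduct.finsuppRight A B B (A ⧸ n0) _)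
  let δ : B ⊗[A] (A ⧸ n0) := 1 ⊗ₜ Ideal.Quotient.mk n0 1
  have hδ : ∀ t, ∃ d : B, d • δ = t := fun t => by
    induction t using TensorProduct.induction_on with
    | zero => exact ⟨0, zero_smul _ _⟩
    | add a b ha hb =>
      obtain ⟨a, rfl⟩ := ha
      obtain ⟨b, rfl⟩ := hb
      exact ⟨a + b, add_smul _ _ _⟩
    | tmul b a =>
      obtain ⟨a, rfl⟩ := Ideal.Quotient.mk_surjective a
      refine ⟨a • b, ?_⟩
      rw [TensorProduct.smul_tmul', smul_eq_mul, mul_one, TensorProduct.smul_tmul]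
      congr 1
      change Ideal.Quotient.mk n0 (a * 1) = _
      rw [mul_one]
  have hδ0 : ∀ d : B, d • δ = 0 ↔ d ∈ mB A B := fun d => by
    rw [TensorProduct.smul_tmul', smul_eq_mul, mul_one,
      ← (TensorProduct.tensorQuotEquivQuotSMul B n0).map_eq_zero_iff]
    erw [TensorProduct.tensorQuotEquivQuotSMul_tmul_mk]
    rw [one_smul, Submodule.Quotient.mk_eq_zero, Ideal.smul_top_eq_map]
    rfl
  choose d hd using fun i j => hδ (Φ (w i) j)
  have hv : ∀ j, ∃ v, ∀ i, r i * v - d i j ∈ mB A B := fun j => hsi l r (fun i => d i j) fun c hc => by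
    have h1 : ∑ i, c i • w i = 0 := hι (by
      rw [map_sum, map_zero, ← hk1 ⟨∑ i, c i * r i, Ideal.sum_mem _ fun i _ => Ideal.mul_mem_left _ _ (hrq i)⟩ hc]
      rw [show (⟨∑ i, c i * r i, _⟩ : maximalIdeal B) = ∑ i, c i • ⟨r i, hrq i⟩ from Subtype.ext (by simp), map_sum]
      exact Finset.sum_congr rfl fun i _ => by rw [map_smul, map_smul, hw])
    rw [← hδ0, Finset.sum_smul]
    have h2 := DFunLike.congr_fun (congrArg Φ h1) j
    simp only [map_sum, map_smul, map_zero, Finsupp.finset_sum_apply, Finsupp.smul_apply, ← hd, smul_smul] at h2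
    exact h2
  choose v hv using hv
  let S := Finset.univ.biUnion fun i => (Φ (w i)).support
  let vv := Finsupp.onFinset S (fun j => if j ∈ S then v j • δ else 0) (fun j hj => by
    by_contra h; simp [h] at hj)
  have hsol : ∀ i, r i • Φ.symm vv = w i := fun i => Φ.injective (by
    rw [map_smul, LinearEquiv.apply_symm_apply]
    ext j
    change r i • (if j ∈ S then v j • δ else 0) = _
    split_ifs with hj
    · rw [← hd, smul_smul, ← sub_eq_zero, ← sub_smul, hδ0]; exact hv j i
    · rw [smul_zero]
      by_contra h
      exact hj (Finset.mem_biUnion.2 ⟨i, Finset.mem_univ _, Finsupp.mem_support_iff.2 (Ne.symm h)⟩))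
  refine ⟨y + ι (Φ.symm vv), ?_⟩
  have : maximalIdeal B ≤ (LinearMap.ker (g' - (LinearMap.toSpanSingleton B _ (ι (Φ.symm vv))).comp
      (Submodule.subtype _))).map (maximalIdeal B).subtype := by
    nth_rw 1 [← hr]
    rw [Submodule.span_le]
    rintro _ ⟨i, rfl⟩
    refine ⟨⟨r i, hrq i⟩, ?_, rfl⟩
    change g' _ - r i • _ = 0
    rw [← map_smul, hsol, hw, sub_self]
  intro z
  obtain ⟨z', hz', h⟩ := this z.2
  rw [← show z' = z from Subtype.ext h]
  have h3 : g z' - (z' : B) • y - (z' : B) • ι (Φ.symm vv) = 0 := hz'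
  rw [smul_add, ← sub_eq_zero, ← h3]; abel

theorem inj_tensor (hsi : SI (mB A B)) (hmq : mB A B ≤ maximalIdeal B) (hk : ∃ k, maximalIdeal B ^ k ≤ mB A B)
    {J : Type u} [AddCommGroup J] [Module A J] (hJ : Module.Injective A J)
    (ht : ∀ j, j ∈ gam (maximalIdeal A) J) : Module.Injective B (B ⊗[A] J) := by
  obtain ⟨k0, hk0⟩ := hk
  have htors : ∀ t : B ⊗[A] J, t ∈ gam (maximalIdeal B) (B ⊗[A] J) := fun t => by
    have : t ∈ gam (mB A B) (B ⊗[A] J) := by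
      induction t using TensorProduct.induction_on with
      | zero => exact zero_mem _
      | add a b ha hb => exact add_mem ha hb
      | tmul b j =>
        rw [gam_algebra]
        obtain ⟨k, hk⟩ := ht j
        exact ⟨k, fun r hr => by rw [← TensorProduct.tmul_smul, hk r hr, TensorProduct.tmul_zero]⟩
    obtain ⟨k, hk⟩ := this
    exact ⟨k0 * k, fun r hr => hk r (by rw [pow_mul] at hr; exact Ideal.pow_right_mono hk0 k hr)⟩
  have key : ∀ a : Ideal B, ∀ g : a →ₗ[B] B ⊗[A] J, ∃ y, ∀ z : a, g z = (z : B) • y := by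
    intro a
    induction a using IsNoetherian.induction with
    | hgt a ih => ?_
    intro g
    by_cases hat : a = ⊤
    · refine ⟨g ⟨1, hat ▸ trivial⟩, fun z => ?_⟩
      rw [← map_smul]; congr 1; exact Subtype.ext (by simp)
    obtain ⟨k, hk⟩ := ideal_kill (maximalIdeal B) a g (fun z => htors _)
    obtain ⟨b, hb, y, hy⟩ : ∃ b, b ∉ a ∧ ∃ y, ∀ c (h : c * b ∈ a), g ⟨c * b, h⟩ = c • y := by
      by_cases hka : maximalIdeal B ^ k ≤ a
      · classical
        have hex : ∃ l, maximalIdeal B ^ l ≤ a := ⟨k, hka⟩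
        obtain ⟨l, hl⟩ : ∃ l, Nat.find hex = l + 1 := Nat.exists_eq_succ_of_ne_zero fun h0 => hat (by
          have := Nat.find_spec hex
          rw [h0, pow_zero, Ideal.one_eq_top] at this
          exact top_le_iff.1 this)
        obtain ⟨b, hb, hba⟩ := Set.not_subset.1 (Nat.find_min hex (show l < _ by omega))
        have hqb : ∀ z ∈ maximalIdeal B, z * b ∈ a := fun z hz => by
          have := Nat.find_spec hex
          rw [hl, pow_succ'] at this
          exact this (Ideal.mul_mem_mul hz hb)
        obtain ⟨y, hy⟩ := baer_q hsi hmq hJ (g.comp (((LinearMap.toSpanSingleton B B b).comp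
          (maximalIdeal B).subtype).codRestrict a fun z => hqb z.1 z.2))
        refine ⟨b, hba, y, fun c hc => ?_⟩
        have hcq : c ∈ maximalIdeal B := (mem_maximalIdeal c).2 fun hu => hba (by
          obtain ⟨u, rfl⟩ := hu
          have := Ideal.mul_mem_left a (↑u⁻¹) hc
          rwa [Units.inv_mul_cancel_left] at this)
        exact hy ⟨c, hcq⟩
      · obtain ⟨b, hb, hba⟩ := Set.not_subset.1 hka
        exact ⟨b, hba, 0, fun c hc => by rw [smul_zero]; exact hk _ (Ideal.mul_mem_left _ _ hb)⟩
    let h : (a × B) →ₗ[B] B := a.subtype.coprod (LinearMap.toSpanSingleton B B b)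
    have hh : ∀ z, h z = z.1 + z.2 * b := fun z => rfl
    obtain ⟨f, hf⟩ := exists_factor h.rangeRestrict h.surjective_rangeRestrict
      (g.coprod (LinearMap.toSpanSingleton B _ y)) (fun z hz => by
        have hz : (z.1 : B) + z.2 * b = 0 := congrArg Subtype.val hz
        have hm : z.2 * b ∈ a := by rw [← neg_eq_of_add_eq_zero_right hz]; exact neg_mem z.1.2
        change g z.1 + z.2 • y = 0
        rw [← hy _ hm, ← map_add, ← map_zero g]; congr 1; exact Subtype.ext hz)
    obtain ⟨y', hy'⟩ := ih (LinearMap.range h) (lt_of_le_not_ge (fun z hz => ⟨(⟨z, hz⟩, 0), by simp [hh]⟩)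
      fun hle => hb (hle ⟨(0, 1), by simp [hh]⟩)) f
    refine ⟨y', fun z => ?_⟩
    have h1 := hf (z, 0)
    rw [hy'] at h1
    change ((z : B) + 0 * b) • y' = g z + (0 : B) • y at h1
    rw [zero_mul, zero_smul, add_zero, add_zero] at h1
    exact h1.symm
  refine Module.Baer.injective fun a g => ?_
  obtain ⟨y, hy⟩ := key a g
  exact ⟨LinearMap.toSpanSingleton B _ y, fun z hz => (hy ⟨z, hz⟩).symm⟩

end InjTensor
end GidAux

namespace GidAux
open scoped TensorProduct

section LeftRes
variable {B : Type u} [CommRing B] [IsNoetherianRing B] {X : Type u} [AddCommGroup X] [Module B X]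

theorem gi_ker {K I W : Type u} [AddCommGroup K] [Module B K] [AddCommGroup I] [Module B I] [AddCommGroup W]
    [Module B W] {i : K →ₗ[B] I} {p : I →ₗ[B] X} (hs : SE i p) (f : W →ₗ[B] X) (hK : GI B K)
    (hW : GI B W) : GI B (LinearMap.ker (p.coprod f)) := by
  refine gi_ext (i := LinearMap.codRestrict (LinearMap.ker (p.coprod f)) ((LinearMap.inl B I W).comp i)
    (fun k => by simp [hs.zero])) (p := (LinearMap.snd B I W).domRestrict (LinearMap.ker (p.coprod f)))
    (SE.mk' (fun k hk => hs.inj0 (congrArg (fun z => z.1.1) hk)) (fun k => rfl) ?_ fun c => ?_) hK hW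
  · rintro ⟨⟨a, b⟩, hz⟩ (h0 : b = 0)
    subst h0
    obtain ⟨k, rfl⟩ := hs.lift (b := a) (by simpa using hz)
    exact ⟨k, rfl⟩
  · obtain ⟨y, hy⟩ := hs.2.2 (f c)
    exact ⟨⟨(-y, c), by simp [hy]⟩, rfl⟩

theorem leftres0 (hX : GI B X) (L : List B) (hL : ∀ s ∈ L, Module.Injective B (co s X)) :
    ∃ (K I : ModuleCat.{u} B) (i : K →ₗ[B] I) (p : I →ₗ[B] X), SE i p ∧ Module.Injective B I ∧ GI B K ∧
      ∀ s ∈ L, ∃ φ : co s X →ₗ[B] I, ∀ c, p (φ c) = ev0 s X c := by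
  induction L with
  | nil =>
    obtain ⟨K, hK, I, i, p, hI, hs⟩ := hX.left
    exact ⟨K, I, i, p, hs, hI, hK, by simp⟩
  | cons s L ih =>
    obtain ⟨K, I, i, p, hs, hI, hK, hφ⟩ := ih fun t ht => hL t (by simp [ht])
    let q : (I × co s X) →ₗ[B] X := p.coprod (ev0 s X)
    have hq : Function.Surjective q := fun x => by
      obtain ⟨y, rfl⟩ := hs.2.2 x
      exact ⟨(y, 0), by simp [q]⟩
    have hsX := hL s (by simp)
    refine ⟨ModuleCat.of B (LinearMap.ker q), ModuleCat.of B (I × co s X), _, q, se_ker q hq,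
      injective_prod hI hsX, ?_, fun t ht => ?_⟩
    · exact gi_ker hs (ev0 s X) hK (gi_of_injective hsX)
    · rcases List.mem_cons.1 ht with rfl | ht
      · exact ⟨LinearMap.inr B I _, fun c => by simp [q]⟩
      · obtain ⟨φ, hφ⟩ := hφ t ht
        exact ⟨(LinearMap.inl B I _).comp φ, fun c => by simp [q, hφ]⟩

theorem leftres (hX : GI B X) {L : List B} (hL : Good L X) :
    ∃ K : ModuleCat.{u} B, GI B K ∧ Good L K ∧ Link B K X := by
  obtain ⟨K, I, i, p, hs, hI, hK, hφ⟩ := leftres0 hX L fun s hs => (hL s hs).2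
  refine ⟨K, hK, fun s hsL => ?_, I, i, p, hI, hs⟩
  obtain ⟨φ, hφ⟩ := hφ s hsL
  obtain ⟨ψ, hψ⟩ := exists_toCo co_inv φ
  have hψ' : ∀ c, coMap s p (ψ c) = c := fun c => by
    ext k
    let c' : co s X := ⟨fun j => c.1 (k + j), fun j => co.eq c (k + j)⟩
    have h1 : s ^ k • c' = c := by
      ext j; exact co.pow c k j
    change p ((ψ c).1 k) = c.1 k
    have h2 : (ψ c).1 k = φ c' := by
      rw [← hψ, ← co.pow (ψ c') k 0, ← h1, map_smul]; rfl
    rw [h2, hφ]; rfl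
  have hA : A2 s K := by
    intro y
    obtain ⟨z, hz⟩ := a2_inj hI (s := s) (fun k => i (y k))
    let c : co s X := ⟨fun k => p (z k), fun k => by
      have := congrArg p (hz k)
      rw [hs.zero, map_sub, map_smul] at this
      exact (sub_eq_zero.1 this.symm)⟩
    choose w hw using fun k => hs.lift (show p (z k - (ψ c).1 k) = 0 by
      rw [map_sub, sub_eq_zero]; exact (congrFun (congrArg Subtype.val (hψ' c)) k).symm)
    refine ⟨w, fun k => hs.1 ?_⟩
    rw [map_sub, map_smul, hw, hw, hz, co.eq (ψ c) k]
    module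
  obtain ⟨r, hr⟩ := exists_cofactor (coMap s i) (co_se hs hA).1 (LinearMap.id - ψ.comp (coMap s p))
    fun c => (co_se hs hA).lift (by simp [hψ'])
  exact ⟨hA, injective_retract (injective_co hI) (coMap s i) r fun a => (co_se hs hA).1 (by
    simp [hr, (co_se hs hA).zero])⟩

end LeftRes

section Desc
variable {R B : Type u} [CommRing R] [IsNoetherianRing R] [CommRing B] [IsNoetherianRing B] [Algebra R B]
  [Module.Flat R B]

theorem good_restrict {L : List R} {K : Type u} [AddCommGroup K] [Module R K] [Module B K]
    [IsScalarTower R B K] (h : Good (L.map (algebraMap R B)) K) : Good L K := fun s hs => by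
  obtain ⟨h1, h2⟩ := h (algebraMap R B s) (List.mem_map_of_mem hs)
  refine ⟨fun y => ?_, injective_of_equiv (injective_restrict (B := B) h2)
    { toFun := fun y => ⟨y.1, fun k => by rw [co.eq y k, algebraMap_smul]⟩
      invFun := fun y => ⟨y.1, fun k => by rw [co.eq y k, algebraMap_smul]⟩
      map_add' := fun _ _ => rfl
      map_smul' := fun _ _ => rfl
      left_inv := fun _ => rfl
      right_inv := fun _ => rfl }⟩
  obtain ⟨z, hz⟩ := h1 y
  exact ⟨z, fun k => by rw [hz k, algebraMap_smul]⟩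

/-- base change to `B` of `p`-torsion injectives is injective -/
def BH (p : Ideal R) (B : Type u) [CommRing B] [Algebra R B] : Prop :=
  ∀ J : ModuleCat.{u} R, Module.Injective R J → (∀ j : J, j ∈ gam p J) → Module.Injective B (B ⊗[R] J)

theorem desc_lift {p : Ideal R} (hp : BH p B) {L : List R} (hS : Ideal.span {s | s ∈ L} = p)
    {X J C : Type u} [AddCommGroup X] [Module R X] [Module B X] [IsScalarTower R B X]
    [AddCommGroup J] [Module R J] [Module B J] [IsScalarTower R B J] [AddCommGroup C] [Module R C]
    [Module B C] [IsScalarTower R B C] {i : X →ₗ[B] J} {q : J →ₗ[B] C} (h : SE i q)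
    (hJ : Module.Injective B J) (hX : GI B X) (hG : Good (L.map (algebraMap R B)) X) : LiftP R X := by
  have hJ' : Module.Injective R J := injective_restrict (B := B) hJ
  have h' : SE (i.restrictScalars R) (q.restrictScalars R) := ⟨h.1, h.2.1, h.2.2⟩
  refine liftP_of_one hJ' h' fun I hI f => ?_
  have hΓ := hp (ModuleCat.of R (gam p I)) (injective_gam p hI) (fun j =>
    gam_of_inj (gam p I).subtype (Submodule.subtype_injective _) j.2)
  obtain ⟨g, hg⟩ := hX.liftP.lift hΓ h (LinearMap.liftBaseChange B (f.comp (gam p I).subtype))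
  obtain ⟨g', hg'⟩ := inj_extend hJ' (gam p I).subtype (Submodule.subtype_injective _)
    ((g.restrictScalars R).comp (TensorProduct.mk R B (gam p I) 1))
  refine lift_tors h' hJ' L (good_restrict hG) hI f g' fun v hv => ?_
  have hv' : v ∈ gam p I := (mem_gam_list hS).2 fun s hs => mem_gam_span.2 (hv s hs)
  have h3 := hg (1 ⊗ₜ ⟨v, hv'⟩)
  rw [LinearMap.liftBaseChange_tmul, one_smul] at h3
  have h4 := hg' ⟨v, hv'⟩
  exact (congrArg q h4).trans h3

theorem desc_gi {p : Ideal R} (hp : BH p B) {L : List R} (hS : Ideal.span {s | s ∈ L} = p)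
    {X : Type u} [AddCommGroup X] [Module R X] [Module B X] [IsScalarTower R B X] (hX : GI B X)
    (hG : Good (L.map (algebraMap R B)) X) : GI R X := by
  refine gi_of_closed (P := fun X => ∃ (_ : Module B X) (_ : IsScalarTower R B X), GI B X ∧
    Good (L.map (algebraMap R B)) X) ?_ (ModuleCat.of R X) ⟨inferInstance, inferInstance, hX, hG⟩
  rintro X ⟨_, _, hX, hG⟩
  obtain ⟨C, hC, J, i, q, hJ, h⟩ := hX.right
  obtain ⟨K, hK, hKG, J', i', q', hJ', h'⟩ := leftres hX hG
  letI : Module R C := Module.compHom C (algebraMap R B)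
  letI : Module R J := Module.compHom J (algebraMap R B)
  letI : Module R K := Module.compHom K (algebraMap R B)
  letI : Module R J' := Module.compHom J' (algebraMap R B)
  haveI : IsScalarTower R B C := ⟨fun r a d => by rw [Algebra.smul_def, mul_smul]; rfl⟩
  haveI : IsScalarTower R B J := ⟨fun r a d => by rw [Algebra.smul_def, mul_smul]; rfl⟩
  haveI : IsScalarTower R B K := ⟨fun r a d => by rw [Algebra.smul_def, mul_smul]; rfl⟩
  haveI : IsScalarTower R B J' := ⟨fun r a d => by rw [Algebra.smul_def, mul_smul]; rfl⟩
  refine ⟨desc_lift hp hS h hJ hX hG, ⟨ModuleCat.of R K, ⟨inferInstanceAs (Module B K), inferInstanceAs (IsScalarTower R B K), hK, hKG⟩, ModuleCat.of R J',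
    i'.restrictScalars R, q'.restrictScalars R, injective_restrict (B := B) hJ', ⟨h'.1, h'.2.1, h'.2.2⟩⟩,
    ModuleCat.of R C, ⟨inferInstanceAs (Module B C),
    inferInstanceAs (IsScalarTower R B C), hC, fun s hs => ?_⟩, ModuleCat.of R J,
    i.restrictScalars R, q.restrictScalars R, injective_restrict (B := B) hJ, ⟨h.1, h.2.1, h.2.2⟩⟩
  exact ⟨(a2_inj hJ).of_surj q h.2.2, (co_se h (hG s hs).1).injective_right (hG s hs).2 (injective_co hJ)⟩

theorem desc {p : Ideal R} (hp : BH p B) {L : List R} (hS : Ideal.span {s | s ∈ L} = p) (n : ℕ) :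
    ∀ {X : Type u} [AddCommGroup X] [Module R X] [Module B X] [IsScalarTower R B X] (hX : GD B n X)
    (hG : Good (L.map (algebraMap R B)) X), GD R n X := by
  induction n with
  | zero => exact fun hX hG => desc_gi hp hS hX hG
  | succ n ih =>
    intro X _ _ _ _ hX hG
    obtain ⟨C, hl⟩ := exists_link (R := B) X
    obtain ⟨J, i, q, hJ, h⟩ := id hl
    letI : Module R C := Module.compHom C (algebraMap R B)
    letI : Module R J := Module.compHom J (algebraMap R B)
    haveI : IsScalarTower R B C := ⟨fun r a d => by rw [Algebra.smul_def, mul_smul]; rfl⟩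
    haveI : IsScalarTower R B J := ⟨fun r a d => by rw [Algebra.smul_def, mul_smul]; rfl⟩
    exact gd_of_link ⟨ModuleCat.of R J, i.restrictScalars R, q.restrictScalars R,
      injective_restrict (B := B) hJ, h.1, h.2.1, h.2.2⟩ (ih (gd_link hl hX) fun s hs =>
      ⟨(a2_inj hJ).of_surj q h.2.2, (co_se h (hG s hs).1).injective_right (hG s hs).2 (injective_co hJ)⟩)

theorem gd_retract {n : ℕ} {X Y : Type u} [AddCommGroup X] [Module R X] [AddCommGroup Y] [Module R Y]
    (a : X →ₗ[R] Y) (b : Y →ₗ[R] X) (hab : ∀ x, b (a x) = x) (hY : GD R n Y) : GD R (n+1) X := by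
  have hN : GD R n (ℕ → Y) := (gd_pi (ι := ULift.{u} ℕ) (A := fun _ => Y) fun _ => hY).of_equiv
    (LinearEquiv.funCongrLeft R Y Equiv.ulift.symm)
  let e := a.comp b
  have he : ∀ y, e (e y) = e y := fun y => by simp [e, hab]
  refine gd_ker (i := (LinearMap.single R (fun _ : ℕ => Y) 0).comp a) (p := LinearMap.pi fun k =>
    (LinearMap.id - e).comp (LinearMap.proj k) + e.comp (LinearMap.proj (k+1))) (SE.mk' ?_ ?_ ?_ ?_) hN hN
  · intro x hx
    have : a x = 0 := by simpa using congrFun hx 0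
    rw [← hab x, this, map_zero]
  · intro x
    funext k
    rcases k with - | k <;> simp [e, hab]
  · intro y hy
    have h1 : ∀ k, y k - e (y k) + e (y (k+1)) = 0 := fun k => congrFun hy k
    have h2 : ∀ k, e (y (k+1)) = 0 := fun k => by simpa [he] using congrArg e (h1 k)
    have h3 : ∀ k, y k = e (y k) := fun k => by simpa [h2, sub_eq_zero] using h1 k
    refine ⟨b (y 0), funext fun k => ?_⟩
    rcases k with - | k
    · simpa [e] using (h3 0).symm
    · rw [h3 (k+1), h2]; simp
  · intro z
    refine ⟨fun k => Nat.casesOn k (z 0 - e (z 0)) fun k => e (z k) + (z (k+1) - e (z (k+1))),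
      funext fun k => ?_⟩
    rcases k with - | k <;> simp [he]

theorem z_fin {s : R} {T M : Type u} [AddCommGroup T] [Module R T] [Module.Flat R T] [AddCommGroup M]
    [Module R M] [Module.Finite R M] (h1 : A2 s T) (h2 : Subsingleton (co s T)) :
    A2 s (T ⊗[R] M) ∧ Subsingleton (co s (T ⊗[R] M)) := by
  have hA : ∀ c : ℕ, A2 s (T ⊗[R] (Fin c → R)) := fun c => by
    have : A2 s (Fin c → T) := fun y => by
      choose z hz using fun j : Fin c => h1 (fun k => y k j)
      exact ⟨fun k j => z j k, fun k => funext fun j => hz j k⟩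
    exact this.of_surj (TensorProduct.piScalarRight R R T (Fin c)).symm.toLinearMap (LinearEquiv.surjective _)
  have hM : ∀ (M : Type u) [AddCommGroup M] [Module R M] [Module.Finite R M], A2 s (T ⊗[R] M) := by
    intro M _ _ _
    obtain ⟨c, q, hq⟩ := Module.Finite.exists_fin' R M
    exact (hA c).of_surj (q.lTensor T) (LinearMap.lTensor_surjective T hq)
  refine ⟨hM M, ?_⟩
  obtain ⟨c, q, hq⟩ := Module.Finite.exists_fin' R M
  have hs := co_se (se_lT T (se_ker q hq)) (hM (LinearMap.ker q)) (s := s)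
  refine subsingleton_of_forall_eq 0 fun y => ?_
  obtain ⟨w, rfl⟩ := hs.2.2 y
  have : w = 0 := by
    ext k
    refine (TensorProduct.piScalarRight R R T (Fin c)).injective (funext fun j => ?_)
    have h3 := h2.elim (coMap s ((LinearMap.proj j).comp
      (TensorProduct.piScalarRight R R T (Fin c)).toLinearMap) w) 0
    simpa using congrFun (congrArg Subtype.val h3) k
  rw [this, map_zero]

theorem desc_T {p : Ideal R} (hp : BH p B) {n : ℕ} {M : Type u} [AddCommGroup M] [Module R M]
    [Module.Finite R M] (hn : ∀ (F : Type u) [AddCommGroup F] [Module R F] [Module B F] [IsScalarTower R B F],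
      Module.Flat B F → GD B n (F ⊗[R] M)) {E G Q : Type u} [AddCommGroup E] [Module R E]
    [AddCommGroup G] [Module R G] [AddCommGroup Q] [Module R Q] [Module B Q] [IsScalarTower R B Q]
    (hE : Module.Injective R E) (ht : ∀ e, e ∈ gam p E) (hG : Module.Injective R G)
    (hQ : Module.Injective B Q) (ι : G →ₗ[R] Q) (hι : Function.Injective ι) :
    GD R (n+1) ((E →ₗ[R] G) ⊗[R] M) := by
  obtain ⟨L, hS⟩ := exists_list p
  have hf : Module.Flat B (E →ₗ[R] Q) := by
    have := flat_hom (hp (ModuleCat.of R E) hE ht) hQ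
    exact Module.Flat.of_linearEquiv (LinearMap.liftBaseChangeEquiv B)
  have hf' := Module.Flat.trans R B (E →ₗ[R] Q)
  have hY : GD R n ((E →ₗ[R] Q) ⊗[R] M) := by
    refine desc hp hS n (hn _ hf) fun s' hs' => ?_
    obtain ⟨s, hs, rfl⟩ := List.mem_map.1 hs'
    obtain ⟨h1, h2⟩ := z_fin (s := s) (M := M) (a2_hom (G := E) (injective_restrict (B := B) hQ))
      (subsingleton_of_forall_eq 0 fun c => by
        ext k e
        obtain ⟨N, hN⟩ := mem_gam_span.1 ((mem_gam_list hS).1 (ht e) s hs)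
        change c.1 k e = 0
        rw [← co.pow c N k, LinearMap.smul_apply, ← map_smul, hN, map_zero])
    refine ⟨fun y => ?_, @injective_sub _ _ _ _ _ _ (subsingleton_of_forall_eq 0 fun c => ?_)⟩
    · obtain ⟨z, hz⟩ := h1 y
      exact ⟨z, fun k => by rw [hz k, algebraMap_smul]⟩
    · have := h2.elim ⟨c.1, fun k => by rw [co.eq c k, algebraMap_smul]⟩ 0
      exact Subtype.ext (show c.1 = 0 from congrArg Subtype.val this)
  obtain ⟨ρ, hρ⟩ := inj_extend hG _ hι LinearMap.id
  refine gd_retract ((LinearMap.compRight R ι).rTensor M) ((LinearMap.compRight R ρ).rTensor M) (fun x => ?_) hY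
  rw [← LinearMap.comp_apply, ← LinearMap.rTensor_comp, show (LinearMap.compRight R ρ).comp
    (LinearMap.compRight (M := E) R ι) = LinearMap.id from LinearMap.ext fun f => LinearMap.ext fun e => hρ _,
    LinearMap.rTensor_id, LinearMap.id_apply]

end Desc
end GidAux

namespace GidAux
open scoped TensorProduct

section Res
variable {R : Type u} [CommRing R] [IsNoetherianRing R]

/-- `E` behaves like the injective hull of `R/p`, with `e0` generating a copy of `R/p`. -/
structure PH (p : Ideal R) (E : Type u) [AddCommGroup E] [Module R E] (e0 : E) : Prop where
  prime : p.IsPrime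
  inj : Module.Injective R E
  tors : ∀ e : E, e ∈ gam p E
  inv : ∀ s, s ∉ p → Inv s E
  ann : ∀ r : R, r • e0 = 0 ↔ r ∈ p
  soc : ∀ e : E, e ∈ kil p E → ∃ s, s ∉ p ∧ ∃ r : R, s • e = r • e0

theorem mem_sm {a : Ideal R} {m : ℕ} {s : Fin m → R} (hs : Submodule.span R (Set.range s) = a)
    {X : Type u} [AddCommGroup X] [Module R X] {x : X} :
    x ∈ (a • ⊤ : Submodule R X) ↔ ∃ β : Fin m → X, x = ∑ i, s i • β i := by
  constructor
  · intro hx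
    induction hx using Submodule.smul_induction_on' with
    | smul r hr y _ =>
      rw [← hs, Submodule.mem_span_range_iff_exists_fun] at hr
      obtain ⟨c, rfl⟩ := hr
      exact ⟨fun i => c i • y, by simp [Finset.sum_smul, smul_smul, mul_comm]⟩
    | add y _ z _ hy hz =>
      obtain ⟨β, rfl⟩ := hy
      obtain ⟨γ, rfl⟩ := hz
      exact ⟨β + γ, by simp [smul_add, Finset.sum_add_distrib]⟩
  · rintro ⟨β, rfl⟩
    exact sum_mem fun i _ => Submodule.smul_mem_smul (hs ▸ Submodule.subset_span ⟨i, rfl⟩) trivial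

theorem tens_kill {F E : Type u} [AddCommGroup F] [Module R F] [AddCommGroup E] [Module R E] {a : Ideal R}
    {y : F} (hy : y ∈ (a • ⊤ : Submodule R F)) {e : E} (he : e ∈ kil a E) : y ⊗ₜ[R] e = 0 := by
  induction hy using Submodule.smul_induction_on' with
  | smul r hr z _ => rw [TensorProduct.smul_tmul, he r hr, TensorProduct.tmul_zero]
  | add y _ z _ hy hz => rw [TensorProduct.add_tmul, hy, hz, add_zero]

theorem inv_tens {s : R} {E : Type u} [AddCommGroup E] [Module R E] (h : Inv s E) (F : Type u) [AddCommGroup F]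
    [Module R F] {z : F ⊗[R] E} (hz : s • z = 0) : z = 0 := by
  let e : E ≃ₗ[R] E := LinearEquiv.ofBijective (LinearMap.lsmul R E s) h
  have h1 : s • e.symm.toLinearMap = LinearMap.id := LinearMap.ext fun x => e.apply_symm_apply x
  rw [← LinearMap.id_apply (R := R) z, ← LinearMap.lTensor_id, ← h1, LinearMap.lTensor_smul,
    LinearMap.smul_apply, ← map_smul, hz, map_zero]

section One
variable {p : Ideal R} {E : Type u} [AddCommGroup E] [Module R E] {e0 : E}
  {Fl : Type u} [AddCommGroup Fl] [Module R Fl] [Module.Flat R Fl]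

theorem PH.e0_mem (h : PH p E e0) : e0 ∈ kil p E := fun r hr => (h.ann r).2 hr

theorem PH.tz (h : PH p E e0) {w : Fl} (hw : w ⊗ₜ[R] e0 = 0) : w ∈ (p • ⊤ : Submodule R Fl) := by
  let g : (R ⧸ p) →ₗ[R] E := Submodule.liftQ p (LinearMap.toSpanSingleton R E e0) fun r hr => (h.ann r).2 hr
  have hg : Function.Injective g := (injective_iff_map_eq_zero g).2 fun z hz => by
    obtain ⟨r, rfl⟩ := Submodule.Quotient.mk_surjective p z
    exact (Submodule.Quotient.mk_eq_zero p).2 ((h.ann r).1 hz)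
  have h1 : w ⊗ₜ[R] (Submodule.Quotient.mk 1 : R ⧸ p) = 0 :=
    Module.Flat.lTensor_preserves_injective_linearMap (M := Fl) g hg (by
      rw [LinearMap.lTensor_tmul, map_zero, ← hw, show g (Submodule.Quotient.mk 1) = e0 from one_smul R e0])
  have h2 := TensorProduct.tensorQuotEquivQuotSMul_tmul_mk p w 1
  rw [one_smul] at h2
  exact (Submodule.Quotient.mk_eq_zero _).1 (h2.symm.trans ((congrArg _ h1).trans (map_zero _)))

theorem PH.tf (h : PH p E e0) {s : R} (hs : s ∉ p) {z : Fl} (hz : s • z ∈ (p • ⊤ : Submodule R Fl)) :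
    z ∈ (p • ⊤ : Submodule R Fl) :=
  h.tz (inv_tens (h.inv s hs) Fl (by rw [TensorProduct.smul_tmul', tens_kill hz h.e0_mem]))

theorem PH.zero (h : PH p E e0) (hK : ∀ y : Fl, y ∈ (p • ⊤ : Submodule R Fl)) (z : Fl ⊗[R] E) : z = 0 := by
  induction z using TensorProduct.induction_on with
  | zero => rfl
  | add a b ha hb => rw [ha, hb, add_zero]
  | tmul y e =>
    obtain ⟨k, hk⟩ := h.tors e
    have : ∀ k, (p ^ k • ⊤ : Submodule R Fl) = ⊤ := fun k => by
      induction k with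
      | zero => simp
      | succ k ih => rw [pow_succ, Submodule.mul_smul, (eq_top_iff.2 fun y _ => hK y : (p • ⊤ : Submodule R Fl) = ⊤), ih]
    exact tens_kill (a := p ^ k) (by rw [this]; trivial) hk

theorem PH.hom_inv (h : PH p E e0) {s : R} (hs : s ∉ p) {G : Type u} [AddCommGroup G] [Module R G] (f : E →ₗ[R] G) :
    ∃ g : E →ₗ[R] G, s • g = f := by
  let e : E ≃ₗ[R] E := LinearEquiv.ofBijective (LinearMap.lsmul R E s) (h.inv s hs)
  exact ⟨f.comp e.symm.toLinearMap, LinearMap.ext fun x => by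
    rw [LinearMap.smul_apply, LinearMap.comp_apply, ← map_smul]; exact congrArg f (e.apply_symm_apply x)⟩

theorem PH.loc (h : PH p E e0) (τ : E →ₗ[R] Fl ⊗[R] E) : ∃ s, s ∉ p ∧ ∃ y : Fl,
    s • τ - TensorProduct.mk R Fl E y ∈ (p • ⊤ : Submodule R (E →ₗ[R] Fl ⊗[R] E)) := by
  have hp := h.prime
  obtain ⟨w, hw⟩ := tensor_kil (τ e0) fun r hr => by rw [← map_smul, h.e0_mem r hr, map_zero]
  have h1 : ∃ s, s ∉ p ∧ ∃ y : Fl, s • LinearMap.lTensor Fl (kil p E).subtype w = y ⊗ₜ e0 := by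
    clear hw
    induction w using TensorProduct.induction_on with
    | zero => exact ⟨1, hp.one_notMem, 0, by simp⟩
    | add a b ha hb =>
      obtain ⟨s, hs, y, hy⟩ := ha
      obtain ⟨t, ht, z, hz⟩ := hb
      exact ⟨s * t, hp.mul_notMem hs ht, t • y + s • z, by
        rw [map_add, smul_add, mul_comm s t, mul_smul, hy, mul_comm t s, mul_smul, hz, TensorProduct.add_tmul]; rfl⟩
    | tmul y e =>
      obtain ⟨s, hs, r, hr⟩ := h.soc e.1 e.2
      exact ⟨s, hs, r • y, by
        rw [LinearMap.lTensor_tmul, ← TensorProduct.tmul_smul, TensorProduct.smul_tmul, ← hr]; rfl⟩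
  obtain ⟨s, hs, y, hy⟩ := h1
  refine ⟨s, hs, y, ?_⟩
  obtain ⟨m, σ, hσ⟩ := Submodule.fg_iff_exists_fin_generating_family.1 (IsNoetherian.noetherian p)
  generalize hδ : s • τ - TensorProduct.mk R Fl E y = δ
  have h0 : ∀ e ∈ kil p E, δ e = 0 := fun e he => by
    obtain ⟨t, ht, r, hr⟩ := h.soc e he
    refine inv_tens (h.inv t ht) Fl ?_
    rw [← map_smul, hr, map_smul, ← hδ]
    simp [← hw, hy]
  obtain ⟨f, hf⟩ := inj_extend' (injective_flat h.inj (F := Fl))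
    (∑ i, σ i • LinearMap.single R (fun _ : Fin m => E) i) δ (fun e he => h0 e (by
      have h2 : p ≤ LinearMap.ker (LinearMap.toSpanSingleton R E e) := by
        rw [← hσ, Submodule.span_le]
        rintro _ ⟨i, rfl⟩
        simpa [LinearMap.sum_apply, Finset.sum_apply, Pi.single_apply] using congrFun he i
      exact fun r hr => h2 hr))
  refine (mem_sm hσ).2 ⟨fun i => f.comp (LinearMap.single R (fun _ : Fin m => E) i), LinearMap.ext fun e => ?_⟩
  rw [← hf]; simp [map_sum]

end One
theorem flat_coker {X C Z : Type u} [AddCommGroup X] [Module R X] [AddCommGroup C] [Module R C]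
    [Module.Flat R C] [AddCommGroup Z] [Module R Z] {j : X →ₗ[R] C} {q : C →ₗ[R] Z} (h : SE j q)
    (hj : ∀ (a : Ideal R) (y : X), j y ∈ (a • ⊤ : Submodule R C) → y ∈ (a • ⊤ : Submodule R X)) :
    Module.Flat R Z := by
  let Φ : ∀ (a : Ideal R) (Y : Type u) [AddCommGroup Y] [Module R Y], a ⊗[R] Y →ₗ[R] Y := fun a Y _ _ =>
    TensorProduct.lift ((LinearMap.lsmul R Y).comp a.subtype)
  have hΦ : ∀ (a : Ideal R) {Y W : Type u} [AddCommGroup Y] [Module R Y] [AddCommGroup W] [Module R W]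
      (f : Y →ₗ[R] W) (z : a ⊗[R] Y), Φ a W (f.lTensor a z) = f (Φ a Y z) := fun a Y W _ _ _ _ f z => by
    induction z using TensorProduct.induction_on with
    | zero => simp
    | add x y hx hy => simp only [map_add, hx, hy]
    | tmul r y => simp [Φ]
  refine Module.Flat.iff_lift_lsmul_comp_subtype_injective.2 fun a _ =>
    (injective_iff_map_eq_zero (Φ a Z)).2 fun z hz => ?_
  obtain ⟨c, rfl⟩ := LinearMap.lTensor_surjective a h.2.2 z
  rw [hΦ] at hz
  obtain ⟨y, hy⟩ := h.lift hz
  have hc : ∀ c, Φ a C c ∈ (a • ⊤ : Submodule R C) := fun c => by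
    induction c using TensorProduct.induction_on with
    | zero => simp
    | add x y hx hy => rw [map_add]; exact add_mem hx hy
    | tmul r y => exact Submodule.smul_mem_smul r.2 trivial
  have hy' : ∃ w, Φ a X w = y := by
    have := hj a y (hy ▸ hc c)
    clear hy
    induction this using Submodule.smul_induction_on' with
    | smul r hr z _ => exact ⟨⟨r, hr⟩ ⊗ₜ z, rfl⟩
    | add y _ z _ hy hz =>
      obtain ⟨v, rfl⟩ := hy
      obtain ⟨w, rfl⟩ := hz
      exact ⟨v + w, map_add _ _ _⟩
  obtain ⟨w, rfl⟩ := hy'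
  have h2 : j.lTensor a w = c :=
    Module.Flat.iff_lift_lsmul_comp_subtype_injective.1 inferInstance (IsNoetherian.noetherian a)
      ((hΦ a j w).trans hy)
  rw [← h2, ← LinearMap.comp_apply, ← LinearMap.lTensor_comp, show q.comp j = 0 from LinearMap.ext h.zero]
  simp

theorem gd_pi_tens {n : ℕ} {ι : Type u} (X : ι → ModuleCat.{u} R) {M : Type u} [AddCommGroup M] [Module R M]
    [Module.Finite R M] (h : ∀ i, GD R n (X i ⊗[R] M)) : GD R n ((∀ i, X i) ⊗[R] M) := by
  let π : ∀ i, (∀ i, X i) →ₗ[R] X i := fun i => LinearMap.proj i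
  have hnat : ∀ (c : ℕ) (i : ι) (w : (∀ i, X i) ⊗[R] (Fin c → R)) (k : Fin c), TensorProduct.piScalarRight R R (X i)
      (Fin c) ((π i).rTensor _ w) k = TensorProduct.piScalarRight R R (∀ i, X i) (Fin c) w k i := fun c i w k => by
    induction w using TensorProduct.induction_on with
    | zero => simp
    | add x y hx hy => simp only [map_add, Pi.add_apply, hx, hy]
    | tmul x f => simp [π]
  have hs : ∀ (M : Type u) [AddCommGroup M] [Module R M] [Module.Finite R M] (z : ∀ i, X i ⊗[R] M),
      ∃ w, ∀ i, (π i).rTensor M w = z i := by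
    intro M _ _ _ z
    obtain ⟨c, q, hq⟩ := Module.Finite.exists_fin' R M
    choose v hv using fun i => LinearMap.lTensor_surjective (X i) hq (z i)
    refine ⟨q.lTensor _ ((TensorProduct.piScalarRight R R (∀ i, X i) (Fin c)).symm
      fun k i => TensorProduct.piScalarRight R R (X i) (Fin c) (v i) k), fun i => ?_⟩
    rw [← hv i, ← LinearMap.comp_apply, LinearMap.rTensor_comp_lTensor, ← LinearMap.lTensor_comp_rTensor,
      LinearMap.comp_apply]
    congr 1
    exact (TensorProduct.piScalarRight R R (X i) (Fin c)).injective (funext fun k => by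
      rw [hnat, LinearEquiv.apply_symm_apply])
  let Φ : (∀ i, X i) ⊗[R] M →ₗ[R] ∀ i, X i ⊗[R] M := LinearMap.pi fun i => (π i).rTensor M
  refine (gd_pi h).of_equiv (LinearEquiv.ofBijective Φ ⟨(injective_iff_map_eq_zero Φ).2 fun z hz => ?_,
    fun z => ?_⟩).symm
  · obtain ⟨c, q, hq⟩ := Module.Finite.exists_fin' R M
    obtain ⟨v, rfl⟩ := LinearMap.lTensor_surjective (∀ i, X i) hq z
    have h1 := fun i => (lTensor_exact (X i) (se_ker q hq).2.1 hq ((π i).rTensor _ v)).1 (by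
      rw [← LinearMap.comp_apply, LinearMap.lTensor_comp_rTensor, ← LinearMap.rTensor_comp_lTensor]
      exact congrFun hz i)
    choose t ht using h1
    obtain ⟨w, hw⟩ := hs (LinearMap.ker q) t
    have h2 : (LinearMap.ker q).subtype.lTensor _ w = v :=
      (TensorProduct.piScalarRight R R _ (Fin c)).injective (funext fun k => funext fun i => by
        rw [← hnat, ← hnat, ← ht, ← hw, ← LinearMap.comp_apply, ← LinearMap.comp_apply,
          LinearMap.lTensor_comp_rTensor, LinearMap.rTensor_comp_lTensor])
    rw [← h2]
    exact (lTensor_exact _ (se_ker q hq).2.1 hq _).2 ⟨w, rfl⟩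
  · obtain ⟨w, hw⟩ := hs M z
    exact ⟨w, funext hw⟩

variable {E : PrimeSpectrum R → ModuleCat.{u} R} {e0 : ∀ P, E P}
  {Fl : Type u} [AddCommGroup Fl] [Module R Fl] [Module.Flat R Fl]

theorem exists_sep (hE : ∀ P, PH P.asIdeal (E P) (e0 P)) {a : Ideal R} {y : Fl}
    (hy : y ∉ (a • ⊤ : Submodule R Fl)) : ∃ P, ∃ e ∈ kil a (E P), y ⊗ₜ[R] e ≠ 0 := by
  obtain ⟨b, ⟨hab, hyb⟩, hmax⟩ := WellFounded.has_min (wellFounded_gt (α := Ideal R))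
    {b | a ≤ b ∧ y ∉ (b • ⊤ : Submodule R Fl)} ⟨a, le_rfl, hy⟩
  have : Nontrivial (R ⧸ b) := Ideal.Quotient.nontrivial_iff.2 fun hb => hyb (by simp [hb])
  obtain ⟨p, hp⟩ := associatedPrimes.nonempty R (R ⧸ b)
  obtain ⟨hp, x, hx⟩ := isAssociatedPrime_iff.1 hp
  obtain ⟨v, rfl⟩ := Submodule.Quotient.mk_surjective b x
  have hpv : ∀ r, r ∈ p ↔ r * v ∈ b := fun r => by
    rw [hx, Submodule.mem_colon_singleton, Submodule.mem_bot, ← Submodule.Quotient.mk_smul,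
      Submodule.Quotient.mk_eq_zero, smul_eq_mul]
  have hv : v ∉ b := fun hv => hp.one_notMem ((hpv 1).2 (by rwa [one_mul]))
  have hyv : y ∈ ((b ⊔ Ideal.span {v}) • ⊤ : Submodule R Fl) := by
    by_contra hh
    exact hmax _ ⟨hab.trans le_sup_left, hh⟩ (lt_of_le_of_ne le_sup_left fun hbe => hv (by
      rw [hbe]; exact Ideal.mem_sup_right (Ideal.mem_span_singleton_self v)))
  rw [Submodule.sup_smul] at hyv
  obtain ⟨w', hw', z, hz, rfl⟩ := Submodule.mem_sup.1 hyv
  rw [Submodule.ideal_span_singleton_smul] at hz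
  obtain ⟨w, -, rfl⟩ := Submodule.mem_smul_pointwise_iff_exists _ _ _ |>.1 hz
  have h := hE ⟨p, hp⟩
  obtain ⟨f, hf⟩ := inj_extend' h.inj (LinearMap.toSpanSingleton R (R ⧸ b) (Submodule.Quotient.mk v))
    (LinearMap.toSpanSingleton R _ (e0 ⟨p, hp⟩)) fun r hr => (h.ann r).2 ((hpv r).2
      ((Submodule.Quotient.mk_eq_zero b).1 hr))
  have hb : f (Submodule.Quotient.mk 1) ∈ kil b (E ⟨p, hp⟩) := fun r hr => by
    rw [← map_smul, ← Submodule.Quotient.mk_smul, (Submodule.Quotient.mk_eq_zero b).2 (by simpa using hr), map_zero]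
  refine ⟨⟨p, hp⟩, _, fun r hr => hb r (hab hr), fun h0 => hyb (add_mem hw' ?_)⟩
  rw [TensorProduct.add_tmul, tens_kill hw' hb, zero_add, TensorProduct.smul_tmul, ← map_smul,
    ← Submodule.Quotient.mk_smul, smul_eq_mul, mul_one] at h0
  have h1 := hf 1
  simp only [LinearMap.toSpanSingleton_apply, one_smul] at h1
  rw [h1] at h0
  exact Submodule.smul_induction_on (p := fun w => v • w ∈ (b • ⊤ : Submodule R Fl)) (h.tz h0)
    (fun r hr z _ => by rw [smul_smul, mul_comm]; exact Submodule.smul_mem_smul ((hpv r).1 hr) trivial)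
    fun x z hx hz => by rw [smul_add]; exact add_mem hx hz

theorem mem_pi_sm {ι : Type u} {X : ι → ModuleCat.{u} R} {a : Ideal R} {c : ∀ i, X i}
    (h : ∀ i, c i ∈ (a • ⊤ : Submodule R (X i))) : c ∈ (a • ⊤ : Submodule R (∀ i, X i)) := by
  obtain ⟨m, s, hs⟩ := Submodule.fg_iff_exists_fin_generating_family.1 (IsNoetherian.noetherian a)
  choose β hβ using fun i => (mem_sm hs).1 (h i)
  exact (mem_sm hs).2 ⟨fun k i => β i k, funext fun i => by simp [hβ i]⟩

/-- the resolution of a flat module by products of modules of homomorphisms between injectives -/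
theorem resolve (hE : ∀ P, PH P.asIdeal (E P) (e0 P)) {M : Type u} [AddCommGroup M] [Module R M] [Module.Finite R M] {n : ℕ}
    (hn : ∀ P (Fl : Type u) [AddCommGroup Fl] [Module R Fl], Module.Flat R Fl →
      GD R n ((E P →ₗ[R] Fl ⊗[R] E P) ⊗[R] M)) (ht : PrimeSpectrum R → ℕ) (hm : StrictMono ht) (N : ℕ) :
    ∀ (Fl : Type u) [AddCommGroup Fl] [Module R Fl] [Module.Flat R Fl],
    (∀ P, N ≤ ht P → ∀ y : Fl, y ∈ (P.asIdeal • ⊤ : Submodule R Fl)) → GD R (n + N) (Fl ⊗[R] M) := by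
  induction N with
  | zero =>
    intro Fl _ _ _ hK
    have : Subsingleton Fl := subsingleton_of_forall_eq 0 fun y => by
      by_contra hy
      obtain ⟨P, e, -, he⟩ := exists_sep hE (a := ⊥) (y := y) (by simpa using hy)
      exact he ((hE P).zero (hK P (Nat.zero_le _)) _)
    exact gi_gd (gi_of_injective injective_sub)
  | succ N ih =>
    intro Fl _ _ _ hK
    let T : PrimeSpectrum R → ModuleCat.{u} R := fun P => ModuleCat.of R (E P →ₗ[R] Fl ⊗[R] E P)
    let j : Fl →ₗ[R] ∀ P, T P := LinearMap.pi fun P => TensorProduct.mk R Fl (E P)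
    have hpur : ∀ (a : Ideal R) (y : Fl), j y ∈ (a • ⊤ : Submodule R (∀ P, T P)) →
        y ∈ (a • ⊤ : Submodule R Fl) := fun a y hy => by
      by_contra hh
      obtain ⟨P, e, he, hne⟩ := exists_sep hE hh
      obtain ⟨m, s, hs⟩ := Submodule.fg_iff_exists_fin_generating_family.1 (IsNoetherian.noetherian a)
      obtain ⟨β, hβ⟩ := (mem_sm hs).1 hy
      refine hne ?_
      change (j y P : E P →ₗ[R] Fl ⊗[R] E P) e = 0
      rw [hβ, Finset.sum_apply, LinearMap.sum_apply]
      refine Finset.sum_eq_zero fun i _ => (map_smul (β i P : E P →ₗ[R] Fl ⊗[R] E P) (s i) e).symm.trans ?_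
      rw [he (s i) (hs ▸ Submodule.subset_span ⟨i, rfl⟩), map_zero]
    have hflat : Module.Flat R (∀ P, T P) := flat_pi_hom (fun P => (hE P).inj) fun P => injective_flat (hE P).inj
    have hs := se_mkQ j ((injective_iff_map_eq_zero j).2 fun y hy => by simpa using hpur ⊥ y (by simp [hy]))
    have hf := flat_coker hs hpur
    refine gd_ker (A := Fl ⊗[R] M) ⟨?_, rTensor_exact M hs.2.1 hs.2.2, LinearMap.rTensor_surjective M hs.2.2⟩ ((gd_pi_tens T fun P => hn P Fl inferInstance).mono_le (Nat.le_add_right n N)) (ih _ fun P hP z => ?_)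
    · have h1 := LinearMap.lTensor_injective_of_exact_of_flat _ hs.2.2 j hs.1 hs.2.1 M
      rw [← LinearMap.comm_comp_rTensor_comp_comm_eq] at h1
      simpa using h1
    obtain ⟨c, rfl⟩ := hs.2.2 z
    obtain ⟨s, hsP, y, hy⟩ := (hE P).loc (c P)
    refine (hE P).tf hsP ?_
    have h1 : s • c - j y ∈ (P.asIdeal • ⊤ : Submodule R (∀ P, T P)) := mem_pi_sm fun P' => by
      by_cases hle : P ≤ P'
      · rcases hle.eq_or_lt with rfl | hlt
        · exact hy
        · have h0 : (s • c - j y) P' = 0 := LinearMap.ext fun e => (hE P').zero (hK P' (by have := hm hlt; lia)) _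
          rw [h0]; exact zero_mem _
      · obtain ⟨r, hr, hr'⟩ := Set.not_subset.1 hle
        obtain ⟨g, hg⟩ := (hE P').hom_inv hr' ((s • c - j y) P')
        rw [← hg]
        exact Submodule.smul_mem_smul hr trivial
    have h2 := Submodule.mem_map_of_mem (f := (LinearMap.range j).mkQ) h1
    rw [Submodule.map_smul'', map_sub, hs.zero, sub_zero, map_smul] at h2
    exact Submodule.smul_mono le_rfl le_top h2

end Res
end GidAux

namespace GidAux
open scoped TensorProduct

section Fin
variable {R : Type u} [CommRing R] [IsNoetherianRing R] {p : Ideal R}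

theorem gam_tens {F J : Type u} [AddCommGroup F] [Module R F] [AddCommGroup J] [Module R J]
    (h : ∀ j, j ∈ gam p J) (z : F ⊗[R] J) : z ∈ gam p (F ⊗[R] J) := by
  induction z using TensorProduct.induction_on with
  | zero => exact zero_mem _
  | add a b ha hb => exact add_mem ha hb
  | tmul f j => exact gam_map (TensorProduct.mk R F J f) (h j)

/-- the injective hull of the residue field of the localization at `p`, as an `R`-module -/
theorem ph_hull [p.IsPrime] {B : Type u} [CommRing B] [Algebra R B] [IsLocalization.AtPrime B p] [IsLocalRing B]
    {E : Type u} [AddCommGroup E] [Module R E] [Module B E] [IsScalarTower R B E] {e0 : E} (h : Hull B E e0) :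
    PH p E e0 := by
  have hfl : Module.Flat R B := IsLocalization.flat B p.primeCompl
  have hpm := IsLocalization.AtPrime.map_eq_maximalIdeal p B
  have hinv : ∀ s, s ∉ p → Inv s E := fun s hs => by
    obtain ⟨v, hv⟩ := IsLocalization.map_units B (⟨s, hs⟩ : p.primeCompl)
    have : (fun w : E => s • w) = fun w => v • w := funext fun w => by
      rw [Units.smul_def, hv, algebraMap_smul]
    rw [Inv, this]; exact MulAction.bijective v
  refine ⟨‹_›, injective_restrict h.inj, fun e => gam_algebra.1 (hpm.symm ▸ h.tors e), hinv, fun r =>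
    ⟨fun hr => by_contra fun hp => h.ne ((hinv r hp).1 (hr.trans (smul_zero r).symm)), fun hr => ?_⟩, fun e he => ?_⟩
  · rw [← algebraMap_smul B]
    exact h.kill _ (hpm ▸ Ideal.mem_map_of_mem _ hr)
  · have h1 : p.map (algebraMap R B) ≤ LinearMap.ker (LinearMap.toSpanSingleton B E e) :=
      Ideal.map_le_iff_le_comap.2 fun r hr => (algebraMap_smul B r e).trans (he r hr)
    obtain ⟨b, hb⟩ := h.soc e fun r hr => h1 (hpm ▸ hr)
    obtain ⟨⟨r, s⟩, hrs⟩ := IsLocalization.surj p.primeCompl b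
    refine ⟨s, s.2, r, ?_⟩
    rw [hb, ← algebraMap_smul B, ← algebraMap_smul B r, ← hrs, mul_comm, mul_smul]

/-- the local part of the argument, over a flat local extension `B` of `R_p` -/
theorem loc_gd [p.IsPrime] {A C B : Type u} [CommRing A] [IsNoetherianRing A] [Algebra R A]
    [CommRing C] [IsNoetherianRing C] [IsLocalRing C] [Algebra R C] [IsLocalization.AtPrime C p]
    [CommRing B] [IsNoetherianRing B] [IsLocalRing B] [Algebra R B] [Algebra A B] [Algebra C B]
    [IsScalarTower R A B] [IsScalarTower R C B] [Module.Flat A B] [Module.FaithfullyFlat C B]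
    {M : Type u} [AddCommGroup M] [Module R M] [Module.Finite R M] [Nontrivial (C ⊗[R] M)] {n : ℕ}
    (hT : ∀ F : ModuleCat.{u} A, Module.Flat A F → GD A n (F ⊗[A] (A ⊗[R] M))) (hAB : Epi A B)
    (hmq : mB C B ≤ maximalIdeal B) (hk : ∃ k, maximalIdeal B ^ k ≤ mB C B)
    {E : Type u} [AddCommGroup E] [Module R E] [Module C E] [IsScalarTower R C E] {e0 : E} (h : Hull C E e0)
    (Fl : Type u) [AddCommGroup Fl] [Module R Fl] (hFl : Module.Flat R Fl) :
    GD R (n + 1) ((E →ₗ[R] Fl ⊗[R] E) ⊗[R] M) := by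
  have hn : ∀ (F : Type u) [AddCommGroup F] [Module R F] [Module B F] [IsScalarTower R B F],
      Module.Flat B F → GD B n (F ⊗[R] M) := by
    intro F _ _ _ _ hF
    letI : Module A F := Module.compHom F (algebraMap A B)
    haveI : IsScalarTower A B F := ⟨fun r a d => by rw [Algebra.smul_def, mul_smul]; rfl⟩
    haveI : IsScalarTower R A F := ⟨fun r a d => by
      rw [← algebraMap_smul B (r • a), ← algebraMap_smul B a, ← smul_assoc, Algebra.smul_def r a, map_mul,
        ← IsScalarTower.algebraMap_apply, Algebra.smul_def]⟩
    exact hAB.gd ((hT (ModuleCat.of A F) (Module.Flat.trans A B F)).of_equiv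
      (TensorProduct.AlgebraTensorModule.cancelBaseChange R A A F M))
  have hC : Module.Flat R C := IsLocalization.flat C p.primeCompl
  have hpm := IsLocalization.AtPrime.map_eq_maximalIdeal p C
  have hsi : SI (mB C B) := by
    obtain ⟨X, H, i, q, hs, -, hX⟩ := approx n (ModuleCat.of B (B ⊗[R] M)) (hn B inferInstance)
    obtain ⟨K, hK⟩ := IsCoatomic.exists_coatom (Submodule C (C ⊗[R] M))
    obtain ⟨I, hI, ⟨e⟩⟩ := isSimpleModule_iff_quot_maximal.1 (isSimpleModule_iff_isCoatom.2 hK)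
    let ψ : (C ⧸ I) →ₗ[C] B ⧸ mB C B := Submodule.liftQ I (LinearMap.toSpanSingleton C (B ⧸ mB C B) 1) fun r hr => by
      rw [IsLocalRing.eq_maximalIdeal hI] at hr
      exact (Algebra.smul_def r _).trans ((mul_one _).trans
        (Ideal.Quotient.eq_zero_iff_mem.2 (Ideal.mem_map_of_mem _ hr)))
    let l := ψ.comp (e.toLinearMap.comp K.mkQ)
    obtain ⟨k, hk1⟩ := (e.surjective.comp K.mkQ_surjective) (Submodule.Quotient.mk 1)
    have hl : l k = 1 := (congrArg ψ hk1).trans (one_smul C (1 : B ⧸ mB C B))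
    let f := TensorProduct.AlgebraTensorModule.cancelBaseChange R C B B M
    refine si_all n C B hmq hk X hX ((l.liftBaseChange B).comp (f.symm.toLinearMap.comp q)) fun z => ?_
    obtain ⟨b, rfl⟩ := Submodule.Quotient.mk_surjective _ z
    obtain ⟨x, hx⟩ := hs.2.2 (f (b ⊗ₜ k))
    refine ⟨x, ?_⟩
    change l.liftBaseChange B (f.symm (q x)) = _
    rw [hx, f.symm_apply_apply, LinearMap.liftBaseChange_tmul, hl]
    exact congrArg (Ideal.Quotient.mk (mB C B)) (mul_one b)
  have hbc : ∀ {J : Type u} [AddCommGroup J] [Module R J] [Module C J] [IsScalarTower R C J],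
      Module.Injective R J → (∀ j : J, j ∈ gam p J) → Module.Injective B (B ⊗[C] J) := fun hJ ht =>
    inj_tensor hsi hmq hk ((epi_loc p.primeCompl).inj hJ) fun j => hpm ▸ gam_algebra.2 (ht j)
  have hRB : Module.Flat R B := Module.Flat.trans R C B
  have hP := ph_hull (p := p) h
  have hG := injective_flat hP.inj (F := Fl)
  refine desc_T (B := B) (p := p) (fun J hJ ht => injective_of_equiv (hbc (injective_flat hJ) (gam_tens ht))
      (TensorProduct.AlgebraTensorModule.cancelBaseChange R C B B J)) hn hP.inj hP.tors hG
    (hbc (J := E ⊗[R] Fl) (injective_of_equiv hG (TensorProduct.comm R Fl E)) fun j => ?_)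
    (((TensorProduct.mk C B (E ⊗[R] Fl) 1).restrictScalars R).comp (TensorProduct.comm R Fl E).toLinearMap)
    ((Module.FaithfullyFlat.tensorProduct_mk_injective _).comp (TensorProduct.comm R Fl E).injective)
  have := gam_map (TensorProduct.comm R Fl E).toLinearMap (gam_tens hP.tors ((TensorProduct.comm R Fl E).symm j))
  simpa using this

/-- the backward direction -/
theorem bwd [IsLocalRing R] {x : R} (hxm : x ∈ maximalIdeal R) (hx : IsSMulRegular R x)
    {S : Type u} [CommRing S] [Algebra R S] (hS : IsQ x S)
    {M : Type u} [AddCommGroup M] [Module R M] [Module.Finite R M] (hM : IsSMulRegular M x)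
    {N : Type u} [AddCommGroup N] [Module S N] (π : M →+ N) (hπ : Function.Surjective π)
    (hl : ∀ (r : R) m, π (r • m) = algebraMap R S r • π m)
    (hk : ∀ m, π m = 0 ↔ ∃ m', x • m' = m) {n : ℕ} (hN : GD S n N) : ∃ n, GD R n M := by
  obtain ⟨E1, e1, h1⟩ := exists_hull R
  obtain ⟨A, _, _, _, _, _, h⟩ := exists_md h1
  obtain ⟨n, hT⟩ := star h hxm hx hS hM π hπ hl hk n hN
  have hfl := h.flat
  obtain ⟨_, hm⟩ := h.local
  have hloc : IsLocalHom (algebraMap R A) := ((IsLocalRing.local_hom_TFAE (algebraMap R A)).out 0 2).2 hm.ge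
  have hff : Module.FaithfullyFlat R A := Module.FaithfullyFlat.of_flat_of_isLocalHom
  have key : ∀ P : PrimeSpectrum R, ∃ (E : ModuleCat.{u} R) (e0 : E), PH P.asIdeal E e0 ∧
      ∀ (Fl : Type u) [AddCommGroup Fl] [Module R Fl], Module.Flat R Fl →
        GD R (n + 1) ((E →ₗ[R] Fl ⊗[R] E) ⊗[R] M) := by
    intro P
    let p := P.asIdeal
    obtain ⟨E, e0, hE⟩ := exists_hull (Localization.AtPrime p)
    letI : Module R E := Module.compHom E (algebraMap R (Localization.AtPrime p))
    haveI : IsScalarTower R (Localization.AtPrime p) E := ⟨fun r a d => by rw [Algebra.smul_def, mul_smul]; rfl⟩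
    have hP := ph_hull (p := p) hE
    refine ⟨ModuleCat.of R E, e0, hP, fun Fl _ _ hFl => ?_⟩
    rcases subsingleton_or_nontrivial (LocalizedModule p.primeCompl M) with h0 | h0
    · have : Subsingleton ((E →ₗ[R] Fl ⊗[R] E) ⊗[R] M) := subsingleton_of_forall_eq 0 fun z => by
        induction z using TensorProduct.induction_on with
        | zero => rfl
        | add a b ha hb => rw [ha, hb, add_zero]
        | tmul f m =>
          obtain ⟨s, hs, hsm⟩ := LocalizedModule.subsingleton_iff.1 h0 m
          obtain ⟨g, rfl⟩ := hP.hom_inv hs f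
          rw [TensorProduct.smul_tmul, hsm, TensorProduct.tmul_zero]
      exact gi_gd (gi_of_injective injective_sub)
    · have h2 : Nontrivial (Localization.AtPrime p ⊗[R] M) :=
        (LocalizedModule.equivTensorProduct p.primeCompl M).symm.nontrivial
      obtain ⟨Q, hQ⟩ := PrimeSpectrum.comap_surjective_of_faithfullyFlat (B := A) P
      have hQ' : Q.asIdeal.comap (algebraMap R A) = p := congrArg PrimeSpectrum.asIdeal hQ
      obtain ⟨q, hq, hqQ⟩ := Ideal.exists_minimalPrimes_le (Ideal.map_le_iff_le_comap.2 hQ'.ge)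
      have hqp : q.IsPrime := hq.1.1
      have : q.LiesOver p := ⟨le_antisymm (Ideal.map_le_iff_le_comap.1 hq.1.2) ((Ideal.comap_mono hqQ).trans hQ'.le)⟩
      letI := Localization.AtPrime.algebraOfLiesOver p q
      have hrad : (mB (Localization.AtPrime p) (Localization.AtPrime q)).radical =
          maximalIdeal (Localization.AtPrime q) := by
        rw [← Localization.AtPrime.map_eq_maximalIdeal, mB, ← Localization.AtPrime.map_eq_maximalIdeal,
          ← IsLocalization.AtPrime.radical_map_of_mem_minimalPrimes _ q _ hq, Ideal.map_map, Ideal.map_map,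
          ← IsScalarTower.algebraMap_eq, ← IsScalarTower.algebraMap_eq]
      have hmq := hrad ▸ Ideal.le_radical
      have hfl2 : Module.Flat A (Localization.AtPrime q) := IsLocalization.flat _ q.primeCompl
      have : IsLocalHom (algebraMap (Localization.AtPrime p) (Localization.AtPrime q)) :=
        ((IsLocalRing.local_hom_TFAE _).out 0 2).2 hmq
      have : Module.FaithfullyFlat (Localization.AtPrime p) (Localization.AtPrime q) :=
        Module.FaithfullyFlat.of_flat_of_isLocalHom
      exact loc_gd (p := p) hT (epi_loc q.primeCompl) hmq (Ideal.exists_pow_le_of_le_radical_of_fg hrad.ge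
        (IsNoetherian.noetherian _)) hE Fl hFl
  choose E e0 hE hn using key
  have hfin : ∀ P : PrimeSpectrum R, P.asIdeal.height ≠ ⊤ := fun P => Ideal.height_ne_top P.2.ne_top
  refine ⟨_, (resolve hE hn (fun P => P.asIdeal.height.toNat) (fun P P' hlt => ?_)
    ((maximalIdeal R).height.toNat + 1) R fun P hP => ?_).of_equiv (TensorProduct.lid R M)⟩
  · have := Ideal.height_add_one_le_of_lt_of_isPrime (I := P.asIdeal) (J := P'.asIdeal) hlt
    rw [← ENat.coe_toNat (hfin P), ← ENat.coe_toNat (hfin P')] at this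
    exact_mod_cast this
  · have := ENat.toNat_le_toNat (Ideal.height_mono (IsLocalRing.le_maximalIdeal P.2.ne_top))
      (hfin (IsLocalRing.closedPoint R))
    lia

end Fin
end GidAux

/-- **Lemma 4.1(i).** Let `M` be a non-zero finitely generated module over a Noetherian
local ring `R` and let `x ∈ 𝔪` be a non-zerodivisor on both `R` and `M`. Then
`Gid_R M` is finite iff `Gid_{R/xR}(M/xM)` is finite. -/
theorem GinjDim_ne_top_iff_GinjDim_quotient_ne_top
    (R : Type u) [CommRing R] [IsNoetherianRing R] [IsLocalRing R]
    (M : Type u) [AddCommGroup M] [Module R M] [Module.Finite R M]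
    (hM : Nontrivial M) (x : R) (hx : x ∈ maximalIdeal R)
    (hxR : IsSMulRegular R x) (hxM : IsSMulRegular M x) :
    GinjDim R M ≠ ⊤ ↔
      GinjDim (R ⧸ Ideal.span {x}) (M ⧸ x • (⊤ : Submodule R M)) ≠ ⊤ := by
  have h1 : GidAux.IsQ x (R ⧸ Ideal.span {x}) := ⟨Ideal.Quotient.mk_surjective, fun r => by
    have : algebraMap R (R ⧸ Ideal.span {x}) r = 0 ↔ r ∈ Ideal.span {x} := Ideal.Quotient.eq_zero_iff_mem
    rw [this, Ideal.mem_span_singleton']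
    simp [mul_comm]⟩
  have h2 : ∀ m : M, (x • (⊤ : Submodule R M)).mkQ.toAddMonoidHom m = 0 ↔ ∃ m', x • m' = m := fun m => by
    have : (x • (⊤ : Submodule R M)).mkQ m = 0 ↔ m ∈ x • (⊤ : Submodule R M) := by simp
    refine this.trans ?_
    simp [Submodule.mem_smul_pointwise_iff_exists]
  rw [GidAux.ginjDim_ne_top_iff, GidAux.ginjDim_ne_top_iff]
  exact ⟨fun ⟨n, hn⟩ => ⟨n, GidAux.fwd hxR h1 n hxM _ (Submodule.mkQ_surjective _) (fun r m => rfl) h2 hn⟩,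
    fun ⟨n, hn⟩ => GidAux.bwd hx hxR h1 hxM _ (Submodule.mkQ_surjective _) (fun r m => rfl) h2 hn⟩
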